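/- Let u be a very weak solution with integrability deficit δ. There exist constants c = c(data), δ₂ = δ₂(data) ∈ (δ₁,1) with 2 − q(1−δ₂) > 0, θ₀ = θ₀(data) ∈ (0,δ₂), and R₀ ∈ (0,1) depending on data, δ and ‖u‖_{C_loc(0,T;L²_loc(Ω,ℝᴺ))}, such that whenever Q^π_{16ρ}(z₀) ⊂ Ω_T satisfies the p-intrinsic hypotheses with ρ ∈ (0,R₀) and δ ∈ (δ₂,1): (i) π^{δp} ≤ c (⨍_{Q^π_{2ρ}(z₀)} H(z,|∇u|)^{θ₀} dz)^{δ/θ₀} + c ⨍_{Q^π_{2ρ}(z₀)} H(z,|F|)^δ dz; and (ii) ∬_{Q^π_{16ρ}(z₀)} H(z,|∇u|)^δ dz ≤ c Π^{δ−θ₀} ∬_{Q^π_{2ρ}(z₀) ∩ Ψ(c^{−1}Π)} H(z,|∇u|)^{θ₀} dz + c ∬_{Q^π_{2ρ}(z₀) ∩ Φ(c^{−1}Π)} H(z,|F|)^δ dz, where Ψ(Λ) = {z ∈ Ω_T : H(z,|∇u(z)|) > Λ} and Φ(Λ) = {z ∈ Ω_T : H(z,|F(z)|) > Λ}. -/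

import Mathlib

open MeasureTheory Set Metric Filter
open scoped ENNReal NNReal Topology BigOperators Classical

noncomputable section

namespace DoublePhase

/-- Spatial points: ℝⁿ. -/
abbrev Spc (n : ℕ) : Type := EuclideanSpace ℝ (Fin n)
/-- Space-time points `z = (x,t)`. -/
abbrev Pt (n : ℕ) : Type := Spc n × ℝ
/-- Values in ℝᴺ. -/
abbrev Vec (N : ℕ) : Type := Fin N → ℝ
/-- Matrices in ℝ^{N×n}. -/
abbrev Mat (N n : ℕ) : Type := Fin N → Fin n → ℝ

/-- Euclidean inner product on ℝᴺ. -/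
def vdot {N : ℕ} (v w : Vec N) : ℝ := ∑ i, v i * w i
/-- Euclidean norm on ℝᴺ. -/
def vnorm {N : ℕ} (v : Vec N) : ℝ := Real.sqrt (vdot v v)
/-- Euclidean inner product on ℝ^{N×n}. -/
def mdot {N n : ℕ} (A B : Mat N n) : ℝ := ∑ i, ∑ j, A i j * B i j
/-- Euclidean norm on ℝ^{N×n}. -/
def mnorm {N n : ℕ} (A : Mat N n) : ℝ := Real.sqrt (mdot A A)

/-- Parabolic cylinder `Q_{r,s}(z₀) = B_r(x₀) × (t₀−s, t₀+s)`. -/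
def Qrs {n : ℕ} (z₀ : Pt n) (r s : ℝ) : Set (Pt n) :=
  (Metric.ball z₀.1 r) ×ˢ (Set.Ioo (z₀.2 - s) (z₀.2 + s))

/-- Standard parabolic cylinder `Q_ρ(z₀) = B_ρ(x₀) × (t₀−ρ², t₀+ρ²)`. -/
def Qc {n : ℕ} (z₀ : Pt n) (ρ : ℝ) : Set (Pt n) := Qrs z₀ ρ (ρ ^ 2)

/-- The double-phase function `H(z,s) = s^p + a(z) s^q`. -/
def Hf {n : ℕ} (a : Pt n → ℝ) (p q : ℝ) (z : Pt n) (s : ℝ) : ℝ := s ^ p + a z * s ^ q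

/-- `p`-intrinsic cylinder `Q_ρ^λ(z₀) = B_ρ(x₀) × (t₀−λ^{2−p}ρ², t₀+λ^{2−p}ρ²)`. -/
def Qp {n : ℕ} (p : ℝ) (z₀ : Pt n) (lam ρ : ℝ) : Set (Pt n) :=
  Qrs z₀ ρ (lam ^ (2 - p) * ρ ^ 2)

/-- `(p,q)`-intrinsic cylinder `G_ρ^λ(z₀)`. -/
def Gpq {n : ℕ} (a : Pt n → ℝ) (p q : ℝ) (z₀ : Pt n) (lam ρ : ℝ) : Set (Pt n) :=
  Qrs z₀ ρ (lam ^ 2 / Hf a p q z₀ lam * ρ ^ 2)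

/-- The space-time domain `Ω_T = Ω × (0,T)`. -/
def cyl {n : ℕ} (Ω : Set (Spc n)) (T : ℝ) : Set (Pt n) := Ω ×ˢ Set.Ioo 0 T

/-- Spatial partial derivative `∂_{x_j} ψ` of a scalar test function. -/
def dxj {n : ℕ} (ψ : Pt n → ℝ) (j : Fin n) (z : Pt n) : ℝ :=
  fderiv ℝ ψ z (EuclideanSpace.single j 1, 0)

/-- Time derivative `∂_t φ` of a vector-valued test function. -/
def dtd {n N : ℕ} (φ : Pt n → Vec N) (z : Pt n) : Vec N :=
  fderiv ℝ φ z ((0 : Spc n), (1 : ℝ))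

/-- Spatial gradient `∇φ` of a vector-valued test function, as a matrix. -/
def gradm {n N : ℕ} (φ : Pt n → Vec N) (z : Pt n) : Mat N n :=
  fun i j => fderiv ℝ (fun w => φ w i) z (EuclideanSpace.single j 1, 0)

/-- The structural setting of the parabolic double-phase problem:
`data = (n, N, p, q, α, L₁, L₂, [a]_α)` together with the bounded domain `Ω`,
time `T`, the coefficient `a`, the vector field `𝒜` and the source `F`. -/
structure Setting (n N : ℕ) (p q α L₁ L₂ aH : ℝ) where
  Ω : Set (Spc n)
  T : ℝ
  a : Pt n → ℝ
  A : Pt n → Mat N n → Mat N n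
  F : Pt n → Mat N n
  hn : 2 ≤ n
  hN : 1 ≤ N
  hΩo : IsOpen Ω
  hΩb : Bornology.IsBounded Ω
  hΩne : Ω.Nonempty
  hT : 0 < T
  hα : α ∈ Set.Ioc (0 : ℝ) 1
  hp2 : 2 < p
  hpq : p < q
  hqub : q < p + 2 * α / ((n : ℝ) + 2)
  hL₁ : 0 < L₁
  hL₁₂ : L₁ ≤ L₂
  haH : 0 < aH
  ha0 : ∀ z, 0 ≤ a z
  haM : Measurable a
  haB : BddAbove (Set.range a)
  haHol : ∀ x ∈ Ω, ∀ y ∈ Ω, ∀ t ∈ Set.Ioo (0 : ℝ) T, ∀ s ∈ Set.Ioo (0 : ℝ) T,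
    |a (x, t) - a (y, s)| ≤ aH * max (‖x - y‖ ^ α) (|t - s| ^ (α / 2))
  hAM : Measurable (Function.uncurry A)
  hAcoer : ∀ᵐ z ∂(volume.restrict (cyl Ω T)), ∀ ξ : Mat N n,
    L₁ * (mnorm ξ ^ p + a z * mnorm ξ ^ q) ≤ mdot (A z ξ) ξ
  hAgrow : ∀ᵐ z ∂(volume.restrict (cyl Ω T)), ∀ ξ : Mat N n,
    mnorm (A z ξ) ≤ L₂ * (mnorm ξ ^ (p - 1) + a z * mnorm ξ ^ (q - 1))
  hFM : Measurable F
  hFint : IntegrableOn (fun z => Hf a p q z (mnorm (F z))) (cyl Ω T)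

variable {n N : ℕ} {p q α L₁ L₂ aH : ℝ}

/-- The right-hand side field `|F|^{p−2}F + a|F|^{q−2}F`. -/
def rhsF (S : Setting n N p q α L₁ L₂ aH) (z : Pt n) : Mat N n :=
  fun i j => mnorm (S.F z) ^ (p - 2) * S.F z i j + S.a z * mnorm (S.F z) ^ (q - 2) * S.F z i j

/-- Very weak solution with integrability deficit `δ`: `u ∈ L¹(0,T;W^{1,1})` with
weak spatial gradient `Du`, `H(·,|Du|)^δ` integrable, satisfying the weak formulation. -/
structure VeryWeakSolution (S : Setting n N p q α L₁ L₂ aH)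
    (u : Pt n → Vec N) (Du : Pt n → Mat N n) (δ : ℝ) : Prop where
  hδ : δ ∈ Set.Ioo (0 : ℝ) 1
  huM : Measurable u
  hDuM : Measurable Du
  huL1 : IntegrableOn (fun z => vnorm (u z)) (cyl S.Ω S.T)
  hDuL1 : IntegrableOn (fun z => mnorm (Du z)) (cyl S.Ω S.T)
  hgrad : ∀ (i : Fin N) (j : Fin n) (ψ : Pt n → ℝ),
    ContDiff ℝ (⊤ : ℕ∞) ψ → HasCompactSupport ψ → tsupport ψ ⊆ cyl S.Ω S.T →
    ∫ z in cyl S.Ω S.T, u z i * dxj ψ j z = - ∫ z in cyl S.Ω S.T, Du z i j * ψ z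
  henergy : IntegrableOn (fun z => Hf S.a p q z (mnorm (Du z)) ^ δ) (cyl S.Ω S.T)
  hweak : ∀ φ : Pt n → Vec N,
    ContDiff ℝ (⊤ : ℕ∞) φ → HasCompactSupport φ → tsupport φ ⊆ cyl S.Ω S.T →
    ∫ z in cyl S.Ω S.T, (-(vdot (u z) (dtd φ z)) + mdot (S.A z (Du z)) (gradm φ z))
      = ∫ z in cyl S.Ω S.T, mdot (rhsF S z) (gradm φ z)

/-- `H(z,|∇u|)`. -/
def HDu (S : Setting n N p q α L₁ L₂ aH) (Du : Pt n → Mat N n) (z : Pt n) : ℝ :=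
  Hf S.a p q z (mnorm (Du z))

/-- `H(z,|F|)`. -/
def HFf (S : Setting n N p q α L₁ L₂ aH) (z : Pt n) : ℝ :=
  Hf S.a p q z (mnorm (S.F z))

/-- Componentwise integral average `(u)_E` of a vector-valued function. -/
def vavg {n N : ℕ} (u : Pt n → Vec N) (E : Set (Pt n)) : Vec N := fun i => ⨍ z in E, u z i

/-- The `p`-intrinsic hypotheses \eqref{eq_pcase}-\eqref{eq_rho_decay}. -/
structure PHyp (S : Setting n N p q α L₁ L₂ aH) (Du : Pt n → Mat N n)
    (z₀ : Pt n) (π ρ δ : ℝ) : Prop where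
  hz₀ : z₀ ∈ cyl S.Ω S.T
  hπ : 1 < π
  hρ : ρ ∈ Set.Ioo (0 : ℝ) 1
  hcase : S.a z₀ * π ^ q ≤ π ^ p
  hsub : Qp p z₀ π (16 * ρ) ⊆ cyl S.Ω S.T
  hlow : π ^ (δ * p) ≤ ⨍ z in Qp p z₀ π ρ, (HDu S Du z + HFf S z) ^ δ
  hup : (⨍ z in Qp p z₀ π (16 * ρ), (HDu S Du z + HFf S z) ^ δ) ≤ π ^ (δ * p)
  hdecay : ρ ^ α ≤ π ^ (p - q)

/-- The `(p,q)`-intrinsic hypotheses \eqref{eq_pqcase}-\eqref{eq_pq4}. -/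
structure PQHyp (S : Setting n N p q α L₁ L₂ aH) (Du : Pt n → Mat N n)
    (z₀ : Pt n) (π ρ δ : ℝ) : Prop where
  hz₀ : z₀ ∈ cyl S.Ω S.T
  hπ : 1 < π
  hρ : ρ ∈ Set.Ioo (0 : ℝ) 1
  hcase : π ^ p < S.a z₀ * π ^ q
  hsub : Gpq S.a p q z₀ π (16 * ρ) ⊆ cyl S.Ω S.T
  hcomp : ∀ z ∈ Qc z₀ (10 * ρ), S.a z₀ / 2 ≤ S.a z ∧ S.a z ≤ 2 * S.a z₀
  hlow : Hf S.a p q z₀ π ^ δ ≤ ⨍ z in Gpq S.a p q z₀ π ρ, (HDu S Du z + HFf S z) ^ δ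
  hup : (⨍ z in Gpq S.a p q z₀ π (16 * ρ), (HDu S Du z + HFf S z) ^ δ) ≤ Hf S.a p q z₀ π ^ δ

/-- Strong maximal function over parabolic cylinders. -/
def strongMax {n : ℕ} (f : Pt n → ℝ) (z : Pt n) : ℝ :=
  sSup {m : ℝ | ∃ (w : Pt n) (r s : ℝ), 0 < r ∧ 0 < s ∧ z ∈ Qrs w r s ∧
    m = ⨍ y in Qrs w r s, |f y|}

/-- The function `g = (|∇u| + |u−u₀|/ρ + |F|) χ_{𝒬₂}`. -/
def gW (S : Setting n N p q α L₁ L₂ aH) (u : Pt n → Vec N) (Du : Pt n → Mat N n)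
    (Q2 : Set (Pt n)) (ρ : ℝ) (z : Pt n) : ℝ :=
  Q2.indicator (fun w => mnorm (Du w) + vnorm (u w - vavg u Q2) / ρ + mnorm (S.F w)) z

/-- Hölder extension of `a` to all of ℝ^{n+1}. -/
def aExt (S : Setting n N p q α L₁ L₂ aH) (Q2 : Set (Pt n)) (z : Pt n) : ℝ :=
  sInf {v : ℝ | ∃ w ∈ cyl S.Ω S.T,
    v = Q2.indicator S.a w + aH * (‖z.1 - w.1‖ ^ α + |z.2 - w.2| ^ (α / 2))}

/-- Hölder extension of `a` truncated between `inf_{𝒬₂} a` and `sup_{𝒬₂} a`. -/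
def aStar (S : Setting n N p q α L₁ L₂ aH) (Q2 : Set (Pt n)) (z : Pt n) : ℝ :=
  max (min (aExt S Q2 z) (sSup (S.a '' Q2))) (sInf (S.a '' Q2))

/-- The maximal weight `Υ(z) = (M(g^{q−1} + (a g^q)^{(q−1)/p})(z))^{p/(q−1)}`. -/
def Ups (S : Setting n N p q α L₁ L₂ aH) (u : Pt n → Vec N) (Du : Pt n → Mat N n)
    (Q2 : Set (Pt n)) (ρ : ℝ) (z : Pt n) : ℝ :=
  strongMax (fun w => gW S u Du Q2 ρ w ^ (q - 1)
      + (aStar S Q2 w * gW S u Du Q2 ρ w ^ q) ^ ((q - 1) / p)) z ^ (p / (q - 1))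

/-- `Υ̂(z) = max{Υ(z), θΠ}`. -/
def UpsHat (S : Setting n N p q α L₁ L₂ aH) (u : Pt n → Vec N) (Du : Pt n → Mat N n)
    (Q2 : Set (Pt n)) (ρ θ Pi' : ℝ) (z : Pt n) : ℝ :=
  max (Ups S u Du Q2 ρ z) (θ * Pi')

/-- `‖a‖_{L^∞(Ω_T)}`. -/
def supA (S : Setting n N p q α L₁ L₂ aH) : ℝ := sSup (S.a '' cyl S.Ω S.T)

/-- The constant `K = ((1+‖a‖_∞)/|B₁| ∬ Υ^μ)^{α/(n+2)}`. -/
def Kconst (S : Setting n N p q α L₁ L₂ aH) (u : Pt n → Vec N) (Du : Pt n → Mat N n)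
    (Q2 : Set (Pt n)) (ρ μ : ℝ) : ℝ :=
  (((1 + supA S) / (volume (Metric.ball (0 : Spc n) 1)).toReal)
      * ∫ z, Ups S u Du Q2 ρ z ^ μ) ^ (α / ((n : ℝ) + 2))

/-- Conditions \eqref{def_mu}-\eqref{def_mu_2} on `μ`. -/
def muCond (n : ℕ) (p q α μ : ℝ) : Prop :=
  max (1 - 2 / q + ((n : ℝ) + 2) * (q - p) / (q * α)) ((q - 1) / p) < μ ∧ μ < 1 ∧
    (1 / μ - 1) * (2 * (n : ℝ)) / (((n : ℝ) + 2) * q) + (n : ℝ) / ((n : ℝ) + 2) ≤ p / q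

/-- Condition \eqref{def_mfs} on `γ`. -/
def gammaCond (n : ℕ) (p q α μ γ : ℝ) : Prop :=
  0 < γ ∧ γ < 1 ∧ -(2 * α) / ((n : ℝ) + 2) + α * q * (1 - μ) / ((n : ℝ) + 2) < p - q - γ

/-- Condition \eqref{def_mfc} on the structural constant `c₀`. -/
def c0Cond (S : Setting n N p q α L₁ L₂ aH) (u : Pt n → Vec N) (Du : Pt n → Mat N n)
    (Q2 : Set (Pt n)) (ρ θ μ γ c₀ : ℝ) : Prop :=
  1 < c₀ ∧
    Kconst S u Du Q2 ρ μ * (θ * c₀ / (2 * (1 + supA S))) ^ (-(γ / p))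
      ≤ 1 / (800 * (1 + aH))

/-- The cylinder `𝒬` of \eqref{def_Qi}: `p`-intrinsic or `(p,q)`-intrinsic by phase. -/
def QorG (S : Setting n N p q α L₁ L₂ aH) (z₀ : Pt n) (π r : ℝ) : Set (Pt n) :=
  if S.a z₀ * π ^ q ≤ π ^ p then Qp p z₀ π r else Gpq S.a p q z₀ π r

/-- Half-length `σ` of the time interval of `𝒬`. -/
def sigmaOf (S : Setting n N p q α L₁ L₂ aH) (z₀ : Pt n) (π r : ℝ) : ℝ :=
  if S.a z₀ * π ^ q ≤ π ^ p then π ^ (2 - p) * r ^ 2 else π ^ 2 / Hf S.a p q z₀ π * r ^ 2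

/-- `Π_{z₀}` of \eqref{def_Pizo}. -/
def PiZ (S : Setting n N p q α L₁ L₂ aH) (z₀ : Pt n) (π : ℝ) : ℝ :=
  if S.a z₀ * π ^ q ≤ π ^ p then Hf S.a p q z₀ π else π ^ p

/-- Upper level set `Ψ(Λ)` of `H(z,|∇u|)`. -/
def PsiSet (S : Setting n N p q α L₁ L₂ aH) (Du : Pt n → Mat N n) (Λ : ℝ) : Set (Pt n) :=
  {z ∈ cyl S.Ω S.T | Λ < HDu S Du z}

/-- Upper level set `Φ(Λ)` of `H(z,|F|)`. -/
def PhiSet (S : Setting n N p q α L₁ L₂ aH) (Λ : ℝ) : Set (Pt n) :=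
  {z ∈ cyl S.Ω S.T | Λ < HFf S z}

/-- `Π > c₀` for the structural constant `c₀` of the paper. -/
def PiBig (S : Setting n N p q α L₁ L₂ aH) (u : Pt n → Vec N) (Du : Pt n → Mat N n)
    (z₀ : Pt n) (π ρ : ℝ) : Prop :=
  ∃ θ μ γ c₀ : ℝ, θ ∈ Set.Ioo (0 : ℝ) 1 ∧ muCond n p q α μ ∧ gammaCond n p q α μ γ ∧
    c0Cond S u Du (QorG S z₀ π (4 * ρ)) ρ θ μ γ c₀ ∧ c₀ < Hf S.a p q z₀ π

/-- `u ∈ C(0,T; L²(Ω,ℝᴺ))`. -/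
def ContL2 (S : Setting n N p q α L₁ L₂ aH) (u : Pt n → Vec N) : Prop :=
  (∀ t ∈ Set.Ioo (0 : ℝ) S.T, IntegrableOn (fun x => vnorm (u (x, t)) ^ 2) S.Ω) ∧
  ∀ t₁ ∈ Set.Ioo (0 : ℝ) S.T, ∀ ε > (0 : ℝ), ∃ η > (0 : ℝ), ∀ t₂ ∈ Set.Ioo (0 : ℝ) S.T,
    |t₂ - t₁| < η → ∫ x in S.Ω, vnorm (u (x, t₂) - u (x, t₁)) ^ 2 < ε

/-- The Vitali covering cylinder `U(w)`: `Q^{π_w}_{2ρ_w}(w)` or `G^{π_w}_{2ρ_w}(w)` by phase. -/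
def Uw (S : Setting n N p q α L₁ L₂ aH) (w : Pt n) (πw ρw : ℝ) : Set (Pt n) :=
  if S.a w * πw ^ q ≤ πw ^ p then Qp p w πw (2 * ρw) else Gpq S.a p q w πw (2 * ρw)

end DoublePhase

open DoublePhase
open ENNReal (ofReal ofReal_mul ofReal_rpow_of_nonneg top_rpow_of_pos toReal_nonneg ofReal_toReal div_le_iff ofReal_ne_top mul_ne_top ofReal_le_ofReal mul_top mul_rpow_of_nonneg zero_rpow_of_pos toReal_pos toReal_ofReal ofReal_one ofReal_sum_of_nonneg ofReal_add ofReal_le_ofReal_iff ofReal_rpow_of_pos ofReal_natCast add_ne_top ofReal_pos ofReal_inv_of_pos)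
open Real (rpow_one rpow_mul rpow_le_rpow zero_rpow rpow_nonneg rpow_sub rpow_le_rpow_of_exponent_le norm_eq_abs enorm_eq_ofReal_abs one_le_rpow rpow_neg rpow_add rpow_natCast mul_rpow inv_rpow HolderConjugate rpow_rpow_inv rpow_two rpow_pos_of_pos rpow_inv_rpow div_rpow rpow_le_one rpow_add_le_add_rpow rpow_add_one rpow_le_rpow_of_exponent_ge rpow_neg_one rpow_zero)
open Finset (sum_nonneg mul_sum abs_sum_le_sum_abs sum_le_sum sum_congr sum_mul sum_add_distrib measurable_sum card_univ sum_const single_le_sum sum_sub_distrib)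
open MeasureTheory.Measure (restrict_restrict addHaar_ball_center volume_eq_prod prod_prod prod_restrict restrict_smul restrict_apply_univ integrableOn_of_bounded)
open EuclideanSpace (single)
open TopologicalSpace (denseSeq)
open Module (finrank finrank_self)
open Function (uncurry support)
open Fintype (card_fin sum_prod_type')
open Filter.Eventually (of_forall)
set_option hygiene false
local notation "psv" => (by positivity)
local notation "lia0" => (by linarith)
local notation "nnm" => (by norm_num)
local notation "fpr" => (by fun_prop)
local notation "smp" => (by simp)
local notation "lqq" => (by linarith only [hR1, rβ, tβ, hk1, r0, h0, rβ0, hp, hpq])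
local notation "O0" => (0 : Pt n)
local notation "vz" => (v z ^ p + a z * v z ^ q)
local notation "fz" => (f z ^ p + a z * f z ^ q)
local notation "Tz" => (TT w r τ z)
local notation "Tρ" => (TT w ρ τ z)
local notation "f54" => (5/4)
local notation "f32" => (3/2)
local notation "qm" => (q-1)
local notation "pm" => (p-1)
local notation "Rz" => (0:ℝ)
local notation "Ro" => (1:ℝ)
local notation "R2" => (2:ℝ)
local notation "nR" => (n:ℝ)
local notation "leq" => (le_of_eq ?_)
local notation "rnτ" => (r ^ n * τ)
local notation "xρy" => (x - ρ • y, s)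
local notation "eJ" => (EuclideanSpace.single j 1, 0)
local notation "κ1" => (κ - 1)
local notation "cyS" => (cyl S.Ω S.T)
local notation "dL" => {z | ENNReal.ofReal (L ^ s) < MS (Gh s G) z}
local notation "αn" => (α / (n+2))
local notation "fE" => (4 ^ Module.finrank ℝ E)
local notation "tκ" => (t ^ (κ - 1))
local notation "tn1" => (2 ^ (n+1))
local notation "qp0" => (q - p)
local notation "bO" => ball (0 : Pt n)
local notation "Pn" => Pt n → ℝ
local notation "Pe" => Pt n → ℝ≥0∞
local notation "bA" => (Pt n)
local notation "cA" => (hk k)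
local notation "dA" => (r w)
local notation "eA" => (τ w)
local notation "fA" => (B j)
local notation "gA" => (Qrs w r τ)
local notation "iA" => (u z - c)
local notation "jA" => (abs_nonneg _)
local notation "kA" => (S.F z)
local notation "lA" => (∑ j, |B j z|)
local notation "mA" => (2 * vb n * ((min r h) ^ n * min τ h))
local notation "nA" => (1 + A₀)
local notation "oA" => (1 - d)
local notation "pA" => (v z + f z)
local notation "qA" => (n+1)
local notation "rA" => (L ^ s)
local notation "sA" => (ball (c i) (r i))
local notation "tA" => (2 ^ κ₁ / (κ₀ - 1))
local notation "uA" => (Q + θ • (P - Q), t)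
local notation "vA" => (n + 1)
local notation "wA" => (b ^ (1 / (nR+2)))
local notation "xA" => (bmp n k)
local notation "yA" => (1 - δ)
local notation "zA" => (bb n)
local notation "aB" => (1-q)
local notation "dB" => (GG p q a v f u)
local notation "eB" => (p * δ)
local notation "fB" => {x | L < HLm μ c r f x}
local notation "gB" => (TT w r τ)
local notation "iB" => (1/2)
local notation "jB" => (2 * r)
local notation "kB" => (2 * ρ)
local notation "lB" => (w.2 ^ (κ - 2))
local notation "nB" => (η z * vz)
local notation "oB" => (RU p q D θ a v f u)
local notation "pB" => (TTh w r τ hr hτ)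
local notation "qB" => (Spc n)
local notation "rB" => (h.rp w hw)
local notation "sB" => (h.tp w hw)
local notation "tB" => (r w ^ n * τ w)
local notation "uB" => (L ^ (1/p))
local notation "vB" => (norm_nonneg _)
local notation "wB" => (Qrs_meas _ _ _)
local notation "xB" => (ε' / b2)
local notation "yB" => (le_max_left _ _)
local notation "aC" => (ball z cA)
local notation "bC" => (RU p q D θ a v f u z)
local notation "cC" => (4 ^ n * 4)
local notation "dC" => (Du z)
local notation "eC" => (z - w)
local notation "fC" => (r z ^ n * τ z)
local notation "gC" => (σ - 1)
local notation "iC" => (1 / r w + 1 / τ w)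
local notation "jC" => (1/q)
local notation "kC" => (p * s)
local notation "lC" => (Gh s G)
local notation "mC" => (q / qm * s - 1)
local notation "nC" => (r/4)
local notation "oC" => (15/8)
local notation "pC" => ((vz + fz) ^ δ)
local notation "qC" => (mn0 _)
local notation "rC" => (le_max_right _ _)
local notation "sC" => (m - 1)
local notation "tC" => (mol k u)
local notation "uC" => (om O r τ w)
local notation "vC" => (D * L / l)
local notation "wC" => (1 + G / L)
local notation "xC" => (jB ^ 2 * β + hk k)
local notation "yC" => (p*s)
local notation "zC" => (n+2)
local notation "aD" => (x + y)
local notation "bD" => (-p)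
local notation "cD" => {z ∈ Y | Λ < g z}
local notation "dD" => (tst n k z)
local notation "eD" => (2 * vb n)
local notation "fD" => (Gw u)
local notation "gD" => (u i)
local notation "jD" => (9/8)
local notation "kD" => (g / el p q L a)
local notation "lD" => (1 / qm)
local notation "mD" => (α / 2)
local notation "nD" => (r / 4)
local notation "oD" => (q/qm*s-1)
local notation "qD" => (2 + A₀)
local notation "rD" => (1 - κ)
local notation "sD" => (16 ^ n * 16 ^ 2)
set_option hygiene true


section HLmax
lemma lc_fin (κ b : ℝ) (hκ : 0 < κ) (hb : 0 ≤ b) :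
    ∫⁻ t in Ioo Rz b, ofReal tκ = ofReal (b ^ κ / κ) := by
  rw [← ofReal_integral_eq_lintegral_ofReal]
  · rw [← integral_Ioc_eq_integral_Ioo, ← intervalIntegral.integral_of_le hb,
      integral_rpow (Or.inl lia0)]
    congr 1
    rw [sub_add_cancel, zero_rpow hκ.ne', sub_zero]
  · have := (intervalIntegral.intervalIntegrable_rpow' (a := 0) (b := b)
      (show (-1:ℝ) < κ - 1 by linarith))
    rw [intervalIntegrable_iff_integrableOn_Ioo_of_le hb] at this
    exact this
  · exact (ae_restrict_mem measurableSet_Ioo).mono fun t ht => rpow_nonneg ht.1.le _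
lemma lc_set (b : ℝ) : {t : ℝ | 0 < t ∧ ofReal t < ofReal b} = Ioo 0 b := by
  ext t
  simp only [mem_ofPred_eq, mem_Ioo]
  constructor
  · rintro ⟨h0, h⟩
    exact ⟨h0, (ENNReal.ofReal_lt_ofReal_iff_of_nonneg h0.le).1 h⟩
  · rintro ⟨h0, h⟩
    exact ⟨h0, (ENNReal.ofReal_lt_ofReal_iff_of_nonneg h0.le).2 h⟩
lemma lc_ge (κ : ℝ) (hκ : 0 < κ) (b : ℝ≥0∞) :
    b ^ κ ≤ ofReal κ *
      ∫⁻ t in {t : ℝ | 0 < t ∧ ofReal t < b}, ofReal tκ := by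
  have key : ∀ b' : ℝ, 0 ≤ b' → ofReal b' ≤ b → ofReal b' ^ κ ≤
      ofReal κ *
      ∫⁻ t in {t : ℝ | 0 < t ∧ ofReal t < b}, ofReal tκ := by
    intro b' hb' h
    calc ofReal b' ^ κ = ofReal κ * ofReal (b' ^ κ / κ) := by
          rw [← ofReal_mul hκ.le, mul_div_cancel₀ _ hκ.ne',
            ofReal_rpow_of_nonneg hb' hκ.le]
      _ ≤ _ := by
          rw [← lc_fin κ b' hκ hb', ← lc_set]
          gcongr
  by_cases hb : b = ∞
  · subst hb
    rw [top_rpow_of_pos hκ, top_le_iff]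
    refine ENNReal.eq_top_of_forall_nnreal_le fun r => ?_
    have := key ((r:ℝ) ^ (1/κ)) psv le_top
    rw [ofReal_rpow_of_nonneg psv hκ.le, ← rpow_mul r.coe_nonneg,
      one_div_mul_cancel hκ.ne', rpow_one, ENNReal.ofReal_coe_nnreal] at this
    exact this
  · have := key b.toReal toReal_nonneg (by rw [ofReal_toReal hb])
    rwa [ofReal_toReal hb] at this
lemma lc_le (κ : ℝ) (hκ : 0 < κ) (b : ℝ≥0∞) (hb : b ≠ ∞) :
    ∫⁻ t in {t : ℝ | 0 < t ∧ ofReal t < b}, ofReal tκ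
      = b ^ κ * ofReal (1 / κ) := by
  rw [← ofReal_toReal hb, lc_set, lc_fin _ _ hκ toReal_nonneg, div_eq_mul_one_div,
    ofReal_mul psv, ofReal_rpow_of_nonneg toReal_nonneg hκ.le]
lemma lc_tonelli {α : Type*} [MeasurableSpace α] (μ : Measure α) [SFinite μ] (g : α → ℝ≥0∞)
    (hg : Measurable g) (k : α → ℝ≥0∞) (hk : Measurable k) (κ : ℝ) :
    ∫⁻ x, k x * (∫⁻ t in {t : ℝ | 0 < t ∧ ofReal t < g x}, ofReal tκ) ∂μ
      = ∫⁻ t in Ioi Rz, ofReal tκ *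
        ∫⁻ x in {x | ofReal t < g x}, k x ∂μ := by
  have hS : MeasurableSet {z : α × ℝ | ofReal z.2 < g z.1} :=
    measurableSet_lt fpr fpr
  have hφ : Measurable (fun z : α × ℝ => {z : α × ℝ | ofReal z.2 < g z.1}.indicator
      (fun z => k z.1 * ofReal (z.2 ^ κ1)) z) := by
    refine Measurable.indicator ?_ hS
    have : Measurable fun z : α × ℝ => z.2 ^ κ1 := by fun_prop
    fun_prop
  have h1 : ∀ x, k x * (∫⁻ t in {t : ℝ | 0 < t ∧ ofReal t < g x},
      ofReal tκ) = ∫⁻ t in Ioi Rz,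
        {z : α × ℝ | ofReal z.2 < g z.1}.indicator
      (fun z => k z.1 * ofReal (z.2 ^ κ1)) (x, t) := by
    intro x
    have hm : MeasurableSet {t : ℝ | ofReal t < g x} :=
      measurableSet_lt fpr fpr
    have e1 : {t : ℝ | 0 < t ∧ ofReal t < g x}
        = {t : ℝ | ofReal t < g x} ∩ Ioi 0 := by
      ext t; simp [and_comm]
    rw [← lintegral_const_mul _ fpr, e1, ← restrict_restrict hm,
      ← lintegral_indicator hm]
    rfl
  simp_rw [h1]
  rw [lintegral_lintegral_swap hφ.aemeasurable]
  refine lintegral_congr fun t => ?_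
  have hm : MeasurableSet {x : α | ofReal t < g x} :=
      measurableSet_lt fpr fpr
  rw [← lintegral_const_mul _ hk, ← lintegral_indicator hm]
  refine lintegral_congr fun x => ?_
  by_cases h : ofReal t < g x
  · simp [indicator, h, mul_comm]
  · simp [indicator, h]
variable {E : Type*} [NormedAddCommGroup E] [NormedSpace ℝ E] [FiniteDimensional ℝ E]
  [MeasurableSpace E] [BorelSpace E] {ι : Type*} [Countable ι]
def HLm (μ : Measure E) (c : ι → E) (r : ι → ℝ) (f : E → ℝ≥0∞) (x : E) : ℝ≥0∞ :=
  ⨆ i, (ball (c i) (r i)).indicator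
    (fun _ => (∫⁻ y in ball (c i) (r i), f y ∂μ) / μ sA) x
lemma HLm_meas (μ : Measure E) (c : ι → E) (r : ι → ℝ) (f : E → ℝ≥0∞) :
    Measurable (HLm μ c r f) :=
  Measurable.iSup fun _ => measurable_const.indicator measurableSet_ball
lemma hl_weak (μ : Measure E) [μ.IsAddHaarMeasure] (c : ι → E) (r : ι → ℝ)
    (hr0 : ∀ i, 0 < r i) (hr : ∀ i, r i ≤ 2) (f : E → ℝ≥0∞) (L : ℝ≥0∞) :
    L * μ fB ≤
      ofReal fE * ∫⁻ y, f y ∂μ := by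
  set B : ι → Set E := fun i => ball (c i) (r i) with hB
  set t : Set ι := {i | L * μ (B i) < ∫⁻ y in B i, f y ∂μ} with ht
  obtain ⟨u, hut, hd, hcov⟩ := Vitali.exists_disjoint_subfamily_covering_enlargement_ball t c r 2
    (fun a _ => hr a) 4 nnm
  have hsub : fB ⊆ ⋃ b : u, ball (c b) (4 * r b) := by
    intro x hx
    simp only [mem_ofPred_eq, HLm, lt_iSup_iff] at hx
    obtain ⟨i, hi⟩ := hx
    by_cases hxi : x ∈ ball (c i) (r i)
    · rw [indicator_of_mem hxi] at hi
      have hit : i ∈ t := by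
        have h0 : μ sA ≠ 0 := (measure_ball_pos μ _ (hr0 i)).ne'
        have h1 : μ sA ≠ ∞ := measure_ball_lt_top.ne
        exact (ENNReal.lt_div_iff_mul_lt (Or.inl h0) (Or.inl h1)).1 hi
      obtain ⟨b, hb, hs⟩ := hcov i hit
      exact mem_iUnion.2 ⟨⟨b, hb⟩, hs hxi⟩
    · rw [indicator_of_notMem hxi] at hi
      exact absurd hi smp
  calc L * μ fB ≤ L * ∑' b : u, μ (ball (c b) (4 * r b)) := by
        gcongr
        exact (measure_mono hsub).trans (measure_iUnion_le _)
    _ = ofReal fE * ∑' b : u, L * μ (B b) := by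
        rw [← ENNReal.tsum_mul_left, ← ENNReal.tsum_mul_left]
        refine tsum_congr fun b => ?_
        rw [Measure.addHaar_ball_mul_of_pos μ _ (by norm_num : Rz < 4),
          hB, addHaar_ball_center]
        simp only []
        rw [addHaar_ball_center μ (c b)]
        ring
    _ ≤ ofReal fE * ∑' b : u, ∫⁻ y in B b, f y ∂μ := by
        gcongr with b
        exact (hut b.2).le
    _ = ofReal fE * ∫⁻ y in ⋃ b : u, B b, f y ∂μ := by
        rw [lintegral_iUnion (fun b => measurableSet_ball)]
        exact fun a b hab => hd a.2 b.2 (fun h => hab (Subtype.ext h))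
    _ ≤ _ := by
        exact mul_le_mul_right (setLIntegral_le_lintegral _ _) _
lemma hl_weak2 (μ : Measure E) [μ.IsAddHaarMeasure] (c : ι → E) (r : ι → ℝ)
    (hr0 : ∀ i, 0 < r i) (hr : ∀ i, r i ≤ 2) (f : E → ℝ≥0∞) (hf : Measurable f)
    (L : ℝ≥0∞) (hL : L ≠ ∞) :
    L * μ fB ≤
      2 * ofReal fE * ∫⁻ y in {y | L < 2 * f y}, f y ∂μ := by
  have hm : MeasurableSet {y | L < 2 * f y} := measurableSet_lt fpr fpr
  set f1 := {y | L < 2 * f y}.indicator f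
  have h1 : ∀ x, HLm μ c r f x ≤ HLm μ c r f1 x + L / 2 := by
    intro x
    refine iSup_le fun i => ?_
    by_cases hxi : x ∈ ball (c i) (r i)
    · refine le_trans ?_ (add_le_add_left (le_iSup _ i) _)
      rw [indicator_of_mem hxi, indicator_of_mem hxi]
      have h0 : μ sA ≠ 0 := (measure_ball_pos μ _ (hr0 i)).ne'
      have h1 : μ sA ≠ ∞ := measure_ball_lt_top.ne
      rw [div_le_iff h0 h1, add_mul, ENNReal.div_mul_cancel h0 h1]
      calc ∫⁻ y in ball (c i) (r i), f y ∂μ ≤ ∫⁻ y in ball (c i) (r i), (f1 y + L / 2) ∂μ := by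
            gcongr with y
            by_cases hy : L < 2 * f y
            · simp [f1, indicator, hy]
            · rw [not_lt] at hy
              refine le_add_left ?_
              rw [ENNReal.le_div_iff_mul_le (Or.inl smp) (Or.inl smp), mul_comm]
              exact hy
        _ = _ := by
            rw [lintegral_add_right _ measurable_const, setLIntegral_const]
    · rw [indicator_of_notMem hxi]; simp
  have h2 : fB ⊆ {x | L / 2 < HLm μ c r f1 x} := by
    intro x hx
    simp only [mem_ofPred_eq] at *
    have := hx.trans_le (h1 x)
    by_contra hc
    rw [not_lt] at hc
    have := this.trans_le (add_le_add_left hc _)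
    rw [ENNReal.add_halves] at this
    exact lt_irrefl _ this
  calc L * μ fB ≤ L * μ {x | L / 2 < HLm μ c r f1 x} := by gcongr
    _ = 2 * (L / 2 * μ {x | L / 2 < HLm μ c r f1 x}) := by
        rw [← mul_assoc, ENNReal.mul_div_cancel smp smp]
    _ ≤ 2 * (ofReal fE * ∫⁻ y, f1 y ∂μ) := by
        exact mul_le_mul_right (hl_weak μ c r hr0 hr f1 _) _
    _ = _ := by rw [lintegral_indicator hm]; ring
lemma hl_strong (μ : Measure E) [μ.IsAddHaarMeasure] (c : ι → E) (r : ι → ℝ)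
    (hr0 : ∀ i, 0 < r i) (hr : ∀ i, r i ≤ 2) (f : E → ℝ≥0∞) (hf : Measurable f)
    (κ₀ κ₁ κ : ℝ) (h0 : 1 < κ₀) (h1 : κ₀ ≤ κ) (h2 : κ ≤ κ₁) :
    ∫⁻ x, HLm μ c r f x ^ κ ∂μ ≤
      ofReal (κ₁ * (2 * 4 ^ finrank ℝ E) * tA) *
        ∫⁻ y, f y ^ κ ∂μ := by
  have hκ : 0 < κ := by linarith
  have hκ1 : 0 < κ - 1 := by linarith
  have hmeas := HLm_meas μ c r f
  calc ∫⁻ x, HLm μ c r f x ^ κ ∂μ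
      ≤ ∫⁻ x, ofReal κ * (1 *
      ∫⁻ t in {t : ℝ | 0 < t ∧ ofReal t < HLm μ c r f x}, ofReal tκ) ∂μ := by
        gcongr with x
        rw [one_mul]
        exact lc_ge κ hκ _
    _ = ofReal κ * ∫⁻ t in Ioi Rz, ofReal tκ *
        ∫⁻ x in {x | ofReal t < HLm μ c r f x}, 1 ∂μ := by
        rw [lintegral_const_mul' _ _ ofReal_ne_top,
          lc_tonelli μ _ hmeas (fun _ => 1) measurable_const κ]
    _ ≤ ofReal κ * ∫⁻ t in Ioi Rz, 2 * ofReal fE *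
        (ofReal (t ^ (κ1 - 1)) *
          ∫⁻ y in {y | ofReal t < 2 * f y}, f y ∂μ) := by
        refine mul_le_mul_right ?_ _
        refine setLIntegral_mono' measurableSet_Ioi fun t ht => ?_
        rw [mem_Ioi] at ht
        rw [setLIntegral_one, rpow_sub ht κ1 1, rpow_one, div_eq_mul_inv, ofReal_mul psv]
        have ht' : ofReal t ≠ 0 := by simpa using ht
        have := hl_weak2 μ c r hr0 hr f hf (ofReal t) ofReal_ne_top
        have h3 : μ {x | ofReal t < HLm μ c r f x} = ofReal (t⁻¹) *
          (ofReal t * μ {x | ofReal t < HLm μ c r f x}) := by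
          rw [← mul_assoc, ← ofReal_mul psv, inv_mul_cancel₀ ht.ne']; simp
        rw [h3]
        refine (mul_le_mul_right (mul_le_mul_right this _) _).trans leq
        ring
    _ = ofReal κ * (2 * ofReal fE) * ∫⁻ y, f y *
        (∫⁻ t in {t : ℝ | 0 < t ∧ ofReal t < 2 * f y}, ofReal (t ^ (κ1 - 1))) ∂μ := by
        rw [lc_tonelli μ (fun y => 2 * f y) fpr f hf κ1,
          lintegral_const_mul' _ _ (mul_ne_top smp ofReal_ne_top)]
        ring
    _ ≤ ofReal κ₁ * (2 * ofReal fE) *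
        ∫⁻ y, ofReal tA * f y ^ κ ∂μ := by
        refine mul_le_mul' (mul_le_mul_left (ofReal_le_ofReal h2) _)
          (lintegral_mono fun y => ?_)
        simp only []
        by_cases hy : f y = ∞
        · have : 0 < 2 ^ κ₁ / (κ₀ - 1) := div_pos psv lia0
          have h6 : ofReal tA ≠ 0 := by simpa using this
          rw [hy, top_rpow_of_pos hκ, mul_top h6]
          exact le_top
        · rw [lc_le _ hκ1 _ (mul_ne_top smp hy),
            mul_rpow_of_nonneg _ _ hκ1.le]
          have h4 : f y * f y ^ κ1 = f y ^ κ := by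
            rcases eq_or_ne (f y) 0 with h | h
            · rw [h, zero_rpow_of_pos hκ, zero_mul]
            · rw [ENNReal.rpow_sub _ _ h hy, ENNReal.rpow_one, ENNReal.mul_div_cancel h hy]
          have h5 : (2:ℝ≥0∞) ^ κ1 * ofReal (1 / κ1) ≤
              ofReal tA := by
            rw [show (2:ℝ≥0∞) = ofReal 2 by simp,
              ofReal_rpow_of_nonneg nnm hκ1.le,
              ← ofReal_mul psv]
            apply ofReal_le_ofReal
            rw [mul_one_div]
            gcongr
            · linarith
            · norm_num; linarith
          calc f y * (2 ^ κ1 * f y ^ κ1 * ofReal (1 / κ1))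
              = (2 ^ κ1 * ofReal (1 / κ1)) * (f y * f y ^ κ1) := by ring
            _ ≤ _ := by rw [h4]; gcongr
    _ = _ := by
        have : 0 < κ₀ - 1 := by linarith
        have : 0 < κ₁ := by linarith
        rw [lintegral_const_mul _ fpr, ofReal_mul psv,
          ofReal_mul psv, ofReal_mul psv]
        simp
        ring
end HLmax

section Strong
variable {n : ℕ}
instance pt_haar : (volume : Measure bA).IsAddHaarMeasure := by
  rw [volume_eq_prod]; infer_instance
lemma Qrs_meas (w : Pt n) (r τ : ℝ) : MeasurableSet gA :=
  measurableSet_ball.prod measurableSet_Ioo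
lemma Qrs_open (w : Pt n) (r τ : ℝ) : IsOpen gA :=
  isOpen_ball.prod isOpen_Ioo
lemma Qrs_vol (w : Pt n) (r τ : ℝ) :
    volume gA = volume (ball (w.1) r) * ofReal (2 * τ) := by
  rw [Qrs, volume_eq_prod, prod_prod, Real.volume_Ioo]
  congr 2; ring
def vb (n : ℕ) : ℝ := (volume (ball (0 : Spc n) 1)).toReal
lemma vb_pos (n : ℕ) : 0 < vb n :=
  toReal_pos (measure_ball_pos volume _ one_pos).ne' measure_ball_lt_top.ne
lemma ball_vol (x : Spc n) {r : ℝ} (hr : 0 < r) :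
    volume (ball x r) = ofReal (r ^ n * vb n) := by
  rw [Measure.addHaar_ball_of_pos volume x hr, ofReal_mul psv, vb,
    ofReal_toReal measure_ball_lt_top.ne, finrank_euclideanSpace_fin]
lemma Qrs_vol' (w : Pt n) {r τ : ℝ} (hr : 0 < r) :
    volume gA = ofReal (2 * vb n * rnτ) := by
  have := vb_pos n
  rw [Qrs_vol, ball_vol _ hr, ← ofReal_mul psv]
  congr 1; ring
lemma Qrs_vol_ne_top (w : Pt n) (r τ : ℝ) : volume gA ≠ ∞ := by
  rw [Qrs_vol]
  exact mul_ne_top measure_ball_lt_top.ne ofReal_ne_top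
lemma Qrs_vol_ne_zero (w : Pt n) {r τ : ℝ} (hr : 0 < r) (hτ : 0 < τ) :
    volume gA ≠ 0 := by
  have := vb_pos n
  rw [Qrs_vol' w hr]
  have : 0 < 2 * vb n * rnτ := psv
  simpa using this
def MS (f : Pe) (z : Pt n) : ℝ≥0∞ :=
  ⨆ (i : {i : Pt n × ℝ × ℝ // 0 < i.2.1 ∧ i.2.1 ≤ 1 ∧ 0 < i.2.2 ∧ i.2.2 ≤ 1}),
    (Qrs i.1.1 i.1.2.1 i.1.2.2).indicator
      (fun _ => (∫⁻ y in Qrs i.1.1 i.1.2.1 i.1.2.2, f y) / volume (Qrs i.1.1 i.1.2.1 i.1.2.2)) z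
lemma le_MS (f : Pe) {z w : Pt n} {r τ : ℝ} (hr : 0 < r) (hr1 : r ≤ 1) (hτ : 0 < τ)
    (hτ1 : τ ≤ 1) (hz : z ∈ Qrs w r τ) :
    (∫⁻ y in Qrs w r τ, f y) / volume gA ≤ MS f z := by
  refine le_trans ?_ (le_iSup _ ⟨(w, r, τ), hr, hr1, hτ, hτ1⟩)
  simp only []
  rw [indicator_of_mem hz]
lemma MS_open (f : Pe) (L : ℝ≥0∞) : IsOpen {z | L < MS f z} := by
  have : {z | L < MS f z} = ⋃ (i : {i : Pt n × ℝ × ℝ // 0 < i.2.1 ∧ i.2.1 ≤ 1 ∧ 0 < i.2.2 ∧ i.2.2 ≤ 1}),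
      {z | z ∈ Qrs i.1.1 i.1.2.1 i.1.2.2 ∧ L < (∫⁻ y in Qrs i.1.1 i.1.2.1 i.1.2.2, f y) /
        volume (Qrs i.1.1 i.1.2.1 i.1.2.2)} := by
    ext z
    simp only [mem_ofPred_eq, MS, lt_iSup_iff, mem_iUnion]
    refine exists_congr fun i => ?_
    by_cases h : z ∈ Qrs i.1.1 i.1.2.1 i.1.2.2
    · rw [indicator_of_mem h]; simp [h]
    · rw [indicator_of_notMem h]; simp [h]
  rw [this]
  refine isOpen_iUnion fun i => ?_
  exact (Qrs_open _ _ _).inter isOpen_const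
lemma MS_meas (f : Pe) : Measurable (MS f) :=
  measurable_of_Ioi fun L => (MS_open f L).measurableSet
lemma ball_eq_Qrs (z : Pt n) (r : ℝ) : ball z r = Qrs z r r := by
  rw [Qrs, ← Real.ball_eq_Ioo, ball_prod_same]
lemma MS_ae (f : Pe) (hf : Measurable f) (hfi : ∫⁻ y, f y ≠ ∞) :
    ∀ᵐ z, f z ≤ MS f z := by
  have h := (Besicovitch.vitaliFamily (volume : Measure bA)).ae_tendsto_lintegral_div
    hf.aemeasurable hfi
  filter_upwards [h] with z hz
  have h2 := hz.comp (Besicovitch.tendsto_filterAt volume z)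
  refine le_of_tendsto h2 ?_
  have : Ioc Rz 1 ∈ 𝓝[>] Rz := Ioc_mem_nhdsGT one_pos
  filter_upwards [this] with r hr
  have e : (closedBall z r : Set bA) =ᵐ[volume] ball z r := by
    rw [← ball_union_sphere]
    refine union_ae_eq_left_of_ae_eq_empty ?_
    exact ae_eq_empty.2 (Measure.addHaar_sphere_of_ne_zero _ _ hr.1.ne')
  simp only [Function.comp]
  rw [setLIntegral_congr e, measure_congr e, ball_eq_Qrs]
  refine le_MS f hr.1 hr.2 hr.1 hr.2 ?_
  rw [← ball_eq_Qrs]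
  exact mem_ball_self hr.1
def dr (k : ℕ) : ℝ := 2 * (1 / 2) ^ k
lemma dr_pos (k : ℕ) : 0 < dr k := by unfold dr; positivity
lemma dr_le (k : ℕ) : dr k ≤ 2 := by
  unfold dr
  have : (Ro/2) ^ k ≤ 1 := pow_le_one₀ nnm nnm
  linarith
lemma dr_ex {E : Type*} [NormedAddCommGroup E] [TopologicalSpace.SeparableSpace E]
    (x : E) {r : ℝ} (hr : 0 < r) (hr1 : r ≤ 1) :
    ∃ i : ℕ × ℕ, ball x r ⊆ ball (denseSeq E i.1) (dr i.2) ∧ dr i.2 ≤ 4 * r := by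
  obtain ⟨k, hk1, hk2⟩ := exists_nat_pow_near_of_lt_one hr hr1
    (by norm_num : Rz < 1/2) (by norm_num : Ro/2 < 1)
  have hd : 0 < dr k / 2 := by have := dr_pos k; linarith
  obtain ⟨d, hd1⟩ := (TopologicalSpace.denseRange_denseSeq E).exists_mem_open isOpen_ball
    ((nonempty_ball).2 hd)
  refine ⟨(d, k), ?_, ?_⟩
  · refine ball_subset_ball' ?_
    have h1 : dist x (denseSeq E d) < dr k / 2 := by
      rw [dist_comm]; exact hd1
    have h2 : r ≤ dr k / 2 := by simpa [dr] using hk2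
    linarith
  · show dr k ≤ _
    unfold dr
    rw [pow_succ] at hk1
    linarith
def Mx (f : Pe) (z : Pt n) : ℝ≥0∞ :=
  HLm volume (fun i : ℕ × ℕ => denseSeq qB i.1) (fun i => dr i.2)
    (fun x => f (x, z.2)) z.1
def Mt (f : Pe) (z : Pt n) : ℝ≥0∞ :=
  HLm volume (fun i : ℕ × ℕ => denseSeq ℝ i.1) (fun i => dr i.2)
    (fun t => f (z.1, t)) z.2
lemma Mx_meas (f : Pe) (hf : Measurable f) : Measurable (Mx f) := by
  refine Measurable.iSup fun i => ?_
  refine Measurable.ite (measurable_fst measurableSet_ball) ?_ measurable_const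
  refine Measurable.div_const ?_ _
  have : Measurable fun t : ℝ => ∫⁻ y in ball (denseSeq qB i.1) (dr i.2), f (y, t) :=
    Measurable.lintegral_prod_left' (f := f) hf
  exact this.comp measurable_snd
lemma Mt_meas (f : Pe) (hf : Measurable f) : Measurable (Mt f) := by
  refine Measurable.iSup fun i => ?_
  refine Measurable.ite (measurable_snd measurableSet_ball) ?_ measurable_const
  refine Measurable.div_const ?_ _
  have : Measurable fun x : Spc n => ∫⁻ y in ball (denseSeq ℝ i.1) (dr i.2), f (x, y) :=
    Measurable.lintegral_prod_right' (f := f) hf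
  exact this.comp measurable_fst
lemma le_HLm {E : Type*} [NormedAddCommGroup E] [MeasurableSpace E] {ι : Type*} (μ : Measure E)
    (c : ι → E) (r : ι → ℝ) (f : E → ℝ≥0∞) (x : E) (i : ι) (hx : x ∈ ball (c i) (r i)) :
    (∫⁻ y in ball (c i) (r i), f y ∂μ) / μ sA ≤ HLm μ c r f x := by
  refine le_trans ?_ (le_iSup _ i)
  rw [indicator_of_mem hx]
lemma avg_le_HLd {E : Type*} [NormedAddCommGroup E] [NormedSpace ℝ E] [FiniteDimensional ℝ E]
    [MeasurableSpace E] [BorelSpace E] (μ : Measure E) [μ.IsAddHaarMeasure]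
    (f : E → ℝ≥0∞) (x₀ x : E) {r : ℝ} (hr : 0 < r) (hr1 : r ≤ 1) (hx : x ∈ ball x₀ r) :
    ∫⁻ y in ball x₀ r, f y ∂μ ≤ ofReal fE * μ (ball x₀ r) *
      HLm μ (fun i : ℕ × ℕ => denseSeq E i.1) (fun i => dr i.2) f x := by
  obtain ⟨i, hi, hi2⟩ := dr_ex x₀ hr hr1
  have h := le_HLm μ (fun i : ℕ × ℕ => denseSeq E i.1) (fun i => dr i.2) f x i (hi hx)
  have h0 : μ (ball (denseSeq E i.1) (dr i.2)) ≠ 0 :=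
    (measure_ball_pos μ _ (dr_pos _)).ne'
  rw [div_le_iff h0 measure_ball_lt_top.ne] at h
  have hv : μ (ball (denseSeq E i.1) (dr i.2)) ≤
      ofReal fE * μ (ball x₀ r) := by
    calc _ ≤ μ (ball (denseSeq E i.1) (4 * r)) :=
          measure_mono (ball_subset_ball hi2)
      _ = _ := by
          rw [Measure.addHaar_ball_mul_of_pos μ _ (by norm_num : Rz < 4),
            addHaar_ball_center μ x₀]
  calc ∫⁻ y in ball x₀ r, f y ∂μ ≤ _ := lintegral_mono_set hi
    _ ≤ _ := h
    _ ≤ _ := by rw [mul_comm]; gcongr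
lemma MS_le (f : Pe) (hf : Measurable f) (z : Pt n) :
    MS f z ≤ ofReal cC * Mt (Mx f) z := by
  refine iSup_le fun ⟨⟨w, r, τ⟩, hr, hr1, hτ, hτ1⟩ => ?_
  simp only [] at hr hr1 hτ hτ1 ⊢
  by_cases hz : z ∈ Qrs w r τ
  swap
  · rw [indicator_of_notMem hz]; exact zero_le
  rw [indicator_of_mem hz, div_le_iff (Qrs_vol_ne_zero w hr hτ) (Qrs_vol_ne_top w r τ)]
  have hz' := hz
  rw [Qrs, ← Real.ball_eq_Ioo] at hz' ⊢
  calc ∫⁻ y in ball w.1 r ×ˢ ball w.2 τ, f y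
      = ∫⁻ t in ball w.2 τ, ∫⁻ x in ball w.1 r, f (x, t) := by
        rw [volume_eq_prod, ← prod_restrict, lintegral_prod_symm' _ hf]
    _ ≤ ∫⁻ t in ball w.2 τ, ofReal (4 ^ n) * volume (ball w.1 r) * Mx f (z.1, t) := by
        gcongr with t
        have := avg_le_HLd volume (fun x => f (x, t)) w.1 z.1 hr hr1 hz'.1
        rwa [finrank_euclideanSpace_fin] at this
    _ = ofReal (4 ^ n) * volume (ball w.1 r) * ∫⁻ t in ball w.2 τ, Mx f (z.1, t) := by
        rw [lintegral_const_mul' _ _ (mul_ne_top ofReal_ne_top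
          measure_ball_lt_top.ne)]
    _ ≤ ofReal (4 ^ n) * volume (ball w.1 r) *
        (ofReal 4 * volume (ball w.2 τ) * Mt (Mx f) z) := by
        refine mul_le_mul_right ?_ _
        have := avg_le_HLd volume (fun t => Mx f (z.1, t)) w.2 z.2 hτ hτ1 hz'.2
        rwa [finrank_self, pow_one] at this
    _ = _ := by
        rw [volume_eq_prod qB ℝ, prod_prod, ofReal_mul psv]; ring
lemma mx_strong (n : ℕ) (κ₀ κ₁ : ℝ) (h0 : 1 < κ₀) (f : Pe) (hf : Measurable f)
    (κ : ℝ) (hκ : κ₀ ≤ κ) (hκ' : κ ≤ κ₁) : ∫⁻ z, Mx f z ^ κ ≤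
      ofReal (κ₁ * (2 * 4 ^ n) * tA) * ∫⁻ z, f z ^ κ := by
  rw [volume_eq_prod, lintegral_prod_symm' _ ((Mx_meas f hf).pow_const _),
    lintegral_prod_symm' _ fpr,
    ← lintegral_const_mul' _ _ ofReal_ne_top]
  refine lintegral_mono fun t => ?_
  have := hl_strong volume (fun i : ℕ × ℕ => denseSeq qB i.1) (fun i => dr i.2)
    (fun i => dr_pos _) (fun i => dr_le _) (fun x => f (x, t)) fpr κ₀ κ₁ κ h0 hκ hκ'
  rwa [finrank_euclideanSpace_fin] at this
lemma ms_strong (n : ℕ) (κ₀ κ₁ : ℝ) (h0 : 1 < κ₀) (h1 : κ₀ ≤ κ₁) :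
    ∃ C : ℝ, 0 < C ∧ ∀ f : Pe, Measurable f → ∀ κ, κ₀ ≤ κ → κ ≤ κ₁ →
      ∫⁻ z, MS f z ^ κ ≤ ofReal C * ∫⁻ z, f z ^ κ := by
  set C1 := κ₁ * (2 * 4 ^ n) * tA
  set C2 := κ₁ * (2 * 4 ^ 1) * tA
  have h10 : 0 < κ₀ - 1 := by linarith
  have h11 : 0 < κ₁ := by linarith
  refine ⟨cC ^ κ₁ * (C2 * C1), by positivity, fun f hf κ hκ hκ' => ?_⟩
  have hx : ∫⁻ z, Mx f z ^ κ ≤ ofReal C1 * ∫⁻ z, f z ^ κ :=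
    mx_strong n κ₀ κ₁ h0 f hf κ hκ hκ'
  have hy : ∀ g : Pe, Measurable g →
      ∫⁻ z, Mt g z ^ κ ≤ ofReal C2 * ∫⁻ z, g z ^ κ := by
    intro g hg
    have hm : AEMeasurable (fun z => Mt g z ^ κ) ((volume : Measure qB).prod (volume : Measure ℝ)) :=
      ((Mt_meas g hg).pow_const κ).aemeasurable
    have hm2 : AEMeasurable (fun z => g z ^ κ) ((volume : Measure qB).prod (volume : Measure ℝ)) :=
      (hg.pow_const κ).aemeasurable
    rw [volume_eq_prod, lintegral_prod _ hm, lintegral_prod _ hm2,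
      ← lintegral_const_mul' _ _ ofReal_ne_top]
    refine lintegral_mono fun t => ?_
    have := hl_strong volume (fun i : ℕ × ℕ => denseSeq ℝ i.1) (fun i => dr i.2)
      (fun i => dr_pos _) (fun i => dr_le _) (fun x => g (t, x)) fpr κ₀ κ₁ κ h0 hκ hκ'
    rwa [finrank_self] at this
  have hκ0 : 0 ≤ κ := by linarith
  calc ∫⁻ z, MS f z ^ κ ≤ ∫⁻ z, ofReal (cC ^ κ₁) * Mt (Mx f) z ^ κ := by
        refine lintegral_mono fun z => ?_
        calc MS f z ^ κ ≤ (ofReal cC * Mt (Mx f) z) ^ κ := by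
              gcongr; exact MS_le f hf z
          _ = ofReal (cC ^ κ) * Mt (Mx f) z ^ κ := by
              rw [mul_rpow_of_nonneg _ _ hκ0,
                ofReal_rpow_of_nonneg psv hκ0]
          _ ≤ _ := by
              refine mul_le_mul_left (ofReal_le_ofReal ?_) _
              refine rpow_le_rpow_of_exponent_le ?_ hκ'
              have : Ro ≤ 4 ^ n := one_le_pow₀ nnm
              linarith
    _ = ofReal (cC ^ κ₁) * ∫⁻ z, Mt (Mx f) z ^ κ := by
        rw [lintegral_const_mul' _ _ ofReal_ne_top]
    _ ≤ ofReal (cC ^ κ₁) * (ofReal C2 * (ofReal C1 * ∫⁻ z, f z ^ κ)) := by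
        refine mul_le_mul_right ((hy _ (Mx_meas f hf)).trans (mul_le_mul_right hx _)) _
    _ = _ := by
        rw [ofReal_mul (p := cC ^ κ₁) psv,
          ofReal_mul (p := C2) psv]; ring
end Strong

section Affine
variable {n : ℕ}
def TT (w : Pt n) (r τ : ℝ) (z : Pt n) : Pt n := (w.1 + r • z.1, w.2 + τ * z.2)
lemma aff_map {E : Type*} [NormedAddCommGroup E] [NormedSpace ℝ E] [FiniteDimensional ℝ E]
    [MeasurableSpace E] [BorelSpace E] (μ : Measure E) [μ.IsAddHaarMeasure] (x : E) {r : ℝ}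
    (hr : r ≠ 0) :
    Measure.map (fun y => x + r • y) μ = ofReal (|r| ^ finrank ℝ E)⁻¹ • μ := by
  have : (fun y => x + r • y) = (fun y => x + y) ∘ (fun y : E => r • y) := rfl
  rw [this, ← Measure.map_map fpr fpr, Measure.map_addHaar_smul μ hr,
    Measure.map_smul, map_add_left_eq_self]
  simp [abs_inv, abs_pow]
lemma aff_emb {E : Type*} [NormedAddCommGroup E] [NormedSpace ℝ E]
    [MeasurableSpace E] [BorelSpace E] (x : E) {r : ℝ} (hr : r ≠ 0) :
    MeasurableEmbedding (fun y : E => x + r • y) :=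
  ((Homeomorph.smulOfNeZero r hr).trans (Homeomorph.addLeft x)).measurableEmbedding
lemma aff_lint (x : Spc n) {r : ℝ} (hr : r ≠ 0) (s : Set qB) (f : Spc n → ℝ≥0∞) :
    ∫⁻ y in (fun y => x + r • y) ⁻¹' s, f (x + r • y) = ofReal (|r| ^ n)⁻¹ * ∫⁻ y in s, f y := by
  rw [← (aff_emb x hr).lintegral_map, ← (aff_emb x hr).restrict_map,
    aff_map volume x hr, restrict_smul, lintegral_smul_measure, finrank_euclideanSpace_fin]
  rfl
lemma TT_map (w : Pt n) {r τ : ℝ} (hr : 0 < r) (hτ : 0 < τ) :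
    Measure.map gB volume = ofReal rnτ⁻¹ • volume := by
  have : TT w r τ = Prod.map (fun y => w.1 + r • y) (fun t => w.2 + τ • t) := rfl
  rw [this, volume_eq_prod, ← Measure.map_prod_map _ _ fpr fpr,
    aff_map _ _ hr.ne', aff_map _ _ hτ.ne', Measure.prod_smul_left, Measure.prod_smul_right,
    smul_smul, ← ofReal_mul psv, abs_of_pos hr, abs_of_pos hτ,
    finrank_euclideanSpace_fin, finrank_self, pow_one, mul_inv]
lemma TT_cont (w : Pt n) (r τ : ℝ) : Continuous gB := by unfold TT; fun_prop
lemma TT_contDiff (w : Pt n) (r τ : ℝ) : ContDiff ℝ (⊤ : ℕ∞) gB := by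
  unfold TT; fun_prop
def TTh (w : Pt n) (r τ : ℝ) (hr : 0 < r) (hτ : 0 < τ) : Pt n ≃ₜ Pt n where
  toFun := TT w r τ
  invFun := fun z => (r⁻¹ • (z.1 - w.1), τ⁻¹ * (z.2 - w.2))
  left_inv := fun z => by
    simp [TT, smul_smul, inv_mul_cancel₀ hr.ne', ← mul_assoc, inv_mul_cancel₀ hτ.ne']
  right_inv := fun z => by
    simp [TT, smul_smul, mul_inv_cancel₀ hr.ne', ← mul_assoc, mul_inv_cancel₀ hτ.ne']
  continuous_toFun := TT_cont w r τ
  continuous_invFun := by fun_prop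
lemma TT_emb (w : Pt n) {r τ : ℝ} (hr : 0 < r) (hτ : 0 < τ) : MeasurableEmbedding gB :=
  (TTh w r τ hr hτ).measurableEmbedding
lemma TT_lint (w : Pt n) {r τ : ℝ} (hr : 0 < r) (hτ : 0 < τ) (s : Set bA) (f : Pe) :
    ∫⁻ y in gB ⁻¹' s, f (TT w r τ y) = ofReal rnτ⁻¹ * ∫⁻ y in s, f y := by
  rw [← (TT_emb w hr hτ).lintegral_map,
    ← (TT_emb w hr hτ).restrict_map,
    TT_map w hr hτ, restrict_smul, lintegral_smul_measure]
  rfl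
lemma TT_int (w : Pt n) {r τ : ℝ} (hr : 0 < r) (hτ : 0 < τ) (s : Set bA) (f : Pn) :
    ∫ y in gB ⁻¹' s, f (TT w r τ y) = rnτ⁻¹ * ∫ y in s, f y := by
  rw [← (TT_emb w hr hτ).integral_map,
    ← (TT_emb w hr hτ).restrict_map,
    TT_map w hr hτ, restrict_smul, integral_smul_measure,
    toReal_ofReal psv]
  rfl
lemma TT_pre (w : Pt n) {r τ : ℝ} (hr : 0 < r) (hτ : 0 < τ) (a b : ℝ) :
    gB ⁻¹' (Qrs w (r * a) (τ * b)) = Qrs 0 a b := by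
  ext z
  simp only [TT, Qrs, mem_preimage, mem_prod, mem_ball, mem_Ioo, Prod.fst_zero, Prod.snd_zero,
    dist_eq_norm, add_sub_cancel_left, norm_smul, norm_eq_abs, abs_of_pos hr, sub_zero,
    zero_sub, zero_add]
  constructor
  · rintro ⟨h1, h2, h3⟩
    exact ⟨lt_of_mul_lt_mul_left h1 hr.le, by nlinarith, by nlinarith⟩
  · rintro ⟨h1, h2, h3⟩
    exact ⟨by gcongr, by nlinarith, by nlinarith⟩
end Affine
section LemmaS
variable {n : ℕ}
structure PsiOK (ψ : Spc n → ℝ) (C : ℝ) : Prop where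
  pos : 0 < C
  sm : ContDiff ℝ (⊤ : ℕ∞) ψ
  nn : ∀ y, 0 ≤ ψ y
  int : ∫ y, ψ y = 1
  cs : HasCompactSupport ψ
  ts : tsupport ψ ⊆ ball 0 1
  le : ∀ y, ψ y ≤ C
  dle : ∀ y v, |fderiv ℝ ψ y v| ≤ C * ‖v‖
lemma psi_ex (n : ℕ) : ∃ (ψ : Spc n → ℝ) (C : ℝ), PsiOK ψ C := by
  let b : ContDiffBump (0 : Spc n) := ⟨1/4, 1/2, by norm_num, by norm_num⟩
  have hc : ContDiff ℝ (⊤ : ℕ∞) (b.normed volume) := b.contDiff_normed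
  have hs : HasCompactSupport (b.normed volume) := b.hasCompactSupport_normed
  obtain ⟨C1, h1⟩ := hs.exists_bound_of_continuous hc.continuous
  obtain ⟨C2, h2⟩ := (hs.fderiv (𝕜 := ℝ)).exists_bound_of_continuous (hc.continuous_fderiv smp)
  refine ⟨b.normed volume, max 1 (max C1 C2), by positivity, hc, fun y => b.nonneg_normed y,
    b.integral_normed, hs, ?_, fun y => ?_, fun y v => ?_⟩
  · rw [b.tsupport_normed_eq]
    exact closedBall_subset_ball nnm
  · exact (le_abs_self _).trans ((h1 y).trans (le_max_of_le_right yB))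
  · refine ((fderiv ℝ (b.normed volume) y).le_opNorm v).trans ?_
    gcongr
    exact (h2 y).trans (le_max_of_le_right rC)
def Wg (u : Pn) (z : Pt n) : ℝ := ∑ j, |dxj u j z|
lemma fderiv_x_le (u : Pn) (z : Pt n) (ξ : Spc n) :
    |fderiv ℝ u z (ξ, 0)| ≤ ‖ξ‖ * Wg u z := by
  have h : (ξ, Rz) = ∑ j, ξ j • ((single j Ro : Spc n), Rz) := by
    have h1 : ξ = ∑ j, ξ j • (single j Ro : Spc n) := by
      have := (EuclideanSpace.basisFun (Fin n) ℝ).sum_repr ξ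
      simpa using this.symm
    refine Prod.ext ?_ ?_
    · simpa [Prod.fst_sum] using h1
    · simp [Prod.snd_sum]
  rw [h, map_sum, Wg, mul_sum]
  refine (abs_sum_le_sum_abs _ _).trans (sum_le_sum fun j _ => ?_)
  rw [map_smul, smul_eq_mul, abs_mul]
  refine mul_le_mul_of_nonneg_right ?_ jA
  exact PiLp.norm_apply_le ξ j
lemma Wg_cont {u : Pn} (hu : ContDiff ℝ 1 u) : Continuous (Wg u) := by
  unfold Wg dxj
  have := hu.continuous_fderiv smp
  fun_prop
lemma seg_le {u : Pn} (hu : ContDiff ℝ 1 u) (P Q : Spc n) (t : ℝ) :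
    ‖u (P, t) - u (Q, t)‖ₑ ≤ ofReal ‖P - Q‖ *
      ∫⁻ θ in Ioc Rz 1, ofReal (Wg u uA) := by
  have hd : ∀ θ ∈ uIcc Rz 1, HasDerivAt (fun θ : ℝ => u uA)
      (fderiv ℝ u uA (P - Q, 0)) θ := by
    intro θ _
    have h1 : HasDerivAt (fun θ : ℝ => (uA : Pt n)) (P - Q, 0) θ := by
      refine HasDerivAt.prodMk ?_ (hasDerivAt_const _ _)
      simpa using ((hasDerivAt_id θ).smul_const (P - Q)).const_add Q
    exact ((hu.differentiable smp) _).hasFDerivAt.comp_hasDerivAt θ h1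
  have hcf := hu.continuous_fderiv smp
  have hc : Continuous fun θ : ℝ => fderiv ℝ u uA (P - Q, 0) := by
    have : Continuous fun θ : ℝ => fderiv ℝ u uA := by fun_prop
    fun_prop
  have h := intervalIntegral.integral_eq_sub_of_hasDerivAt hd (hc.intervalIntegrable _ _)
  simp only [one_smul, zero_smul, add_zero, add_sub_cancel] at h
  rw [← h, intervalIntegral.integral_of_le zero_le_one]
  refine (enorm_integral_le_lintegral_enorm _).trans ?_
  have hWc := Wg_cont hu
  rw [← lintegral_const_mul _ fpr]
  refine lintegral_mono fun θ => ?_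
  rw [← ofReal_mul vB, enorm_eq_ofReal_abs]
  exact ofReal_le_ofReal (fderiv_x_le u _ _)
end LemmaS

section LemmaS2
variable {n : ℕ}
lemma PsiOK.zero {ψ : Spc n → ℝ} {C : ℝ} (h : PsiOK ψ C) {y : Spc n} (hy : y ∉ ball (0 : Spc n) 1) :
    ψ y = 0 := image_eq_zero_of_notMem_tsupport fun h' => hy (h.ts h')
lemma PsiOK.intg {ψ : Spc n → ℝ} {C : ℝ} (h : PsiOK ψ C) {g : Spc n → ℝ} (hg : Continuous g) :
    Integrable fun y => ψ y * g y :=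
  (h.sm.continuous.mul hg).integrable_of_hasCompactSupport (h.cs.mul_right)
def ur (ψ : Spc n → ℝ) (u : Pn) (ρ : ℝ) (x : Spc n) (t : ℝ) : ℝ :=
  ∫ y, ψ y * u (x - ρ • y, t)
lemma ur_zero {ψ : Spc n → ℝ} {C : ℝ} (h : PsiOK ψ C) (u : Pn) (x : Spc n) (t : ℝ) :
    ur ψ u 0 x t = u (x, t) := by
  simp [ur, integral_mul_const, h.int]
lemma star {ψ : Spc n → ℝ} {C : ℝ} (h : PsiOK ψ C) {u : Pn} (hu : ContDiff ℝ 1 u)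
    (x x' : Spc n) (ρ ρ' t : ℝ) :
    ‖ur ψ u ρ x t - ur ψ u ρ' x' t‖ₑ ≤ ofReal (C * (‖x - x'‖ + |ρ - ρ'|)) *
      ∫⁻ θ in Ioc Rz 1, ∫⁻ y in ball (0 : Spc n) 1,
        ofReal (Wg u ((x' + θ • (x - x')) + (-(ρ' + θ * (ρ - ρ'))) • y, t)) := by
  have hWc := Wg_cont hu
  have huc := hu.continuous
  have e : ur ψ u ρ x t - ur ψ u ρ' x' t =
      ∫ y, ψ y * (u (x - ρ • y, t) - u (x' - ρ' • y, t)) := by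
    simp_rw [mul_sub]
    rw [ur, ur, integral_sub (h.intg fpr) (h.intg fpr)]
  rw [e]
  refine (enorm_integral_le_lintegral_enorm _).trans ?_
  calc ∫⁻ y, ‖ψ y * (u (x - ρ • y, t) - u (x' - ρ' • y, t))‖ₑ
      ≤ ∫⁻ y, (ball (0 : Spc n) 1).indicator (fun y =>
        ofReal (C * (‖x - x'‖ + |ρ - ρ'|)) * ∫⁻ θ in Ioc Rz 1,
        ofReal (Wg u ((x' + θ • (x - x')) + (-(ρ' + θ * (ρ - ρ'))) • y, t))) y := by
        refine lintegral_mono fun y => ?_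
        by_cases hy : y ∈ ball (0 : Spc n) 1
        · rw [indicator_of_mem hy, enorm_mul]
          have hs := seg_le hu (x - ρ • y) (x' - ρ' • y) t
          have e2 : ∀ θ : ℝ, (x' - ρ' • y) + θ • (x - ρ • y - (x' - ρ' • y)) =
              (x' + θ • (x - x')) + (-(ρ' + θ * (ρ - ρ'))) • y := by
            intro θ; module
          simp_rw [e2] at hs
          refine (mul_le_mul' (b := ofReal C) ?_ hs).trans ?_
          · rw [enorm_eq_ofReal_abs, abs_of_nonneg (h.nn y)]
            exact ofReal_le_ofReal (h.le y)
          · rw [← mul_assoc, ← ofReal_mul h.pos.le]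
            refine mul_le_mul_left (ofReal_le_ofReal ?_) _
            refine mul_le_mul_of_nonneg_left ?_ h.pos.le
            rw [show x - ρ • y - (x' - ρ' • y) = (x - x') - (ρ - ρ') • y by module]
            refine (norm_sub_le _ _).trans ?_
            rw [norm_smul, norm_eq_abs]
            rw [mem_ball_zero_iff] at hy
            have := mul_le_mul_of_nonneg_left hy.le (abs_nonneg (ρ - ρ'))
            linarith
        · rw [h.zero hy]; simp
    _ = _ := by
        rw [lintegral_indicator measurableSet_ball, lintegral_const_mul' _ _ ofReal_ne_top,
          lintegral_lintegral_swap]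
        exact Continuous.aemeasurable (ENNReal.continuous_ofReal.comp (hWc.comp fpr))
abbrev Qo (n : ℕ) : Set bA := Qrs O0 f54 f54
lemma mem_Qo {x : Spc n} {t : ℝ} (hx : ‖x‖ < 5/4) (ht : |t| < 5/4) : (x, t) ∈ Qo n := by
  refine ⟨by simpa using hx, ?_⟩
  simp only [Prod.snd_zero, zero_sub, zero_add, mem_Ioo]
  exact abs_lt.1 ht
def Gw (u : Pn) : Pe := (Qo n).indicator fun z => ofReal (Wg u z)
lemma Gw_meas {u : Pn} (hu : ContDiff ℝ 1 u) : Measurable fD := by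
  have := (Wg_cont hu).measurable
  exact Measurable.indicator fpr wB
lemma ball_scale (f : Spc n → ℝ≥0∞) (x : Spc n) {ρ : ℝ} (hρ : 0 < ρ) :
    ∫⁻ y in ball (0 : Spc n) 1, f (x + (-ρ) • y) =
      ofReal (ρ ^ n)⁻¹ * ∫⁻ y in ball x ρ, f y := by
  have := aff_lint x (neg_ne_zero.2 hρ.ne') (ball x ρ) f
  rw [abs_neg, abs_of_pos hρ] at this
  rw [← this]
  congr 2
  ext y
  simp [dist_eq_norm, norm_smul, abs_of_pos hρ]
  constructor
  · intro h; nlinarith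
  · intro h; nlinarith [norm_nonneg y]
lemma Sa {ψ : Spc n → ℝ} {C : ℝ} (h : PsiOK ψ C) {u : Pn} (hu : ContDiff ℝ 1 u)
    (x : Spc n) (ρ t : ℝ) (hx : ‖x‖ < 1) (ht : |t| < 5/4) (hρ : 0 < ρ) (hρ1 : ρ ≤ 1/4) :
    ‖u (x, t) - ur ψ u ρ x t‖ₑ ≤
      ofReal (C * (4 ^ n * vb n)) * (ofReal ρ * Mx fD (x, t)) := by
  have hs := star h hu x x ρ 0 t
  rw [ur_zero h, enorm_sub_rev] at hs
  refine hs.trans ?_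
  have hvb := vb_pos n
  have : ∀ θ ∈ Ioc Rz 1, ∫⁻ y in ball (0 : Spc n) 1,
        ofReal (Wg u ((x + θ • (x - x)) + (-(0 + θ * (ρ - 0))) • y, t)) ≤
        ofReal (4 ^ n * vb n) * Mx fD (x, t) := by
    intro θ hθ
    have hp := mul_pos hθ.1 hρ
    have hp1 : θ * ρ ≤ 1/4 := by nlinarith [hθ.2]
    calc _ = ofReal ((θ * ρ) ^ n)⁻¹ * ∫⁻ y in ball x (θ * ρ), ofReal (Wg u (y, t)) := by
          rw [← ball_scale (fun y => ofReal (Wg u (y, t))) x hp]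
          simp
      _ ≤ ofReal ((θ * ρ) ^ n)⁻¹ * ∫⁻ y in ball x (θ * ρ), Gw u (y, t) := by
          refine mul_le_mul_right (setLIntegral_mono' measurableSet_ball fun y hy => ?_) _
          rw [Gw, indicator_of_mem]
          refine mem_Qo ?_ ht
          have := norm_sub_norm_le y x
          rw [mem_ball_iff_norm] at hy
          linarith
      _ ≤ ofReal ((θ * ρ) ^ n)⁻¹ * (ofReal (4 ^ n) * volume (ball x (θ * ρ)) *
          Mx fD (x, t)) := by
          refine mul_le_mul_right ?_ _
          have := avg_le_HLd volume (fun y => Gw u (y, t)) x x hp lia0 (mem_ball_self hp)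
          rwa [finrank_euclideanSpace_fin] at this
      _ = _ := by
          rw [ball_vol _ hp, ← ofReal_mul psv, ← mul_assoc,
            ← ofReal_mul psv]
          congr 2
          have : (θ * ρ) ^ n ≠ 0 := psv
          field_simp
  refine (mul_le_mul_right (setLIntegral_mono' measurableSet_Ioc this) _).trans ?_
  rw [setLIntegral_const, Real.volume_Ioc]
  simp only [sub_self, norm_zero, zero_add, sub_zero, ofReal_one, mul_one, abs_of_pos hρ]
  rw [ofReal_mul h.pos.le, ofReal_mul h.pos.le]
  apply le_of_eq; ring
lemma Sc {ψ : Spc n → ℝ} {C : ℝ} (h : PsiOK ψ C) {u : Pn} (hu : ContDiff ℝ 1 u)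
    (x : Spc n) (ρ t : ℝ) (hx : ‖x‖ < 1) (ht : |t| < 5/4) (hρ : 0 < ρ) (hρ1 : ρ ≤ 1/4) :
    ‖ur ψ u ρ x t - ur ψ u (1/4) 0 t‖ₑ ≤
      ofReal (C * f54) * (ofReal (ρ ^ n)⁻¹ * ∫⁻ y, Gw u (y, t)) := by
  refine (star h hu x 0 ρ (1/4) t).trans ?_
  have : ∀ θ ∈ Ioc Rz 1, ∫⁻ y in ball (0 : Spc n) 1,
        ofReal (Wg u ((0 + θ • (x - 0)) + (-(1/4 + θ * (ρ - 1/4))) • y, t)) ≤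
        ofReal (ρ ^ n)⁻¹ * ∫⁻ y, Gw u (y, t) := by
    intro θ hθ
    have hp : ρ ≤ 1/4 + θ * (ρ - 1/4) := by nlinarith [hθ.2]
    have hp2 : 1/4 + θ * (ρ - 1/4) ≤ 1/4 := by nlinarith [hθ.1]
    rw [ball_scale (fun y => ofReal (Wg u (y, t))) _ (hρ.trans_le hp)]
    refine mul_le_mul' (ofReal_le_ofReal ?_) ?_
    · gcongr
    · calc _ ≤ ∫⁻ y in ball (0 + θ • (x - 0)) (1/4 + θ * (ρ - 1/4)), Gw u (y, t) := by
            refine setLIntegral_mono' measurableSet_ball fun y hy => ?_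
            rw [Gw, indicator_of_mem]
            refine mem_Qo ?_ ht
            rw [mem_ball_iff_norm] at hy
            have h1 := norm_sub_norm_le y (0 + θ • (x - 0))
            have h2 : ‖(0 : Spc n) + θ • (x - 0)‖ ≤ ‖x‖ := by
              rw [zero_add, sub_zero, norm_smul, norm_eq_abs, abs_of_pos hθ.1]
              nlinarith [norm_nonneg x, hθ.2]
            linarith
        _ ≤ _ := setLIntegral_le_lintegral _ _
  refine (mul_le_mul_right (setLIntegral_mono' measurableSet_Ioc this) _).trans ?_
  rw [setLIntegral_const, Real.volume_Ioc]
  simp only [sub_zero, ofReal_one, mul_one]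
  refine mul_le_mul_left (ofReal_le_ofReal ?_) _
  refine mul_le_mul_of_nonneg_left ?_ h.pos.le
  rw [abs_of_nonpos lia0]
  linarith
end LemmaS2

section LemmaS3
variable {n : ℕ}
lemma Sb {ψ : Spc n → ℝ} {C : ℝ} (h : PsiOK ψ C) {u : Pn} (hu : ContDiff ℝ 1 u)
    {B : Fin n → Pn} (hB : ∀ j, ContDiff ℝ 1 fA)
    (heq : ∀ z ∈ Qo n, fderiv ℝ u z (0, 1) = ∑ j, dxj fA j z)
    (x : Spc n) (ρ t t' : ℝ) (hx : ‖x‖ < 1) (ht : |t| < 5/4) (ht' : |t'| < 5/4) (htt : t' ≤ t)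
    (hρ : 0 < ρ) (hρ1 : ρ ≤ 1/4) :
    ‖ur ψ u ρ x t - ur ψ u ρ x t'‖ₑ ≤
      ofReal (C * (ρ ^ vA)⁻¹) * ∫⁻ z in Qo n, ofReal lA := by
  have huc := hu.continuous
  have hBc := fun j => (hB j).continuous
  have hcf := hu.continuous_fderiv smp
  have hcB : ∀ j, Continuous (fderiv ℝ fA) := fun j => (hB j).continuous_fderiv smp
  have hψc := h.sm.continuous
  have hψd := h.sm.continuous_fderiv smp
  have hin : ∀ y ∈ ball (0 : Spc n) 1, ∀ s ∈ Ioc t' t, xρy ∈ Qo n := by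
    intro y hy s hs
    refine mem_Qo ?_ ?_
    · rw [mem_ball_zero_iff] at hy
      have := norm_sub_le x (ρ • y)
      rw [norm_smul, norm_eq_abs, abs_of_pos hρ] at this
      nlinarith
    · rw [abs_lt] at *
      constructor <;> linarith [hs.1, hs.2]
  have e1 : ur ψ u ρ x t - ur ψ u ρ x t' =
      ∫ y, ∫ s in Ioc t' t, ψ y * fderiv ℝ u xρy (0, 1) := by
    rw [ur, ur, ← integral_sub (h.intg fpr) (h.intg fpr)]
    congr 1; ext y
    rw [integral_const_mul, ← mul_sub]
    congr 1
    rw [← intervalIntegral.integral_of_le htt]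
    symm
    refine intervalIntegral.integral_eq_sub_of_hasDerivAt (f := fun s => u xρy) ?_ ?_
    · intro s _
      exact ((hu.differentiable smp) _).hasFDerivAt.comp_hasDerivAt s
        ((hasDerivAt_const s _).prodMk (hasDerivAt_id s))
    · exact Continuous.intervalIntegrable fpr _ _
  have e2 : (∫ y, ∫ s in Ioc t' t, ψ y * fderiv ℝ u xρy (0, 1)) =
      ∫ s in Ioc t' t, ∫ y, ψ y * fderiv ℝ u xρy (0, 1) := by
    refine integral_integral_swap ?_
    have hc : Continuous (uncurry fun (y : Spc n) (s : ℝ) =>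
        ψ y * fderiv ℝ u xρy (0, 1)) := by
      unfold uncurry; fun_prop
    have h1 : IntegrableOn (uncurry fun (y : Spc n) (s : ℝ) =>
        ψ y * fderiv ℝ u xρy (0, 1)) (closedBall (0 : Spc n) 1 ×ˢ Icc t' t)
        (volume.prod volume) :=
      hc.continuousOn.integrableOn_compact ((isCompact_closedBall _ _).prod isCompact_Icc)
    have h2 := h1.mono_set (prod_mono (subset_refl (closedBall (0 : Spc n) 1)) Ioc_subset_Icc_self)
    rw [IntegrableOn, ← prod_restrict] at h2
    have h3 : (volume : Measure qB).prod (volume.restrict (Ioc t' t)) =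
      ((volume : Measure qB).restrict univ).prod (volume.restrict (Ioc t' t)) := by
        rw [Measure.restrict_univ]
    rw [h3, prod_restrict, ← IntegrableOn]
    rw [prod_restrict, ← IntegrableOn] at h2
    refine h2.of_forall_diff_eq_zero (MeasurableSet.univ.prod measurableSet_Ioc) ?_
    rintro ⟨y, s⟩ ⟨⟨-, hs⟩, hy⟩
    have : y ∉ ball (0 : Spc n) 1 := fun h' => hy ⟨ball_subset_closedBall h', hs⟩
    simp [h.zero this]
  have e3 : ∀ s ∈ Ioc t' t, ‖∫ y, ψ y * fderiv ℝ u xρy (0, 1)‖ₑ ≤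
      ofReal (C * (ρ ^ vA)⁻¹) *
        ∫⁻ y in ball x ρ, ofReal (∑ j, |B j (y, s)|) := by
    intro s hs
    have hib : ∀ j, ∫ y, ψ y * dxj fA j xρy =
        ρ⁻¹ * ∫ y, fderiv ℝ ψ y (single j 1) * B j xρy := by
      intro j
      have hd : ∀ y, HasFDerivAt (fun y : Spc n => B j xρy)
          ((fderiv ℝ fA xρy).comp
            ((-(ρ • ContinuousLinearMap.id ℝ qB)).prod 0)) y := by
        intro y
        refine (((hB j).differentiable smp) _).hasFDerivAt.comp y
          (HasFDerivAt.prodMk ?_ (hasFDerivAt_const s y))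
        simpa using ((hasFDerivAt_id y).const_smul ρ).const_sub x
      have hd' : ∀ y, fderiv ℝ (fun y : Spc n => B j xρy) y (single j 1) =
          - ρ * dxj fA j xρy := by
        intro y
        rw [(hd y).fderiv, dxj, ← smul_eq_mul, ← map_smul]
        simp
      have hcd : Continuous fun y : Spc n => dxj fA j xρy := by
        unfold dxj; have := hcB j; fun_prop
      have hk := integral_mul_fderiv_eq_neg_fderiv_mul_of_integrable
        (v := single j 1)
        (by
          refine Continuous.integrable_of_hasCompactSupport (by have := hBc j; fun_prop) ?_
          exact ((h.cs.fderiv (𝕜 := ℝ)).comp_left (g := fun L : Spc n →L[ℝ] ℝ => L (single j 1)) smp).mul_right)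
        (by simp_rw [hd']; exact h.intg fpr) (h.intg (by have := hBc j; fun_prop))
        (fun y _ => (h.sm.differentiable smp) y)
        (fun y _ => (hd y).differentiableAt)
      simp_rw [hd'] at hk
      rw [eq_inv_mul_iff_mul_eq₀ hρ.ne', ← integral_const_mul]
      rw [neg_eq_iff_eq_neg.symm, ← integral_neg] at hk
      rw [← hk]; congr 1; ext y; ring
    have e4 : ∫ y, ψ y * fderiv ℝ u xρy (0, 1) =
        ∑ j, ρ⁻¹ * ∫ y, fderiv ℝ ψ y (single j 1) * B j xρy := by
      simp_rw [← hib]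
      rw [← integral_finsetSum]
      · congr 1; ext y
        by_cases hy : y ∈ ball (0 : Spc n) 1
        · rw [heq _ (hin y hy s hs), mul_sum]
        · simp [h.zero hy]
      · intro j _
        refine h.intg ?_
        unfold dxj; have := hcB j; fun_prop
    have hsm : Continuous fun z => ∑ j, |B j z| := by fun_prop
    rw [e4]
    calc _ ≤ ∑ j, ‖ρ⁻¹ * ∫ y, fderiv ℝ ψ y (single j 1) * B j xρy‖ₑ :=
          enorm_sum_le _ _
      _ ≤ ∑ j, ∫⁻ y in ball (0 : Spc n) 1, ofReal (ρ⁻¹ * C * |B j xρy|) := by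
          refine sum_le_sum fun j _ => ?_
          rw [← integral_const_mul]
          refine (enorm_integral_le_lintegral_enorm _).trans ?_
          rw [← lintegral_indicator measurableSet_ball]
          refine lintegral_mono fun y => ?_
          by_cases hy : y ∈ ball (0 : Spc n) 1
          · rw [indicator_of_mem hy, enorm_eq_ofReal_abs]
            refine ofReal_le_ofReal ?_
            rw [abs_mul, abs_mul, abs_of_pos (inv_pos.2 hρ), mul_assoc]
            gcongr
            simpa using h.dle y (single j 1)
          · have : fderiv ℝ ψ y = 0 := by
              refine image_eq_zero_of_notMem_tsupport fun h' => hy (h.ts ?_)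
              exact tsupport_fderiv_subset ℝ h'
            simp [this]
      _ = ofReal (ρ⁻¹ * C) * ∫⁻ y in ball (0 : Spc n) 1,
          ofReal (∑ j, |B j (x + (-ρ) • y, s)|) := by
          rw [← lintegral_finsetSum _ (fun j _ => by have := hBc j; fun_prop),
            ← lintegral_const_mul _ fpr]
          refine lintegral_congr fun y => ?_
          rw [← ofReal_sum_of_nonneg (fun j _ => by have := h.pos; positivity),
            ← ofReal_mul (by have := h.pos; positivity), mul_sum]
          simp [sub_eq_add_neg]
      _ = _ := by
          rw [ball_scale (fun y => ofReal (∑ j, |B j (y, s)|)) x hρ, ← mul_assoc,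
            ← ofReal_mul (by have := h.pos; positivity)]
          congr 2
          rw [pow_succ]; field_simp
  rw [e1, e2]
  refine (enorm_integral_le_lintegral_enorm _).trans ?_
  refine (setLIntegral_mono' measurableSet_Ioc e3).trans ?_
  have hsm : Continuous fun z => ∑ j, |B j z| := by fun_prop
  rw [lintegral_const_mul' _ _ ofReal_ne_top]
  refine mul_le_mul_right ?_ _
  have hm : Measurable fun z => ofReal lA := by fun_prop
  calc _ ≤ ∫⁻ z in ball x ρ ×ˢ Ioc t' t, ofReal lA := by
        rw [volume_eq_prod, ← prod_restrict,
          lintegral_prod_symm' _ hm]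
    _ ≤ _ := by
        refine lintegral_mono_set ?_
        rintro ⟨y, s⟩ ⟨hy, hs⟩
        refine mem_Qo ?_ ?_
        · have := norm_sub_norm_le y x
          rw [mem_ball_iff_norm] at hy
          simp only at hy
          linarith
        · rw [abs_lt] at *
          simp only at hs
          constructor <;> linarith [hs.1, hs.2]
end LemmaS3

section LemmaS4
variable {n : ℕ}
lemma enn_le_one_add (b : ℝ≥0∞) {m : ℝ} (hm : 1 ≤ m) : b ≤ 1 + b ^ m := by
  rcases le_total b 1 with h | h
  · exact h.trans le_self_add
  · refine le_trans ?_ le_add_self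
    calc b = b ^ Ro := (ENNReal.rpow_one b).symm
      _ ≤ b ^ m := ENNReal.rpow_le_rpow_of_exponent_le h hm
lemma S_unit (n : ℕ) (m σ' : ℝ) (hm : 1 < m) (hσ : 0 < σ') (hσm : σ' * vA ≤ m * (n + 2)) :
    ∃ K : ℝ, 0 < K ∧ ∀ (u : Pn) (B : Fin n → Pn), ContDiff ℝ 1 u →
      (∀ j, ContDiff ℝ 1 fA) →
      (∀ z ∈ Qo n, fderiv ℝ u z (0, 1) = ∑ j, dxj fA j z) →
      ∫⁻ z in Qo n, ofReal (Wg u z) ^ m ≤ 1 →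
      ∫⁻ z in Qo n, ofReal lA ≤ 1 →
      ∃ c : ℝ, ∫⁻ z in Qrs O0 1 1, ‖u z - c‖ₑ ^ σ' ≤ ofReal K := by
  obtain ⟨ψ, C, h⟩ := psi_ex n
  have hC := h.pos
  have hvb := vb_pos n
  set v0 := (volume (Qo n)).toReal with hv0
  have hv0' : volume (Qo n) = ofReal v0 := (ofReal_toReal (Qrs_vol_ne_top _ _ _)).symm
  have hv0n : 0 ≤ v0 := toReal_nonneg
  set K2 := C * (4 ^ n * vb n) + C + C * f54 * (v0 + 1) with hK2
  have hK2p : 0 < K2 := psv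
  set K3 := (K2 * (1 + 4 ^ vA)) with hK3
  set Cm := (m * (2 * 4 ^ n) * (2 ^ m / sC)) with hCm
  have hm1 : 0 < m - 1 := by linarith
  have hCmp : 0 < Cm := psv
  refine ⟨K3 ^ σ' * (v0 + Cm), by positivity, fun u B hu hB heq hW hBi => ?_⟩
  have hGm := Gw_meas hu
  have hG1 : ∫⁻ t, ∫⁻ y, Gw u (y, t) ≤ ofReal (v0 + 1) := by
    rw [← lintegral_prod_symm' _ hGm, ← volume_eq_prod, Gw, lintegral_indicator wB]
    calc _ ≤ ∫⁻ z in Qo n, (1 + ofReal (Wg u z) ^ m) :=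
          lintegral_mono fun z => enn_le_one_add _ hm.le
      _ = volume (Qo n) + ∫⁻ z in Qo n, ofReal (Wg u z) ^ m := by
          rw [lintegral_add_left measurable_const, setLIntegral_one]
      _ ≤ _ := by
          rw [ofReal_add hv0n zero_le_one, hv0', ofReal_one]
          gcongr
  have hGm' : ∫⁻ z, Gw u z ^ m ≤ 1 := by
    refine le_trans leq hW
    rw [← lintegral_indicator wB]
    refine lintegral_congr fun z => ?_
    by_cases hz : z ∈ Qo n
    · simp [Gw, hz]
    · simp [Gw, hz, zero_rpow_of_pos (by linarith : 0 < m)]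
  obtain ⟨t', ht', hGt⟩ : ∃ t' ∈ Ioo (-1:ℝ) 1, ∫⁻ y, Gw u (y, t') ≤ ofReal (v0 + 1) := by
    by_contra hcon
    push Not at hcon
    have h1 : ∫⁻ t in Ioo (-1:ℝ) 1, ofReal (v0 + 1) ≤ ∫⁻ t in Ioo (-1:ℝ) 1, ∫⁻ y, Gw u (y, t) :=
      setLIntegral_mono' measurableSet_Ioo fun t ht => (hcon t ht).le
    have h2 := (h1.trans (setLIntegral_le_lintegral _ _)).trans hG1
    rw [setLIntegral_const, Real.volume_Ioo, ← ofReal_mul psv,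
      ofReal_le_ofReal_iff psv] at h2
    linarith
  set c := ur ψ u (1/4) 0 t' with hc
  have ht'5 : |t'| < 5/4 := by rw [abs_lt]; constructor <;> linarith [ht'.1, ht'.2]
  have key : ∀ z ∈ Qrs O0 1 1, ∀ ρ : ℝ, 0 < ρ → ρ ≤ 1/4 →
      ‖u z - c‖ₑ ≤ ofReal K2 * (ofReal ρ * Mx fD z + ofReal (ρ ^ qA)⁻¹) := by
    rintro ⟨x, t⟩ ⟨hx, ht⟩ ρ hρ hρ1
    simp only [Prod.fst_zero, Prod.snd_zero, mem_ball_zero_iff, zero_sub, zero_add] at hx ht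
    have ht5 : |t| < 5/4 := by rw [abs_lt]; constructor <;> linarith [ht.1, ht.2]
    have a1 := Sa h hu x ρ t hx ht5 hρ hρ1
    have a3 := Sc h hu x ρ t' hx ht'5 hρ hρ1
    have a2 : ‖ur ψ u ρ x t - ur ψ u ρ x t'‖ₑ ≤ ofReal (C * (ρ ^ vA)⁻¹) := by
      rcases le_total t' t with htt | htt
      · refine (Sb h hu hB heq x ρ t t' hx ht5 ht'5 htt hρ hρ1).trans ?_
        exact mul_le_of_le_one_right zero_le hBi
      · rw [enorm_sub_rev]
        refine (Sb h hu hB heq x ρ t' t hx ht'5 ht5 htt hρ hρ1).trans ?_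
        exact mul_le_of_le_one_right zero_le hBi
    have e : u (x, t) - c = (u (x, t) - ur ψ u ρ x t) + (ur ψ u ρ x t - ur ψ u ρ x t') +
        (ur ψ u ρ x t' - ur ψ u (1/4) 0 t') := by rw [hc]; ring
    rw [e]
    refine (enorm_add_le _ _).trans ((add_le_add ((enorm_add_le _ _).trans (add_le_add a1 a2)) a3).trans ?_)
    have hR : (ρ ^ n)⁻¹ ≤ (ρ ^ qA)⁻¹ := by
      gcongr 1
      exact pow_le_pow_of_le_one hρ.le lia0 (by omega)
    have a4 : ofReal (C * f54) * (ofReal (ρ ^ n)⁻¹ * ∫⁻ y, Gw u (y, t')) ≤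
        ofReal (C * f54 * (v0 + 1)) * ofReal (ρ ^ qA)⁻¹ := by
      calc _ ≤ ofReal (C * f54) * (ofReal (ρ ^ qA)⁻¹ * ofReal (v0 + 1)) := by
            gcongr
        _ = _ := by rw [ofReal_mul (p := C * f54) psv]; ring
    refine (add_le_add_right a4 _).trans ?_
    rw [hK2, ofReal_add psv psv,
      ofReal_add psv psv, ofReal_mul (q := (ρ ^ qA)⁻¹) hC.le]
    set X := ofReal ρ * Mx fD (x, t)
    set Y := ofReal (ρ ^ vA)⁻¹
    set A1 := ofReal (C * (4 ^ n * vb n))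
    set A2 := ofReal C
    set A3 := ofReal (C * f54 * (v0 + 1))
    calc A1 * X + A2 * Y + A3 * Y ≤ A1 * X + A2 * Y + A3 * Y + (A1 * Y + A2 * X + A3 * X) := le_self_add
      _ = _ := by ring
  refine ⟨c, ?_⟩
  have key2 : ∀ z ∈ Qrs O0 1 1, ‖u z - c‖ₑ ^ σ' ≤
      ofReal (K3 ^ σ') * (1 + Mx fD z ^ m) := by
    intro z hz
    have hK3p : 0 < K3 := psv
    rcases le_or_gt (Mx fD z) 1 with hM | hM
    · refine le_trans ?_ (mul_le_mul_right le_self_add _)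
      rw [mul_one, ← ofReal_rpow_of_nonneg hK3p.le hσ.le]
      gcongr
      refine (key z hz (1/4) nnm le_rfl).trans ?_
      rw [hK3, ofReal_mul hK2p.le, ofReal_add (p := 1) nnm psv]
      refine mul_le_mul_right (add_le_add ?_ ?_) _
      · rw [ofReal_one]
        refine mul_le_one' ?_ hM
        rw [← ofReal_one]; exact ofReal_le_ofReal nnm
      · simp
    · rcases eq_or_ne (Mx fD z) ∞ with hT | hT
      · rw [hT, top_rpow_of_pos lia0, add_top, mul_top]
        · exact le_top
        · simp; positivity
      · refine le_trans ?_ (mul_le_mul_right le_add_self _)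
        set b := (Mx fD z).toReal with hb
        have hMb := (ofReal_toReal hT).symm
        have hb1 : 1 < b := by
          rw [hb, ← ENNReal.toReal_one]; exact (ENNReal.toReal_lt_toReal smp hT).2 hM
        have hb0 : 0 < b := by linarith
        have hn2 : Rz < n + 2 := psv
        set e := (nR + 1) / (n + 2) with he
        have hbe : 1 ≤ b ^ (1 / (nR + 2)) := one_le_rpow hb1.le psv
        have hk := key z hz ((1/4) * wA⁻¹) psv
          (by
            have : wA⁻¹ ≤ 1 := inv_le_one_of_one_le₀ hbe
            linarith)
        have e1 : (1/4) * wA⁻¹ * b ≤ b ^ e := by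
          have : wA⁻¹ * b = b ^ e := by
            rw [← rpow_neg hb0.le]
            nth_rewrite 2 [← rpow_one b]
            rw [← rpow_add hb0]
            congr 1; rw [he]; field_simp; ring
          rw [mul_assoc, this]
          have : 0 ≤ b ^ e := psv
          linarith
        have e2 : (((1/4) * wA⁻¹) ^ qA)⁻¹ = 4 ^ qA * b ^ e := by
          have : wA ^ qA = b ^ e := by
            rw [← rpow_natCast, ← rpow_mul hb0.le]
            congr 1; rw [he]; push_cast; field_simp
          rw [mul_pow, mul_inv, inv_pow, inv_inv, this]; simp
        have hk2 : ‖u z - c‖ₑ ≤ ofReal (K3 * b ^ e) := by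
          refine hk.trans ?_
          rw [hMb, ← ofReal_mul psv, e2, ← ofReal_add psv
            psv, ← ofReal_mul hK2p.le]
          refine ofReal_le_ofReal ?_
          rw [hK3, mul_assoc K2]
          refine mul_le_mul_of_nonneg_left ?_ hK2p.le
          linarith
        calc _ ≤ (ofReal (K3 * b ^ e)) ^ σ' := by gcongr
          _ = ofReal (K3 ^ σ' * b ^ (e * σ')) := by
              rw [ofReal_rpow_of_nonneg psv hσ.le,
                mul_rpow hK3p.le psv, rpow_mul hb0.le]
          _ ≤ ofReal (K3 ^ σ' * b ^ m) := by
              refine ofReal_le_ofReal (mul_le_mul_of_nonneg_left ?_ psv)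
              refine rpow_le_rpow_of_exponent_le hb1.le ?_
              rw [he, div_mul_eq_mul_div, div_le_iff₀ hn2]; linarith
          _ = _ := by
              rw [ofReal_mul psv, hMb, ofReal_rpow_of_nonneg hb0.le lia0]
  refine (setLIntegral_mono' wB key2).trans ?_
  rw [lintegral_const_mul' _ _ ofReal_ne_top, ofReal_mul psv]
  refine mul_le_mul_right ?_ _
  rw [lintegral_add_left measurable_const, setLIntegral_one, ofReal_add hv0n hCmp.le]
  refine add_le_add ?_ ?_
  · rw [← hv0']
    refine measure_mono (prod_mono (ball_subset_ball nnm) (Ioo_subset_Ioo ?_ ?_)) <;> norm_num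
  · refine (setLIntegral_le_lintegral _ _).trans
      ((mx_strong n m m hm fD hGm m le_rfl le_rfl).trans ?_)
    exact mul_le_of_le_one_right zero_le hGm'
end LemmaS4

section LemmaS5
variable {n : ℕ}
lemma TT_hasFDerivAt (w : Pt n) (r τ : ℝ) (z : Pt n) : HasFDerivAt gB
    ((r • ContinuousLinearMap.fst ℝ qB ℝ).prod (τ • ContinuousLinearMap.snd ℝ qB ℝ)) z := by
  unfold TT
  refine HasFDerivAt.prodMk ?_ ?_
  · simpa using ((hasFDerivAt_fst).const_smul r).const_add w.1
  · simpa using ((hasFDerivAt_snd).const_smul τ).const_add w.2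
lemma TT_fderiv {u : Pn} (hu : ContDiff ℝ 1 u) (w : Pt n) (r τ k : ℝ) (z : Pt n)
    (ξ : Spc n) (s : ℝ) :
    fderiv ℝ (fun z => k * u Tz) z (ξ, s) = k * fderiv ℝ u Tz (r • ξ, τ * s) := by
  have h1 := ((hu.differentiable smp Tz).hasFDerivAt.comp z (TT_hasFDerivAt w r τ z)).const_mul k
  have h2 := h1.fderiv
  simp only [Function.comp_def] at h2
  rw [h2]; simp
lemma TT_dxj {u : Pn} (hu : ContDiff ℝ 1 u) (w : Pt n) (r τ k : ℝ) (z : Pt n) (j : Fin n) :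
    dxj (fun z => k * u Tz) j z = k * r * dxj u j Tz := by
  rw [dxj, TT_fderiv hu, dxj, mul_zero, mul_assoc]
  rw [show ((r • single j Ro, 0) : Pt n) = r • eJ by simp,
    map_smul, smul_eq_mul]
lemma S_scaled (n : ℕ) (m σ' : ℝ) (hm : 1 < m) (hσ : 0 < σ') (hσm : σ' * vA ≤ m * (n + 2)) :
    ∃ K : ℝ, 0 < K ∧ ∀ (u : Pn) (B : Fin n → Pn) (w : Pt n) (r τ κ : ℝ),
      0 < r → 0 < τ → 0 < κ → ContDiff ℝ 1 u →
      (∀ j, ContDiff ℝ 1 fA) →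
      (∀ z ∈ Qrs w (r * f54) (τ * f54), fderiv ℝ u z (0, 1) = ∑ j, dxj fA j z) →
      ∫⁻ z in Qrs w (r * f54) (τ * f54), ofReal (r * Wg u z) ^ m ≤
        ofReal (κ ^ m * rnτ) →
      ∫⁻ z in Qrs w (r * f54) (τ * f54), ofReal (τ / r * ∑ j, |B j z|) ≤
        ofReal (κ * rnτ) →
      ∃ c : ℝ, ∫⁻ z in Qrs w r τ, ‖u z - c‖ₑ ^ σ' ≤ ofReal (K * (κ ^ σ' * rnτ)) := by
  obtain ⟨K, hK, H⟩ := S_unit n m σ' hm hσ hσm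
  refine ⟨K, hK, fun u B w r τ κ hr hτ hκ hu hB heq hW hBi => ?_⟩
  have hpre := TT_pre w hr hτ f54 f54
  have hTc : ContDiff ℝ 1 gB := (TT_contDiff w r τ).of_le smp
  have hP : 0 < r ^ n * τ := psv
  have hWe : ∀ z, ofReal (Wg (fun z => κ⁻¹ * u Tz) z) ^ m =
      ofReal (κ ^ m)⁻¹ * ofReal (r * Wg u Tz) ^ m := by
    intro z
    rw [← inv_rpow hκ.le, ← ofReal_rpow_of_pos psv,
      ← mul_rpow_of_nonneg _ _ lia0, ← ofReal_mul psv]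
    congr 2
    simp only [Wg, TT_dxj hu, abs_mul, abs_of_pos hr, abs_of_pos (inv_pos.2 hκ), mul_sum, mul_assoc]
  obtain ⟨c, hc⟩ := H (fun z => κ⁻¹ * u Tz) (fun j z => (κ⁻¹ * (τ / r)) * B j Tz)
    (contDiff_const.mul (hu.comp hTc)) (fun j => contDiff_const.mul ((hB j).comp hTc))
    (by
      intro z hz
      rw [Qo, ← hpre] at hz
      simp_rw [TT_dxj (hB _)]
      rw [TT_fderiv hu, ← mul_sum, ← heq _ hz, smul_zero, mul_one,
        show ((0, τ) : Pt n) = τ • (0, 1) by simp, map_smul, smul_eq_mul]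
      field_simp)
    (by
      simp_rw [hWe]
      rw [lintegral_const_mul' _ _ ofReal_ne_top, Qo, ← hpre,
        TT_lint w hr hτ _ (fun z => ofReal (r * Wg u z) ^ m)]
      refine (mul_le_mul_right (mul_le_mul_right hW _) _).trans leq
      rw [← ofReal_mul psv, ← ofReal_mul psv,
        ← ofReal_one]
      congr 1
      have : κ ^ m ≠ 0 := psv
      field_simp)
    (by
      have : ∀ z, ofReal (∑ j, |(κ⁻¹ * (τ / r)) * B j Tz|) =
          ofReal κ⁻¹ * ofReal (τ / r * ∑ j, |B j Tz|) := by
        intro z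
        rw [← ofReal_mul psv]
        congr 1
        simp only [abs_mul, abs_of_pos (div_pos hτ hr), abs_of_pos (inv_pos.2 hκ), mul_sum, mul_assoc]
      simp_rw [this]
      rw [lintegral_const_mul' _ _ ofReal_ne_top, Qo, ← hpre,
        TT_lint w hr hτ _ (fun z => ofReal (τ / r * ∑ j, |B j z|))]
      refine (mul_le_mul_right (mul_le_mul_right hBi _) _).trans leq
      rw [← ofReal_mul psv, ← ofReal_mul psv,
        ← ofReal_one]
      congr 1
      field_simp)
  refine ⟨κ * c, ?_⟩
  have hpre1 := TT_pre w hr hτ 1 1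
  rw [mul_one, mul_one] at hpre1
  have he : ∀ z, ‖κ⁻¹ * u Tz - c‖ₑ ^ σ' =
      ofReal (κ ^ σ')⁻¹ * ‖u Tz - κ * c‖ₑ ^ σ' := by
    intro z
    rw [← inv_rpow hκ.le, ← ofReal_rpow_of_pos psv,
      ← mul_rpow_of_nonneg _ _ hσ.le, ← Real.enorm_of_nonneg (inv_pos.2 hκ).le, ← enorm_mul]
    congr 2
    field_simp
  simp_rw [he] at hc
  rw [lintegral_const_mul' _ _ ofReal_ne_top, ← hpre1,
    TT_lint w hr hτ _ (fun z => ‖u z - κ * c‖ₑ ^ σ'), ← mul_assoc, ← ofReal_mul psv] at hc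
  have h2 := mul_le_mul_right hc (ofReal (κ ^ σ' * rnτ))
  rw [← mul_assoc, ← ofReal_mul psv, ← ofReal_mul psv] at h2
  have : κ ^ σ' * rnτ * ((κ ^ σ')⁻¹ * rnτ⁻¹) = 1 := by
    have : κ ^ σ' ≠ 0 := psv
    field_simp
  rw [this, ofReal_one, one_mul] at h2
  rwa [mul_comm K]
end LemmaS5

section Moll
variable {n : ℕ}
lemma jens {X : Type*} [MeasurableSpace X] (μ : Measure X) (f : X → ℝ≥0∞) (hf : AEMeasurable f μ)
    {m : ℝ} (hm : 1 ≤ m) : (∫⁻ x, f x ∂μ) ^ m ≤ μ univ ^ sC * ∫⁻ x, f x ^ m ∂μ := by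
  rcases eq_or_lt_of_le hm with h | h
  · simp [← h]
  · have hc := HolderConjugate.conjExponent h
    have := ENNReal.lintegral_mul_le_Lp_mul_Lq μ hc hf (aemeasurable_const (b := (1:ℝ≥0∞)))
    simp only [Pi.mul_apply, mul_one, ENNReal.one_rpow, lintegral_const, one_mul] at this
    calc _ ≤ ((∫⁻ x, f x ^ m ∂μ) ^ (1 / m) * μ univ ^ (1 / m.conjExponent)) ^ m := by gcongr
      _ = _ := by
        rw [mul_rpow_of_nonneg _ _ lia0, ← ENNReal.rpow_mul, ← ENNReal.rpow_mul,
          mul_comm]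
        have h1 : 1 / m * m = 1 := by field_simp
        have h2 : 1 / m.conjExponent * m = m - 1 := by
          rw [Real.conjExponent]; have : m - 1 ≠ 0 := by linarith
          field_simp
        rw [h1, h2, ENNReal.rpow_one]
def hk (k : ℕ) : ℝ := 1 / (k + 1)
lemma hk_pos (k : ℕ) : 0 < hk k := by unfold hk; positivity
def bmp (n k : ℕ) : ContDiffBump O0 := ⟨hk k / 2, hk k, half_pos (hk_pos k), half_lt_self (hk_pos k)⟩
def mol (k : ℕ) (f : Pn) : Pn :=
  convolution f ((bmp n k).normed volume) (ContinuousLinearMap.mul ℝ ℝ) volume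
lemma mol_eq (k : ℕ) (f : Pn) (z : Pt n) :
    mol k f z = ∫ y, f y * (bmp n k).normed volume (z - y) := rfl
lemma mol_smooth (k : ℕ) {f : Pn} (hf : Integrable f) : ContDiff ℝ (⊤ : ℕ∞) (mol k f) :=
  HasCompactSupport.contDiff_convolution_right _ (bmp n k).hasCompactSupport_normed
    hf.locallyIntegrable (bmp n k).contDiff_normed
def tst (n k : ℕ) (z : Pt n) : Pn := fun y => (bmp n k).normed volume (z - y)
lemma mol_fderiv (k : ℕ) {f : Pn} (hf : Integrable f) (z v : Pt n) :
    fderiv ℝ (mol k f) z v =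
      - ∫ y, f y * fderiv ℝ dD y v := by
  have hsm : ContDiff ℝ (⊤ : ℕ∞) ((bmp n k).normed volume) := (bmp n k).contDiff_normed
  have hcs := (bmp n k).hasCompactSupport_normed (μ := (volume : Measure bA))
  have h := HasCompactSupport.hasFDerivAt_convolution_right (ContinuousLinearMap.mul ℝ ℝ)
    hcs hf.locallyIntegrable (hsm.of_le smp) z
  have h2 : fderiv ℝ (mol k f) z = _ := h.fderiv
  rw [h2, convolution_precompR_apply _ hf.locallyIntegrable (hcs.fderiv ℝ)
    (hsm.continuous_fderiv smp), convolution, ← integral_neg]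
  congr 1; ext y
  have h3 : HasFDerivAt dD
      ((fderiv ℝ ((bmp n k).normed volume) (z - y)).comp (-(ContinuousLinearMap.id ℝ bA))) y :=
    ((hsm.differentiable smp) _).hasFDerivAt.comp y ((hasFDerivAt_id y).const_sub z)
  rw [h3.fderiv]
  simp
lemma mol_ae {f : Pn} (hf : Integrable f) :
    ∀ᵐ z, Tendsto (fun k => mol k f z) atTop (𝓝 (f z)) := by
  have := ContDiffBump.ae_convolution_tendsto_right_of_locallyIntegrable
    (φ := fun k => bmp n k) (l := atTop) (K := 2)
    (by
      show Tendsto (fun k : ℕ => hk k) atTop (𝓝 0)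
      exact tendsto_one_div_add_atTop_nhds_zero_nat)
    (of_forall fun k => by show hk k ≤ 2 * (hk k / 2); linarith) hf.locallyIntegrable
  filter_upwards [this] with z hz
  refine hz.congr fun k => ?_
  rw [convolution_lsmul_swap, mol_eq]
  refine integral_congr_ae (of_forall fun y => ?_)
  simp [mul_comm]
lemma tst_smooth (k : ℕ) (z : Pt n) : ContDiff ℝ (⊤ : ℕ∞) dD :=
  (bmp n k).contDiff_normed.comp (contDiff_const.sub contDiff_id)
lemma tst_supp (k : ℕ) (z : Pt n) : tsupport dD ⊆ closedBall z cA := by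
  refine closure_minimal ?_ isClosed_closedBall
  intro y hy
  have : z - y ∈ support ((bmp n k).normed volume) := hy
  rw [ContDiffBump.support_normed_eq, mem_ball_zero_iff] at this
  rw [mem_closedBall, dist_comm, dist_eq_norm]
  exact this.le
lemma tst_cs (k : ℕ) (z : Pt n) : HasCompactSupport dD :=
  HasCompactSupport.of_support_subset_isCompact (isCompact_closedBall z cA)
    ((subset_tsupport _).trans (tst_supp k z))
structure WS (u : Pn) (V B : Fin n → Pn) : Prop where
  ui : Integrable u
  Vi : ∀ j, Integrable (V j)
  Bi : ∀ j, Integrable fA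
  grad : ∀ j (ψ : Pn), ContDiff ℝ (⊤ : ℕ∞) ψ → HasCompactSupport ψ → tsupport ψ ⊆ ball 0 2 →
    ∫ z, u z * dxj ψ j z = - ∫ z, V j z * ψ z
  eq : ∀ (ψ : Pn), ContDiff ℝ (⊤ : ℕ∞) ψ → HasCompactSupport ψ → tsupport ψ ⊆ ball 0 2 →
    ∫ z, u z * fderiv ℝ ψ z (0, 1) = ∑ j, ∫ z, B j z * dxj ψ j z
lemma tst_supp2 (k : ℕ) {z : Pt n} (hz : z ∈ bO (2 - hk k)) :
    tsupport dD ⊆ ball 0 2 := by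
  refine (tst_supp k z).trans fun y hy => ?_
  rw [mem_ball] at *
  rw [mem_closedBall] at hy
  linarith [dist_triangle y z 0]
lemma WS.mol_grad {u : Pn} {V B : Fin n → Pn} (h : WS u V B) (k : ℕ) (j : Fin n) {z : Pt n}
    (hz : z ∈ bO (2 - hk k)) : dxj tC j z = mol k (V j) z := by
  rw [dxj, mol_fderiv k h.ui]
  have := h.grad j dD (tst_smooth k z) (tst_cs k z) (tst_supp2 k hz)
  simp only [dxj] at this
  rw [this, neg_neg, mol_eq]; rfl
lemma WS.mol_eqn {u : Pn} {V B : Fin n → Pn} (h : WS u V B) (k : ℕ) {z : Pt n}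
    (hz : z ∈ bO (2 - hk k)) :
    fderiv ℝ tC z (0, 1) = ∑ j, dxj (mol k fA) j z := by
  rw [mol_fderiv k h.ui]
  have := h.eq dD (tst_smooth k z) (tst_cs k z) (tst_supp2 k hz)
  simp only [dxj] at this
  rw [this, ← Finset.sum_neg_distrib]
  refine sum_congr rfl fun j _ => ?_
  rw [dxj, mol_fderiv k (h.Bi j)]
lemma mol_le (k : ℕ) (f : Pn) (z : Pt n) :
    ‖mol k f z‖ₑ * volume aC ≤ ofReal tn1 * ∫⁻ y in ball z cA, ‖f y‖ₑ := by
  have hv : volume aC ≠ ∞ := measure_ball_lt_top.ne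
  have hv0 : volume aC ≠ 0 := (measure_ball_pos _ _ (hk_pos k)).ne'
  have hb : ∀ y, ‖(bmp n k).normed volume y‖ₑ ≤ ofReal tn1 / volume aC := by
    intro y
    have h1 := (bmp n k).normed_le_div_measure_closedBall_rOut (volume : Measure bA) 2
      (by show hk k ≤ 2 * (hk k / 2); linarith) y
    rw [enorm_eq_ofReal_abs, abs_of_nonneg ((bmp n k).nonneg_normed y)]
    refine (ofReal_le_ofReal h1).trans ?_
    change ofReal (_ / (volume (closedBall O0 cA)).toReal) ≤ _
    rw [ENNReal.ofReal_div_of_pos (toReal_pos (measure_closedBall_pos _ _ (hk_pos k)).ne'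
      measure_closedBall_lt_top.ne), ofReal_toReal measure_closedBall_lt_top.ne]
    have e : finrank ℝ bA = n + 1 := by simp [Module.finrank_prod]
    rw [e]
    refine ENNReal.div_le_div_left ?_ _
    rw [addHaar_ball_center volume z]
    exact measure_mono ball_subset_closedBall
  calc _ ≤ (∫⁻ y in ball z cA, (ofReal tn1 / volume aC) * ‖f y‖ₑ) *
        volume aC := by
        refine mul_le_mul_left ?_ _
        rw [mol_eq]
        refine (enorm_integral_le_lintegral_enorm _).trans ?_
        rw [← lintegral_indicator measurableSet_ball]
        refine lintegral_mono fun y => ?_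
        by_cases hy : y ∈ ball z cA
        · rw [indicator_of_mem hy, enorm_mul, mul_comm]
          exact mul_le_mul_left (hb _) _
        · have : (bmp n k).normed volume (z - y) = 0 := by
            by_contra hne
            have : z - y ∈ support ((bmp n k).normed volume) := hne
            rw [ContDiffBump.support_normed_eq, mem_ball_zero_iff] at this
            exact hy (by rw [mem_ball, dist_comm, dist_eq_norm]; exact this)
          simp [this]
    _ = _ := by
        rw [lintegral_const_mul' _ _ (ENNReal.div_ne_top ofReal_ne_top hv0), mul_right_comm,
          ENNReal.div_mul_cancel hv0 hv]
lemma mol_pow_le (k : ℕ) {f : Pn} (hf : AEMeasurable f) {m : ℝ} (hm : 1 ≤ m) (z : Pt n) :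
    ‖mol k f z‖ₑ ^ m * volume aC ≤
      ofReal (tn1 ^ m) * ∫⁻ y in ball z cA, ‖f y‖ₑ ^ m := by
  have hv : volume aC ≠ ∞ := measure_ball_lt_top.ne
  have hv0 : volume aC ≠ 0 := (measure_ball_pos _ _ (hk_pos k)).ne'
  have h1 := ENNReal.rpow_le_rpow (mol_le k f z) (by linarith : 0 ≤ m)
  rw [mul_rpow_of_nonneg _ _ lia0, mul_rpow_of_nonneg _ _ lia0,
    ofReal_rpow_of_nonneg psv lia0] at h1
  have h2 := jens (volume.restrict aC) (fun y => ‖f y‖ₑ) hf.enorm.restrict hm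
  rw [restrict_apply_univ] at h2
  have h3 := h1.trans (mul_le_mul_right h2 _)
  set v := volume aC
  have hvm : v ^ m = v ^ sC * v := by
    rw [show m = sC + 1 by ring, ENNReal.rpow_add _ _ hv0 hv, ENNReal.rpow_one]; simp
  have hvm0 : v ^ sC ≠ 0 := by simp [hv0, hv]
  have hvmt : v ^ sC ≠ ∞ := by simp [hv0, hv]
  rw [hvm] at h3
  have h4 : v ^ sC * (‖mol k f z‖ₑ ^ m * v) ≤ v ^ sC *
      (ofReal (tn1 ^ m) * ∫⁻ y in ball z cA, ‖f y‖ₑ ^ m) := by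
    rw [mul_left_comm, mul_left_comm (v ^ (m-1))]; exact h3
  exact (ENNReal.mul_le_mul_iff_right hvm0 hvmt).1 h4
end Moll

section M34
variable {n : ℕ}
lemma minmul (a b : ℝ) (ha : 0 < a) (hb : 0 < b) : (a + b) * min a b ≤ 2 * (a * b) := by
  rcases le_total a b with h | h
  · rw [min_eq_left h]; nlinarith
  · rw [min_eq_right h]; nlinarith
lemma inter_vol (w y : Pt n) {r τ h : ℝ} (hr : 0 < r) (hh : 0 < h) :
    volume (Qrs w r τ ∩ ball y h) ≤ ofReal mA := by
  rw [ball_eq_Qrs, ← Qrs_vol' (if r ≤ h then w.1 else y.1, if τ ≤ h then w.2 else y.2) (lt_min hr hh)]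
  refine measure_mono ?_
  rintro z ⟨⟨h1, h2⟩, h3, h4⟩
  constructor
  · by_cases h' : r ≤ h
    · simpa [h'] using h1
    · simpa [h', min_eq_right (le_of_not_ge h')] using h3
  · by_cases h' : τ ≤ h
    · simpa [h'] using h2
    · simpa [h', min_eq_right (le_of_not_ge h')] using h4
lemma m34 (k : ℕ) {f : Pn} (hf : AEMeasurable f) {m : ℝ} (hm : 1 ≤ m) (w : Pt n) {r τ : ℝ}
    (hr : 0 < r) (hτ : 0 < τ) :
    (∫⁻ z in Qrs w r τ, ‖mol k f z‖ₑ ^ m) * volume (Qrs w (r + hk k) (τ + hk k)) ≤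
      ofReal (tn1 ^ m * 2 ^ qA) * volume gA *
        ∫⁻ z in Qrs w (r + hk k) (τ + hk k), ‖f z‖ₑ ^ m := by
  set h := hk k with hh
  have h0 := hk_pos k
  set P := Qrs w (r + h) (τ + h) with hP
  have hPm : MeasurableSet P := Qrs_meas _ _ _
  have hUm : MeasurableSet gA := Qrs_meas _ _ _
  have hbv : ∀ z : Pt n, volume (ball z h) = ofReal (2 * vb n * (h ^ n * h)) := fun z => by
    rw [ball_eq_Qrs, Qrs_vol' _ h0]
  set v := ofReal (2 * vb n * (h ^ n * h)) with hv
  have hvb := vb_pos n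
  have hv0 : v ≠ 0 := by rw [hv, Ne, ENNReal.ofReal_eq_zero, not_le]; positivity
  have hvt : v ≠ ∞ := ofReal_ne_top
  set F : Pe := P.indicator (fun y => ‖f y‖ₑ ^ m) with hF
  have hFm := (hf.enorm.pow_const m).indicator hPm
  set C := ofReal (tn1 ^ m) with hC
  have e1 : (∫⁻ z in Qrs w r τ, ‖mol k f z‖ₑ ^ m) * v ≤ C * ∫⁻ z in Qrs w r τ, ∫⁻ y, (ball z h).indicator F y := by
    rw [← lintegral_mul_const' _ _ hvt, ← lintegral_const_mul' _ _ ofReal_ne_top]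
    refine setLIntegral_mono' hUm fun z hz => ?_
    rw [← hbv z]
    refine (mol_pow_le k hf hm z).trans (mul_le_mul_right ?_ _)
    rw [lintegral_indicator measurableSet_ball]
    refine setLIntegral_mono' measurableSet_ball fun y hy => ?_
    have : y ∈ P := by
      rw [← hh, ball_eq_Qrs] at hy
      obtain ⟨a1, a2⟩ := hy; obtain ⟨b1, b2⟩ := hz
      rw [mem_ball] at a1 b1; simp only [mem_Ioo] at a2 b2
      refine ⟨?_, ?_⟩
      · rw [mem_ball]; linarith [dist_triangle y.1 z.1 w.1]
      · constructor <;> linarith [a2.1, a2.2, b2.1, b2.2]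
    rw [hF, indicator_of_mem this]
  have e2 : ∫⁻ z in Qrs w r τ, ∫⁻ y, (ball z h).indicator F y =
      ∫⁻ y, F y * volume (Qrs w r τ ∩ ball y h) := by
    have hS : MeasurableSet {x : Pt n × Pt n | dist x.2 x.1 < h} :=
      (isOpen_lt fpr continuous_const).measurableSet
    have ee : ∀ z y : Pt n, (ball z h).indicator F y =
        {x : Pt n × Pt n | dist x.2 x.1 < h}.indicator (fun x => F x.2) (z, y) := fun z y => rfl
    simp only [ee]
    rw [lintegral_lintegral_swap]
    · refine lintegral_congr fun y => ?_
      have : ∀ z : Pt n, {x : Pt n × Pt n | dist x.2 x.1 < h}.indicator (fun x => F x.2) (z, y) =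
          (ball y h).indicator (fun _ => F y) z := fun z => by
        simp only [indicator, mem_ball, mem_ofPred_eq, dist_comm]
      simp only [this]
      rw [lintegral_indicator measurableSet_ball, lintegral_const, restrict_restrict measurableSet_ball,
        restrict_apply_univ, inter_comm]
    · refine AEMeasurable.indicator ?_ hS
      exact hFm.comp_quasiMeasurePreserving Measure.quasiMeasurePreserving_snd
  have e3 : ∫⁻ y, F y * volume (Qrs w r τ ∩ ball y h) ≤
      (∫⁻ y in P, ‖f y‖ₑ ^ m) * ofReal mA := by
    rw [← lintegral_indicator hPm, ← lintegral_mul_const' _ _ ofReal_ne_top]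
    exact lintegral_mono fun y => mul_le_mul_right (inter_vol w y hr h0) _
  have e4 : ofReal mA * volume P ≤
      ofReal tn1 * volume gA * v := by
    rw [hP, Qrs_vol' _ (by linarith : 0 < r + h), Qrs_vol' _ hr, hv, ← ofReal_mul psv,
      ← ofReal_mul psv, ← ofReal_mul psv]
    refine ofReal_le_ofReal ?_
    have a1 := pow_le_pow_left₀ (mul_nonneg lia0 (le_min hr.le h0.le)) (minmul r h hr h0) n
    rw [mul_pow, mul_pow, mul_pow] at a1
    have a2 := minmul τ h hτ h0
    have a3 := mul_le_mul a1 a2 (mul_nonneg lia0 (le_min hτ.le h0.le)) psv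
    calc _ = eD ^ 2 * ((r + h) ^ n * min r h ^ n * ((τ + h) * min τ h)) := by ring
      _ ≤ eD ^ 2 * (2 ^ n * (r ^ n * h ^ n) * (2 * (τ * h))) := by gcongr
      _ = _ := by ring
  have e5 : ((∫⁻ z in Qrs w r τ, ‖mol k f z‖ₑ ^ m) * volume P) * v ≤
      (ofReal (tn1 ^ m * 2 ^ qA) * volume gA * ∫⁻ z in P, ‖f z‖ₑ ^ m) * v := by
    calc _ = ((∫⁻ z in Qrs w r τ, ‖mol k f z‖ₑ ^ m) * v) * volume P := by ring
      _ ≤ (C * ((∫⁻ y in P, ‖f y‖ₑ ^ m) * ofReal mA)) * volume P :=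
          mul_le_mul_left (e1.trans (mul_le_mul_right (e2.le.trans e3) _)) _
      _ = C * (∫⁻ y in P, ‖f y‖ₑ ^ m) * (ofReal mA * volume P) := by ring
      _ ≤ C * (∫⁻ y in P, ‖f y‖ₑ ^ m) * (ofReal tn1 * volume gA * v) :=
          mul_le_mul_right e4 _
      _ = _ := by rw [ofReal_mul psv]; ring
  exact (ENNReal.mul_le_mul_iff_left hv0 hvt).1 e5
lemma int_fderiv_zero {f : Pn} (hf : Differentiable ℝ f) (hi : Integrable f) (v : Pt n)
    (hd : Integrable (fun z => fderiv ℝ f z v)) : ∫ z, fderiv ℝ f z v = 0 := by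
  have := integral_mul_fderiv_eq_neg_fderiv_mul_of_integrable
    (f := fun _ => Ro) (g := f) (v := v) smp (by simpa using hd) (by simpa using hi)
    fpr (fun x _ => hf x)
  simpa using this
lemma WS.shift {u : Pn} {V B : Fin n → Pn} (h : WS u V B) (c : ℝ) :
    WS ((ball 0 2).indicator fun z => u z - c) V B := by
  have key : ∀ (ψ : Pn) (v : Pt n), ContDiff ℝ (⊤ : ℕ∞) ψ → HasCompactSupport ψ → tsupport ψ ⊆ ball 0 2 →
      ∫ z, (bO 2).indicator (fun z => u z - c) z * fderiv ℝ ψ z v = ∫ z, u z * fderiv ℝ ψ z v := by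
    intro ψ v h1 h2 h3
    have hc : Continuous (fun z => fderiv ℝ ψ z v) := (h1.continuous_fderiv smp).clm_apply continuous_const
    have hcs : HasCompactSupport (fun z => fderiv ℝ ψ z v) := (h2.fderiv_apply (𝕜 := ℝ) v)
    have i1 : Integrable (fun z => fderiv ℝ ψ z v) := hc.integrable_of_hasCompactSupport hcs
    obtain ⟨D, hD⟩ := hcs.exists_bound_of_continuous hc
    have i2 :=
      h.ui.mul_bdd hc.aestronglyMeasurable (of_forall hD)
    have : ∀ z, (bO 2).indicator (fun z => u z - c) z * fderiv ℝ ψ z v =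
        u z * fderiv ℝ ψ z v - c * fderiv ℝ ψ z v := by
      intro z
      by_cases hz : z ∈ bO 2
      · rw [indicator_of_mem hz]; ring
      · have : fderiv ℝ ψ z = 0 := by
          have h4 : z ∉ tsupport ψ := fun h' => hz (h3 h')
          exact image_eq_zero_of_notMem_tsupport fun h' => h4 (tsupport_fderiv_subset ℝ h')
        simp [this]
    simp only [this]
    rw [integral_sub i2 (i1.const_mul c), integral_const_mul,
      int_fderiv_zero (h1.differentiable smp) (h1.continuous.integrable_of_hasCompactSupport h2) v i1]
    ring
  refine ⟨?_, h.Vi, h.Bi, fun j ψ h1 h2 h3 => ?_, fun ψ h1 h2 h3 => ?_⟩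
  · rw [integrable_indicator_iff measurableSet_ball]
    exact h.ui.integrableOn.sub (integrableOn_const)
  · rw [← h.grad j ψ h1 h2 h3]; exact key ψ _ h1 h2 h3
  · rw [← h.eq ψ h1 h2 h3]; exact key ψ _ h1 h2 h3
end M34

section Part
variable {n : ℕ}
def bb (n : ℕ) : ContDiffBump O0 := ⟨1/2, 3/4, by norm_num, by norm_num⟩
def LL (n : ℕ) (r τ : ℝ) : Pt n →L[ℝ] Pt n :=
  r⁻¹ • ((ContinuousLinearMap.inl ℝ qB ℝ).comp (ContinuousLinearMap.fst ℝ qB ℝ)) +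
    τ⁻¹ • ((ContinuousLinearMap.inr ℝ qB ℝ).comp (ContinuousLinearMap.snd ℝ qB ℝ))
lemma LL_app (r τ : ℝ) (z : Pt n) : LL n r τ z = (r⁻¹ • z.1, τ⁻¹ * z.2) := by
  simp [LL]
def kf (w : Pt n) (r τ : ℝ) (z : Pt n) : ℝ := rnτ⁻¹ * bb n (LL n r τ eC)
lemma kf_nonneg (w : Pt n) {r τ : ℝ} (hr : 0 < r) (hτ : 0 < τ) (z : Pt n) : 0 ≤ kf w r τ z :=
  mul_nonneg psv (bb n).nonneg
lemma kf_le (w : Pt n) {r τ : ℝ} (hr : 0 < r) (hτ : 0 < τ) (z : Pt n) : kf w r τ z ≤ rnτ⁻¹ :=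
  mul_le_of_le_one_right psv (bb n).le_one
lemma LL_mem {w z : Pt n} {r τ d : ℝ} (hr : 0 < r) (hτ : 0 < τ) :
    LL n r τ eC ∈ bO d ↔ z ∈ Qrs w (r * d) (τ * d) := by
  rw [LL_app, ball_eq_Qrs]
  simp only [Qrs, mem_prod, sub_zero, zero_sub, zero_add, norm_smul, norm_inv, norm_eq_abs, abs_of_pos hr, mem_Ioo,
    Prod.fst_sub, Prod.snd_sub, Prod.fst_zero, Prod.snd_zero, mem_ball, dist_eq_norm]
  rw [inv_mul_lt_iff₀ hr, lt_inv_mul_iff₀ hτ, inv_mul_lt_iff₀ hτ]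
  constructor
  · rintro ⟨h1, h2, h3⟩; refine ⟨h1, ?_, ?_⟩ <;> linarith
  · rintro ⟨h1, h2, h3⟩; refine ⟨h1, ?_, ?_⟩ <;> linarith
lemma LL_cball {w z : Pt n} {r τ : ℝ} (hr : 0 < r) (hτ : 0 < τ) (h : z ∉ Qrs w r τ) :
    LL n r τ eC ∉ closedBall O0 (3/4) := by
  intro h'
  refine h ?_
  have := (LL_mem (w := w) (z := z) (d := 1) hr hτ).1 (closedBall_subset_ball nnm h')
  simpa using this
lemma kf_zero {w z : Pt n} {r τ : ℝ} (hr : 0 < r) (hτ : 0 < τ) (h : z ∉ Qrs w r τ) : kf w r τ z = 0 := by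
  have h1 := LL_cball hr hτ h
  rw [kf, (bb n).zero_of_le_dist, mul_zero]
  rw [mem_closedBall, not_le] at h1; exact h1.le
lemma kf_ts (w : Pt n) {r τ : ℝ} (hr : 0 < r) (hτ : 0 < τ) : tsupport (kf w r τ) ⊆ Qrs w r τ := by
  intro z hz
  by_contra h
  have h1 := LL_cball hr hτ h
  have hcl : IsClosed {z : Pt n | LL n r τ eC ∈ closedBall O0 (3/4)} :=
    isClosed_closedBall.preimage fpr
  refine h1 (closure_minimal ?_ hcl hz)
  intro y hy
  by_contra h2
  rw [mem_ofPred_eq, mem_closedBall, not_le] at h2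
  exact hy (by rw [kf, (bb n).zero_of_le_dist h2.le, mul_zero])
lemma kf_lb {w z : Pt n} {r τ : ℝ} (hr : 0 < r) (hτ : 0 < τ) (h : z ∈ Qrs w (r/2) (τ/2)) :
    kf w r τ z = rnτ⁻¹ := by
  rw [kf, (bb n).one_of_mem_closedBall, mul_one]
  refine ball_subset_closedBall ((LL_mem hr hτ).2 ?_)
  change z ∈ Qrs w (r * iB) (τ * iB)
  convert h using 2 <;> ring
def kd (w : Pt n) (r τ : ℝ) (z : Pt n) : Pt n →L[ℝ] ℝ :=
  rnτ⁻¹ • (fderiv ℝ zA (LL n r τ eC)).comp (LL n r τ)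
lemma kf_deriv (w : Pt n) (r τ : ℝ) (z : Pt n) : HasFDerivAt (kf w r τ) (kd w r τ z) z := by
  have h1 : HasFDerivAt (fun z => LL n r τ eC) (LL n r τ) z := by
    have := (LL n r τ).hasFDerivAt.comp z ((hasFDerivAt_id z).sub_const w)
    rwa [ContinuousLinearMap.comp_id] at this
  have h2 : HasFDerivAt zA (fderiv ℝ zA (LL n r τ eC)) (LL n r τ eC) :=
    (((bb n).contDiff (n := 1)).differentiable smp _).hasFDerivAt
  exact (h2.comp z h1).const_mul _
lemma kd_zero {w z : Pt n} {r τ : ℝ} (hr : 0 < r) (hτ : 0 < τ) (h : z ∉ Qrs w r τ) : kd w r τ z = 0 := by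
  have h1 : z ∉ tsupport (kf w r τ) := fun h' => h (kf_ts w hr hτ h')
  rw [← (kf_deriv w r τ z).fderiv]
  exact image_eq_zero_of_notMem_tsupport fun h' => h1 (tsupport_fderiv_subset ℝ h')
lemma bb_bd (n : ℕ) : ∃ C > 0, ∀ z v, |fderiv ℝ zA z v| ≤ C * ‖v‖ := by
  obtain ⟨C, hC⟩ := ((bb n).hasCompactSupport.fderiv (𝕜 := ℝ)).exists_bound_of_continuous
    (((bb n).contDiff (n := 1)).continuous_fderiv smp)
  refine ⟨max 1 C, by positivity, fun z v => ?_⟩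
  refine ((fderiv ℝ zA z).le_opNorm v).trans ?_
  gcongr
  exact (hC z).trans rC
def An (r τ : ℝ) (v : Pt n) : ℝ := ‖v.1‖ / r + |v.2| / τ
lemma An_nn {r τ : ℝ} (hr : 0 < r) (hτ : 0 < τ) (v : Pt n) : 0 ≤ An r τ v := by unfold An; positivity
lemma LL_le {r τ : ℝ} (hr : 0 < r) (hτ : 0 < τ) (v : Pt n) : ‖LL n r τ v‖ ≤ An r τ v := by
  rw [LL_app, Prod.norm_mk, An, norm_smul, norm_mul, norm_inv, norm_inv, norm_eq_abs, norm_eq_abs,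
    abs_of_pos hr, abs_of_pos hτ, norm_eq_abs, inv_mul_eq_div, inv_mul_eq_div]
  have : 0 ≤ ‖v.1‖ / r := psv
  have : 0 ≤ |v.2| / τ := psv
  exact max_le lia0 lia0
lemma kd_le {C : ℝ} (hC0 : 0 < C) (hC : ∀ z v, |fderiv ℝ zA z v| ≤ C * ‖v‖) (w : Pt n) {r τ : ℝ}
    (hr : 0 < r) (hτ : 0 < τ) (z v : Pt n) : |kd w r τ z v| ≤ C * An r τ v * rnτ⁻¹ := by
  simp only [kd, ContinuousLinearMap.smul_apply, ContinuousLinearMap.comp_apply, smul_eq_mul, abs_mul]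
  rw [abs_of_pos (by positivity : 0 < rnτ⁻¹), mul_comm]
  gcongr
  exact (hC _ _).trans (by gcongr; exact LL_le hr hτ v)
lemma kf_meas {r τ : Pn} (hr : Measurable r) (hτ : Measurable τ) :
    Measurable (fun x : Pt n × Pt n => kf x.1 (r x.1) (τ x.1) x.2) := by
  simp only [kf, LL_app]
  refine Measurable.mul fpr ?_
  exact (bb n).continuous.measurable.comp fpr
lemma kd_meas {r τ : Pn} (hr : Measurable r) (hτ : Measurable τ) (z : Pt n) :
    StronglyMeasurable (fun w : Pt n => kd w dA eA z) := by
  have h1 : StronglyMeasurable (fun w : Pt n => LL n dA eA) :=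
    (hr.inv.stronglyMeasurable.smul_const _).add (hτ.inv.stronglyMeasurable.smul_const _)
  have h2 : StronglyMeasurable (fun w : Pt n => fderiv ℝ zA (LL n dA eA eC)) := by
    have : Measurable (fun w : Pt n => LL n dA eA eC) := by simp only [LL_app]; fun_prop
    exact (((bb n).contDiff (n := 1)).continuous_fderiv smp).comp_stronglyMeasurable this.stronglyMeasurable
  have h3 :=
    (isBoundedBilinearMap_comp).continuous.comp_stronglyMeasurable
      (h2.prodMk h1)
  have h4 : Measurable (fun w => (dA ^ n * τ w)⁻¹) := by fun_prop
  exact h4.stronglyMeasurable.smul h3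
structure WF (O : Set bA) (r τ : Pn) : Prop where
  op : IsOpen O
  fin : volume O ≠ ∞
  rm : Measurable r
  tm : Measurable τ
  rp : ∀ w ∈ O, 0 < r w
  tp : ∀ w ∈ O, 0 < τ w
  sub : ∀ w ∈ O, Qrs w dA eA ⊆ O
  cmp : ∀ w ∈ O, ∀ w' ∈ O, (Qrs w dA eA ∩ Qrs w' (r w') (τ w')).Nonempty → r w ≤ 4 * r w' ∧ τ w ≤ 32 * τ w'
lemma self_mem (w : Pt n) {r τ : ℝ} (hr : 0 < r) (hτ : 0 < τ) : w ∈ Qrs w r τ :=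
  ⟨mem_ball_self hr, by constructor <;> linarith⟩
lemma Qrs_symm {w z : Pt n} {r τ : ℝ} (h : z ∈ Qrs w r τ) : w ∈ Qrs z r τ := by
  obtain ⟨h1, h2, h3⟩ := h
  exact ⟨by rwa [mem_ball, dist_comm], by linarith, by linarith⟩
lemma Qrs_mono (w : Pt n) {r τ r' τ' : ℝ} (hr : r ≤ r') (hτ : τ ≤ τ') : Qrs w r τ ⊆ Qrs w r' τ' := by
  rintro z ⟨h1, h2, h3⟩
  exact ⟨ball_subset_ball hr h1, by linarith, by linarith⟩
variable {O : Set bA} {r τ : Pn}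
lemma WF.c1 (h : WF O r τ) {w z : Pt n} (hw : w ∈ O) (hz : z ∈ Qrs w dA eA) :
    r w ≤ 4 * r z ∧ τ w ≤ 32 * τ z ∧ r z ≤ 4 * r w ∧ τ z ≤ 32 * τ w := by
  have hzO := h.sub w hw hz
  have h1 := h.cmp w hw z hzO ⟨z, hz, self_mem z (h.rp z hzO) (h.tp z hzO)⟩
  have h2 := h.cmp z hzO w hw ⟨z, self_mem z (h.rp z hzO) (h.tp z hzO), hz⟩
  exact ⟨h1.1, h1.2, h2.1, h2.2⟩
lemma inv_cmp {a b c d : ℝ} (ha : 0 < a) (hb : 0 < b) (hc : 0 < c) (hd : 0 < d) (h1 : c ≤ 4 * a) (h2 : d ≤ 32 * b) :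
    (a ^ n * b)⁻¹ ≤ 4 ^ n * 32 * (c ^ n * d)⁻¹ := by
  rw [← div_eq_mul_inv, inv_eq_one_div, div_le_div_iff₀ psv psv]
  calc 1 * (c ^ n * d) ≤ (4 * a) ^ n * (32 * b) := by rw [one_mul]; gcongr
    _ = _ := by ring
lemma An_cmp {a b c d : ℝ} (ha : 0 < a) (hb : 0 < b) (hc : 0 < c) (hd : 0 < d) (h1 : c ≤ 4 * a) (h2 : d ≤ 32 * b)
    (v : Pt n) : An a b v ≤ 32 * An c d v := by
  have e1 : ‖v.1‖ / a ≤ 4 * (‖v.1‖ / c) := by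
    rw [div_le_iff₀ ha, mul_div_assoc', div_mul_eq_mul_div, le_div_iff₀ hc]; nlinarith [norm_nonneg v.1]
  have e2 : |v.2| / b ≤ 32 * (|v.2| / d) := by
    rw [div_le_iff₀ hb, mul_div_assoc', div_mul_eq_mul_div, le_div_iff₀ hd]; nlinarith [abs_nonneg v.2]
  have e3 : 0 ≤ ‖v.1‖ / c := psv
  unfold An; linarith
def mf (O : Set bA) (r τ : Pn) (z : Pt n) : ℝ := ∫ w in O, kf w dA eA z
lemma WF.kf_le' (h : WF O r τ) {w z : Pt n} (hw : w ∈ O) (hz : z ∈ O) :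
    kf w dA eA z ≤ (Qrs z (4 * r z) (32 * τ z)).indicator
      (fun _ => 4 ^ n * 32 * fC⁻¹) w := by
  by_cases hm : z ∈ Qrs w dA eA
  · obtain ⟨a1, a2, a3, a4⟩ := h.c1 hw hm
    rw [indicator_of_mem (Qrs_mono z a1 a2 (Qrs_symm hm))]
    exact (kf_le w rB sB z).trans (inv_cmp rB sB (h.rp z hz) (h.tp z hz) a3 a4)
  · rw [kf_zero rB sB hm]
    have := h.rp z hz; have := h.tp z hz
    exact indicator_nonneg (fun _ _ => by positivity) _
lemma WF.kf_int (h : WF O r τ) {z : Pt n} (hz : z ∈ O) : IntegrableOn (fun w => kf w dA eA z) O := by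
  refine integrableOn_of_bounded (M := 4 ^ n * 32 * fC⁻¹) h.fin
    ((kf_meas h.rm h.tm).comp measurable_prodMk_right).aestronglyMeasurable ?_
  filter_upwards [ae_restrict_mem h.op.measurableSet] with w hw
  have := h.rp z hz; have := h.tp z hz
  rw [norm_eq_abs, abs_of_nonneg (kf_nonneg w rB sB z)]
  exact (h.kf_le' hw hz).trans (indicator_le_self' (fun _ _ => by positivity) _)
def ml (n : ℕ) : ℝ := 2 * vb n * ((1/8) ^ n * (1/64)) * (4 ^ n * 32)⁻¹
lemma ml_pos (n : ℕ) : 0 < ml n := by have := vb_pos n; unfold ml; positivity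
lemma WF.mf_lb (h : WF O r τ) {z : Pt n} (hz : z ∈ O) : ml n ≤ mf O r τ z := by
  have r0 := h.rp z hz; have t0 := h.tp z hz; have v0 := vb_pos n
  have hs : Qrs z (r z / 8) (τ z / 64) ⊆ O := (Qrs_mono z lia0 lia0).trans (h.sub z hz)
  have h1 : ∫ w in Qrs z (r z / 8) (τ z / 64), (4 ^ n * 32)⁻¹ * fC⁻¹ ≤
      ∫ w in Qrs z (r z / 8) (τ z / 64), kf w dA eA z := by
    refine setIntegral_mono_on (integrableOn_const (hs := Qrs_vol_ne_top _ _ _)) ((h.kf_int hz).mono_set hs)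
      wB fun w hw => ?_
    have hwO := hs hw
    have rw0 := h.rp w hwO; have tw0 := h.tp w hwO
    obtain ⟨a1, a2, a3, a4⟩ := h.c1 hz (Qrs_mono z lia0 lia0 hw : w ∈ Qrs z (r z) (τ z))
    rw [kf_lb rw0 tw0 (Qrs_mono w lia0 lia0 (Qrs_symm hw))]
    rw [inv_mul_le_iff₀ psv]
    exact inv_cmp r0 t0 rw0 tw0 a3 a4
  have h2 :=
    setIntegral_mono_set (h.kf_int hz) ((ae_restrict_mem h.op.measurableSet).mono fun w hw =>
      kf_nonneg w rB sB z) hs.eventuallyLE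
  refine le_trans leq (h1.trans h2)
  rw [setIntegral_const, Measure.real, Qrs_vol' _ psv, toReal_ofReal psv, ml, smul_eq_mul, div_pow (r z),
    div_pow Ro, one_pow]
  field_simp
def md (O : Set bA) (r τ : Pn) (z : Pt n) : Pt n →L[ℝ] ℝ := ∫ w in O, kd w dA eA z
lemma opn_le {C : ℝ} (L : Pt n →L[ℝ] ℝ) (hC : 0 ≤ C) (r τ : ℝ) (hr : 0 < r) (hτ : 0 < τ)
    (h : ∀ v, |L v| ≤ C * An r τ v) : ‖L‖ ≤ C * (1 / r + 1 / τ) := by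
  refine L.opNorm_le_bound psv fun v => (h v).trans ?_
  rw [mul_assoc]
  gcongr
  have e1 := norm_fst_le v
  have e2 : |v.2| ≤ ‖v‖ := norm_snd_le v
  rw [An, add_mul, one_div_mul_eq_div, one_div_mul_eq_div]
  gcongr
lemma WF.kd_le' (h : WF O r τ) {C : ℝ} (hC0 : 0 < C) (hC : ∀ z v, |fderiv ℝ zA z v| ≤ C * ‖v‖)
    {w z z₀ : Pt n} (hw : w ∈ O) (hz₀ : z₀ ∈ O) (hz : z ∈ Qrs z₀ (r z₀) (τ z₀)) (v : Pt n) :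
    |kd w dA eA z v| ≤ C * 32 * (4 ^ n * 32 * (r z₀ ^ n * τ z₀)⁻¹) * An (r z₀) (τ z₀) v := by
  have a0 := h.rp z₀ hz₀; have b0 := h.tp z₀ hz₀; have a1 := h.rp w hw; have b1 := h.tp w hw
  have := An_nn a0 b0 v
  by_cases hm : z ∈ Qrs w dA eA
  · have hc := h.cmp z₀ hz₀ w hw ⟨z, hz, hm⟩
    refine (kd_le hC0 hC w a1 b1 z v).trans ?_
    calc _ ≤ C * (32 * An (r z₀) (τ z₀) v) * (4 ^ n * 32 * (r z₀ ^ n * τ z₀)⁻¹) := by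
          have := An_nn a1 b1 v
          gcongr
          · exact An_cmp a1 b1 a0 b0 hc.1 hc.2 v
          · exact inv_cmp a1 b1 a0 b0 hc.1 hc.2
      _ = _ := by ring
  · rw [kd_zero a1 b1 hm]; simp; positivity
lemma WF.mf_deriv (h : WF O r τ) {z : Pt n} (hz : z ∈ O) : HasFDerivAt (mf O r τ) (md O r τ z) z := by
  obtain ⟨C, hC0, hC⟩ := bb_bd n
  have a0 := h.rp z hz; have b0 := h.tp z hz
  refine hasFDerivAt_integral_of_dominated_of_fderiv_le (s := Qrs z (r z) (τ z))
    (bound := fun _ => C * 32 * (4 ^ n * 32 * fC⁻¹) * (1 / r z + 1 / τ z))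
    (F' := fun y w => kd w dA eA y)
    ((Qrs_open _ _ _).mem_nhds (self_mem z a0 b0)) ?_ (h.kf_int hz) (kd_meas h.rm h.tm z).aestronglyMeasurable ?_ ?_ ?_
  · exact of_forall fun y => ((kf_meas h.rm h.tm).comp measurable_prodMk_right).aestronglyMeasurable
  · filter_upwards [ae_restrict_mem h.op.measurableSet] with w hw y hy
    exact opn_le _ psv _ _ a0 b0 (h.kd_le' hC0 hC hw hz hy)
  · exact integrableOn_const (hs := h.fin)
  · exact of_forall fun w y _ => kf_deriv _ _ _ _
end Part

section Part2
variable {n : ℕ} {O : Set bA} {r τ : Pn}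
lemma WF.md_le (h : WF O r τ) {C : ℝ} (hC0 : 0 < C) (hC : ∀ z v, |fderiv ℝ zA z v| ≤ C * ‖v‖)
    {z : Pt n} (hz : z ∈ O) (v : Pt n) :
    |md O r τ z v| ≤ C * 32 * (4 ^ n * 32) ^ 2 * eD * An (r z) (τ z) v := by
  have a0 := h.rp z hz; have b0 := h.tp z hz; have v0 := vb_pos n
  have hA := An_nn a0 b0 v
  have hzz := self_mem z a0 b0
  have hi : IntegrableOn (fun w => kd w dA eA z) O := by
    refine integrableOn_of_bounded (M := C * 32 * (4 ^ n * 32 * fC⁻¹) * (1 / r z + 1 / τ z)) h.fin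
      (kd_meas h.rm h.tm z).aestronglyMeasurable ?_
    filter_upwards [ae_restrict_mem h.op.measurableSet] with w hw
    exact opn_le _ psv _ _ a0 b0 (h.kd_le' hC0 hC hw hz hzz)
  set D := C * 32 * (4 ^ n * 32 * fC⁻¹) * An (r z) (τ z) v with hD
  have hD0 : 0 ≤ D := psv
  rw [md, ContinuousLinearMap.integral_apply hi, ← norm_eq_abs]
  refine (norm_integral_le_of_norm_le (g := (Qrs z (4 * r z) (32 * τ z)).indicator fun _ => D)
    (((integrable_indicator_iff wB).2
      (integrableOn_const (hs := Qrs_vol_ne_top _ _ _))).integrableOn) ?_).trans ?_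
  · filter_upwards [ae_restrict_mem h.op.measurableSet] with w hw
    by_cases hm : z ∈ Qrs w dA eA
    · obtain ⟨a1, a2, a3, a4⟩ := h.c1 hw hm
      rw [indicator_of_mem (Qrs_mono z a1 a2 (Qrs_symm hm))]
      exact h.kd_le' hC0 hC hw hz hzz v
    · rw [kd_zero rB sB hm]
      simpa using indicator_nonneg (fun _ _ => hD0) w
  · refine (setIntegral_le_integral ((integrable_indicator_iff wB).2
      (integrableOn_const (hs := Qrs_vol_ne_top _ _ _))) (of_forall fun w =>
        indicator_nonneg (fun _ _ => hD0) w)).trans leq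
    rw [integral_indicator wB, setIntegral_const, Measure.real, Qrs_vol' _ psv,
      toReal_ofReal psv, smul_eq_mul, hD]
    field_simp
    ring
def om (O : Set bA) (r τ : Pn) (w z : Pt n) : ℝ := kf w dA eA z / mf O r τ z
lemma WF.om_zero (h : WF O r τ) {w z : Pt n} (hw : w ∈ O) (hz : z ∉ Qrs w dA eA) : om O r τ w z = 0 := by
  rw [om, kf_zero rB sB hz, zero_div]
lemma WF.om_ts (h : WF O r τ) {w : Pt n} (hw : w ∈ O) : tsupport uC ⊆ Qrs w dA eA := by
  refine (closure_mono ?_).trans (kf_ts w rB sB)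
  intro z hz
  rw [Function.mem_support] at *
  intro h'; exact hz (by rw [om, h', zero_div])
lemma WF.om_hd (h : WF O r τ) (w : Pt n) {z : Pt n} (hz : z ∈ O) : HasFDerivAt uC
    (kf w dA eA z • (-(mf O r τ z ^ 2)⁻¹) • md O r τ z + (mf O r τ z)⁻¹ • kd w dA eA z) z := by
  have h1 := (hasDerivAt_inv ((ml_pos n).trans_le (h.mf_lb hz)).ne').comp_hasFDerivAt z (h.mf_deriv hz)
  exact (kf_deriv w dA eA z).mul h1
lemma WF.om_diff (h : WF O r τ) {w : Pt n} (hw : w ∈ O) : Differentiable ℝ uC := by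
  intro z
  by_cases hz : z ∈ tsupport uC
  · have hzO := h.sub w hw (h.om_ts hw hz)
    exact (h.om_hd w hzO).differentiableAt
  · exact (hasFDerivAt_const Rz z).differentiableAt.congr_of_eventuallyEq
      (notMem_tsupport_iff_eventuallyEq.1 hz)
lemma WF.om_nn (h : WF O r τ) {w : Pt n} (hw : w ∈ O) (z : Pt n) : 0 ≤ om O r τ w z := by
  by_cases hz : z ∈ Qrs w dA eA
  · exact div_nonneg (kf_nonneg w rB sB z) ((ml_pos n).trans_le (h.mf_lb (h.sub w hw hz))).le
  · rw [h.om_zero hw hz]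
lemma WF.om_le (h : WF O r τ) {w : Pt n} (hw : w ∈ O) (z : Pt n) :
    om O r τ w z ≤ (ml n)⁻¹ * tB⁻¹ := by
  have a0 := h.rp w hw; have b0 := h.tp w hw; have := ml_pos n
  by_cases hz : z ∈ Qrs w dA eA
  · rw [om, div_eq_mul_inv, mul_comm]
    have h1 := h.mf_lb (h.sub w hw hz)
    exact mul_le_mul (inv_anti₀ this h1) (kf_le w a0 b0 z) (kf_nonneg w a0 b0 z) psv
  · rw [h.om_zero hw hz]; positivity
lemma om_dle (n : ℕ) : ∃ C > 0, ∀ (O : Set bA) (r τ : Pn), WF O r τ → ∀ w ∈ O, ∀ z v,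
    |fderiv ℝ uC z v| ≤ C * An dA eA v * tB⁻¹ := by
  obtain ⟨C, hC0, hC⟩ := bb_bd n
  have v0 := vb_pos n; have m0 := ml_pos n
  set D := C * 32 * (4 ^ n * 32) ^ 2 * eD with hD
  have D0 : 0 < D := psv
  refine ⟨C / ml n + 32 * D / ml n ^ 2, by positivity, fun O r τ h w hw z v => ?_⟩
  have a0 := h.rp w hw; have b0 := h.tp w hw
  have hA := An_nn a0 b0 v
  by_cases hz : z ∈ tsupport uC
  · have hzw := h.om_ts hw hz
    have hzO := h.sub w hw hzw
    obtain ⟨a1, a2, a3, a4⟩ := h.c1 hw hzw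
    have ml1 := h.mf_lb hzO
    have mp := m0.trans_le ml1
    rw [(h.om_hd w hzO).fderiv]
    simp only [ContinuousLinearMap.smul_apply, ContinuousLinearMap.add_apply, smul_eq_mul]
    have k1 := kd_le hC0 hC w a0 b0 z v
    have k2 := h.md_le hC0 hC hzO v
    rw [← hD] at k2
    have k3 := An_cmp (h.rp z hzO) (h.tp z hzO) a0 b0 a1 a2 v
    have k4 := kf_le w a0 b0 z
    have k5 := kf_nonneg w a0 b0 z
    set M := mf O r τ z
    set X := kd w dA eA z v
    set Y := md O r τ z v
    set K := kf w dA eA z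
    have e2 : K * (-(M ^ 2)⁻¹ * Y) + M⁻¹ * X = X / M - K * Y / M ^ 2 := by field_simp; ring
    calc _ = |X / M - K * Y / M ^ 2| := by rw [← e2]
      _ ≤ |X / M| + |K * Y / M ^ 2| := abs_sub _ _
      _ = |X| / M + K * |Y| / M ^ 2 := by
          rw [abs_div, abs_div, abs_mul, abs_of_pos mp, abs_of_nonneg k5, abs_of_pos (by positivity : 0 < M ^ 2)]
      _ ≤ (C * An dA eA v * tB⁻¹) / ml n +
          tB⁻¹ * (D * (32 * An dA eA v)) / ml n ^ 2 := by
          gcongr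
          exact k2.trans (by gcongr)
      _ = _ := by ring
  · have :=
      image_eq_zero_of_notMem_tsupport fun h' => hz (tsupport_fderiv_subset ℝ h')
    rw [this]; simp; positivity
lemma mf_meas (hr : Measurable r) (hτ : Measurable τ) : Measurable (mf O r τ) := by
  have : StronglyMeasurable (fun x : Pt n × Pt n => kf x.2 (r x.2) (τ x.2) x.1) :=
    ((kf_meas hr hτ).comp measurable_swap).stronglyMeasurable
  exact (this.integral_prod_right (ν := volume.restrict O)).measurable
lemma WF.fub (h : WF O r τ) {F : Pn} (hF : Integrable F) {L : ℝ}
    (hL : ∀ w ∈ O, |∫ z, om O r τ w z * F z| ≤ L) : |∫ z in O, F z| ≤ L * (volume O).toReal := by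
  have hOm := h.op.measurableSet
  have i1 : ∀ z ∈ O, ∫ w in O, om O r τ w z = 1 := by
    intro z hz
    simp only [om]
    rw [integral_div]
    exact div_self ((ml_pos n).trans_le (h.mf_lb hz)).ne'
  have z1 : ∀ z ∉ O, ∀ w ∈ O, om O r τ w z = 0 := fun z hz w hw => h.om_zero hw fun h' => hz (h.sub w hw h')
  have hint : Integrable (uncurry fun w z => om O r τ w z * F z) ((volume.restrict O).prod volume) := by
    have hm : AEStronglyMeasurable (uncurry fun w z => om O r τ w z * F z) ((volume.restrict O).prod volume) := by
      refine AEStronglyMeasurable.mul ?_ ?_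
      · exact ((kf_meas h.rm h.tm).div ((mf_meas h.rm h.tm).comp measurable_snd)).aestronglyMeasurable
      · exact hF.1.comp_quasiMeasurePreserving Measure.quasiMeasurePreserving_snd
    rw [integrable_prod_iff' hm]
    constructor
    · refine of_forall fun z => ?_
      change Integrable (fun w => om O r τ w z * F z) (volume.restrict O)
      refine Integrable.mul_const (f := fun w => om O r τ w z) ?_ _
      by_cases hz : z ∈ O
      · exact (h.kf_int hz).div_const _
      · refine (integrable_zero _ _ _).congr ?_
        filter_upwards [ae_restrict_mem hOm] with w hw
        simp only [Pi.zero_apply]; exact (z1 z hz w hw).symm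
    · refine (hF.norm.indicator hOm).congr (of_forall fun z => ?_)
      simp only [uncurry, norm_mul]
      rw [integral_mul_const]
      have e : ∫ w in O, ‖om O r τ w z‖ = ∫ w in O, om O r τ w z :=
        setIntegral_congr_fun hOm fun w hw => by
          simp only [norm_eq_abs]; rw [abs_of_nonneg (h.om_nn hw z)]
      rw [e]
      by_cases hz : z ∈ O
      · rw [i1 z hz, indicator_of_mem hz, one_mul]
      · rw [indicator_of_notMem hz, setIntegral_congr_fun hOm (fun w hw => z1 z hz w hw)]; simp
  have hsw := integral_integral_swap hint
  have e2 : ∫ z, ∫ w in O, om O r τ w z * F z = ∫ z in O, F z := by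
    rw [← integral_indicator hOm]
    refine integral_congr_ae (of_forall fun z => ?_)
    simp only []
    rw [integral_mul_const]
    by_cases hz : z ∈ O
    · rw [i1 z hz, indicator_of_mem hz, one_mul]
    · rw [indicator_of_notMem hz, setIntegral_congr_fun hOm (fun w hw => z1 z hz w hw)]; simp
  rw [← e2, ← hsw, ← norm_eq_abs]
  exact norm_setIntegral_le_of_norm_le_const h.fin.lt_top hL
end Part2

section Lev
variable {n : ℕ}
lemma bi_int {g h : Pn} (hg : Continuous g) (hm : Measurable h) {M : ℝ} (hM : ∀ z, |h z| ≤ M)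
    {K : Set bA} (hK : IsCompact K) (hs : ∀ z ∉ K, h z = 0) : Integrable (fun z => g z * h z) := by
  obtain ⟨D, hD⟩ := hK.exists_bound_of_continuousOn hg.continuousOn
  have : IntegrableOn (fun z => g z * h z) K := by
    refine integrableOn_of_bounded (M := D * M) hK.measure_lt_top.ne
      (hg.measurable.mul hm).aestronglyMeasurable ?_
    filter_upwards [ae_restrict_mem hK.measurableSet] with z hz
    rw [norm_mul]
    exact mul_le_mul (hD z hz) (hM z) vB ((norm_nonneg _).trans (hD z hz))
  refine (integrableOn_iff_integrable_of_support_subset fun z hz => ?_).1 this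
  by_contra hzK
  exact hz (by simp [hs z hzK])
def NN (U : Pn) (B : Fin n → Pn) (ζ : Pn) (z : Pt n) : ℝ :=
  ∑ j, B j z * (dxj U j z * ζ z + U z * dxj ζ j z) - U z ^ 2 * fderiv ℝ ζ z (0, 1) / 2
structure CO (ζ : Pn) (K : Set bA) (M : ℝ) : Prop where
  d : Differentiable ℝ ζ
  cK : IsCompact K
  s : tsupport ζ ⊆ K
  b : ∀ z, |ζ z| ≤ M
  bd : ∀ z v, |fderiv ℝ ζ z v| ≤ M * ‖v‖
lemma CO.z0 {ζ : Pn} {K : Set bA} {M : ℝ} (h : CO ζ K M) {z : Pt n} (hz : z ∉ K) : ζ z = 0 :=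
  image_eq_zero_of_notMem_tsupport fun h' => hz (h.s h')
lemma CO.dz0 {ζ : Pn} {K : Set bA} {M : ℝ} (h : CO ζ K M) {z : Pt n} (hz : z ∉ K) : fderiv ℝ ζ z = 0 :=
  image_eq_zero_of_notMem_tsupport fun h' => hz (h.s (tsupport_fderiv_subset ℝ h'))
lemma CO.i1 {ζ : Pn} {K : Set bA} {M : ℝ} (h : CO ζ K M) {g : Pn} (hg : Continuous g) :
    Integrable (fun z => g z * ζ z) :=
  bi_int hg h.d.continuous.measurable h.b h.cK fun _ hz => h.z0 hz
lemma CO.i2 {ζ : Pn} {K : Set bA} {M : ℝ} (h : CO ζ K M) {g : Pn} (hg : Continuous g) (v : Pt n) :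
    Integrable (fun z => g z * fderiv ℝ ζ z v) :=
  bi_int hg (measurable_fderiv_apply_const ℝ ζ v) (fun z => h.bd z v) h.cK fun _ hz => by simp [h.dz0 hz]
lemma c1_cont {U : Pn} (hU : ContDiff ℝ 1 U) (v : Pt n) : Continuous (fun z => fderiv ℝ U z v) :=
  (hU.continuous_fderiv smp).clm_apply continuous_const
lemma CO.p0 {ζ : Pn} {K : Set bA} {M : ℝ} (h : CO ζ K M) {g : Pn} (hg : ContDiff ℝ 1 g) (v : Pt n) :
    Integrable (fun z => fderiv ℝ g z v * ζ z + g z * fderiv ℝ ζ z v) ∧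
    ∫ z, (fderiv ℝ g z v * ζ z + g z * fderiv ℝ ζ z v) = 0 := by
  have e : ∀ z, fderiv ℝ (fun z => g z * ζ z) z v = fderiv ℝ g z v * ζ z + g z * fderiv ℝ ζ z v := by
    intro z
    rw [fderiv_fun_mul (hg.differentiable smp z) (h.d z)]
    simp; ring
  have i := (h.i1 (c1_cont hg v)).add (h.i2 hg.continuous v)
  refine ⟨i, ?_⟩
  have := int_fderiv_zero (f := fun z => g z * ζ z) ((hg.differentiable smp).mul h.d) (h.i1 hg.continuous) v
    (by simp only [e]; exact i)
  simpa only [e] using this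
lemma NN_zero {U : Pn} {B : Fin n → Pn} {ζ : Pn} {K : Set bA} {M : ℝ} (h : CO ζ K M)
    (hU : ContDiff ℝ 1 U) (hB : ∀ j, ContDiff ℝ 1 fA)
    (heq : ∀ z ∈ K, fderiv ℝ U z (0, 1) = ∑ j, dxj fA j z) :
    Integrable (NN U B ζ) ∧ ∫ z, NN U B ζ z = 0 := by
  have hj := fun j : Fin n => h.p0 ((hB j).mul hU) eJ
  have ht := h.p0 (hU.pow 2) (0, 1)
  have e : ∀ z, NN U B ζ z = ∑ j, (fderiv ℝ (fun x => B j x * U x) z eJ * ζ z +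
      B j z * U z * fderiv ℝ ζ z eJ) -
      iB * (fderiv ℝ (fun z => U z ^ 2) z (0, 1) * ζ z + U z ^ 2 * fderiv ℝ ζ z (0, 1)) := by
    intro z
    have e1 : fderiv ℝ (fun z => U z ^ 2) z (0, 1) * ζ z = 2 * U z * ((∑ j, dxj fA j z) * ζ z) := by
      by_cases hz : z ∈ K
      · rw [← heq z hz, fderiv_fun_pow 2 (hU.differentiable smp z)]
        simp; ring
      · simp [h.z0 hz]
    have e2 : ∀ j : Fin n, fderiv ℝ (fun x => B j x * U x) z eJ =
        B j z * dxj U j z + dxj fA j z * U z := by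
      intro j
      rw [fderiv_fun_mul ((hB j).differentiable smp z) (hU.differentiable smp z)]
      simp [dxj]; ring
    rw [e1, NN]
    simp only [e2]
    have e3 : ∑ j, ((B j z * dxj U j z + dxj fA j z * U z) * ζ z +
        B j z * U z * fderiv ℝ ζ z eJ) =
        ∑ j, B j z * (dxj U j z * ζ z + U z * dxj ζ j z) + U z * ((∑ j, dxj fA j z) * ζ z) := by
      rw [sum_mul, mul_sum, ← sum_add_distrib]
      refine sum_congr rfl fun j _ => ?_
      simp only [dxj]; ring
    rw [e3]; ring
  have i1 := integrable_finsetSum Finset.univ fun j _ => (hj j).1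
  have i2 := ht.1.const_mul iB
  constructor
  · exact (i1.sub i2).congr (of_forall fun z => (e z).symm)
  · simp only [e]
    rw [integral_sub i1 i2, integral_finsetSum _ fun j _ => (hj j).1, integral_const_mul, ht.2]
    simp only [(hj _).2]; simp
def RR (u : Pn) (c : ℝ) (B : Fin n → Pn) (η ω : Pn) (z : Pt n) : ℝ :=
  ∑ j, (-(iA * η z * B j z * dxj ω j z) + c * ω z * B j z * dxj η j z) +
    iA ^ 2 * η z * fderiv ℝ ω z (0, 1) / 2 - c * ω z * u z * fderiv ℝ η z (0, 1) +
    c ^ 2 * ω z * fderiv ℝ η z (0, 1) / 2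
lemma RR_eq (u : Pn) (c : ℝ) (B : Fin n → Pn) {η ω : Pn} (hη : Differentiable ℝ η)
    (hω : Differentiable ℝ ω) (z : Pt n) :
    ω z * NN u B η z = NN (fun z => u z - c) B (fun z => ω z * η z) z + RR u c B η ω z := by
  have d : ∀ v, fderiv ℝ (fun z => ω z * η z) z v = fderiv ℝ ω z v * η z + ω z * fderiv ℝ η z v := by
    intro v; rw [fderiv_fun_mul (hω z) (hη z)]; simp; ring
  have d2 : ∀ v, fderiv ℝ (fun z => u z - c) z v = fderiv ℝ u z v := by intro v; rw [fderiv_sub_const]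
  simp only [NN, RR, dxj, d, d2]
  have e3 : ω z * ∑ j, B j z * (fderiv ℝ u z eJ * η z +
        u z * fderiv ℝ η z eJ) =
      ∑ j, B j z * (fderiv ℝ u z eJ * (ω z * η z) + iA *
        (fderiv ℝ ω z eJ * η z + ω z * fderiv ℝ η z eJ)) +
      ∑ j, (-(iA * η z * B j z * fderiv ℝ ω z eJ) +
        c * ω z * B j z * fderiv ℝ η z eJ) := by
    rw [mul_sum, ← sum_add_distrib]
    exact sum_congr rfl fun j _ => by ring
  rw [mul_sub, e3]; ring
lemma norm_ej (j : Fin n) : ‖(eJ : Pt n)‖ = 1 := by simp [Prod.norm_mk]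
lemma RR_le {u : Pn} {c : ℝ} {B : Fin n → Pn} {η ω : Pn} {K : Set bA} {M a X r τ : ℝ}
    (hη : CO η K M) (ha : 0 ≤ a) (hX : 0 ≤ X) (hr : 0 < r) (hτ : 0 < τ) (z : Pt n) (h1 : |ω z| ≤ a)
    (h2 : ∀ v, |fderiv ℝ ω z v| ≤ X * An r τ v) :
    |RR u c B η ω z| ≤ (M * (X + a)) * (iA ^ 2 / τ + |u z - c| * lA / r +
      |c| * lA + |c| * |u z| + c ^ 2) := by
  have hM := (abs_nonneg _).trans (hη.b z)
  have A1 : ∀ j : Fin n, |dxj ω j z| ≤ X / r := fun j => by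
    refine (h2 _).trans leq; simp [An]; ring
  have A2 : |fderiv ℝ ω z (0, 1)| ≤ X / τ := by
    refine (h2 _).trans leq; simp [An]; ring
  have A3 : ∀ j : Fin n, |dxj η j z| ≤ M := fun j => by
    have := hη.bd z eJ; rwa [norm_ej, mul_one] at this
  have A4 : |fderiv ℝ η z (0, 1)| ≤ M := by
    have := hη.bd z (0, 1); simpa [Prod.norm_mk] using this
  have A5 := hη.b z
  set S := ∑ j, |B j z| with hS
  have B1 : |∑ j, (-(iA * η z * B j z * dxj ω j z) + c * ω z * B j z * dxj η j z)| ≤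
      M * X * (|u z - c| * S / r) + M * a * (|c| * S) := by
    refine (abs_sum_le_sum_abs _ _).trans ?_
    have : M * X * (|u z - c| * S / r) + M * a * (|c| * S) =
        ∑ j, (|u z - c| * M * |B j z| * (X / r) + |c| * a * |B j z| * M) := by
      rw [sum_add_distrib, ← sum_mul, ← mul_sum, ← sum_mul, ← mul_sum, ← hS]; ring
    rw [this]
    refine sum_le_sum fun j _ => (abs_add_le _ _).trans (add_le_add ?_ ?_)
    · rw [abs_neg, abs_mul, abs_mul, abs_mul]; gcongr; exact A1 j
    · rw [abs_mul, abs_mul, abs_mul]; gcongr; exact A3 j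
  have B2 : |iA ^ 2 * η z * fderiv ℝ ω z (0, 1) / 2| ≤ M * X * (iA ^ 2 / τ) := by
    rw [abs_div, abs_mul, abs_mul, abs_of_nonneg (sq_nonneg iA), abs_two]
    calc _ ≤ iA ^ 2 * M * (X / τ) / 2 := by gcongr
      _ ≤ iA ^ 2 * M * (X / τ) := half_le_self psv
      _ = _ := by ring
  have B3 : |c * ω z * u z * fderiv ℝ η z (0, 1)| ≤ M * a * (|c| * |u z|) := by
    rw [abs_mul, abs_mul, abs_mul]
    calc _ ≤ |c| * a * |u z| * M := by gcongr
      _ = _ := by ring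
  have B4 : |c ^ 2 * ω z * fderiv ℝ η z (0, 1) / 2| ≤ M * a * c ^ 2 := by
    rw [abs_div, abs_mul, abs_mul, abs_of_nonneg (sq_nonneg c), abs_two]
    calc _ ≤ c ^ 2 * a * M / 2 := by gcongr
      _ ≤ c ^ 2 * a * M := half_le_self psv
      _ = _ := by ring
  have S0 : 0 ≤ S := sum_nonneg fun j _ => abs_nonneg _
  have t1 : 0 ≤ M * a * (iA ^ 2 / τ) := psv
  have t2 : 0 ≤ M * a * (|u z - c| * S / r) := psv
  have t3 : 0 ≤ M * X * (|c| * S) := psv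
  have t4 : 0 ≤ M * X * (|c| * |u z|) := psv
  have t5 : 0 ≤ M * X * c ^ 2 := psv
  unfold RR
  calc _ ≤ (M * X * (|u z - c| * S / r) + M * a * (|c| * S)) + M * X * (iA ^ 2 / τ) + M * a * (|c| * |u z|) +
        M * a * c ^ 2 := by
        refine (abs_add_le _ _).trans (add_le_add ((abs_sub _ _).trans (add_le_add ((abs_add_le _ _).trans
          (add_le_add B1 B2)) B3)) B4)
    _ ≤ _ := by linear_combination t1 + t2 + t3 + t4 + t5
end Lev

section LevB
variable {n : ℕ}
lemma Jl {E : Set bA} {f : Pe} (hf : Measurable f) {σ c X v : ℝ} (hσ : 1 ≤ σ) (hc : 1 ≤ c) (hX : 0 ≤ X)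
    (hv : 0 < v) (hE : volume E ≤ ofReal (c * v)) (h : ∫⁻ z in E, f z ^ σ ≤ ofReal (X ^ σ * v)) :
    ∫⁻ z in E, f z ≤ ofReal (c * X * v) := by
  have hs0 : 0 < σ := by linarith
  have j := jens (volume.restrict E) f hf.aemeasurable hσ
  rw [restrict_apply_univ] at j
  have j2 : (∫⁻ z in E, f z) ^ σ ≤ ofReal (c * X * v) ^ σ := by
    refine j.trans ((mul_le_mul' (ENNReal.rpow_le_rpow hE lia0) h).trans ?_)
    rw [ofReal_rpow_of_nonneg psv lia0, ofReal_rpow_of_nonneg psv hs0.le,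
      ← ofReal_mul psv]
    refine ofReal_le_ofReal ?_
    rw [mul_rpow psv hv.le, mul_rpow psv hv.le, mul_rpow psv hX]
    have e : v ^ σ = v ^ gC * v := by
      nth_rewrite 3 [← rpow_one v]; rw [← rpow_add hv]; ring_nf
    have : c ^ gC ≤ c ^ σ := rpow_le_rpow_of_exponent_le hc lia0
    calc c ^ gC * v ^ gC * (X ^ σ * v) = c ^ gC * (X ^ σ * v ^ σ) := by rw [e]; ring
      _ ≤ c ^ σ * (X ^ σ * v ^ σ) := by gcongr
      _ = _ := by ring
  exact (ENNReal.rpow_le_rpow_iff hs0).1 j2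
set_option maxHeartbeats 1000000 in
lemma loc_bd (n : ℕ) (m σ : ℝ) (hm : 1 < m) (hσ : 1 < σ) (hσ2 : 2 ≤ σ / gC)
    (hσm : σ / gC * vA ≤ m * (n + 2)) {D : ℝ} (hD : 1 ≤ D) :
    ∃ C > 0, ∀ (u : Pn) (B : Fin n → Pn) (w : Pt n) (r τ l L : ℝ), 0 < r → r ≤ 1 → 0 < τ → 0 < l →
      l ^ 2 ≤ L → τ * L = (r * l) ^ 2 → ContDiff ℝ 1 u → (∀ j, ContDiff ℝ 1 fA) →
      (∀ z ∈ Qrs w (r * f54) (τ * f54), fderiv ℝ u z (0, 1) = ∑ j, dxj fA j z) →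
      ∫⁻ z in Qrs w (r * f54) (τ * f54), ofReal (Wg u z) ^ m ≤ ofReal ((D * l) ^ m * rnτ) →
      ∫⁻ z in Qrs w (r * f54) (τ * f54), ofReal lA ^ σ ≤
        ofReal (vC ^ σ * rnτ) →
      ∫⁻ z in Qrs w r τ, ‖u z‖ₑ ≤ ofReal (D * l * rnτ) →
      ∃ c : ℝ, ∫⁻ z in Qrs w r τ, ofReal (iA ^ 2 / τ + |u z - c| * lA / r +
        |c| * lA + |c| * |u z| + c ^ 2) ≤ ofReal (C * L * rnτ) := by
  set σ' := σ / gC with hs'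
  have hs1 : 0 < σ - 1 := by linarith
  obtain ⟨K, hK, H⟩ := S_scaled n m σ' hm lia0 hσm
  have vb0 := vb_pos n
  set cq := 1 + 2 * vb n * f54 ^ vA with hcq
  have cq1 : 1 ≤ cq := by rw [hcq]; have : 0 ≤ 2 * vb n * f54 ^ vA := psv
                          linarith
  set E := (1 + K) * (cq * D) with hE
  have E0 : 0 < E := psv
  set G := (D + cq * E) / eD with hG
  have G0 : 0 < G := psv
  refine ⟨cq * E ^ 2 + E * D + G * (cq * D) + G * D + G ^ 2 * cq, by positivity, ?_⟩
  intro u B w r τ l L hr hr1 hτ hl hlL hτL hu hB heq hW hBs hu1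
  have hL : 0 < L := lt_of_lt_of_le psv hlL
  have hv : 0 < r ^ n * τ := psv
  set v := r ^ n * τ with hvd
  set S : Pn := fun z => ∑ j, |B j z| with hS
  have Sm : Measurable S := measurable_sum _ fun j _ => (hB j).continuous.abs.measurable
  have S0 : ∀ z, 0 ≤ S z := fun z => sum_nonneg fun j _ => abs_nonneg _
  have um : Measurable u := hu.continuous.measurable
  set Qp := Qrs w (r * f54) (τ * f54) with hQp
  have hQs : Qrs w r τ ⊆ Qp := Qrs_mono w lia0 lia0
  have vQp : volume Qp ≤ ofReal (cq * v) := by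
    rw [hQp, Qrs_vol' w psv]
    refine ofReal_le_ofReal ?_
    have : 2 * vb n * ((r * f54) ^ n * (τ * f54)) = 2 * vb n * f54 ^ vA * v := by rw [hvd]; ring
    rw [this, hcq]; exact mul_le_mul_of_nonneg_right lia0 hv.le
  have vQ : volume gA ≤ ofReal (cq * v) := (measure_mono hQs).trans vQp
  have Y0 : 0 ≤ D * L / l := psv
  have hS1 : ∫⁻ z in Qp, ofReal (S z) ≤ ofReal (cq * vC * v) :=
    Jl Sm.ennreal_ofReal hσ.le cq1 Y0 hv vQp hBs
  set κ := cq * D * (r * l) with hκ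
  have κ0 : 0 < κ := psv
  have g1 : ∫⁻ z in Qp, ofReal (r * Wg u z) ^ m ≤ ofReal (κ ^ m * v) := by
    have : ∀ z, ofReal (r * Wg u z) ^ m = ofReal (r ^ m) * ofReal (Wg u z) ^ m := fun z => by
      rw [ofReal_mul hr.le, mul_rpow_of_nonneg _ _ lia0, ofReal_rpow_of_pos hr]
    simp only [this]
    rw [lintegral_const_mul' _ _ ofReal_ne_top]
    refine (mul_le_mul_right hW _).trans ?_
    rw [← ofReal_mul psv]
    refine ofReal_le_ofReal ?_
    rw [← mul_assoc, ← mul_rpow hr.le psv]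
    gcongr
    have := mul_le_mul_of_nonneg_right cq1 (show 0 ≤ D * (r * l) by positivity)
    rw [hκ]; linarith
  have g2 : ∫⁻ z in Qp, ofReal (τ / r * S z) ≤ ofReal (κ * v) := by
    have : ∀ z, ofReal (τ / r * S z) = ofReal (τ / r) * ofReal (S z) := fun z =>
      ofReal_mul psv
    simp only [this]
    rw [lintegral_const_mul' _ _ ofReal_ne_top]
    refine (mul_le_mul_right hS1 _).trans ?_
    rw [← ofReal_mul psv]
    refine ofReal_le_ofReal leq
    have : τ / r * (L / l) = r * l := by field_simp; linarith
    calc _ = cq * D * (τ / r * (L / l)) * v := by ring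
      _ = _ := by rw [this]
  obtain ⟨c, hc⟩ := H u B w r τ κ hr hτ κ0 hu hB heq g1 g2
  set X := E * (r * l) with hX
  have X0 : 0 < X := psv
  have hx : ∫⁻ z in Qrs w r τ, ‖u z - c‖ₑ ^ σ' ≤ ofReal (X ^ σ' * v) := by
    refine hc.trans (ofReal_le_ofReal ?_)
    have : X = (1 + K) * κ := by rw [hX, hE, hκ]; ring
    rw [this, mul_rpow psv κ0.le, ← mul_assoc]
    gcongr
    have : (1 + K) ^ Ro ≤ (1 + K) ^ σ' := rpow_le_rpow_of_exponent_le lia0 lia0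
    rw [rpow_one] at this; linarith
  have xm : Measurable fun z => ‖u z - c‖ₑ := (um.sub_const c).enorm
  have h1 : ∫⁻ z in Qrs w r τ, ‖u z - c‖ₑ ≤ ofReal (cq * X * v) :=
    Jl xm lia0 cq1 X0.le hv vQ hx
  have h2 : ∫⁻ z in Qrs w r τ, ‖u z - c‖ₑ ^ R2 ≤ ofReal (cq * X ^ 2 * v) := by
    refine Jl (σ := σ' / 2) (xm.pow_const _) lia0 cq1 psv hv vQ ?_
    have e : ∀ z, (‖u z - c‖ₑ ^ R2) ^ (σ' / 2) = ‖u z - c‖ₑ ^ σ' := fun z => by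
      rw [← ENNReal.rpow_mul]; congr 1; ring
    simp only [e]
    rw [← rpow_natCast X 2, ← rpow_mul X0.le]
    convert hx using 4; push_cast; ring
  have h3 : ∫⁻ z in Qrs w r τ, ‖u z - c‖ₑ * ofReal (S z) ≤ ofReal (X * vC * v) := by
    have hcj : HolderConjugate σ' σ := (HolderConjugate.conjExponent hσ).symm
    refine (ENNReal.lintegral_mul_le_Lp_mul_Lq _ hcj xm.aemeasurable Sm.ennreal_ofReal.aemeasurable).trans ?_
    refine (mul_le_mul' (ENNReal.rpow_le_rpow hx (by have := hcj.pos; positivity)) (ENNReal.rpow_le_rpow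
      ((lintegral_mono_set hQs).trans hBs) psv)).trans leq
    rw [ofReal_rpow_of_nonneg psv (by have := hcj.pos; positivity),
      ofReal_rpow_of_nonneg psv psv, ← ofReal_mul psv]
    congr 1
    rw [mul_rpow psv hv.le, mul_rpow psv hv.le, one_div, one_div,
      rpow_rpow_inv X0.le hcj.pos.ne', rpow_rpow_inv Y0 psv]
    have : v ^ σ'⁻¹ * v ^ σ⁻¹ = v := by rw [← rpow_add hv, hcj.inv_add_inv_eq_one, rpow_one]
    linear_combination X * vC * this
  have hcl : |c| ≤ G * l := by
    have k1 : ofReal (|c| * (2 * vb n * v)) ≤ ofReal (D * l * v) + ofReal (cq * X * v) := by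
      refine le_trans ?_ (add_le_add hu1 h1)
      rw [← lintegral_add_left um.enorm, ofReal_mul (abs_nonneg c), ← Qrs_vol' w hr, ← setLIntegral_const]
      refine lintegral_mono fun z => ?_
      rw [← ofReal_norm, ← ofReal_norm, ← ofReal_add vB vB]
      refine ofReal_le_ofReal ?_
      rw [norm_eq_abs, norm_eq_abs, ← abs_neg c]
      calc |-c| = |iA - u z| := by ring_nf
        _ ≤ _ := (abs_sub _ _).trans (by rw [add_comm])
    rw [← ofReal_add psv psv, ofReal_le_ofReal_iff psv] at k1
    have k2 : |c| * eD ≤ D * l + cq * X := by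
      refine le_of_mul_le_mul_right ?_ hv; linarith
    have k3 : X ≤ E * l := by rw [hX]; exact mul_le_mul_of_nonneg_left (mul_le_of_le_one_left hl.le hr1) E0.le
    rw [hG, div_mul_eq_mul_div, le_div_iff₀ psv]
    have := mul_le_mul_of_nonneg_left k3 (show 0 ≤ cq by linarith)
    linarith
  refine ⟨c, ?_⟩
  have c0 := abs_nonneg c
  have split : ∀ z, ofReal (iA ^ 2 / τ + |u z - c| * S z / r + |c| * S z + |c| * |u z| + c ^ 2) =
      ofReal (1 / τ) * ‖u z - c‖ₑ ^ R2 + ofReal (1 / r) * (‖u z - c‖ₑ * ofReal (S z)) +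
      ofReal |c| * ofReal (S z) + ofReal |c| * ‖u z‖ₑ + ofReal (c ^ 2) := by
    intro z
    have := S0 z
    rw [show iA ^ 2 / τ = 1 / τ * iA ^ 2 by ring, show |u z - c| * S z / r = 1 / r * (|u z - c| * S z) by ring]
    rw [ofReal_add psv psv, ofReal_add psv psv,
      ofReal_add psv psv, ofReal_add psv psv,
      ← ofReal_norm, ← ofReal_norm, ofReal_rpow_of_nonneg vB nnm]
    simp only [← ofReal_mul (abs_nonneg iA), ← ofReal_mul c0, norm_eq_abs, rpow_two,
      ← ofReal_mul (show 0 ≤ 1 / τ by positivity), ← ofReal_mul (show 0 ≤ 1 / r by positivity), sq_abs]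
  refine (lintegral_congr split).trans_le ?_
  have m4 : Measurable fun z => ofReal |c| * ‖u z‖ₑ := um.enorm.const_mul _
  have m2 : Measurable fun z => ofReal (1 / r) * (‖u z - c‖ₑ * ofReal (S z)) :=
    (xm.mul Sm.ennreal_ofReal).const_mul _
  have m3 : Measurable fun z => ofReal |c| * ofReal (S z) := Sm.ennreal_ofReal.const_mul _
  rw [lintegral_add_right _ measurable_const, lintegral_add_right _ m4, lintegral_add_right _ m3,
    lintegral_add_right _ m2, lintegral_const_mul' _ _ ofReal_ne_top, lintegral_const_mul' _ _ ofReal_ne_top,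
    lintegral_const_mul' _ _ ofReal_ne_top, lintegral_const_mul' _ _ ofReal_ne_top, setLIntegral_const]
  have hSQ := (lintegral_mono_set hQs).trans hS1
  refine (add_le_add (add_le_add (add_le_add (add_le_add (mul_le_mul_right h2 _) (mul_le_mul_right h3 _))
    (mul_le_mul_right hSQ _)) (mul_le_mul_right hu1 _)) (mul_le_mul_right vQ _)).trans ?_
  simp only [← ofReal_mul c0, ← ofReal_mul (show 0 ≤ 1 / τ by positivity),
    ← ofReal_mul (show 0 ≤ 1 / r by positivity), ← ofReal_mul (sq_nonneg c)]
  rw [← ofReal_add psv psv, ← ofReal_add psv psv,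
      ← ofReal_add psv psv, ← ofReal_add psv psv]
  refine ofReal_le_ofReal ?_
  have t1 : 1 / τ * (cq * X ^ 2 * v) = cq * E ^ 2 * L * v := by
    have : X ^ 2 = E ^ 2 * (τ * L) := by rw [hτL, hX]; ring
    rw [this]; field_simp
  have t2 : 1 / r * (X * vC * v) = E * D * L * v := by rw [hX]; field_simp
  have t3 : |c| * (cq * vC * v) ≤ G * (cq * D) * L * v := by
    calc _ ≤ G * l * (cq * vC * v) := by gcongr
      _ = _ := by field_simp
  have t4 : |c| * (D * l * v) ≤ G * D * L * v := by
    calc _ ≤ G * l * (D * l * v) := by gcongr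
      _ = G * D * l ^ 2 * v := by ring
      _ ≤ _ := by gcongr
  have t5 : c ^ 2 * (cq * v) ≤ G ^ 2 * cq * L * v := by
    have : c ^ 2 ≤ (G * l) ^ 2 := by rw [← sq_abs]; gcongr
    calc _ ≤ (G * l) ^ 2 * (cq * v) := by gcongr
      _ = G ^ 2 * cq * l ^ 2 * v := by ring
      _ ≤ _ := by gcongr
  linear_combination t1 + t2 + t3 + t4 + t5
end LevB

section LevC
variable {n : ℕ}
lemma An_le {r τ : ℝ} (hr : 0 < r) (hτ : 0 < τ) (v : Pt n) : An r τ v ≤ (1 / r + 1 / τ) * ‖v‖ := by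
  have h1 : ‖v.1‖ ≤ ‖v‖ := le_max_left _ _
  have h2 : |v.2| ≤ ‖v‖ := le_max_right _ _
  unfold An
  calc _ ≤ ‖v‖ / r + ‖v‖ / τ := by gcongr
    _ = _ := by ring
lemma levL (n : ℕ) (m σ : ℝ) (hm : 1 < m) (hσ : 1 < σ) (hσ2 : 2 ≤ σ / gC)
    (hσm : σ / gC * vA ≤ m * (n + 2)) {D : ℝ} (hD : 1 ≤ D) {η : Pn} {K : Set bA} {M : ℝ}
    (hη : CO η K M) (hK : K ⊆ ball 0 jD) :
    ∃ C > 0, ∀ (O : Set bA) (r τ l : Pn) (L : ℝ) (u : Pn) (B : Fin n → Pn),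
      WF O r τ → O ⊆ ball 0 f54 → (∀ w ∈ O, r w ≤ 1/32) → (∀ w ∈ O, τ w ≤ 1/32) →
      ContDiff ℝ 1 u → (∀ j, ContDiff ℝ 1 fA) →
      (∀ z ∈ ball 0 f32, fderiv ℝ u z (0, 1) = ∑ j, dxj fA j z) → 0 < L →
      (∀ w ∈ O, (Qrs w dA eA ∩ ball 0 jD).Nonempty → 0 < l w ∧ l w ^ 2 ≤ L ∧ τ w * L = (r w * l w) ^ 2 ∧
        ∫⁻ z in Qrs w (r w * f54) (τ w * f54), ofReal (Wg u z) ^ m ≤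
          ofReal ((D * l w) ^ m * tB) ∧
        ∫⁻ z in Qrs w (r w * f54) (τ w * f54), ofReal lA ^ σ ≤
          ofReal ((D * L / l w) ^ σ * tB) ∧
        ∫⁻ z in Qrs w dA eA, ‖u z‖ₑ ≤ ofReal (D * l w * tB)) →
      |∫ z in Oᶜ, NN u B η z| ≤ C * L * (volume O).toReal := by
  obtain ⟨C1, hC1, H1⟩ := loc_bd n m σ hm hσ hσ2 hσm hD
  obtain ⟨C2, hC2, H2⟩ := om_dle n
  have ml0 := ml_pos n
  have hM : 0 ≤ M := (abs_nonneg _).trans (hη.b 0)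
  refine ⟨M * (C2 + (ml n)⁻¹) * C1 + 1, by positivity, ?_⟩
  intro O r τ l L u B hW hO hr32 ht32 hu hB heq hL hloc
  have hK3 : K ⊆ ball 0 f32 := hK.trans (ball_subset_ball nnm)
  have hN := NN_zero hη hu hB fun z hz => heq z (hK3 hz)
  have key : ∀ w ∈ O, |∫ z, om O r τ w z * NN u B η z| ≤ (M * (C2 + (ml n)⁻¹) * C1 + 1) * L := by
    intro w hw
    have hr := hW.rp w hw
    have hτ := hW.tp w hw
    by_cases hne : (Qrs w dA eA ∩ ball 0 jD).Nonempty
    swap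
    · have : ∀ z, om O r τ w z * NN u B η z = 0 := by
        intro z
        by_cases hz : z ∈ Qrs w dA eA
        · have hzK : z ∉ K := fun h => hne ⟨z, hz, hK h⟩
          simp [NN, dxj, hη.z0 hzK, hη.dz0 hzK]
        · rw [hW.om_zero hw hz, zero_mul]
      simp only [this, integral_zero, abs_zero]; positivity
    obtain ⟨l0, l1, l2, l3, l4, l5⟩ := hloc w hw hne
    have hv : 0 < r w ^ n * τ w := psv
    set v := r w ^ n * τ w with hvd
    have g3 : ∀ z ∈ Qrs w (r w * f54) (τ w * f54), z ∈ ball 0 f32 := by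
      intro z hz
      have a1 := hO hw
      have a2 := hr32 w hw
      have a3 := ht32 w hw
      rw [ball_eq_Qrs] at a1 ⊢
      simp only [Qrs, mem_prod, mem_ball, mem_Ioo, dist_zero_right, Prod.fst_zero, Prod.snd_zero] at a1 hz ⊢
      have := norm_le_norm_add_norm_sub w.1 z.1
      rw [dist_comm, dist_eq_norm] at hz
      refine ⟨by linarith [hz.1, a1.1], by linarith [hz.2.1, a1.2.1], by linarith [hz.2.2, a1.2.2]⟩
    obtain ⟨c, hc⟩ := H1 u B w dA eA (l w) L hr (by linarith [hr32 w hw]) hτ l0 l1 l2 hu hB (fun z hz => heq z (g3 z hz)) l3 l4 l5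
    set ω := om O r τ w with hω
    set X := C2 * v⁻¹ with hX
    set a := (ml n)⁻¹ * v⁻¹ with ha
    have X0 : 0 < X := psv
    have a0 : 0 < a := psv
    have ob : ∀ z, |ω z| ≤ a := fun z => by rw [abs_of_nonneg (hW.om_nn hw z)]; exact hW.om_le hw z
    have od : ∀ z v', |fderiv ℝ ω z v'| ≤ X * An dA eA v' := fun z v' => by
      refine (H2 O r τ hW w hw z v').trans leq; rw [hX]; ring
    have hd := hW.om_diff hw
    have dz : ∀ z v', fderiv ℝ (fun z => ω z * η z) z v' = fderiv ℝ ω z v' * η z + ω z * fderiv ℝ η z v' := by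
      intro z v'; rw [fderiv_fun_mul (hd z) (hη.d z)]; simp; ring
    have Y0 : 0 ≤ X * iC := psv
    have co : CO (fun z => ω z * η z) K (a * M + X * iC * M) := by
      refine ⟨hd.mul hη.d, hη.cK, (tsupport_mul_subset_right).trans hη.s, fun z => ?_, fun z v' => ?_⟩
      · rw [abs_mul]
        have := mul_le_mul (ob z) (hη.b z) jA a0.le
        have : 0 ≤ X * iC * M := psv
        linarith
      · rw [dz]
        refine (abs_add_le _ _).trans ?_
        rw [abs_mul, abs_mul]
        have e1 : |fderiv ℝ ω z v'| ≤ X * iC * ‖v'‖ := (od z v').trans (by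
          have := mul_le_mul_of_nonneg_left (An_le hr hτ v') X0.le
          linarith)
        calc _ ≤ X * iC * ‖v'‖ * M + a * (M * ‖v'‖) := by
              gcongr
              · exact hη.b z
              · exact ob z
              · exact hη.bd z v'
          _ = _ := by ring
    have hN2 := NN_zero (U := fun z => u z - c) co (hu.sub contDiff_const) hB fun z hz => by
      rw [fderiv_sub_const]; exact heq z (hK3 hz)
    have hRz : ∀ z ∉ Qrs w dA eA, RR u c B η ω z = 0 := by
      intro z hz
      have z1 : ω z = 0 := hW.om_zero hw hz
      have z2 : fderiv ℝ ω z = 0 :=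
        image_eq_zero_of_notMem_tsupport fun h' => hz (hW.om_ts hw (tsupport_fderiv_subset ℝ h'))
      simp [RR, dxj, z1, z2]
    have hi := hN.1.bdd_mul hd.continuous.aestronglyMeasurable
      (of_forall ob)
    have hR : ∫ z, ω z * NN u B η z = ∫ z, RR u c B η ω z := by
      have e : ∀ z, RR u c B η ω z = ω z * NN u B η z - NN (fun z => u z - c) B (fun z => ω z * η z) z := fun z => by
        rw [RR_eq u c B hη.d hd z]; ring
      simp only [e]; rw [integral_sub hi hN2.1, hN2.2, sub_zero]
    rw [hR]
    have h1 : ‖∫ z, RR u c B η ω z‖ₑ ≤ ofReal (M * (X + a)) * ofReal (C1 * L * v) := by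
      refine (enorm_integral_le_lintegral_enorm _).trans ?_
      rw [← setLIntegral_eq_of_support_subset (fun z hz => by
        by_contra h; exact hz (by simp [hRz z h]))]
      refine le_trans ?_ (mul_le_mul_right hc _)
      rw [← lintegral_const_mul' _ _ ofReal_ne_top]
      refine lintegral_mono fun z => ?_
      rw [← ofReal_mul psv, ← ofReal_norm]
      exact ofReal_le_ofReal (RR_le hη a0.le X0.le hr hτ z (ob z) (od z))
    rw [← ofReal_mul psv, ← ofReal_norm, ofReal_le_ofReal_iff psv] at h1
    refine h1.trans ?_
    have : M * (X + a) * (C1 * L * v) = M * (C2 + (ml n)⁻¹) * C1 * L := by rw [hX, ha]; field_simp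
    rw [this]; linarith
  have f := hW.fub hN.1 key
  have s := integral_add_compl hW.op.measurableSet hN.1
  rw [hN.2] at s
  rw [show ∫ z in Oᶜ, NN u B η z = -∫ z in O, NN u B η z by linarith, abs_neg]
  exact f
end LevC

section Ell
def el (p q L a : ℝ) : ℝ := (max (L ^ (-1/p)) ((a / L) ^ jC))⁻¹
variable {p q L a : ℝ}
lemma el_pos (hL : 0 < L) : 0 < el p q L a := inv_pos.2 (lt_max_of_lt_left (rpow_pos_of_pos hL _))
lemma el_leP (hp : 0 < p) (hL : 0 < L) : el p q L a ≤ L ^ (1/p) := by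
  have h : el p q L a ≤ (L ^ (-1/p))⁻¹ := inv_anti₀ (rpow_pos_of_pos hL _) yB
  rwa [← rpow_neg hL.le, show -(-1/p) = 1/p by ring] at h
lemma el_p (hp : 0 < p) (hL : 0 < L) : el p q L a ^ p ≤ L := by
  have := rpow_le_rpow (el_pos hL).le (el_leP (a := a) (q := q) hp hL) hp.le
  rwa [one_div, rpow_inv_rpow hL.le hp.ne'] at this
lemma el_q (hq : 0 < q) (hL : 0 < L) (ha : 0 ≤ a) : a * el p q L a ^ q ≤ L := by
  rcases ha.eq_or_lt with rfl | ha
  · simpa using hL.le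
  have h0 : 0 < (a / L) ^ jC := psv
  have h : el p q L a ≤ ((a / L) ^ jC)⁻¹ := inv_anti₀ h0 rC
  have := rpow_le_rpow (el_pos hL).le h hq.le
  rw [inv_rpow h0.le, one_div, rpow_inv_rpow psv hq.ne'] at this
  calc _ ≤ a * (a / L)⁻¹ := by gcongr
    _ = L := by field_simp
lemma el_or (hp : 0 < p) (hq : 0 < q) (hL : 0 < L) (ha : 0 ≤ a) : el p q L a ^ p = L ∨ a * el p q L a ^ q = L := by
  unfold el
  rcases max_choice (L ^ (-1/p)) ((a / L) ^ jC) with h | h <;> rw [h]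
  · left
    rw [← rpow_neg hL.le, ← rpow_mul hL.le, show -(-1/p) * p = 1 by field_simp, rpow_one]
  · right
    have ha : 0 < a := by
      rcases ha.eq_or_lt with rfl | ha
      · have h1 : 0 < L ^ (-1/p) := psv
        have h2 := le_max_left (L ^ (-1/p)) ((0 / L) ^ jC)
        rw [h, zero_div, zero_rpow psv] at h2
        linarith
      · exact ha
    rw [inv_rpow psv, one_div, rpow_inv_rpow psv hq.ne']
    field_simp
lemma el_sq (hp : 2 ≤ p) (hL : 1 ≤ L) : el p q L a ^ 2 ≤ L := by
  have h := el_leP (a := a) (q := q) (by linarith : 0 < p) (by linarith : 0 < L)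
  have h0 := (el_pos (p := p) (q := q) (a := a) (by linarith : 0 < L)).le
  calc _ ≤ uB ^ 2 := by gcongr
    _ = L ^ (2/p) := by rw [← rpow_natCast, ← rpow_mul lia0]; congr 1; push_cast; ring
    _ ≤ L ^ Ro := rpow_le_rpow_of_exponent_le hL (by rw [div_le_one lia0]; exact hp)
    _ = L := rpow_one L
lemma el_lb {A : ℝ} (hp : 1 ≤ p) (hpq : p ≤ q) (hL : 1 ≤ L) (ha : 0 ≤ a) (haA : a ≤ A) : L ^ jC ≤ (1 + A) * el p q L a := by
  have hL0 : 0 < L := by linarith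
  have hq : 0 < q := by linarith
  rw [el, ← div_eq_mul_inv, le_div_iff₀ (lt_max_of_lt_left (rpow_pos_of_pos hL0 _)), mul_max_of_nonneg _ _ psv]
  refine max_le ?_ ?_
  · rw [← rpow_add hL0]
    have : L ^ (1/q + -1/p) ≤ 1 := Real.rpow_le_one_of_one_le_of_nonpos hL (by
      have : 1/q ≤ 1/p := one_div_le_one_div_of_le lia0 hpq
      rw [neg_div]; linarith)
    linarith
  · rw [← mul_rpow hL0.le psv, mul_div_cancel₀ _ hL0.ne']
    calc a ^ jC ≤ (1 + A) ^ jC := by gcongr; linarith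
      _ ≤ (1 + A) ^ Ro := rpow_le_rpow_of_exponent_le lia0 (by rw [div_le_one hq]; linarith)
      _ = _ := rpow_one _
lemma el_cmp {a' : ℝ} (hp : 0 < p) (hq : 2 ≤ q) (hL : 0 < L) (ha : 0 ≤ a) (ha' : 0 ≤ a')
    (h : |a - a'| * el p q L a ^ q ≤ L / 2) : el p q L a' ^ 2 ≤ 2 * el p q L a ^ 2 := by
  have e0 := el_pos (p := p) (q := q) (a := a) hL
  have e0' := el_pos (p := p) (q := q) (a := a') hL
  rcases el_or (q := q) hp lia0 hL ha with h1 | h1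
  · have : el p q L a' ≤ el p q L a := by
      refine (Real.rpow_le_rpow_iff e0'.le e0.le hp).1 ?_
      rw [h1]; exact el_p hp hL
    nlinarith
  · have h2 : L / 2 ≤ a' * el p q L a ^ q := by
      have : (a - a') * el p q L a ^ q ≤ L / 2 := le_trans (by gcongr; exact le_abs_self _) h
      linarith
    have h3 := el_q (p := p) (q := q) (a := a') lia0 hL ha'
    have a0 : 0 < a' := by
      rcases ha'.eq_or_lt with rfl | h'
      · linarith
      · exact h'
    have h4 : el p q L a' ^ q ≤ 2 * el p q L a ^ q := by
      refine le_of_mul_le_mul_left ?_ a0; linarith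
    have h5 := rpow_le_rpow psv h4 (show 0 ≤ 2 / q by positivity)
    rw [← rpow_mul e0'.le, mul_rpow nnm psv, ← rpow_mul e0.le,
      mul_div_cancel₀ _ psv, rpow_two, rpow_two] at h5
    refine h5.trans ?_
    gcongr
    calc R2 ^ (2/q) ≤ 2 ^ Ro := rpow_le_rpow_of_exponent_le nnm (by rw [div_le_one lia0]; exact hq)
      _ = 2 := rpow_one 2
lemma el_g {a' g : ℝ} (hp : 0 < p) (hpq : p ≤ q) (hL : 0 < L) (ha : 0 ≤ a) (ha' : 0 ≤ a') (hg : 0 ≤ g)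
    (h : |a - a'| * el p q L a ^ q ≤ L / 2) : kD ^ p ≤ 1 + 2 * ((g ^ p + a' * g ^ q) / L) := by
  have e0 := el_pos (p := p) (q := q) (a := a) hL
  have hq : 0 < q := by linarith
  have P1 : 0 ≤ g ^ p := psv
  have P2 : 0 ≤ a' * g ^ q := psv
  rcases el_or hp hq hL ha with h1 | h1
  · rw [div_rpow hg e0.le, h1]
    have : g ^ p / L ≤ (g ^ p + a' * g ^ q) / L := by gcongr; linarith
    have : 0 ≤ g ^ p / L := psv
    linarith
  · rcases le_total kD 1 with hx | hx
    · have := rpow_le_one psv hx hp.le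
      have : 0 ≤ (g ^ p + a' * g ^ q) / L := psv
      linarith
    · have h2 : L / 2 ≤ a' * el p q L a ^ q := by
        have : (a - a') * el p q L a ^ q ≤ L / 2 := le_trans (by gcongr; exact le_abs_self _) h
        linarith
      have h3 := rpow_le_rpow_of_exponent_le hx hpq
      rw [div_rpow hg e0.le (z := q)] at h3
      have h4 : g ^ q / el p q L a ^ q ≤ 2 * (a' * g ^ q / L) := by
        have el0 : 0 < el p q L a ^ q := psv
        rw [div_le_iff₀ el0]
        have h5 : 0 ≤ g ^ q / L := psv
        calc g ^ q = 2 * (g ^ q / L) * (L / 2) := by field_simp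
          _ ≤ 2 * (g ^ q / L) * (a' * el p q L a ^ q) := by gcongr
          _ = _ := by ring
      have : a' * g ^ q / L ≤ (g ^ p + a' * g ^ q) / L := by gcongr; linarith
      linarith
lemma el_meas {X : Type*} [MeasurableSpace X] {f : X → ℝ} (hf : Measurable f) : Measurable fun x => el p q L (f x) := by
  unfold el; fun_prop
end Ell

section Whit
variable {n : ℕ}
lemma pw_s {x e C y s : ℝ} (hx : 0 ≤ x) (hC : 1 ≤ C) (hy : 0 ≤ y) (hs : 0 < s) (hs1 : s ≤ 1)
    (h : x ^ e ≤ C * (1 + y)) : x ^ (e * s) ≤ C * (1 + y ^ s) := by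
  rw [rpow_mul hx]
  calc (x ^ e) ^ s ≤ (C * (1 + y)) ^ s := by gcongr
    _ = C ^ s * (1 + y) ^ s := mul_rpow lia0 lia0
    _ ≤ C ^ Ro * (1 ^ s + y ^ s) := by
        gcongr
        exact rpow_add_le_add_rpow nnm hy hs.le hs1
    _ = _ := by rw [rpow_one, Real.one_rpow]
lemma pw_V {x l p y s : ℝ} (hx : 0 ≤ x) (hl : 0 < l) (hy : 0 ≤ y) (hs : 0 < s) (hs1 : s ≤ 1)
    (h : (x / l) ^ p ≤ 1 + 2 * y) : x ^ kC ≤ 2 * l ^ kC * (1 + y ^ s) := by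
  have := pw_s psv (by norm_num : Ro ≤ 2) hy hs hs1 (h.trans lia0)
  rw [div_rpow hx hl.le, div_le_iff₀ psv] at this
  linarith
lemma pw_u {x q L G s : ℝ} (hx : 0 ≤ x) (hq : 0 < q) (hL : 0 < L) (hs : 1 / q ≤ s) (h : x ^ q ≤ G) :
    x ≤ L ^ jC * (1 + (G / L) ^ s) := by
  have hG := le_trans psv h
  have h1 : x ≤ G ^ jC := by
    have := rpow_le_rpow psv h (show 0 ≤ 1/q by positivity)
    rwa [one_div, rpow_rpow_inv hx hq.ne', ← one_div] at this
  refine h1.trans ?_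
  rw [show G = L * (G / L) by field_simp, mul_rpow hL.le psv, ← show G = L * (G / L) by field_simp]
  gcongr
  have hy : 0 ≤ G / L := psv
  rcases le_total (G / L) 1 with h' | h'
  · have := rpow_le_one hy h' (show 0 ≤ 1/q by positivity)
    have : 0 ≤ (G / L) ^ s := psv
    linarith
  · have := rpow_le_rpow_of_exponent_le h' hs
    linarith
def cB (C q A : ℝ) : ℝ := 1 + (2 * C) ^ (q / qm) * (2 + A ^ lD)
lemma cB_one {C q A : ℝ} (hC : 0 ≤ C) (hA : 0 ≤ A) : 1 ≤ cB C q A := by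
  have : 0 ≤ (2 * C) ^ (q / qm) * (2 + A ^ lD) := psv
  unfold cB; linarith
lemma pw_B {p q L l a g G b C A s : ℝ} (hp : 1 < p) (hpq : p ≤ q) (hL : 0 < L) (hl : 0 < l) (ha : 0 ≤ a) (hg : 0 ≤ g)
    (hlp : l ^ p ≤ L) (hA : 0 ≤ A) (hlq : a * l ^ q ≤ A * L) (hG : g ^ p + a * g ^ q ≤ G) (hb0 : 0 ≤ b) (hC : 0 ≤ C)
    (hs : 0 < s) (hs1 : s ≤ 1)
    (hb : b ≤ C * (g ^ pm + a * g ^ qm)) (hx : (g / l) ^ p ≤ 1 + 2 * (G / L)) :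
    b ^ (q / qm * s) ≤ cB C q A * (L / l) ^ (q / qm * s) * (1 + (G / L) ^ s) := by
  have hq1 : 0 < q - 1 := by linarith
  have hq : 0 < q := by linarith
  set e := q / qm with he
  have e0 : 0 < e := psv
  set x := g / l with hxd
  have x0 : 0 ≤ x := psv
  have gx : g = x * l := by rw [hxd]; field_simp
  set β := a * l ^ q / L with hβ
  have β0 : 0 ≤ β := psv
  have βA : β ≤ A := by rw [hβ, div_le_iff₀ hL]; exact hlq
  have G0 := le_trans psv hG
  have y0 : 0 ≤ G / L := psv
  have lp : l ^ pm * l = l ^ p := by rw [Real.rpow_sub_one hl.ne']; field_simp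
  have lq : l ^ qm * l = l ^ q := by rw [Real.rpow_sub_one hl.ne']; field_simp
  have b1 : b / (L / l) ≤ C * (x ^ pm + β * x ^ qm) := by
    have k : g ^ pm * l ≤ x ^ pm * L := by
      rw [gx, mul_rpow x0 hl.le, mul_assoc, lp]; gcongr
    have k2 : a * g ^ qm * l = β * x ^ qm * L := by
      rw [gx, mul_rpow x0 hl.le, hβ, ← lq]; field_simp
    rw [div_div_eq_mul_div, div_le_iff₀ hL]
    calc b * l ≤ C * (g ^ pm + a * g ^ qm) * l := by gcongr
      _ = C * (g ^ pm * l + a * g ^ qm * l) := by ring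
      _ ≤ C * (x ^ pm * L + β * x ^ qm * L) := by rw [k2]; gcongr
      _ = _ := by ring
  have t1 : (x ^ pm) ^ e ≤ 2 * wC := by
    rw [← rpow_mul x0]
    have hep : pm * e ≤ p := by rw [he, ← mul_div_assoc, div_le_iff₀ hq1]; linarith
    rcases le_total x 1 with h | h
    · have := rpow_le_one x0 h (show 0 ≤ pm * e by have : 0 < p - 1 := lia0; positivity)
      linarith
    · have := rpow_le_rpow_of_exponent_le h hep
      linarith
  have t2 : (β * x ^ qm) ^ e ≤ A ^ lD * wC := by
    rw [mul_rpow β0 psv, ← rpow_mul x0, show qm * e = q by rw [he]; field_simp]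
    have hbx : β * x ^ q ≤ G / L := by
      have : β * x ^ q = a * g ^ q / L := by rw [hxd, div_rpow hg hl.le, hβ]; field_simp
      rw [this]; gcongr
      have : 0 ≤ g ^ p := psv
      linarith
    have he1 : e = 1 + 1 / qm := by rw [he]; field_simp; ring
    have h1 : β ^ e = β * β ^ lD := by
      rw [he1, Real.rpow_add_of_nonneg β0 nnm psv, rpow_one]
    rw [h1]
    calc β * β ^ lD * x ^ q = β ^ lD * (β * x ^ q) := by ring
      _ ≤ A ^ lD * wC := by gcongr; linarith
  set Y := x ^ pm
  set W := β * x ^ qm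
  have Y0 : 0 ≤ Y := psv
  have W0 : 0 ≤ W := psv
  have t3 : (b / (L / l)) ^ e ≤ cB C q A * wC := by
    have : (Y + W) ^ e ≤ 2 ^ e * (Y ^ e + W ^ e) := by
      have hm : Y + W ≤ 2 * max Y W := by linarith [le_max_left Y W, le_max_right Y W]
      calc (Y + W) ^ e ≤ (2 * max Y W) ^ e := by gcongr
        _ = 2 ^ e * (max Y W) ^ e := mul_rpow nnm psv
        _ ≤ _ := by
          gcongr
          have r1 : 0 ≤ Y ^ e := psv
          have r2 : 0 ≤ W ^ e := psv
          rcases max_choice Y W with h | h <;> rw [h] <;> linarith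
    calc _ ≤ (C * (Y + W)) ^ e := by gcongr
      _ = C ^ e * (Y + W) ^ e := mul_rpow hC psv
      _ ≤ C ^ e * (2 ^ e * (2 * wC + A ^ lD * wC)) := by
          gcongr; exact this.trans (by gcongr)
      _ = (2 * C) ^ e * (2 + A ^ lD) * wC := by rw [mul_rpow nnm hC]; ring
      _ ≤ _ := by unfold cB; gcongr; linarith
  have := pw_s psv (cB_one hC hA) y0 hs hs1 t3
  rw [div_rpow hb0 psv, div_le_iff₀ psv] at this
  linarith
structure Cf (p q α A₀ A₁ : ℝ) (a : Pn) : Prop where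
  m : Measurable a
  nn : ∀ z, 0 ≤ a z
  A00 : 0 ≤ A₀
  A10 : 0 ≤ A₁
  le : ∀ z ∈ bO 2, a z ≤ A₀
  hol : ∀ z ∈ bO 2, ∀ w ∈ bO 2, |a z - a w| ≤ A₁ * max (‖z.1 - w.1‖ ^ α) (|z.2 - w.2| ^ mD)
  hα : 0 < α
  hα1 : α ≤ 1
  hp : 2 < p
  hpq : p < q
variable {p q α A₀ A₁ : ℝ} {a : Pn}
lemma Cf.hol' (h : Cf p q α A₀ A₁ a) {z w : Pt n} (hz : z ∈ bO 2) (hw : w ∈ bO 2) {d : ℝ} (hd : 0 ≤ d)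
    (h1 : ‖z.1 - w.1‖ ≤ d) (h2 : |z.2 - w.2| ≤ d ^ 2) : |a z - a w| ≤ A₁ * d ^ α := by
  refine (h.hol z hz w hw).trans (mul_le_mul_of_nonneg_left (max_le ?_ ?_) h.A10)
  · exact rpow_le_rpow vB h1 h.hα.le
  · refine (rpow_le_rpow jA h2 (by have := h.hα; positivity)).trans leq
    rw [← rpow_natCast, ← rpow_mul hd]; congr 1; push_cast; ring
lemma Cf.cont (h : Cf p q α A₀ A₁ a) : ContinuousOn a (ball 0 2) := by
  intro w hw
  have hα := h.hα
  refine ContinuousWithinAt.mono_of_mem_nhdsWithin ?_ self_mem_nhdsWithin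
  rw [ContinuousWithinAt, tendsto_iff_dist_tendsto_zero]
  have hb : Continuous fun z : Pt n => A₁ * max (‖z.1 - w.1‖ ^ α) (|z.2 - w.2| ^ mD) := by
    refine continuous_const.mul (Continuous.max ?_ ?_)
    · exact (by fun_prop : Continuous fun z : Pt n => ‖z.1 - w.1‖).rpow_const fun _ => Or.inr hα.le
    · exact (by fun_prop : Continuous fun z : Pt n => |z.2 - w.2|).rpow_const fun _ => Or.inr psv
  have h0 := (hb.tendsto w).mono_left (nhdsWithin_le_nhds (s := ball 0 2))
  simp only [sub_self, norm_zero, abs_zero, zero_rpow hα.ne', zero_rpow (show α / 2 ≠ 0 by positivity), max_self,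
    mul_zero] at h0
  refine squeeze_zero' (of_forall fun _ => dist_nonneg) ?_ h0
  filter_upwards [self_mem_nhdsWithin] with z hz
  exact h.hol z hz w hw
end Whit

section Whit2
variable {n : ℕ} {p q α A₀ A₁ : ℝ} {a : Pn}
def be (p q L : ℝ) (a : Pn) (w : Pt n) : ℝ := el p q L (a w) ^ 2 / L
lemma be_pos {L : ℝ} (hL : 1 ≤ L) (w : Pt n) : 0 < be p q L a w := by
  have := el_pos (p := p) (q := q) (a := a w) (by linarith : 0 < L)
  unfold be; positivity
lemma be_le {L : ℝ} (hp : 2 ≤ p) (hL : 1 ≤ L) (w : Pt n) : be p q L a w ≤ 1 := by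
  rw [be, div_le_one lia0]; exact el_sq hp hL
lemma be_cmp (h : Cf p q α A₀ A₁ a) {L : ℝ} (hL : 1 ≤ L) {w w' : Pt n} (hw : w ∈ bO 2) (hw' : w' ∈ bO 2)
    {R : ℝ} (hR : 0 ≤ R) (h1 : ‖w.1 - w'.1‖ ≤ 8 * R) (h2 : |w.2 - w'.2| ≤ (8 * R) ^ 2)
    (hs : A₁ * (8 * R) ^ α * el p q L (a w) ^ q ≤ L / 4) : be p q L a w' ≤ 2 * be p q L a w := by
  have hp := h.hp
  have hq := h.hpq
  have e0 := el_pos (p := p) (q := q) (a := a w) (by linarith : 0 < L)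
  have := el_cmp (p := p) (q := q) (L := L) lia0 lia0 lia0 (h.nn w) (h.nn w')
    ((mul_le_mul_of_nonneg_right (h.hol' hw hw' psv h1 h2) psv).trans lia0)
  unfold be
  rw [← mul_div_assoc]
  gcongr
lemma be_cont (h : Cf p q α A₀ A₁ a) {L : ℝ} (hL : 1 ≤ L) {w : Pt n} (hw : w ∈ bO 2) : ContinuousAt (be p q L a) w := by
  have hc := h.cont.continuousAt (isOpen_ball.mem_nhds hw)
  have hp := h.hp
  have hq := h.hpq
  unfold be el
  refine ((ContinuousAt.inv₀ (continuousAt_const.max ((hc.div_const L).rpow_const (Or.inr (one_div_nonneg.2 lia0)))) ?_).pow 2).div_const L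
  exact (lt_max_of_lt_left (rpow_pos_of_pos lia0 _)).ne'
lemma whit (h : Cf p q α A₀ A₁ a) {L : ℝ} (hL : 1 ≤ L) {O : Set bA} (hO : IsOpen O) (hOs : O ⊆ ball 0 f54)
    (hsm : ∀ w ∈ O, ∀ R, 0 < R → R ≤ 1 → Qrs w R (R ^ 2 * be p q L a w) ⊆ O →
      R ≤ 1/32 ∧ A₁ * (8 * R) ^ α * el p q L (a w) ^ q ≤ L / 4) :
    ∃ R : Pn, (∀ w, 0 < R w) ∧ WF O (fun w => R w / 4) (fun w => (R w / 4) ^ 2 * be p q L a w) ∧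
      ∀ w ∈ O, R w ≤ 1/32 ∧ A₁ * (8 * R w) ^ α * el p q L (a w) ^ q ≤ L / 4 ∧
        ¬ Qrs w (2 * R w) ((2 * R w) ^ 2 * be p q L a w) ⊆ O := by
  have hp := h.hp
  have b0 := be_pos (p := p) (q := q) (a := a) hL
  have b1 := be_le (p := p) (q := q) (a := a) hp.le hL
  have hO2 : O ⊆ ball 0 2 := hOs.trans (ball_subset_ball nnm)
  let P : Pt n → ℕ → Prop := fun w j => w ∈ O → Qrs w (iB ^ j) ((iB ^ j) ^ 2 * be p q L a w) ⊆ O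
  have hex : ∀ w, ∃ j, P w j := by
    intro w
    by_cases hw : w ∈ O
    · obtain ⟨ε, e0, hε⟩ := Metric.isOpen_iff.1 hO w hw
      obtain ⟨j, hj⟩ := exists_pow_lt_of_lt_one e0 (by norm_num : (1/2 : ℝ) < 1)
      refine ⟨j, fun _ => ?_⟩
      refine Subset.trans ?_ ((ball_subset_ball hj.le).trans hε)
      rw [ball_eq_Qrs]
      refine Qrs_mono w le_rfl ?_
      have t0 : Rz < iB ^ j := psv
      have t1 : (Ro/2) ^ j ≤ 1 := pow_le_one₀ nnm nnm
      have := b1 w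
      have := b0 w
      nlinarith
    · exact ⟨0, fun h => absurd h hw⟩
  let k : Pt n → ℕ := fun w => Nat.find (hex w)
  have hk : Measurable k := by
    refine measurable_find hex fun j => ?_
    rw [← MeasurableSet.compl_iff]
    refine IsOpen.measurableSet (isOpen_iff_mem_nhds.2 fun w hw => ?_)
    simp only [P, mem_compl_iff, mem_ofPred_eq, Classical.not_imp, not_subset] at hw
    obtain ⟨hw, z, hz, hzO⟩ := hw
    have c1 :=
      (continuous_const.dist continuous_fst).continuousAt.eventually_lt continuousAt_const hz.1
    have c2 :=
      (continuous_snd.continuousAt.sub (continuousAt_const.mul (be_cont h hL (hO2 hw)))).eventually_lt continuousAt_const hz.2.1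
    have c3 :=
      continuousAt_const.eventually_lt (continuous_snd.continuousAt.add (continuousAt_const.mul (be_cont h hL (hO2 hw)))) hz.2.2
    filter_upwards [hO.mem_nhds hw, c1, c2, c3] with w' h1 h2 h3 h4
    simp only [P, mem_compl_iff, mem_ofPred_eq, Classical.not_imp, not_subset]
    exact ⟨h1, z, ⟨h2, h3, h4⟩, hzO⟩
  have hkP : ∀ w ∈ O, Qrs w (iB ^ k w) ((iB ^ k w) ^ 2 * be p q L a w) ⊆ O := fun w hw => Nat.find_spec (hex w) hw
  let R : Pn := fun w => iB ^ k w
  have R0 : ∀ w, 0 < R w := fun w => by positivity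
  have R1 : ∀ w, R w ≤ 1 := fun w => pow_le_one₀ nnm nnm
  have hRs := fun w hw => hsm w hw (R w) (R0 w) (R1 w) (hkP w hw)
  have hRn : ∀ w ∈ O, ¬ Qrs w (2 * R w) ((2 * R w) ^ 2 * be p q L a w) ⊆ O := by
    intro w hw hs
    rcases hkw : k w with _ | j
    · have := (hRs w hw).1
      simp only [R, hkw] at this
      norm_num at this
    · have := Nat.find_min (hex w) (by show j < k w; omega)
      refine this fun _ => ?_
      have e : 2 * R w = iB ^ j := by simp only [R, hkw, pow_succ]; ring
      rwa [e] at hs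
  have Rm : Measurable R := (measurable_from_nat (f := fun j => (Ro/2) ^ j)).comp hk
  have bm : Measurable (be p q L a) := ((el_meas h.m).pow_const 2).div_const L
  refine ⟨R, R0, ⟨hO, ((measure_mono hOs).trans_lt measure_ball_lt_top).ne, Rm.div_const 4, ((Rm.div_const 4).pow_const 2).mul bm,
    fun w _ => by have := R0 w; positivity, fun w _ => by have := R0 w; have := b0 w; positivity, fun w hw => ?_, ?_⟩,
    fun w hw => ⟨(hRs w hw).1, (hRs w hw).2, hRn w hw⟩⟩
  · refine (Qrs_mono w ?_ ?_).trans (hkP w hw)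
    · have := R0 w
      linarith
    · have := R0 w
      have := (b0 w).le
      gcongr; linarith
  · intro w hw w' hw' ⟨e, h1, h2⟩
    obtain ⟨h1x, h1a, h1b⟩ := h1
    obtain ⟨h2x, h2a, h2b⟩ := h2
    have hx : dist w.1 w'.1 < R w / 4 + R w' / 4 := by
      have := dist_triangle_left w.1 w'.1 e.1
      simp only [Metric.mem_ball] at h1x h2x
      linarith
    have r0 := R0 w
    have r0' := R0 w'
    have bw := b0 w
    have bw' := b0 w'
    have bu := b1 w
    have bu' := b1 w'
    have ht : |w.2 - w'.2| < (R w / 4) ^ 2 * be p q L a w + (R w' / 4) ^ 2 * be p q L a w' := by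
      rw [abs_lt]; constructor <;> linarith
    have s1 : (R w) ^ 2 * be p q L a w ≤ (R w) ^ 2 := mul_le_of_le_one_right psv bu
    have s2 : (R w') ^ 2 * be p q L a w' ≤ (R w') ^ 2 := mul_le_of_le_one_right psv bu'
    have hA : R w ≤ 4 * R w' := by
      by_contra hc
      push Not at hc
      have h8 : 8 * R w' ≤ R w := by
        have : k w + 3 ≤ k w' := by
          by_contra hk'
          have : k w' ≤ k w + 2 := by omega
          have := pow_le_pow_of_le_one (by norm_num : Rz ≤ 1/2) nnm this
          rw [pow_add] at this
          simp only [R] at hc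
          linarith
        have := pow_le_pow_of_le_one (by norm_num : Rz ≤ 1/2) nnm this
        rw [pow_add] at this
        simp only [R]
        linarith
      have q1 : R w' ^ 2 ≤ (R w / 8) ^ 2 := by gcongr; linarith
      have hb := be_cmp h hL (hO2 hw) (hO2 hw') r0.le (by rw [← dist_eq_norm]; linarith)
        (ht.le.trans (by linarith [sq_nonneg (R w)])) (hRs w hw).2
      refine hRn w' hw' (Subset.trans ?_ (hkP w hw))
      rintro y ⟨y1, y2, y3⟩
      have q2 : R w' ^ 2 * be p q L a w' ≤ (R w / 8) ^ 2 * (2 * be p q L a w) := by gcongr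
      have := abs_lt.1 ht
      have q0 : 0 < R w ^ 2 * be p q L a w := psv
      refine ⟨?_, ?_, ?_⟩
      · show dist y.1 w.1 < R w
        have := dist_triangle_right y.1 w.1 w'.1
        simp only [Metric.mem_ball] at y1
        linarith
      · show w.2 - R w ^ 2 * be p q L a w < y.2
        linarith
      · show y.2 < w.2 + R w ^ 2 * be p q L a w
        linarith
    have q1 : R w ^ 2 ≤ (4 * R w') ^ 2 := by gcongr
    have hb := be_cmp h hL (hO2 hw') (hO2 hw) r0'.le (by rw [← dist_eq_norm, dist_comm]; linarith)
        (by rw [abs_sub_comm]; exact ht.le.trans (by linarith [sq_nonneg (R w')])) (hRs w' hw').2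
    refine ⟨by linarith, ?_⟩
    calc (R w / 4) ^ 2 * be p q L a w ≤ (4 * R w' / 4) ^ 2 * (2 * be p q L a w') := by gcongr
      _ = _ := by ring
end Whit2

section Lev
variable {n : ℕ}
def Gh (s : ℝ) (G : Pn) : Pe := (ball 0 f32).indicator fun z => ofReal (G z ^ s)
lemma Gh_meas {s : ℝ} {G : Pn} (hG : Measurable G) : Measurable lC :=
  (ENNReal.measurable_ofReal.comp (hG.pow_const s)).indicator measurableSet_ball
def cm (n : ℕ) (m : ℝ) : ℝ := (2 ^ vA) ^ m * 2 ^ vA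
lemma cm_pos (n : ℕ) (m : ℝ) : 0 < cm n m := by unfold cm; positivity
lemma intb {f G : Pn} (hG : Measurable G) (G0 : ∀ z, 0 ≤ G z) {m s : ℝ} (hm : 1 ≤ m)
    {w e : Pt n} {r τ R' T' X c L : ℝ} (hr : 0 < r) (hX : 0 ≤ X) (hc : 0 ≤ c) (hL : 0 < L)
    (hR' : 0 < R') (hR1 : R' ≤ 1) (hT' : 0 < T') (hT1 : T' ≤ 1)
    (hsub : Qrs w r τ ⊆ Qrs w R' T') (hP : Qrs w R' T' ⊆ ball 0 f32) (he : e ∈ Qrs w R' T')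
    (hMS : MS lC e ≤ ofReal rA) (hv : R' ^ n * T' ≤ c * rnτ)
    (hb : ∀ᵐ z, z ∈ Qrs w r τ → |f z| ^ m ≤ X * (1 + (G z / L) ^ s)) :
    ∫⁻ z in Qrs w r τ, ‖f z‖ₑ ^ m ≤ ofReal ((1 + c) * X) * volume gA := by
  have i1 : ∫⁻ z in Qrs w r τ, Gh s G z ≤
      ofReal rA * (ofReal c * volume gA) := by
    refine (lintegral_mono_set hsub).trans ?_
    have := (le_MS lC hR' hR1 hT' hT1 he).trans hMS
    rw [div_le_iff (Qrs_vol_ne_zero w hR' hT') (Qrs_vol_ne_top w R' T')] at this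
    refine this.trans (mul_le_mul_right ?_ _)
    rw [Qrs_vol' w hR', Qrs_vol' w psv, ← ofReal_mul hc]
    refine ofReal_le_ofReal ?_
    have := (vb_pos n).le
    nlinarith [mul_le_mul_of_nonneg_left hv this]
  calc _ ≤ ∫⁻ z in Qrs w r τ, ofReal X * (1 + ofReal (rA⁻¹) * Gh s G z) := by
        refine lintegral_mono_ae ((ae_restrict_iff' wB).2 ?_)
        filter_upwards [hb] with z hz hzP
        rw [Gh, indicator_of_mem (hP (hsub hzP)), ← ofReal_mul psv, ← ofReal_one,
          ← ofReal_add nnm (mul_nonneg psv (rpow_nonneg (G0 z) _)), ← ofReal_mul hX, ← ofReal_norm,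
          ofReal_rpow_of_nonneg vB lia0]
        refine ofReal_le_ofReal ((hz hzP).trans leq)
        rw [div_rpow (G0 z) hL.le, div_eq_inv_mul]
    _ = ofReal X * (volume gA +
        ofReal (rA⁻¹) * ∫⁻ z in Qrs w r τ, Gh s G z) := by
        have g1 : Measurable fun z => ofReal (rA⁻¹) * Gh s G z := (Gh_meas hG).const_mul _
        have g2 : Measurable fun z => 1 + ofReal (rA⁻¹) * Gh s G z := measurable_const.add g1
        rw [lintegral_const_mul _ g2, lintegral_add_right _ g1, lintegral_const_mul _ (Gh_meas hG)]
        simp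
    _ ≤ ofReal X * (volume gA +
        ofReal (rA⁻¹) * (ofReal rA * (ofReal c * volume gA))) :=
        mul_le_mul_right (add_le_add_right (mul_le_mul_right i1 _) _) _
    _ = _ := by
        rw [← mul_assoc (ofReal (rA⁻¹)), ← ofReal_mul psv, inv_mul_cancel₀ psv, ofReal_one,
          one_mul, ofReal_mul psv, ofReal_add nnm hc, ofReal_one]
        ring
lemma molb (k : ℕ) {f G : Pn} (hf : Measurable f) (hG : Measurable G) (G0 : ∀ z, 0 ≤ G z) {m s : ℝ} (hm : 1 ≤ m)
    {w e : Pt n} {r τ R' T' X c L : ℝ} (hr : 0 < r) (hτ : 0 < τ) (hX : 0 ≤ X) (hc : 0 ≤ c) (hL : 0 < L)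
    (hR' : 0 < R') (hR1 : R' ≤ 1) (hT' : 0 < T') (hT1 : T' ≤ 1)
    (hsub : Qrs w (r + hk k) (τ + hk k) ⊆ Qrs w R' T') (hP : Qrs w R' T' ⊆ ball 0 f32) (he : e ∈ Qrs w R' T')
    (hMS : MS lC e ≤ ofReal rA) (hv : R' ^ n * T' ≤ c * ((r + hk k) ^ n * (τ + hk k)))
    (hb : ∀ᵐ z, z ∈ Qrs w (r + hk k) (τ + hk k) → |f z| ^ m ≤ X * (1 + (G z / L) ^ s)) :
    ∫⁻ z in Qrs w r τ, ‖mol k f z‖ₑ ^ m ≤ ofReal (cm n m * (1 + c) * X) * volume gA := by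
  have h0 := hk_pos k
  have c0 := cm_pos n m
  have vP0 := Qrs_vol_ne_zero w (show 0 < r + hk k by positivity) (show 0 < τ + hk k by positivity)
  have vPt := Qrs_vol_ne_top w (r + hk k) (τ + hk k)
  have e1 := intb hG G0 hm (show 0 < r + hk k by positivity) hX hc hL hR' hR1 hT' hT1 hsub hP he hMS hv hb
  have e2 := (m34 k hf.aemeasurable hm w hr hτ).trans (mul_le_mul_right e1 _)
  rw [← ENNReal.mul_le_mul_iff_left vP0 vPt]
  refine e2.trans leq
  rw [mul_assoc (cm n m), ofReal_mul c0.le]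
  simp only [cm]
  ring
lemma molbS (k : ℕ) {f : Fin n → Pn} {m X : ℝ} (hm : 1 ≤ m) (hX : 0 ≤ X)
    {U : Set bA} (hmol : ∀ j, Continuous (mol k (f j)))
    (h : ∀ j, ∫⁻ z in U, ‖mol k (f j) z‖ₑ ^ m ≤ ofReal X * volume U) :
    ∫⁻ z in U, ofReal (∑ j, |mol k (f j) z|) ^ m ≤ ofReal (nR ^ sC * n * X) * volume U := by
  have hp : ∀ z, ofReal (∑ j, |mol k (f j) z|) ^ m ≤ ofReal (nR ^ (m-1)) * ∑ j, ‖mol k (f j) z‖ₑ ^ m := by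
    intro z
    rw [ofReal_sum_of_nonneg fun _ _ => abs_nonneg _]
    refine (ENNReal.rpow_sum_le_const_mul_sum_rpow _ _ hm).trans leq
    rw [card_univ, card_fin, ← ofReal_rpow_of_nonneg psv lia0, ofReal_natCast]
    simp only [← ofReal_norm, norm_eq_abs]
  have hmm : ∀ j, Measurable fun z => ‖mol k (f j) z‖ₑ ^ m := fun j => ((hmol j).measurable.enorm).pow_const m
  refine (lintegral_mono hp).trans ?_
  rw [lintegral_const_mul _ (measurable_sum _ fun j _ => hmm j), lintegral_finsetSum _ fun j _ => hmm j]
  refine (mul_le_mul_right (sum_le_sum fun j _ => h j) _).trans leq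
  rw [sum_const, card_univ, card_fin, nsmul_eq_mul, ofReal_mul psv,
    ofReal_mul psv, ofReal_natCast]
  ring
end Lev

section Lev2
variable {n : ℕ} {p q α A₀ A₁ C₀ s : ℝ} {a g G u : Pn} {V B : Fin n → Pn}
structure Ex (n : ℕ) (p q s : ℝ) : Prop where
  s0 : 0 < s
  s1 : s ≤ 1
  sq : 1 / q ≤ s
  m1 : 1 < p * s
  σ1 : 1 < q / qm * s
  σ2 : 2 ≤ q / qm * s / mC
  σq : q ≤ q / qm * s / mC
  σm : q / qm * s / mC * vA ≤ p * s * (n + 2)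
structure PD (p q C₀ : ℝ) (a g G u : Pn) (V B : Fin n → Pn) : Prop where
  Gm : Measurable G
  um : Measurable u
  Vm : ∀ j, Measurable (V j)
  Bm : ∀ j, Measurable fA
  g0 : ∀ z, 0 ≤ g z
  C0 : 0 ≤ C₀
  hG : ∀ z, g z ^ p + a z * g z ^ q ≤ G z
  hu : ∀ z, |u z| ^ q ≤ G z
  hV : ∀ z j, |V j z| ≤ g z
  hB : ∀ᵐ z, z ∈ ball 0 f32 → ∀ j, |B j z| ≤ C₀ * (g z ^ pm + a z * g z ^ qm)
lemma PD.G0 (h : PD p q C₀ a g G u V B) (z : Pt n) : 0 ≤ G z := le_trans psv (h.hu z)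
lemma PD.V_le (h : PD p q C₀ a g G u V B) (hp : 0 < p) {L l : ℝ} (hL : 0 < L) (hl : 0 < l) (hs : 0 < s) (hs1 : s ≤ 1) {z : Pt n}
    (hz : (g z / l) ^ p ≤ 1 + 2 * (G z / L)) (j : Fin n) : |V j z| ^ kC ≤ 2 * l ^ kC * (1 + (G z / L) ^ s) := by
  have := h.G0 z
  refine pw_V jA hl psv hs hs1 (le_trans ?_ hz)
  have := h.hV z j
  gcongr
set_option maxHeartbeats 1000000 in
lemma lev (hE : Ex n p q s) (hp : 2 < p) (hpq : p < q) (hA0 : 0 ≤ A₀) (hC0 : 0 ≤ C₀) {η : Pn} {K : Set bA} {M : ℝ} (hη : CO η K M) (hK : K ⊆ ball 0 jD) :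
    ∃ C > 0, ∀ (A₁ α : ℝ) (a g G u : Pn) (V B : Fin n → Pn) (L : ℝ), Cf p q α A₀ A₁ a → PD p q C₀ a g G u V B → WS u V B →
      1 ≤ L → (∀ w ∈ dL ∩ ball 0 f54, ∀ R, 0 < R → R ≤ 1 →
        Qrs w R (R ^ 2 * be p q L a w) ⊆ dL ∩ ball 0 f54 →
        R ≤ 1/32 ∧ A₁ * (8 * R) ^ α * el p q L (a w) ^ q ≤ L / 4) →
      ∀ᶠ k in atTop, |∫ z in (dL ∩ ball 0 f54)ᶜ, NN tC (fun j => mol k fA) η z| ≤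
        C * L * (volume (dL ∩ bO f54)).toReal := by
  set m := p * s
  set σ := q / qm * s
  have vb0 := vb_pos n
  have hcB := cB_one (q := q) hC0 (by norm_num : Rz ≤ 2)
  let c : ℝ := 8 ^ n * 64
  let vv : ℝ := 2 * vb n * f54 ^ vA
  let D1 : ℝ := nR ^ sC * n * (cm n m * (1 + c) * 2) * vv
  let D2 : ℝ := nR ^ gC * n * (cm n σ * (1 + c) * cB C₀ q 2) * vv
  let D3 : ℝ := cm n 1 * (1 + c) * nA * eD
  have c0 : 0 ≤ c := psv
  have cm1 := cm_pos n m
  have cm2 := cm_pos n σ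
  have cm3 := cm_pos n 1
  have d1 : 0 ≤ D1 := psv
  have d2 : 0 ≤ D2 := psv
  have d3 : 0 ≤ D3 := psv
  obtain ⟨C, hC, H⟩ := levL n m σ hE.m1 hE.σ1 hE.σ2 hE.σm (D := 1 + D1 + D2 + D3) lia0 hη hK
  refine ⟨C, hC, ?_⟩
  intro A₁ α a g G u V B L hcf hpd hws hL hsm
  set O := dL ∩ bO f54
  have hL0 : 0 < L := by linarith
  obtain ⟨R, R0, hWF, hRw⟩ := whit hcf hL ((MS_open _ _).inter isOpen_ball) inter_subset_right hsm
  have hα := hcf.hα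
  have tk : Tendsto hk atTop (𝓝 0) := tendsto_one_div_add_atTop_nhds_zero_nat
  have ev1 : ∀ᶠ k in atTop, hk k < 1/16 := tk.eventually_lt_const nnm
  have ev2 : ∀ᶠ k in atTop, A₁ * (2 * √cA) ^ α * uB ^ q < L / 4 := by
    have h1 : Tendsto (fun k => A₁ * (2 * √cA) ^ α * uB ^ q) atTop (𝓝 (A₁ * (2 * √0) ^ α * uB ^ q)) :=
      (((tk.sqrt.const_mul 2).rpow_const (Or.inr hα.le)).const_mul A₁).mul_const _
    refine h1.eventually_lt_const ?_
    rw [Real.sqrt_zero, mul_zero, zero_rpow hα.ne']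
    simp; linarith
  filter_upwards [ev1, ev2] with k hk1 hk2
  have h0 := hk_pos k
  have b1 := be_le (p := p) (q := q) (a := a) hp.le hL
  have b0 := be_pos (p := p) (q := q) (a := a) hL
  have hmolc : ∀ {f : Pn}, Integrable f → ContDiff ℝ 1 (mol k f) := fun hf => (mol_smooth k hf).of_le (by exact_mod_cast le_top)
  refine H O _ _ (fun w => el p q L (a w)) L tC (fun j => mol k fA) hWF inter_subset_right
    (fun w hw => by have := (hRw w hw).1; linarith)
    (fun w hw => by
      have h1 := (hRw w hw).1
      have h2 := R0 w
      have : (R w / 4) ^ 2 * be p q L a w ≤ (1/32/4) ^ 2 * 1 := by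
        have := b1 w
        have := (b0 w).le
        gcongr
      linarith) (hmolc hws.ui) (fun j => hmolc (hws.Bi j))
    (fun z hz => hws.mol_eqn k (ball_subset_ball lia0 hz)) hL0 ?_
  intro w hw hne
  obtain ⟨hR1, hRa, hRn⟩ := hRw w hw
  have r0 := R0 w
  have e0 := el_pos (p := p) (q := q) (a := a w) hL0
  have hβl : be p q L a w * L = el p q L (a w) ^ 2 := div_mul_cancel₀ _ hL0.ne'
  set l := el p q L (a w)
  set β := be p q L a w
  have β0 : 0 < β := b0 w
  have β1 : β ≤ 1 := b1 w
  set r := R w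
  clear_value r β
  have rβ : nD ^ 2 * β ≤ (1/32/4) * nD := by
    calc nD ^ 2 * β ≤ nC^2 * 1 := by gcongr
      _ = nD * nD := by ring
      _ ≤ _ := by gcongr
  have rβ0 : 0 < nD ^ 2 * β := psv
  have hw1 : ‖w.1‖ < 9/8 + r / 4 ∧ |w.2| < 9/8 + r / 4 := by
    obtain ⟨z, ⟨z1, z2, z3⟩, z4⟩ := hne
    rw [mem_ball_zero_iff, Prod.norm_def, max_lt_iff, norm_eq_abs] at z4
    obtain ⟨z4, z5⟩ := z4
    rw [mem_ball, dist_comm, dist_eq_norm] at z1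
    rw [abs_lt] at z5 ⊢
    refine ⟨?_, by linarith, by linarith⟩
    have := norm_le_norm_add_norm_sub' w.1 z.1
    linarith
  have hin : ∀ {R' T' b : ℝ}, 9/8 + r / 4 + R' ≤ b → 9/8 + r/4 + T' ≤ b → Qrs w R' T' ⊆ ball 0 b := by
    rintro R' T' b h1 h2 z ⟨z1, z2, z3⟩
    rw [mem_ball_zero_iff, Prod.norm_def, max_lt_iff, norm_eq_abs]
    rw [mem_ball, dist_eq_norm] at z1
    have := abs_lt.1 hw1.2
    refine ⟨?_, abs_lt.2 ⟨by linarith, by linarith⟩⟩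
    have := norm_le_norm_add_norm_sub' z.1 w.1
    linarith [hw1.1]
  obtain ⟨e, heQ, heO⟩ := not_subset.1 hRn
  have tβ : jB ^ 2 * β = 64 * (nD ^ 2 * β) := by ring
  have hMS : MS lC e ≤ ofReal rA := by
    by_contra hc
    exact heO ⟨not_le.1 hc, hin lqq lqq heQ⟩
  have hP32 : Qrs w (2 * r + hk k) xC ⊆ ball 0 f32 := hin lqq lqq
  have heP := Qrs_mono w (by linarith only [hR1, rβ, tβ, hk1, r0, h0, rβ0, hp, hpq] : 2 * r ≤ 2 * r + hk k) (by linarith only [hR1, rβ, tβ, hk1, r0, h0, rβ0, hp, hpq] : jB ^ 2 * β ≤ jB ^ 2 * β + hk k) heQ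
  have sq0 := Real.sqrt_nonneg cA
  have sqs := Real.mul_self_sqrt h0.le
  have sq1 : √cA ≤ 1 := Real.sqrt_le_one.2 lqq
  have hosc : ∀ z ∈ Qrs w (2 * r + hk k) xC, |a w - a z| * l ^ q ≤ L / 2 := by
    intro z hz
    obtain ⟨z1, z2, z3⟩ := hz
    rw [mem_ball, dist_comm, dist_eq_norm] at z1
    have t1 : jB ^ 2 * β ≤ jB ^ 2 := mul_le_of_le_one_right psv β1
    have t2 : hk k ≤ √cA := by rw [← sqs]; simpa [sqs] using mul_le_of_le_one_right sq0 sq1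
    have t3 : (2 * r + √cA) ^ 2 = jB ^ 2 + 4 * (r * √cA) + √cA * √cA := by ring
    have t4 : 0 ≤ r * √cA := psv
    rw [sqs] at t3
    have h1 := hcf.hol' (hin (R' := 1/32) (T' := 1/32) lqq lqq (self_mem w nnm nnm))
      (ball_subset_ball nnm (hP32 ⟨by rwa [mem_ball, dist_comm, dist_eq_norm], z2, z3⟩))
      (d := 2 * r + √cA) psv (by linarith only [t2, z1]) (abs_le.2 ⟨by linarith only [t1, t3, t4, z2, z3], by linarith only [t1, t3, t4, z2, z3]⟩)
    have h2 : (2 * r + √cA) ^ α ≤ (8 * r) ^ α + (2 * √cA) ^ α := by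
      have u1 : 0 ≤ (8 * r) ^ α := psv
      have u2 : 0 ≤ (2 * √cA) ^ α := psv
      rcases le_total r (√cA / 2) with h' | h'
      · have := rpow_le_rpow psv (show 2 * r + √cA ≤ 2 * √cA by linarith only [h']) hα.le
        linarith
      · have := rpow_le_rpow psv (show 2 * r + √cA ≤ 8 * r by linarith only [h', r0]) hα.le
        linarith
    have h3 : l ^ q ≤ uB ^ q := by
      exact rpow_le_rpow e0.le (el_leP (by linarith only [hR1, rβ, tβ, hk1, r0, h0, rβ0, hp, hpq] : 0 < p) hL0) lqq
    have := hcf.A10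
    calc |a w - a z| * l ^ q ≤ A₁ * ((8 * r) ^ α + (2 * √cA) ^ α) * l ^ q := by
          refine mul_le_mul_of_nonneg_right (h1.trans ?_) psv
          gcongr
      _ = A₁ * (8 * r) ^ α * l ^ q + A₁ * (2 * √cA) ^ α * l ^ q := by ring
      _ ≤ L / 4 + A₁ * (2 * √cA) ^ α * uB ^ q := by gcongr
      _ ≤ L / 2 := by linarith
  have hgl : ∀ z ∈ Qrs w (2 * r + hk k) xC, (g z / l) ^ p ≤ 1 + 2 * (G z / L) := by
    intro z hz
    refine (el_g lqq hpq.le hL0 (hcf.nn w) (hcf.nn z) (hpd.g0 z) (hosc z hz)).trans ?_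
    have := hpd.hG z
    gcongr
  have key : ∀ {r' τ' m X : ℝ} {f : Pn}, Measurable f → 1 ≤ m → 0 ≤ X → 0 < r' → 0 < τ' → r' ≤ 2 * r → τ' ≤ jB ^ 2 * β →
      r / 4 ≤ r' → nC ^ 2 * β ≤ τ' →
      (∀ᵐ z, z ∈ Qrs w (2 * r + hk k) xC → |f z| ^ m ≤ X * (1 + (G z / L) ^ s)) →
      ∫⁻ z in Qrs w r' τ', ‖mol k f z‖ₑ ^ m ≤ ofReal (cm n m * (1 + c) * X) * volume (Qrs w r' τ') := by
    intro r' τ' m X f hf hm hX hr' hτ' h1 h2 h3 h4 hb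
    have hs1 := Qrs_mono w (by linarith only [h1] : r' + hk k ≤ 2 * r + hk k) (by linarith only [h2] : τ' + hk k ≤ jB ^ 2 * β + hk k)
    refine molb k hf hpd.Gm hpd.G0 hm (R' := 2 * r + hk k) (T' := jB ^ 2 * β + hk k) hr' hτ' hX c0 hL0 psv lqq psv lqq hs1
      hP32 heP hMS ?_ (hb.mono fun z hz h => hz (hs1 h))
    calc (2 * r + hk k) ^ n * xC ≤ (8 * (r' + hk k)) ^ n * (64 * (τ' + hk k)) := by
          gcongr <;> linarith
      _ = _ := by rw [mul_pow]; simp only [c]; ring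
  have hD : ∀ {x m : ℝ}, 0 ≤ x → 1 ≤ m → x ≤ 1 + D1 + D2 + D3 → x ≤ (1 + D1 + D2 + D3) ^ m := by
    intro x m hx hm h
    exact h.trans (Real.self_le_rpow_of_one_le (by linarith only [d1, d2, d3]) hm)
  have hvol : volume (Qrs w (r / 4 * f54) (nD ^ 2 * β * f54)) = ofReal (vv * (nC ^ n * (nC ^ 2 * β))) := by
    rw [Qrs_vol' w psv]
    simp only [vv, mul_pow, pow_succ]; congr 1; ring
  refine ⟨e0, el_sq hp.le hL, ?_, ?_, ?_, ?_⟩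
  · rw [mul_assoc, hβl]; ring
  · have hW : ∀ z ∈ Qrs w (r / 4 * f54) (nD ^ 2 * β * f54), Wg tC z = ∑ j, |mol k (V j) z| := by
      intro z hz
      refine sum_congr rfl fun j _ => ?_
      rw [hws.mol_grad k j (hin lqq lqq hz)]
    rw [setLIntegral_congr_fun wB fun z hz => by rw [hW z hz]]
    refine (molbS k hE.m1.le psv (fun j => (mol_smooth k (hws.Vi j)).continuous) fun j => key (hpd.Vm j) hE.m1.le psv
      psv psv lqq lqq lqq lqq
      (of_forall fun z hz => hpd.V_le lqq hL0 e0 hE.s0 hE.s1 (hgl z hz) j)).trans ?_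
    rw [hvol, ← ofReal_mul psv]
    refine ofReal_le_ofReal ?_
    rw [mul_rpow psv e0.le]
    calc _ = D1 * l ^ m * (nC ^ n * (nC ^ 2 * β)) := by simp only [D1]; ring
      _ ≤ _ := by
        gcongr
        exact hD d1 hE.m1.le (by linarith only [d1, d2, d3])
  · refine (molbS k hE.σ1.le (X := cm n σ * (1 + c) * (cB C₀ q 2 * (L / l) ^ σ)) psv (fun j => (mol_smooth k (hws.Bi j)).continuous) fun j => key (hpd.Bm j) hE.σ1.le psv
      psv psv lqq lqq lqq lqq ?_).trans ?_
    · filter_upwards [hpd.hB] with z hzB hz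
      refine pw_B lqq hpq.le hL0 e0 (hcf.nn z) (hpd.g0 z) (el_p lqq hL0) nnm ?_ (hpd.hG z) jA hC0 hE.s0 hE.s1
        (hzB (hP32 hz) j) (hgl z hz)
      have h1 := hosc z hz
      have h2 := el_q (p := p) (by linarith only [hR1, rβ, tβ, hk1, r0, h0, rβ0, hp, hpq] : 0 < q) hL0 (hcf.nn w)
      have h3 : a z ≤ a w + |a w - a z| := by have := neg_abs_le (a w - a z); linarith
      have h4 : a z * l ^ q ≤ (a w + |a w - a z|) * l ^ q := by gcongr
      linarith
    · rw [hvol, ← ofReal_mul psv]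
      refine ofReal_le_ofReal ?_
      rw [mul_div_assoc, mul_rpow psv psv]
      calc _ = D2 * (L / l) ^ σ * (nC ^ n * (nC ^ 2 * β)) := by simp only [D2]; ring
        _ ≤ _ := by
          gcongr
          exact hD d2 hE.σ1.le (by linarith only [d1, d2, d3])
  · have := key (X := nA * l) (r' := r/4) (τ' := nC ^ 2 * β) hpd.um le_rfl psv psv psv
      lqq lqq le_rfl le_rfl (of_forall fun z hz => by
        rw [rpow_one]
        refine (pw_u jA lqq hL0 hE.sq (hpd.hu z)).trans (mul_le_mul_of_nonneg_right ?_ ?_)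
        · exact el_lb lqq hpq.le hL (hcf.nn w) (hcf.le w (hin (R' := 1/32) (T' := 1/32) lqq lqq (self_mem w nnm nnm)))
        · have := hpd.G0 z
          positivity)
    simp only [ENNReal.rpow_one] at this
    refine this.trans ?_
    rw [Qrs_vol' w psv, ← ofReal_mul psv]
    refine ofReal_le_ofReal ?_
    calc _ = D3 * l * (nC ^ n * (nC ^ 2 * β)) := by simp only [D3]; ring
      _ ≤ _ := by gcongr; linarith
end Lev2

section Lim
variable {n : ℕ} {p q α A₀ A₁ C₀ s : ℝ} {a g G u : Pn} {V B : Fin n → Pn}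
lemma mol_bd {k : ℕ} {f G : Pn} (hf : Measurable f) (hG : Measurable G) (G0 : ∀ z, 0 ≤ G z) {m s : ℝ} (hm : 1 ≤ m) (hs : 0 ≤ s)
    {z : Pt n} {X L : ℝ} (hX : 0 ≤ X) (hL : 1 ≤ L) (hz : z ∈ bO jD) (hk1 : hk k < 1/4)
    (hMS : MS lC z ≤ ofReal rA) (hb : ∀ᵐ z, z ∈ ball 0 f32 → |f z| ^ m ≤ X * (1 + (G z / 1) ^ s)) :
    |mol k f z| ≤ (tn1 ^ m * ((1 + 1) * (X * L ^ s))) ^ m⁻¹ := by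
  have h0 := hk_pos k
  have hP : Qrs z cA cA ⊆ ball 0 f32 := by
    rw [← ball_eq_Qrs]
    refine ball_subset_ball' ?_
    have := mem_ball.1 hz
    linarith
  have h1 := mol_pow_le k hf.aemeasurable hm z
  rw [ball_eq_Qrs] at h1
  have h2 := h1.trans (mul_le_mul_right (intb hG G0 hm (X := X * L ^ s) (c := 1) h0 psv nnm (by linarith : 0 < L) h0 lia0 h0 lia0 Subset.rfl hP
    (self_mem z h0 h0) hMS lia0 (hb.mono fun y hy hyP => (hy (hP hyP)).trans (by
      rw [mul_assoc]
      refine mul_le_mul_of_nonneg_left ?_ hX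
      rw [div_one, mul_add, mul_one, ← mul_rpow lia0 (div_nonneg (G0 y) lia0), mul_div_cancel₀ _ lia0]
      have := one_le_rpow hL hs
      linarith))) _)
  rw [← mul_assoc, ENNReal.mul_le_mul_iff_left (Qrs_vol_ne_zero z h0 h0) (Qrs_vol_ne_top z _ _), ← ofReal_norm,
    ofReal_rpow_of_nonneg vB lia0, ← ofReal_mul psv, ofReal_le_ofReal_iff psv] at h2
  have h3 := rpow_le_rpow psv h2 (show 0 ≤ m⁻¹ by positivity)
  rwa [rpow_rpow_inv vB lia0, norm_eq_abs] at h3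
def N0 (u : Pn) (V B : Fin n → Pn) (ζ : Pn) (z : Pt n) : ℝ :=
  ∑ j, B j z * (V j z * ζ z + u z * dxj ζ j z) - u z ^ 2 * fderiv ℝ ζ z (0, 1) / 2
lemma lim_lev (hE : Ex n p q s) (hcf : Cf p q α A₀ A₁ a) (hpd : PD p q C₀ a g G u V B) (hws : WS u V B)
    {η : Pn} {K : Set bA} {M : ℝ} (hη : CO η K M) (hK : K ⊆ ball 0 jD) {L Y : ℝ} (hL : 1 ≤ L)
    (H : ∀ᶠ k in atTop, |∫ z in (dL ∩ ball 0 f54)ᶜ, NN tC (fun j => mol k fA) η z| ≤ Y) :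
    |∫ z in (dL ∩ ball 0 f54)ᶜ, N0 u V B η z| ≤ Y := by
  have hp := hcf.hp
  have hpq := hcf.hpq
  set O := dL ∩ bO f54
  have hMo : IsOpen O := (MS_open _ _).inter isOpen_ball
  have tk : Tendsto hk atTop (𝓝 0) := tendsto_one_div_add_atTop_nhds_zero_nat
  have hcB := cB_one (q := q) hpd.C0 hcf.A00
  have hgz : ∀ z, (g z / 1) ^ p ≤ 1 + 2 * (G z / 1) := by
    intro z
    have h1 := hpd.hG z
    have h2 := hpd.g0 z
    have h3 := hcf.nn z
    have h4 := hpd.G0 z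
    have : 0 ≤ a z * g z ^ q := psv
    rw [div_one, div_one]; linarith
  obtain ⟨Y1, hY1⟩ : ∃ Y1, ∀ k, hk k < 1/4 → ∀ z ∈ bO jD, z ∉ O →
      |mol k u z| ≤ Y1 ∧ ∀ j, |mol k (V j) z| ≤ Y1 ∧ |mol k fA z| ≤ Y1 := by
    refine ⟨max (max (((2^qA)^Ro*((1+1)*(1*L^s)))^Ro⁻¹) (((2^qA)^yC*((1+1)*(2*1^yC*L^s)))^yC⁻¹))
      (((2^qA)^(q/qm*s)*((1+1)*(cB C₀ q A₀*(1/1)^(q/qm*s)*L^s)))^(q/qm*s)⁻¹), fun k hk1 z hz hzO => ?_⟩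
    have hMS : MS lC z ≤ ofReal rA := by
      by_contra hc
      exact hzO ⟨not_le.1 hc, ball_subset_ball nnm hz⟩
    refine ⟨(mol_bd hpd.um hpd.Gm hpd.G0 le_rfl hE.s0.le nnm hL hz hk1 hMS ?_).trans ((le_max_left _ _).trans yB),
      fun j => ⟨(mol_bd (hpd.Vm j) hpd.Gm hpd.G0 hE.m1.le hE.s0.le psv hL hz hk1 hMS ?_).trans ((le_max_right _ _).trans yB),
        (mol_bd (hpd.Bm j) hpd.Gm hpd.G0 hE.σ1.le hE.s0.le psv hL hz hk1 hMS ?_).trans rC⟩⟩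
    · refine of_forall fun z hz => ?_
      have := pw_u (L := 1) jA lia0 nnm hE.sq (hpd.hu z)
      rwa [Real.one_rpow, ← rpow_one |u z|] at this
    · exact of_forall fun z hz => hpd.V_le lia0 nnm nnm hE.s0 hE.s1 (hgz z) j
    · filter_upwards [hpd.hB] with z hzB hz
      refine pw_B lia0 hpq.le nnm nnm (hcf.nn z) (hpd.g0 z) smp hcf.A00 ?_ (hpd.hG z) jA hpd.C0 hE.s0 hE.s1 (hzB hz j) (hgz z)
      simpa using hcf.le z (ball_subset_ball nnm hz)
  have hM := (abs_nonneg _).trans (hη.b 0)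
  have hlim : Tendsto (fun k => ∫ z in Oᶜ, NN tC (fun j => mol k fA) η z) atTop (𝓝 (∫ z in Oᶜ, N0 u V B η z)) := by
    refine tendsto_integral_filter_of_dominated_convergence (K.indicator fun _ => ∑ j : Fin n, Y1 * (Y1 * M + Y1 * M) + Y1 ^ 2 * M) ?_ ?_ ?_ ?_
    · filter_upwards [tk.eventually_lt_const (by norm_num : Rz < 1/4)] with k hk1
      exact (NN_zero hη ((mol_smooth k hws.ui).of_le (by exact_mod_cast le_top)) (fun j => (mol_smooth k (hws.Bi j)).of_le (by exact_mod_cast le_top)) fun z hz =>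
        hws.mol_eqn k (ball_subset_ball lia0 (hK hz))).1.aestronglyMeasurable.restrict
    · filter_upwards [tk.eventually_lt_const (by norm_num : Rz < 1/4)] with k hk1
      refine (ae_restrict_iff' hMo.measurableSet.compl).2 (of_forall fun z hzO => ?_)
      by_cases hzK : z ∈ K
      · rw [indicator_of_mem hzK, NN, norm_eq_abs]
        obtain ⟨y1, y2⟩ := hY1 k hk1 z (hK hzK) hzO
        have y0 := (abs_nonneg _).trans y1
        refine (abs_sub _ _).trans (add_le_add ((abs_sum_le_sum_abs _ _).trans (sum_le_sum fun j _ => ?_)) ?_)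
        · rw [abs_mul]
          refine mul_le_mul (y2 j).2 ((abs_add_le _ _).trans ?_) jA y0
          rw [abs_mul, abs_mul, hws.mol_grad k j (ball_subset_ball lia0 (hK hzK))]
          refine add_le_add (mul_le_mul (y2 j).1 (hη.b z) jA y0) (mul_le_mul y1 ?_ jA y0)
          exact (hη.bd z _).trans (mul_le_of_le_one_right hM (norm_ej j).le)
        · have h1 : |fderiv ℝ η z (0, 1)| ≤ M := (hη.bd z _).trans (mul_le_of_le_one_right hM (by simp [Prod.norm_def]))
          have h2 := sq_le_sq' (by linarith [(abs_le.1 y1).1]) (abs_le.1 y1).2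
          rw [abs_div, abs_mul, abs_of_nonneg (sq_nonneg _), abs_of_pos (by norm_num : Rz < 2)]
          have : mol k u z ^ 2 * |fderiv ℝ η z (0, 1)| ≤ Y1 ^ 2 * M := by gcongr
          have : 0 ≤ Y1 ^ 2 * M := psv
          linarith
      · simp [NN, dxj, hη.z0 hzK, hη.dz0 hzK, hzK]
    · exact ((integrable_indicator_iff hη.cK.measurableSet).2 (integrableOn_const (hs := hη.cK.measure_lt_top.ne))).restrict
    · refine ae_restrict_of_ae ?_
      filter_upwards [mol_ae hws.ui, ae_all_iff.2 fun j => mol_ae (hws.Vi j), ae_all_iff.2 fun j => mol_ae (hws.Bi j)] with z zu zV zB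
      by_cases hzK : z ∈ K
      · have : Tendsto (fun k => N0 tC (fun j => mol k (V j)) (fun j => mol k fA) η z) atTop (𝓝 (N0 u V B η z)) :=
          (tendsto_finsetSum _ fun j _ => (zB j).mul (((zV j).mul_const _).add (zu.mul_const _))).sub (((zu.pow 2).mul_const _).div_const 2)
        refine this.congr' ?_
        filter_upwards [tk.eventually_lt_const (by norm_num : Rz < 1/4)] with k hk1
        simp only [N0, NN, hws.mol_grad k _ (ball_subset_ball lia0 (hK hzK))]
      · simp [NN, N0, dxj, hη.z0 hzK, hη.dz0 hzK]
  exact le_of_tendsto hlim.abs H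
end Lim

section Hsm
lemma hsm_lem (n : ℕ) {p q α A₀ A₁ D d : ℝ} (hα : 0 < α) (hα1 : α ≤ 1) (hp : 2 < p) (hpq : p < q) (hA0 : 0 ≤ A₀) (hA1 : 0 ≤ A₁) (hD : 0 ≤ D)
    (h2 : 0 < 2 - q * oA) (he : oA * αn + (q - 2 * αn) / p < 1) :
    ∃ Λ ≥ Ro, ∀ a δ L R : ℝ, 0 ≤ a → a ≤ A₀ → d ≤ δ → Λ ≤ L → 0 < R → R ^ n * (R ^ 2 * (el p q L a ^ 2 / L)) ≤ D * L ^ (-δ) →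
      R ≤ 1/32 ∧ A₁ * (8 * R) ^ α * el p q L a ^ q ≤ L / 4 := by
  set b := α / (nR+2)
  have hn : Rz < nR + 2 := psv
  have hb : 0 < b := psv
  have hb1 : b ≤ 1 := (div_le_one hn).2 (by linarith [(Nat.cast_nonneg n : Rz ≤ n)])
  have e1 : 0 < 2 / q - oA := by rw [sub_pos, lt_div_iff₀ lia0]; linarith
  have e2 : 0 < 1 - (oA * b + (q - 2 * b) / p) := by linarith
  have T1 := ((tendsto_rpow_neg_atTop e1).const_mul (nA ^ 2 * D)).eventually_lt_const
    (show nA ^ 2 * D * 0 < (1/32) ^ zC by rw [mul_zero]; positivity)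
  have T2 := ((tendsto_rpow_neg_atTop e2).const_mul (A₁ * 8 ^ α * D ^ b)).eventually_lt_const
    (show A₁ * 8 ^ α * D ^ b * 0 < 1/4 by rw [mul_zero]; positivity)
  obtain ⟨Λ, hΛ⟩ := eventually_atTop.1 (T1.and T2)
  refine ⟨max Λ 1, le_max_right _ _, fun a δ L R ha haA hδ hL hR hV => ?_⟩
  obtain ⟨t1, t2⟩ := hΛ L ((le_max_left _ _).trans hL)
  have hL1 : 1 ≤ L := (le_max_right _ _).trans hL
  have hL0 : 0 < L := by linarith
  have l0 := el_pos (p := p) (q := q) (a := a) hL0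
  have l1 := el_leP (p := p) (q := q) (a := a) lia0 hL0
  have l2 := el_lb (p := p) (q := q) lia0 hpq.le hL1 ha haA
  set l := el p q L a
  have hX : R ^ zC * l ^ 2 ≤ D * L ^ oA := by
    have h1 : R ^ zC * l ^ 2 = R ^ n * (R ^ 2 * (l ^ 2 / L)) * L := by field_simp; ring
    rw [h1]
    refine (mul_le_mul_of_nonneg_right hV hL0.le).trans ?_
    rw [mul_assoc, ← rpow_add_one hL0.ne']
    exact mul_le_mul_of_nonneg_left (rpow_le_rpow_of_exponent_le hL1 lia0) hD
  constructor
  · refine le_of_pow_le_pow_left₀ (n := n+2) (by omega) nnm (le_trans ?_ t1.le)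
    have h3 : L ^ (2/q) ≤ nA ^ 2 * l ^ 2 := by
      have := pow_le_pow_left₀ psv l2 2
      rwa [mul_pow, ← rpow_natCast, ← rpow_mul hL0.le, show 1 / q * ((2:ℕ):ℝ) = 2 / q by push_cast; ring] at this
    have h4 : R ^ zC * L ^ (2/q) ≤ nA ^ 2 * D * L ^ oA := by
      calc R ^ zC * L ^ (2/q) ≤ R ^ zC * (nA ^ 2 * l ^ 2) := by gcongr
        _ = nA ^ 2 * (R ^ zC * l ^ 2) := by ring
        _ ≤ nA ^ 2 * (D * L ^ oA) := by gcongr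
        _ = _ := by ring
    rw [neg_sub, rpow_sub hL0, ← mul_div_assoc, le_div_iff₀ psv]
    exact h4
  · have h5 : (8 * R) ^ α * l ^ q ≤ 8 ^ α * ((D * L ^ oA) ^ b * uB ^ (q - 2 * b)) := by
      have : (8 * R) ^ α * l ^ q = 8 ^ α * ((R ^ zC * l ^ 2) ^ b * l ^ (q - 2 * b)) := by
        rw [mul_rpow nnm hR.le, mul_rpow psv psv, ← rpow_natCast R, ← rpow_natCast l,
          ← rpow_mul hR.le, ← rpow_mul l0.le, mul_assoc (R ^ _) (l ^ _) _, ← rpow_add l0]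
        have e3 : ((n+2:ℕ):ℝ) * b = α := by push_cast; exact mul_div_cancel₀ _ hn.ne'
        rw [e3]; push_cast; ring_nf
      rw [this]
      have : 0 ≤ q - 2 * b := by linarith
      gcongr
    rw [mul_assoc]
    refine (mul_le_mul_of_nonneg_left h5 hA1).trans ?_
    rw [mul_rpow hD psv, ← rpow_mul hL0.le, ← rpow_mul hL0.le, mul_assoc (D ^ b), ← rpow_add hL0,
      show oA * b + 1 / p * (q - 2 * b) = -(1 - (oA * b + (q - 2 * b) / p)) + 1 by ring, rpow_add_one hL0.ne']
    have := mul_le_mul_of_nonneg_right t2.le hL0.le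
    calc _ = A₁ * 8 ^ α * D ^ b * L ^ (-(1 - (oA * b + (q - 2 * b) / p))) * L := by ring
      _ ≤ _ := this
      _ = _ := by ring
end Hsm

section Glob
variable {n : ℕ} {p q A₀ C₀ s : ℝ}
lemma xab {x l a₀ a b : ℝ} (hx : 0 ≤ x) (hl : 0 < l) (hl1 : l ≤ 1) (h0 : 0 ≤ a₀) (h1 : a₀ ≤ a) (h2 : a ≤ b) :
    x ^ a ≤ l ^ a₀ + l ^ (-b) * x ^ b := by
  rcases le_or_gt x l with h | h
  · have h3 := rpow_le_rpow hx h (h0.trans h1)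
    have h4 := rpow_le_rpow_of_exponent_ge hl hl1 h1
    have : 0 ≤ l ^ (-b) * x ^ b := psv
    linarith
  · have hx' := hl.trans h
    have h3 : x ^ a ≤ l ^ (-b) * x ^ b := by
      rw [show a = (a - b) + b by ring, rpow_add hx']
      refine mul_le_mul_of_nonneg_right ?_ psv
      exact (Real.rpow_le_rpow_of_nonpos hl h.le lia0).trans (rpow_le_rpow_of_exponent_ge hl hl1 lia0)
    have : 0 ≤ l ^ a₀ := psv
    linarith
lemma ev_small (E : ℝ) {F : ℝ} (hF : 0 < F) : ∀ᶠ e in 𝓝[>] Rz, E * e < F :=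
  (((continuous_const.mul continuous_id).tendsto' Rz (E * 0) rfl).mono_left nhdsWithin_le_nhds).eventually_lt_const (by simpa)
lemma vol_ball (r : ℝ) (hr : 0 < r) : volume (bO r) = ofReal (2 * vb n * (r ^ n * r)) := by
  rw [ball_eq_Qrs, Qrs_vol' 0 hr]
lemma vol_ball_lt (r : ℝ) : volume (bO r) ≠ ∞ := measure_ball_lt_top.ne
lemma m34' (k : ℕ) {f : Pn} (hf : Measurable f) {m : ℝ} (hm : 1 ≤ m) (hk1 : hk k < 1/8) :
    ∫⁻ z in bO oC, ‖mol k f z‖ₑ ^ m ≤ ofReal (tn1 ^ m * 2 ^ qA) * ∫⁻ z in bO 2, ‖f z‖ₑ ^ m := by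
  have h0 := hk_pos k
  have h := m34 k hf.aemeasurable hm O0 (show Rz < 15/8 by norm_num) (show Rz < 15/8 by norm_num)
  have hv : volume (Qrs O0 oC oC) ≤ volume (Qrs O0 (15/8 + hk k) (15/8 + hk k)) := measure_mono (Qrs_mono 0 lia0 lia0)
  have hp : 0 < 15/8 + hk k := by linarith
  rw [← ENNReal.mul_le_mul_iff_left (Qrs_vol_ne_zero O0 hp hp) (Qrs_vol_ne_top 0 _ _), ball_eq_Qrs, ball_eq_Qrs]
  refine h.trans ?_
  rw [mul_right_comm]
  refine mul_le_mul' (mul_le_mul_right (lintegral_mono_set (Qrs_mono 0 lia0 lia0)) _) hv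
lemma glob (hE : Ex n p q s) (hp : 2 < p) (hpq : p < q) (hA0 : 0 ≤ A₀) (hC0 : 0 ≤ C₀) {ω : ℝ} (hω : 0 < ω) :
    ∃ ε > 0, ∀ (a g u : Pn) (V B : Fin n → Pn), Measurable a → Measurable g → Measurable u → (∀ j, Measurable (V j)) → (∀ j, Measurable fA) →
      (∀ z, 0 ≤ a z) → (∀ z ∈ ball 0 2, a z ≤ A₀) → (∀ z, 0 ≤ g z) → (∀ z j, |V j z| ≤ g z) →
      (∀ᵐ z, z ∈ ball 0 2 → ∀ j, |B j z| ≤ C₀ * (g z ^ pm + a z * g z ^ qm)) → WS u V B →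
      ∫⁻ z in bO 2, ofReal ((g z ^ p + a z * g z ^ q) ^ s) ≤ ofReal ε →
      ∃ c, ∫⁻ z in bO f32, ‖u z - c‖ₑ ^ (q/qm*s/oD) ≤ ofReal ω := by
  obtain ⟨s0, s1, sq, m1, σ1, σ2, σq, σm⟩ := hE
  set σ' := q/qm*s/oD
  obtain ⟨K, hK, HK⟩ := S_scaled n kC σ' m1 lia0 σm
  obtain ⟨κ, hκω, hκ⟩ : ∃ κ : ℝ, K * (κ ^ σ' * (f32 ^ n * f32)) ≤ ω ∧ 0 < κ := by
    have : 0 < ω / (K * (f32 ^ n * f32)) := psv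
    refine ⟨(ω / (K * (f32 ^ n * f32))) ^ σ'⁻¹, ?_, by positivity⟩
    rw [rpow_inv_rpow this.le lia0]
    exact le_of_eq (by field_simp)
  set v2 := 2 * vb n * (2 ^ n * 2)
  have hv2 : 0 < v2 := by have := vb_pos n; positivity
  set D := 1 + C₀ * qD * (v2 + 1)
  have hD1 : C₀ * qD * (v2 + 1) ≤ D := by simp [D]
  have hD0 : 1 ≤ D := by have : 0 ≤ C₀ * qD * (v2 + 1) := psv
                         linarith
  set cs : ℝ → ℝ := fun m => tn1 ^ m * 2 ^ qA
  have hcs : ∀ m, 0 ≤ cs m := fun m => by positivity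
  have hF1 : 0 < κ ^ yC * (f32 ^ n * f32) := psv
  have hF2 : 0 < κ * (f32 ^ n * f32) := psv
  obtain ⟨e, ⟨he1, he2⟩, he0, heone⟩ := (((ev_small (f32 ^ yC * (n ^ (p*s-1) * n * (cs yC * D))) hF1).and
    (ev_small (n ^ (Ro-1) * n * (cs 1 * D)) hF2)).and (Ioc_mem_nhdsGT (zero_lt_one' ℝ))).exists
  refine ⟨e ^ 4, by positivity, fun a g u V B ma mg mu mV mB ha haA hg hV hB hws hX => ?_⟩
  have mX : Measurable fun z => ofReal ((g z ^ p + a z * g z ^ q) ^ s) :=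
    (((mg.pow_const p).add (ma.mul (mg.pow_const q))).pow_const s).ennreal_ofReal
  have he4 : e ^ 4 ≤ D * e := by
    have : e ^ 4 ≤ e := pow_le_of_le_one he0.le heone nnm
    exact this.trans (le_mul_of_one_le_left he0.le hD0)
  have bV : ∀ j, ∫⁻ z in bO 2, ‖V j z‖ₑ ^ yC ≤ ofReal (D * e) := by
    intro j
    refine (lintegral_mono fun z => ?_).trans (hX.trans (ofReal_le_ofReal he4))
    rw [← ofReal_norm, ofReal_rpow_of_nonneg vB lia0, rpow_mul vB]
    refine ofReal_le_ofReal (rpow_le_rpow psv ?_ s0.le)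
    have h1 : ‖V j z‖ ^ p ≤ g z ^ p := rpow_le_rpow vB (hV z j) lia0
    have : 0 ≤ a z * g z ^ q := mul_nonneg (ha z) (rpow_nonneg (hg z) _)
    linarith
  have bB : ∀ j, ∫⁻ z in bO 2, ‖B j z‖ₑ ^ Ro ≤ ofReal (D * e) := by
    intro j
    calc ∫⁻ z in bO 2, ‖B j z‖ₑ ^ Ro
        ≤ ∫⁻ z in bO 2, ofReal (C₀ * qD) * (ofReal e + ofReal ((e^2)⁻¹) * ofReal ((g z ^ p + a z * g z ^ q) ^ s)) := by
          refine lintegral_mono_ae ((ae_restrict_iff' measurableSet_ball).2 (hB.mono fun z hz hz2 => ?_))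
          have hgz := hg z
          have haz := ha z
          have hA := haA z hz2
          have hG : 0 ≤ a z * g z ^ q := psv
          have hG' : 0 ≤ g z ^ p := psv
          set Xz := g z ^ p + a z * g z ^ q
          have hXz : 0 ≤ Xz := psv
          rw [ENNReal.rpow_one, ← ofReal_mul psv, ← ofReal_add he0.le psv, ← ofReal_mul psv, ← ofReal_norm]
          refine ofReal_le_ofReal ((hz hz2 j).trans ?_)
          rw [mul_assoc]
          refine mul_le_mul_of_nonneg_left ?_ hC0
          have key : ∀ r : ℝ, 1/2 ≤ r → r ≤ s → Xz ^ r ≤ e + (e^2)⁻¹ * Xz ^ s := by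
            intro r h1 h2
            refine (xab hXz (by positivity : 0 < e^2) (pow_le_one₀ he0.le heone) (by norm_num : Rz ≤ 1/2) h1 h2).trans (add_le_add leq (mul_le_mul_of_nonneg_right ?_ psv))
            · rw [← Real.sqrt_eq_rpow, Real.sqrt_sq he0.le]
            · rw [← rpow_neg_one]
              exact rpow_le_rpow_of_exponent_ge psv (pow_le_one₀ he0.le heone) lia0
          have hsq : qm/q ≤ s := by
            rw [div_mul_eq_mul_div, lt_div_iff₀ lia0] at σ1
            rw [div_le_iff₀ lia0]; linarith
          have k1 := key (pm/p) (by rw [le_div_iff₀ lia0]; linarith) (le_trans (by rw [div_le_div_iff₀ lia0 lia0]; linarith) hsq)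
          have k2 := key (qm/q) (by rw [le_div_iff₀ lia0]; linarith) hsq
          have j1 : g z ^ pm ≤ Xz ^ (pm/p) := by
            refine le_trans leq (rpow_le_rpow hG' (le_add_of_nonneg_right hG) (div_nonneg lia0 lia0))
            rw [← rpow_mul hgz, mul_div_cancel₀ _ lia0]
          have j2 : a z * g z ^ qm ≤ nA * Xz ^ (qm/q) := by
            have h1 : a z * g z ^ qm = a z ^ jC * (a z * g z ^ q) ^ (qm/q) := by
              rw [mul_rpow haz psv, ← rpow_mul hgz, mul_div_cancel₀ _ lia0, ← mul_assoc, ← Real.rpow_add_of_nonneg haz (div_nonneg nnm lia0) (div_nonneg lia0 lia0),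
                show 1/q + qm/q = 1 by rw [← add_div, add_sub_cancel, div_self lia0], rpow_one]
            rw [h1]
            refine mul_le_mul ?_ (rpow_le_rpow hG (le_add_of_nonneg_left hG') (div_nonneg lia0 lia0)) psv psv
            refine (rpow_le_rpow haz (show a z ≤ 1 + A₀ by linarith) (div_nonneg nnm lia0)).trans ?_
            exact (rpow_le_rpow_of_exponent_le lia0 (by rw [div_le_one lia0]; linarith)).trans (rpow_one _).le
          have := mul_le_mul_of_nonneg_left k2 (show 0 ≤ 1 + A₀ by linarith)
          linarith only [this, j1, j2, k1]
      _ = ofReal (C₀ * qD) * (ofReal e * ofReal v2 + ofReal ((e^2)⁻¹) * ∫⁻ z in bO 2, ofReal ((g z ^ p + a z * g z ^ q) ^ s)) := by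
          rw [lintegral_const_mul' _ _ ofReal_ne_top, lintegral_add_left measurable_const, lintegral_const_mul _ mX, setLIntegral_const, vol_ball 2 nnm]
      _ ≤ ofReal (C₀ * qD) * (ofReal e * ofReal v2 + ofReal ((e^2)⁻¹) * ofReal (e^4)) :=
          mul_le_mul_right (add_le_add le_rfl (mul_le_mul_right hX _)) _
      _ ≤ _ := by
          rw [← ofReal_mul he0.le, ← ofReal_mul psv, ← ofReal_add psv psv, ← ofReal_mul psv]
          refine ofReal_le_ofReal ?_
          have h1 : (e^2)⁻¹ * e^4 ≤ e := by
            rw [show (e^2)⁻¹ * e^4 = e * e by field_simp]; exact mul_le_of_le_one_left he0.le heone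
          calc C₀ * qD * (e * v2 + (e^2)⁻¹ * e^4) ≤ C₀ * qD * (e * v2 + e) := by gcongr
            _ = C₀ * qD * (v2 + 1) * e := by ring
            _ ≤ _ := by gcongr
  have tk : Tendsto hk atTop (𝓝 0) := tendsto_one_div_add_atTop_nhds_zero_nat
  obtain ⟨k0, hk0⟩ := eventually_atTop.1 (tk.eventually_lt_const (by norm_num : Rz < 1/8))
  have hVU : volume (bO oC) ≠ 0 := (measure_ball_pos _ _ nnm).ne'
  have gen : ∀ k, hk k < 1/8 → ∀ f : Fin n → Pn, (∀ j, Measurable (f j)) → (∀ j, Integrable (f j)) → ∀ m : ℝ, 1 ≤ m → (∀ j, ∫⁻ z in bO 2, ‖f j z‖ₑ ^ m ≤ ofReal (D * e)) →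
      ∫⁻ z in bO oC, ofReal (∑ j, |mol k (f j) z|) ^ m ≤ ofReal (n ^ (m-1) * n * (cs m * D) * e) := by
    intro k hk1 f mf fi m hm hfj
    set vU := 2 * vb n * (oC ^ n * oC)
    have hvU : 0 < vU := by have := vb_pos n; positivity
    have := molbS k (f := f) hm (X := cs m * (D * e) / vU) (U := ball 0 oC) (by have := hcs m; positivity) (fun j => (mol_smooth k (fi j)).continuous) fun j => by
      refine (m34' k (mf j) hm hk1).trans ((mul_le_mul_right (hfj j) _).trans leq)
      rw [vol_ball _ nnm, ← ofReal_mul (hcs m), ← ofReal_mul (by have := hcs m; positivity), div_mul_cancel₀ _ hvU.ne']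
    refine this.trans leq
    rw [vol_ball _ nnm, ← ofReal_mul (by have := hcs m; positivity)]
    change ofReal (_ * vU) = _
    congr 1
    field_simp
  have step : ∀ k, hk k < 1/8 → ∃ c, ∫⁻ z in bO f32, ‖mol k u z - c‖ₑ ^ σ' ≤ ofReal ω := by
    intro k hk1
    have hQ : Qrs O0 (3/2*f54) (3/2*f54) = ball 0 oC := by rw [ball_eq_Qrs]; norm_num
    obtain ⟨c, hc⟩ := HK tC (fun j => mol k fA) 0 f32 f32 κ nnm nnm hκ ((mol_smooth k hws.ui).of_le (by exact_mod_cast le_top))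
      (fun j => (mol_smooth k (hws.Bi j)).of_le (by exact_mod_cast le_top)) (fun z hz => hws.mol_eqn k (ball_subset_ball lia0 (hQ ▸ hz))) (by
        rw [hQ]
        have h1 : ∫⁻ z in bO oC, ofReal (3/2 * Wg tC z) ^ yC = ofReal (f32 ^ yC) * ∫⁻ z in bO oC, ofReal (∑ j, |mol k (V j) z|) ^ yC := by
          rw [← lintegral_const_mul' _ _ ofReal_ne_top]
          refine setLIntegral_congr_fun measurableSet_ball fun z hz => ?_
          simp only [Wg, hws.mol_grad k _ (ball_subset_ball (by linarith) hz)]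
          rw [ofReal_mul nnm, mul_rpow_of_nonneg _ _ lia0, ofReal_rpow_of_nonneg nnm lia0]
        rw [h1]
        refine (mul_le_mul_right (gen k hk1 V mV hws.Vi _ m1.le bV) _).trans ?_
        rw [← ofReal_mul psv, ← mul_assoc]
        exact ofReal_le_ofReal he1.le) (by
        rw [hQ, div_self nnm]
        simp only [one_mul]
        have := gen k hk1 B mB hws.Bi 1 le_rfl bB
        simp only [ENNReal.rpow_one] at this
        exact this.trans (ofReal_le_ofReal he2.le))
    exact ⟨c, by rw [ball_eq_Qrs]; exact hc.trans (ofReal_le_ofReal hκω)⟩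
  have hkk : ∀ k, hk (k + k0) < 1/8 := fun k => hk0 _ (by omega)
  choose c hc using fun k => step (k + k0) (hkk k)
  set U := bO f32
  have hU0 : volume U ≠ 0 := (measure_ball_pos _ _ nnm).ne'
  have hUt : volume U ≠ ∞ := vol_ball_lt _
  obtain ⟨Y, hY, hcY⟩ : ∃ Y : ℝ≥0∞, Y ≠ ∞ ∧ ∀ k, ‖c k‖ₑ ≤ Y := by
    refine ⟨(volume U + ofReal ω + ofReal (cs 1) * ∫⁻ z in bO 2, ‖u z‖ₑ ^ Ro) / volume U, ?_, fun k => ?_⟩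
    · refine ENNReal.div_ne_top (add_ne_top.2 ⟨add_ne_top.2 ⟨hUt, ofReal_ne_top⟩, mul_ne_top ofReal_ne_top ?_⟩) hU0
      simp only [ENNReal.rpow_one]
      exact ne_top_of_le_ne_top hws.ui.hasFiniteIntegral.ne (setLIntegral_le_lintegral _ _)
    · rw [ENNReal.le_div_iff_mul_le (Or.inl hU0) (Or.inl hUt), ← setLIntegral_const]
      have mm : Measurable fun z => ‖mol (k + k0) u z‖ₑ ^ Ro := (mol_smooth _ hws.ui).continuous.measurable.enorm.pow_const _
      calc ∫⁻ _ in U, ‖c k‖ₑ ≤ ∫⁻ z in U, ((1 + ‖mol (k + k0) u z - c k‖ₑ ^ σ') + ‖mol (k + k0) u z‖ₑ ^ Ro) := by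
            refine lintegral_mono fun z => ?_
            refine le_trans ?_ (add_le_add (enn_le_one_add _ lia0) (ENNReal.rpow_one _).ge)
            rw [← enorm_neg (_ - _)]
            exact le_of_eq_of_le (by congr 1; ring) (enorm_add_le _ _)
        _ ≤ _ := by
            rw [lintegral_add_right _ mm, lintegral_add_left measurable_const, setLIntegral_const, one_mul]
            exact add_le_add (add_le_add le_rfl (hc k)) ((lintegral_mono_set (ball_subset_ball nnm)).trans (m34' _ mu le_rfl (hkk k)))
  obtain ⟨c', -, φ, hφ, hlim⟩ := tendsto_subseq_of_bounded (isBounded_closedBall) (x := c) fun k => by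
    rw [mem_closedBall_zero_iff, ← toReal_enorm]
    exact ENNReal.toReal_mono hY (hcY k)
  refine ⟨c', ?_⟩
  calc ∫⁻ z in U, ‖u z - c'‖ₑ ^ σ' ≤ ∫⁻ z in U, liminf (fun i => ‖mol (φ i + k0) u z - c (φ i)‖ₑ ^ σ') atTop := by
        refine lintegral_mono_ae (ae_restrict_of_ae ((mol_ae hws.ui).mono fun z hz => ?_))
        have ht : Tendsto (fun i => mol (φ i + k0) u z) atTop (𝓝 (u z)) := hz.comp (tendsto_atTop_mono (fun i => Nat.le_add_right _ _) hφ.tendsto_atTop)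
        exact (((ENNReal.continuous_rpow_const).tendsto _).comp (ht.sub hlim).enorm).liminf_eq.ge
    _ ≤ liminf (fun i => ∫⁻ z in U, ‖mol (φ i + k0) u z - c (φ i)‖ₑ ^ σ') atTop :=
        lintegral_liminf_le fun i => ((mol_smooth _ hws.ui).continuous.measurable.sub_const _).enorm.pow_const _
    _ ≤ _ := liminf_le_of_le (by isBoundedDefault) fun b hb => by
        obtain ⟨i, hi⟩ := hb.exists
        exact hi.trans (hc _)
end Glob

section Intg
lemma lc_up {κ : ℝ} (hκ : κ < 1) (b : ℝ≥0∞) :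
    ∫⁻ t in {t : ℝ | 0 < t ∧ ofReal t⁻¹ < b}, ofReal (t ^ (κ - 2)) ≤ b ^ rD * ofReal (1 / rD) := by
  have h0 : 0 < 1 - κ := by linarith
  rcases eq_or_ne b ∞ with rfl | hb
  · rw [top_rpow_of_pos h0, ENNReal.top_mul (by simpa using hκ)]; exact le_top
  rcases eq_or_ne b 0 with rfl | hb0
  · simp
  have hβ := toReal_pos hb0 hb
  set β := b.toReal
  have hbe := (ofReal_toReal hb).symm
  have hsub : {t : ℝ | 0 < t ∧ ofReal t⁻¹ < b} ⊆ Ioi β⁻¹ := fun t ht => by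
    have := ht.2
    rw [hbe, ENNReal.ofReal_lt_ofReal_iff hβ] at this
    exact (inv_lt_comm₀ ht.1 hβ).1 this
  have hβ' : 0 < β⁻¹ := psv
  refine (lintegral_mono_set hsub).trans leq
  rw [← ofReal_integral_eq_lintegral_ofReal (integrableOn_Ioi_rpow_of_lt lia0 hβ') ((ae_restrict_iff' measurableSet_Ioi).2 (of_forall fun t ht => rpow_nonneg (hβ'.trans ht).le _)),
    integral_Ioi_rpow_of_lt lia0 hβ', hbe, ofReal_rpow_of_pos hβ, ← ofReal_mul psv, inv_rpow hβ.le, ← rpow_neg hβ.le,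
    show -(κ - 2 + 1) = 1 - κ by ring, show κ - 2 + 1 = -rD by ring, neg_div_neg_eq, mul_one_div]
lemma intg {X : Type*} [MeasurableSpace X] (μ : Measure X) [SFinite μ] {b k₁ k₂ : X → ℝ≥0∞} (hb : Measurable b) (m1 : Measurable k₁) (m2 : Measurable k₂)
    {U : Set X} (hU : MeasurableSet U) {Λ κ C : ℝ} (hΛ : 0 < Λ) (hκ : 0 < κ) (hκ1 : κ < 1) (hC : 0 ≤ C)
    (H : ∀ L, Λ ≤ L → ∫⁻ x in {x | b x < ofReal L}, k₁ x ∂μ ≤ ofReal (C * L) * μ ({x | ofReal L < b x} ∩ U) + ∫⁻ x in {x | b x ≤ ofReal L}, k₂ x ∂μ) :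
    ∫⁻ x, k₁ x * ((max (b x) (ofReal Λ))⁻¹) ^ κ ∂μ ≤
      ofReal (κ * C / rD) * ∫⁻ x in U, b x ^ rD ∂μ + 2 * ∫⁻ x, k₂ x * ((max (b x) (ofReal Λ))⁻¹) ^ κ ∂μ := by
  set h : X → ℝ≥0∞ := fun x => (max (b x) (ofReal Λ))⁻¹
  have mh : Measurable h := (hb.max measurable_const).inv
  have ht : ∀ x, h x ≠ ∞ := fun x => ENNReal.inv_ne_top.2 (lt_of_lt_of_le (ofReal_pos.2 hΛ) rC).ne'
  have hκ' : 0 < 1 - κ := by linarith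
  have A1 : ∫⁻ x, k₁ x * h x ^ κ ∂μ ≤ ofReal κ * ∫⁻ t in Ioi Rz, ofReal tκ * ∫⁻ x in {x | ofReal t < h x}, k₁ x ∂μ := by
    rw [← lc_tonelli μ h mh k₁ m1 κ, ← lintegral_const_mul' _ _ ofReal_ne_top]
    refine lintegral_mono fun x => ?_
    rw [mul_left_comm]
    exact mul_le_mul_right (lc_ge κ hκ _) _
  set P : Set (X × ℝ) := {w | ofReal w.2⁻¹ < b w.1}
  have hP : MeasurableSet P := measurableSet_lt fpr fpr
  have mP : ∀ t : ℝ, MeasurableSet {x | ofReal t⁻¹ < b x} := fun t => measurableSet_lt fpr hb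
  have A2 : ∀ t ∈ Ioi Rz, ofReal tκ * ∫⁻ x in {x | ofReal t < h x}, k₁ x ∂μ ≤
      ofReal C * (∫⁻ x in U, P.indicator (fun w => ofReal lB) (x, t) ∂μ) + ofReal tκ * ∫⁻ x in {x | ofReal t < 2 * h x}, k₂ x ∂μ := by
    intro t ht0
    have ht0' : 0 < t := ht0
    have inv : ofReal t = (ofReal t⁻¹)⁻¹ := by rw [ofReal_inv_of_pos ht0', inv_inv]
    rcases lt_or_ge t⁻¹ Λ with hL | hL
    · have : {x | ofReal t < h x} = ∅ := by
        refine eq_empty_of_forall_notMem fun x hx => ?_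
        have hx' : ofReal t < h x := hx
        rw [inv, ENNReal.inv_lt_inv] at hx'
        exact absurd ((le_max_right _ _).trans_lt hx') (not_lt.2 (ofReal_le_ofReal hL.le))
      simp [this]
    · have s1 : {x | ofReal t < h x} ⊆ {x | b x < ofReal t⁻¹} := fun x hx => by
        have hx' : ofReal t < h x := hx
        rw [inv, ENNReal.inv_lt_inv] at hx'
        exact (le_max_left _ _).trans_lt hx'
      have s2 : {x | b x ≤ ofReal t⁻¹} ⊆ {x | ofReal t < 2 * h x} := fun x hx => by
        have h1 : ofReal t ≤ h x := by
          rw [inv]; exact ENNReal.inv_le_inv.2 (max_le hx (ofReal_le_ofReal hL))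
        have h2 : h x ≠ 0 := ((ofReal_pos.2 ht0').trans_le h1).ne'
        refine h1.trans_lt ?_
        rw [two_mul]
        exact ENNReal.lt_add_right (ht x) h2
      have e : ∫⁻ x in U, P.indicator (fun w => ofReal lB) (x, t) ∂μ = ofReal (t ^ (κ - 2)) * μ ({x | ofReal t⁻¹ < b x} ∩ U) := by
        rw [← Measure.restrict_apply (mP t), ← lintegral_indicator_const (mP t)]; rfl
      rw [e]
      refine (mul_le_mul_right ((lintegral_mono_set s1).trans ((H _ hL).trans (add_le_add le_rfl (lintegral_mono_set s2)))) _).trans ?_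
      rw [mul_add]
      refine add_le_add leq le_rfl
      rw [← mul_assoc, ← mul_assoc, ← ofReal_mul psv, ← ofReal_mul hC, show κ - 1 = (κ - 2) + 1 by ring, rpow_add_one ht0'.ne']
      congr 2; field_simp
  have mφ : Measurable fun w : X × ℝ => P.indicator (fun w => ofReal lB) w := by
    refine Measurable.indicator ?_ hP
    have : Measurable fun z : X × ℝ => z.2 ^ (κ - 2) := by fun_prop
    fun_prop
  have A3 : ∫⁻ t in Ioi Rz, (∫⁻ x in U, P.indicator (fun w => ofReal lB) (x, t) ∂μ) ≤ (∫⁻ x in U, b x ^ rD ∂μ) * ofReal (1 / rD) := by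
    rw [← lintegral_lintegral_swap mφ.aemeasurable, ← lintegral_mul_const' _ _ ofReal_ne_top]
    refine lintegral_mono fun x => le_trans leq (lc_up hκ1 (b x))
    have hm : MeasurableSet {t : ℝ | ofReal t⁻¹ < b x} := measurableSet_lt fpr fpr
    rw [show {t : ℝ | 0 < t ∧ ofReal t⁻¹ < b x} = {t : ℝ | ofReal t⁻¹ < b x} ∩ Ioi 0 by ext t; simp [and_comm], ← restrict_restrict hm, ← lintegral_indicator hm]
    rfl
  have A4 : ∫⁻ t in Ioi Rz, ofReal tκ * ∫⁻ x in {x | ofReal t < 2 * h x}, k₂ x ∂μ ≤ ofReal (1 / κ) * (2 * ∫⁻ x, k₂ x * h x ^ κ ∂μ) := by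
    rw [← lc_tonelli μ (fun x => 2 * h x) (mh.const_mul _) k₂ m2 κ, ← lintegral_const_mul' _ _ nnm, ← lintegral_const_mul' _ _ ofReal_ne_top]
    refine lintegral_mono fun x => ?_
    rw [lc_le κ hκ _ (mul_ne_top nnm (ht x)), mul_rpow_of_nonneg _ _ hκ.le]
    have : (2:ℝ≥0∞) ^ κ ≤ 2 := (ENNReal.rpow_le_rpow_of_exponent_le nnm hκ1.le).trans (ENNReal.rpow_one _).le
    calc k₂ x * (2 ^ κ * h x ^ κ * ofReal (1 / κ)) = 2 ^ κ * (ofReal (1 / κ) * (k₂ x * h x ^ κ)) := by ring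
      _ ≤ 2 * (ofReal (1 / κ) * (k₂ x * h x ^ κ)) := mul_le_mul_left this _
      _ = _ := by ring
  refine A1.trans ((mul_le_mul_right (setLIntegral_mono' measurableSet_Ioi A2) _).trans ?_)
  rw [lintegral_add_left (by
    have : Measurable fun t : ℝ => ∫⁻ x in U, P.indicator (fun w => ofReal lB) (x, t) ∂μ := mφ.lintegral_prod_left'
    exact this.const_mul _), mul_add, lintegral_const_mul' _ _ ofReal_ne_top]
  refine add_le_add ((mul_le_mul_right (mul_le_mul_right A3 _) _).trans leq) ((mul_le_mul_right A4 _).trans leq)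
  · rw [show κ * C / rD = κ * C * (1 / rD) by ring, ofReal_mul psv, ofReal_mul hκ.le]; ring
  · rw [← mul_assoc, ← ofReal_mul hκ.le, mul_one_div_cancel hκ.ne', ofReal_one, one_mul]
end Intg

section Unit
variable {n N : ℕ} {p q α A₀ A₁ c₀ C₀ s : ℝ} {a v f : Pn} {u : Fin N → Pn} {V B : Fin N → Fin n → Pn}
structure UD (p q α A₀ A₁ c₀ C₀ : ℝ) (a v f : Pn) (u : Fin N → Pn) (V B : Fin N → Fin n → Pn) : Prop where
  cf : Cf p q α A₀ A₁ a
  c0 : 0 < c₀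
  C0 : 0 ≤ C₀
  vm : Measurable v
  fm : Measurable f
  um : ∀ i, Measurable gD
  Vm : ∀ i j, Measurable (V i j)
  Bm : ∀ i j, Measurable (B i j)
  v0 : ∀ z, 0 ≤ v z
  f0 : ∀ z, 0 ≤ f z
  hV : ∀ i j z, |V i j z| ≤ v z
  hB : ∀ᵐ z, z ∈ ball 0 2 → ∀ i j, |B i j z| ≤ C₀ * (pA ^ pm + a z * pA ^ qm)
  hc : ∀ᵐ z, z ∈ ball 0 2 → c₀ * vz ≤ ∑ i, ∑ j, B i j z * V i j z + C₀ * fz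
  ws : ∀ i, WS gD (V i) (B i)
def Yu (u : Fin N → Pn) (z : Pt n) : ℝ := ∑ i, |u i z|
def GG (p q : ℝ) (a v f : Pn) (u : Fin N → Pn) (z : Pt n) : ℝ := pA ^ p + a z * pA ^ q + Yu u z ^ q
lemma Yu0 (u : Fin N → Pn) (z : Pt n) : 0 ≤ Yu u z := sum_nonneg fun _ _ => abs_nonneg _
lemma le_Yu (u : Fin N → Pn) (i : Fin N) (z : Pt n) : |u i z| ≤ Yu u z :=
  single_le_sum (f := fun i => |u i z|) (fun _ _ => abs_nonneg _) (Finset.mem_univ i)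
lemma Yu_meas (hu : ∀ i, Measurable gD) : Measurable (Yu u) := by
  unfold Yu; exact measurable_sum _ fun i _ => (hu i).norm
lemma Hadd {x y e q : ℝ} (hx : 0 ≤ x) (hy : 0 ≤ y) (he : 0 ≤ e) (heq : e ≤ q) : aD ^ e ≤ 2 ^ q * (x ^ e + y ^ e) := by
  have h1 : aD ^ e ≤ 2 ^ e * (max x y) ^ e := by
    rw [← mul_rpow nnm (hx.trans yB)]
    exact rpow_le_rpow psv (by linarith [le_max_left x y, le_max_right x y]) he
  have h2 : (max x y) ^ e ≤ x ^ e + y ^ e := by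
    have := rpow_nonneg hx e
    have := rpow_nonneg hy e
    rcases max_choice x y with h | h <;> rw [h] <;> linarith
  refine h1.trans (mul_le_mul (rpow_le_rpow_of_exponent_le nnm heq) h2 (rpow_nonneg (hx.trans yB) _) psv)
lemma H_add {x y b p q : ℝ} (hx : 0 ≤ x) (hy : 0 ≤ y) (hb : 0 ≤ b) (hp : 0 ≤ p) (hpq : p ≤ q) :
    aD ^ p + b * aD ^ q ≤ 2 ^ q * ((x ^ p + b * x ^ q) + (y ^ p + b * y ^ q)) := by
  have h1 := Hadd hx hy hp hpq
  have h2 := mul_le_mul_of_nonneg_left (Hadd hx hy (hp.trans hpq) le_rfl) hb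
  linarith
lemma yg {g y p θ : ℝ} (hg : 0 ≤ g) (hy : 0 ≤ y) (hp : 1 < p) (hθ : 0 < θ) : g ^ pm * y ≤ θ * g ^ p + θ ^ (1-p) * y ^ p := by
  have e : ∀ x : ℝ, 0 ≤ x → x ^ p = x ^ pm * x := fun x hx => by
    rcases hx.eq_or_lt with rfl | h
    · rw [zero_rpow lia0, mul_zero]
    · rw [← rpow_add_one h.ne', sub_add_cancel]
  have k1 : 0 ≤ θ * g ^ p := psv
  have k2 : 0 ≤ θ ^ (1-p) * y ^ p := psv
  rcases le_total y (θ * g) with h | h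
  · have := mul_le_mul_of_nonneg_left h (rpow_nonneg hg pm)
    rw [show g ^ pm * (θ * g) = θ * (g ^ pm * g) by ring, ← e g hg] at this
    linarith
  · have h1 : g ^ pm ≤ θ ^ (1-p) * y ^ pm := by
      have : g ≤ y / θ := by rw [le_div_iff₀ hθ]; linarith
      refine (rpow_le_rpow hg this lia0).trans leq
      rw [div_rpow hy hθ.le, show 1 - p = -pm by ring, rpow_neg hθ.le, div_eq_inv_mul]
    have := mul_le_mul_of_nonneg_right h1 hy
    rw [mul_assoc, ← e y hy] at this
    linarith
def DU (n N : ℕ) (q A₀ C₀ M : ℝ) : ℝ := N * n * M * C₀ * 2 ^ q + M * C₀ + N * n * M * C₀ * nA + M + 1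
def RU (p q D θ : ℝ) (a v f : Pn) (u : Fin N → Pn) (z : Pt n) : ℝ :=
  D * θ * vz + D * θ ^ aB * (fz + (Yu u z ^ R2 + Yu u z ^ p + Yu u z ^ q))
lemma pwU (hd : UD p q α A₀ A₁ c₀ C₀ a v f u V B) {η : Pn} {K : Set bA} {M : ℝ} (hη : CO η K M) (η0 : ∀ z, 0 ≤ η z) {θ : ℝ} (hθ : 0 < θ) (hθ1 : θ ≤ 1) {z : Pt n}
    (hz : z ∈ bO 2) (hB : ∀ i j, |B i j z| ≤ C₀ * (pA ^ pm + a z * pA ^ qm))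
    (hc : c₀ * vz ≤ ∑ i, ∑ j, B i j z * V i j z + C₀ * fz) :
    c₀ * nB ≤ ∑ i, N0 gD (V i) (B i) η z + RU p q (DU n N q A₀ C₀ M) θ a v f u z := by
  have hp := hd.cf.hp
  have hpq := hd.cf.hpq
  have hM := (abs_nonneg _).trans (hη.b z)
  have ha := hd.cf.nn z
  have haA := hd.cf.le z hz
  have hA0 := hd.cf.A00
  have hC0 := hd.C0
  have hv := hd.v0 z
  have hf := hd.f0 z
  have hY := Yu0 u z
  have eN : ∑ i, N0 gD (V i) (B i) η z = η z * (∑ i, ∑ j, B i j z * V i j z) + ((∑ i, ∑ j, B i j z * (u i z * dxj η j z)) - ∑ i, u i z ^ 2 * fderiv ℝ η z (0, 1) / 2) := by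
    simp only [N0, mul_add, sum_add_distrib, sum_sub_distrib, mul_sum]
    have : ∀ i j, B i j z * (V i j z * η z) = η z * (B i j z * V i j z) := fun i j => by ring
    simp only [this]; ring
  set g := v z + f z
  have hg : 0 ≤ g := psv
  set X := g ^ p + a z * g ^ q
  have hX := H_add hv hf ha lia0 hpq.le
  set Hv := v z ^ p + a z * v z ^ q
  set Hf := f z ^ p + a z * f z ^ q
  set y := Yu u z
  have hHf : 0 ≤ Hf := psv
  have hHv : 0 ≤ Hv := psv
  have hy2 : 0 ≤ y ^ R2 := psv
  have hyp : 0 ≤ y ^ p := psv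
  have hyq : 0 ≤ y ^ q := psv
  set t := θ ^ aB
  have ht1 : 1 ≤ t := Real.one_le_rpow_of_pos_of_le_one_of_nonpos hθ hθ1 lia0
  have young : (g ^ pm + a z * g ^ qm) * y ≤ θ * X + t * nA * (y ^ p + y ^ q) := by
    have h1 := yg hg hY (show 1 < p by linarith) hθ
    have h2 := mul_le_mul_of_nonneg_left (yg hg hY (show 1 < q by linarith) hθ) ha
    have h3 : θ ^ (1-p) * y ^ p ≤ t * y ^ p := mul_le_mul_of_nonneg_right (rpow_le_rpow_of_exponent_ge hθ hθ1 lia0) hyp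
    have h4 : a z * (t * y ^ q) ≤ A₀ * (t * y ^ q) := mul_le_mul_of_nonneg_right haA psv
    have h5 : 0 ≤ t * A₀ * y ^ p := psv
    have h6 : 0 ≤ t * y ^ q := psv
    simp only [X]
    linarith
  have S1 : |∑ i, ∑ j, B i j z * (u i z * dxj η j z)| ≤ N * n * M * C₀ * (θ * X + t * nA * (y ^ p + y ^ q)) := by
    have hb : ∀ i j, |B i j z * (u i z * dxj η j z)| ≤ C₀ * (θ * X + t * nA * (y ^ p + y ^ q)) * M := by
      intro i j
      rw [abs_mul, abs_mul, ← mul_assoc]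
      refine mul_le_mul ?_ ((hη.bd z _).trans (mul_le_of_le_one_right hM (norm_ej j).le)) jA (mul_nonneg hC0 psv)
      refine (mul_le_mul (hB i j) (le_Yu u i z) jA psv).trans ?_
      rw [mul_assoc]
      exact mul_le_mul_of_nonneg_left young hC0
    refine (abs_sum_le_sum_abs _ _).trans ((sum_le_sum fun i _ => (abs_sum_le_sum_abs _ _).trans (sum_le_sum fun j _ => hb i j)).trans leq)
    simp only [sum_const, card_univ, card_fin, nsmul_eq_mul]; ring
  have S2 : ∑ i, u i z ^ 2 * fderiv ℝ η z (0, 1) / 2 ≤ M * y ^ R2 := by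
    have h1 : ∑ i, u i z ^ 2 ≤ y ^ R2 := by
      rw [rpow_two, sq]
      calc ∑ i, u i z ^ 2 = ∑ i, |u i z| * |u i z| := sum_congr rfl fun i _ => by rw [← sq, sq_abs]
        _ ≤ ∑ i, |u i z| * y := sum_le_sum fun i _ => mul_le_mul_of_nonneg_left (le_Yu u i z) jA
        _ = _ := by rw [← sum_mul]; rfl
    have h2 : |fderiv ℝ η z (0, 1)| ≤ M := (hη.bd z _).trans (mul_le_of_le_one_right hM (by simp [Prod.norm_def]))
    have h3 : 0 ≤ ∑ i, u i z ^ 2 := sum_nonneg fun i _ => sq_nonneg _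
    rw [← Finset.sum_div, ← sum_mul]
    have h4 := (mul_le_mul_of_nonneg_left ((le_abs_self _).trans h2) h3).trans (mul_le_mul_of_nonneg_right h1 hM)
    have : 0 ≤ y ^ R2 * M := psv
    linarith
  have hηM := (le_abs_self _).trans (hη.b z)
  have k1 := mul_le_mul_of_nonneg_left hc (η0 z)
  have k2 : η z * (C₀ * Hf) ≤ M * (C₀ * Hf) := mul_le_mul_of_nonneg_right hηM psv
  have k3 := (abs_le.1 S1).1
  set W := (N:ℝ) * n * M * C₀
  have hW : 0 ≤ W := psv
  have k4 : W * (θ * X) ≤ W * 2 ^ q * θ * Hv + W * 2 ^ q * t * Hf := by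
    have h1 := mul_le_mul_of_nonneg_left hX (mul_nonneg hW hθ.le)
    have h2 : W * 2 ^ q * θ * Hf ≤ W * 2 ^ q * t * Hf := by gcongr; exact hθ1.trans ht1
    linarith [show W * θ * (2 ^ q * (Hv + Hf)) = W * 2 ^ q * θ * Hv + W * 2 ^ q * θ * Hf by ring]
  have k5 : M * (C₀ * Hf) ≤ t * (M * C₀ * Hf) := by
    rw [← mul_assoc]; exact le_mul_of_one_le_left psv ht1
  have k6 : M * y ^ R2 ≤ t * (M * y ^ R2) := le_mul_of_one_le_left psv ht1
  have r1 : 0 ≤ (M * C₀ + W * nA + M + 1) * (θ * Hv) := psv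
  have r2 : 0 ≤ t * ((W * nA + M + 1) * Hf) := psv
  have r3 : 0 ≤ t * ((W * 2 ^ q + M * C₀ + W * nA + 1) * y ^ R2) := psv
  have r4 : 0 ≤ t * ((W * 2 ^ q + M * C₀ + M + 1) * (y ^ p + y ^ q)) := psv
  have hR : RU p q (DU n N q A₀ C₀ M) θ a v f u z = (W * 2 ^ q + M * C₀ + W * nA + M + 1) * θ * Hv + (W * 2 ^ q + M * C₀ + W * nA + M + 1) * t * (Hf + (y ^ R2 + y ^ p + y ^ q)) := rfl
  rw [eN, hR]
  rw [mul_add] at k1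
  rw [mul_add W] at k3
  linarith only [k1, k2, k3, k4, k5, k6, r1, r2, r3, r4, S2]
end Unit

section Unit2
variable {n N : ℕ} {p q α A₀ A₁ c₀ C₀ s : ℝ} {a v f : Pn} {u : Fin N → Pn} {V B : Fin N → Fin n → Pn}
def bM (s : ℝ) (G : Pn) (z : Pt n) : ℝ≥0∞ := MS lC z ^ s⁻¹
lemma bM_lt (hs : 0 < s) {L : ℝ} (hL : 0 < L) (G : Pn) (z : Pt n) : ofReal L < bM s G z ↔ ofReal rA < MS lC z := by
  rw [bM, ENNReal.lt_rpow_inv_iff hs, ofReal_rpow_of_pos hL]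
lemma bM_meas (s : ℝ) (G : Pn) : Measurable (bM s G) := (MS_meas _).pow_const _
lemma bM_ge (hs : 0 < s) {G : Pn} (hG : Measurable G) (G0 : ∀ z, 0 ≤ G z) (hfi : ∫⁻ y, Gh s G y ≠ ∞) : ∀ᵐ z, z ∈ ball (0:Pt n) f32 → ofReal (G z) ≤ bM s G z := by
  filter_upwards [MS_ae _ (Gh_meas hG) hfi] with z h hz
  rw [bM, ENNReal.le_rpow_inv_iff hs, ofReal_rpow_of_nonneg (G0 z) hs.le]
  rwa [Gh, indicator_of_mem hz] at h
lemma GG_meas (hd : UD p q α A₀ A₁ c₀ C₀ a v f u V B) : Measurable dB := by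
  have h1 := hd.vm.add hd.fm
  exact ((h1.pow_const p).add (hd.cf.m.mul (h1.pow_const q))).add ((Yu_meas hd.um).pow_const q)
lemma UD.pd (hd : UD p q α A₀ A₁ c₀ C₀ a v f u V B) (i : Fin N) : PD p q C₀ a (fun z => v z + f z) dB gD (V i) (B i) where
  Gm := GG_meas hd
  um := hd.um i
  Vm := hd.Vm i
  Bm := hd.Bm i
  g0 z := add_nonneg (hd.v0 z) (hd.f0 z)
  C0 := hd.C0
  hG z := le_add_of_nonneg_right (rpow_nonneg (Yu0 u z) q)
  hu z := by
    have h1 := hd.cf.nn z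
    have h2 := hd.v0 z
    have h3 := hd.f0 z
    exact (rpow_le_rpow jA (le_Yu u i z) (by linarith only [hd.cf.hp, hd.cf.hpq])).trans (le_add_of_nonneg_left psv)
  hV z j := (hd.hV i j z).trans (le_add_of_nonneg_right (hd.f0 z))
  hB := by
    filter_upwards [hd.hB] with z h hz j
    exact h (ball_subset_ball nnm hz) i j
lemma le_of_rpow {x e L : ℝ} (hx : 0 ≤ x) (he : 1 ≤ e) (hL : 1 ≤ L) (h : x ^ e ≤ L) : x ≤ L := by
  rcases le_total x 1 with h1 | h1
  · exact h1.trans hL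
  · exact (Real.self_le_rpow_of_one_le h1 he).trans h
lemma levU (hE : Ex n p q s) (hp : 2 < p) (hpq : p < q) (hA0 : 0 ≤ A₀) (hC0 : 0 ≤ C₀) (N : ℕ) {η : Pn} {K : Set bA} {M : ℝ} (hη : CO η K M) (η0 : ∀ z, 0 ≤ η z) (hK : K ⊆ ball 0 jD) :
    ∃ C > 0, ∀ (α A₁ c₀ : ℝ) (a v f : Pn) (u : Fin N → Pn) (V B : Fin N → Fin n → Pn) (L θ : ℝ), UD p q α A₀ A₁ c₀ C₀ a v f u V B →
      1 ≤ L → 0 < θ → θ ≤ 1 → ∫⁻ y, Gh s dB y ≠ ∞ →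
      (∀ w ∈ {z | ofReal rA < MS (Gh s dB) z} ∩ ball 0 f54, ∀ R, 0 < R → R ≤ 1 →
        Qrs w R (R ^ 2 * be p q L a w) ⊆ {z | ofReal rA < MS (Gh s dB) z} ∩ ball 0 f54 →
        R ≤ 1/32 ∧ A₁ * (8 * R) ^ α * el p q L (a w) ^ q ≤ L / 4) →
      ∫⁻ z in {z | bM s dB z < ofReal L}, ofReal (c₀ * nB) ≤
        ofReal (C * L) * volume ({z | ofReal L < bM s dB z} ∩ ball 0 f54) +
        ∫⁻ z in {z | bM s dB z ≤ ofReal L}, K.indicator (fun z => ofReal (RU p q (DU n N q A₀ C₀ M) θ a v f u z)) z := by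
  obtain ⟨C, hC, HC⟩ := lev hE hp hpq hA0 hC0 hη hK
  refine ⟨(N + 1) * C, by positivity, ?_⟩
  intro α A₁ c₀ a v f u V B L θ hd hL hθ hθ1 hfi hsm
  have hM := (abs_nonneg _).trans (hη.b 0)
  have hL0 : 0 < L := by linarith
  set G := GG p q a v f u with hG
  have eO : {z | ofReal L < bM s G z} = dL := by
    ext z; exact bM_lt hE.s0 hL0 G z
  rw [eO]
  set O := dL ∩ bO f54 with hO
  have hOo : IsOpen O := (MS_open _ _).inter isOpen_ball
  have hOm := hOo.measurableSet
  have hI : ∀ i, |∫ z in Oᶜ, N0 gD (V i) (B i) η z| ≤ C * L * (volume O).toReal := fun i =>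
    lim_lev hE hd.cf (hd.pd i) (hd.ws i) hη hK hL (HC A₁ α a _ G gD (V i) (B i) L hd.cf (hd.pd i) (hd.ws i) hL hsm)
  have hG0 := fun z => (show 0 ≤ G z from by
    have h1 := hd.cf.nn z
    have h2 := hd.v0 z
    have h3 := hd.f0 z
    have h4 := Yu0 u z
    rw [hG, GG]; positivity)
  set D := DU n N q A₀ C₀ M with hD
  have hD0 : 0 ≤ D := by rw [hD, DU]; positivity
  have mη := hη.d.continuous.measurable
  have mdη : ∀ w, Measurable fun z => fderiv ℝ η z w := fun w => measurable_fderiv_apply_const ℝ η w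
  have mN : ∀ i, Measurable (N0 gD (V i) (B i) η) := fun i => by
    unfold N0 dxj
    refine (measurable_sum _ fun j _ => (hd.Bm i j).mul (((hd.Vm i j).mul mη).add ((hd.um i).mul (mdη _)))).sub ((((hd.um i).pow_const 2).mul (mdη _)).div_const 2)
  have mv := (hd.vm.pow_const p).add (hd.cf.m.mul (hd.vm.pow_const q))
  have mf := (hd.fm.pow_const p).add (hd.cf.m.mul (hd.fm.pow_const q))
  have mY := Yu_meas hd.um
  have mR : Measurable oB := by
    unfold RU
    exact (mv.const_mul _).add ((mf.add (((mY.pow_const _).add (mY.pow_const _)).add (mY.pow_const _))).const_mul _)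
  have mF : Measurable fun z => c₀ * nB := (mη.mul mv).const_mul _
  have hKm := hη.cK.measurableSet
  have R0 : ∀ z, 0 ≤ RU p q D θ a v f u z := fun z => by
    have h1 := hd.cf.nn z
    have h2 := hd.v0 z
    have h3 := hd.f0 z
    have h4 := Yu0 u z
    unfold RU; positivity
  have F0 : ∀ z, 0 ≤ c₀ * nB := fun z => by
    have h1 := hd.cf.nn z
    have h2 := hd.v0 z
    have h3 := hd.c0
    have h4 := η0 z
    positivity
  have hbd : ∀ᵐ z, z ∈ Oᶜ → z ∈ K → v z ≤ L ∧ f z ≤ L ∧ v z + f z ≤ L ∧ Yu u z ≤ L := by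
    filter_upwards [MS_ae _ (Gh_meas (GG_meas hd)) hfi] with z h hz hzK
    have hz2 := ball_subset_ball (by norm_num : (9/8:ℝ) ≤ 3/2) (hK hzK)
    rw [Gh, indicator_of_mem hz2] at h
    have h1 : MS lC z ≤ ofReal rA := by
      by_contra h'
      exact hz ⟨not_le.1 h', ball_subset_ball nnm (hK hzK)⟩
    have h2 : G z ≤ L := by
      have := (ofReal_le_ofReal_iff psv).1 (h.trans h1)
      exact (Real.rpow_le_rpow_iff (hG0 z) hL0.le hE.s0).1 this
    have v0 := hd.v0 z
    have f0 := hd.f0 z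
    have a0 := hd.cf.nn z
    have Y0 := Yu0 u z
    have e1 : 0 ≤ pA ^ p := psv
    have e2 : 0 ≤ a z * pA ^ q := psv
    have e3 : 0 ≤ Yu u z ^ q := psv
    simp only [hG, GG] at h2
    have h3 : v z + f z ≤ L := le_of_rpow (e := p) psv (by linarith only [hp]) hL (by linarith only [h2, e1, e2, e3])
    have h4 : Yu u z ≤ L := le_of_rpow (e := q) Y0 (by linarith only [hp, hpq]) hL (by linarith only [h2, e1, e2, e3])
    exact ⟨by linarith only [h3, f0], by linarith only [h3, v0], h3, h4⟩
  have ib : ∀ (F : Pn) (b : ℝ), Measurable F → (∀ z ∉ K, F z = 0) → (∀ᵐ z, z ∈ Oᶜ → z ∈ K → |F z| ≤ b) → IntegrableOn F Oᶜ := by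
    intro F b hF hF0 hFb
    have : IntegrableOn F (Oᶜ ∩ K) := by
      refine integrableOn_of_bounded (M := b) ((measure_mono inter_subset_right).trans_lt hη.cK.measure_lt_top).ne hF.aestronglyMeasurable ?_
      rw [ae_restrict_iff' (hOm.compl.inter hKm)]
      filter_upwards [hFb] with z h hz using h hz.1 hz.2
    refine this.of_forall_sdiff_eq_zero hOm.compl fun z hz => hF0 z fun h' => hz.2 ⟨hz.1, h'⟩
  have iN : ∀ i, IntegrableOn (N0 gD (V i) (B i) η) Oᶜ := fun i => by
    refine ib _ (n * (C₀ * (L ^ pm + A₀ * L ^ qm) * (L * M + L * M)) + L ^ 2 * M) (mN i) (fun z hz => ?_) ?_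
    · simp [N0, dxj, hη.z0 hz, hη.dz0 hz]
    · filter_upwards [hbd, hd.hB] with z h hB hz hzK
      obtain ⟨h1, h2, h3, h4⟩ := h hz hzK
      have hz2 := ball_subset_ball (by norm_num : (9/8:ℝ) ≤ 2) (hK hzK)
      have v0 := hd.v0 z
      have f0 := hd.f0 z
      have a0 := hd.cf.nn z
      have aA := hd.cf.le z hz2
      have hu := (le_Yu u i z).trans h4
      have hB' : ∀ j, |B i j z| ≤ C₀ * (L ^ pm + A₀ * L ^ qm) := fun j => by
        refine (hB hz2 i j).trans (mul_le_mul_of_nonneg_left (add_le_add (rpow_le_rpow psv h3 (by linarith only [hp])) (mul_le_mul aA (rpow_le_rpow psv h3 (by linarith only [hp, hpq])) psv hA0)) hC0)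
      have hdx : ∀ j, |dxj η j z| ≤ M := fun j => (hη.bd z _).trans (mul_le_of_le_one_right hM (norm_ej j).le)
      have hdt : |fderiv ℝ η z (0, 1)| ≤ M := (hη.bd z _).trans (mul_le_of_le_one_right hM (by simp [Prod.norm_def]))
      unfold N0
      refine (abs_sub _ _).trans (add_le_add ?_ ?_)
      · refine (abs_sum_le_sum_abs _ _).trans ((Finset.sum_le_card_nsmul _ _ _ fun j _ => ?_).trans (by rw [card_univ, card_fin, nsmul_eq_mul]))
        rw [abs_mul]
        refine mul_le_mul (hB' j) ((abs_add_le _ _).trans (add_le_add ?_ ?_)) jA psv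
        · rw [abs_mul]; exact mul_le_mul ((hd.hV i j z).trans h1) (hη.b z) jA hL0.le
        · rw [abs_mul]; exact mul_le_mul hu (hdx j) jA hL0.le
      · rw [abs_div, abs_mul, abs_pow, abs_two]
        have := mul_le_mul (pow_le_pow_left₀ jA hu 2) hdt jA psv
        have h0 : 0 ≤ L ^ 2 * M := psv
        linarith only [this, h0]
  have Hle : ∀ {x c : ℝ}, 0 ≤ x → x ≤ L → 0 ≤ c → c ≤ A₀ → x ^ p + c * x ^ q ≤ L ^ p + A₀ * L ^ q := fun h0 h1 h2 h3 =>
    add_le_add (rpow_le_rpow h0 h1 (by linarith only [hp])) (mul_le_mul h3 (rpow_le_rpow h0 h1 (by linarith only [hp, hpq])) psv hA0)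
  have iF : IntegrableOn (fun z => c₀ * nB) Oᶜ := by
    refine ib _ (c₀ * (M * (L ^ p + A₀ * L ^ q))) mF (fun z hz => by simp [hη.z0 hz]) ?_
    filter_upwards [hbd] with z h hz hzK
    obtain ⟨h1, h2, h3, h4⟩ := h hz hzK
    rw [abs_of_nonneg (F0 z)]
    have hz2 := ball_subset_ball (by norm_num : (9/8:ℝ) ≤ 2) (hK hzK)
    have v0 := hd.v0 z
    have a0 := hd.cf.nn z
    exact mul_le_mul_of_nonneg_left (mul_le_mul ((le_abs_self _).trans (hη.b z)) (Hle v0 h1 a0 (hd.cf.le z hz2)) psv hM) hd.c0.le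
  have iR : IntegrableOn (K.indicator oB) Oᶜ := by
    refine ib _ (D * θ * (L ^ p + A₀ * L ^ q) + D * θ ^ aB * ((L ^ p + A₀ * L ^ q) + (L ^ R2 + L ^ p + L ^ q))) (mR.indicator hKm) (fun z hz => indicator_of_notMem hz _) ?_
    filter_upwards [hbd] with z h hz hzK
    obtain ⟨h1, h2, h3, h4⟩ := h hz hzK
    rw [indicator_of_mem hzK, abs_of_nonneg (R0 z)]
    have hz2 := ball_subset_ball (by norm_num : (9/8:ℝ) ≤ 2) (hK hzK)
    have k1 := Hle (hd.v0 z) h1 (hd.cf.nn z) (hd.cf.le z hz2)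
    have k2 := Hle (hd.f0 z) h2 (hd.cf.nn z) (hd.cf.le z hz2)
    have k3 : ∀ e : ℝ, 0 ≤ e → Yu u z ^ e ≤ L ^ e := fun e he => rpow_le_rpow (Yu0 u z) h4 he
    unfold RU
    exact add_le_add (mul_le_mul_of_nonneg_left k1 psv) (mul_le_mul_of_nonneg_left (add_le_add k2 (add_le_add (add_le_add (k3 2 nnm) (k3 p (by linarith only [hp]))) (k3 q (by linarith only [hp, hpq])))) psv)
  have key : ∫ z in Oᶜ, c₀ * nB ≤ N * (C * L * (volume O).toReal) + ∫ z in Oᶜ, K.indicator oB z := by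
    have h1 : ∫ z in Oᶜ, c₀ * nB ≤ ∫ z in Oᶜ, (∑ i, N0 gD (V i) (B i) η z + K.indicator oB z) := by
      refine integral_mono_ae iF ((integrable_finsetSum _ fun i _ => iN i).add iR) ?_
      filter_upwards [ae_restrict_of_ae hd.hB, ae_restrict_of_ae hd.hc] with z hB hc
      by_cases hz : z ∈ K
      · have hz2 := ball_subset_ball (by norm_num : (9/8:ℝ) ≤ 2) (hK hz)
        simp only [indicator_of_mem hz]
        exact pwU hd hη η0 hθ hθ1 hz2 (hB hz2) (hc hz2)
      · simp [N0, dxj, hη.z0 hz, hη.dz0 hz, indicator_of_notMem hz]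
    rw [integral_add (integrable_finsetSum _ fun i _ => iN i) iR, integral_finsetSum _ fun i _ => iN i] at h1
    refine h1.trans (add_le_add ((Finset.sum_le_card_nsmul _ _ _ fun i _ => (le_abs_self _).trans (hI i)).trans ?_) le_rfl)
    rw [card_univ, card_fin, nsmul_eq_mul]
  have hvO : volume O ≠ ∞ := ((measure_mono inter_subset_right).trans_lt measure_ball_lt_top).ne
  calc ∫⁻ z in {z | bM s G z < ofReal L}, ofReal (c₀ * nB)
      ≤ ∫⁻ z in Oᶜ, ofReal (c₀ * nB) := by
        refine lintegral_mono_set fun z hz hz' => ?_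
        exact (not_lt.2 (le_of_lt hz)) ((bM_lt hE.s0 hL0 G z).2 hz'.1)
    _ = ofReal (∫ z in Oᶜ, c₀ * nB) := (ofReal_integral_eq_lintegral_ofReal iF (of_forall F0)).symm
    _ ≤ ofReal ((N + 1) * C * L * (volume O).toReal) + ofReal (∫ z in Oᶜ, K.indicator oB z) := by
        refine (ofReal_le_ofReal key).trans (ENNReal.ofReal_add_le.trans (add_le_add (ofReal_le_ofReal ?_) le_rfl))
        have : 0 ≤ C * L * (volume O).toReal := psv
        linarith only [this]
    _ ≤ _ := by
        refine add_le_add leq ?_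
        · rw [ofReal_mul psv, ofReal_toReal hvO]
        · rw [ofReal_integral_eq_lintegral_ofReal iR (of_forall fun z => indicator_nonneg (fun z _ => R0 z) z)]
          have e : ∀ z, ofReal (K.indicator oB z) = K.indicator (fun z => ofReal bC) z := fun z => by
            by_cases hz : z ∈ K <;> simp [hz]
          simp only [e]
          rw [setLIntegral_indicator hKm, setLIntegral_indicator hKm]
          refine lintegral_mono_set fun z hz => ⟨hz.1, ?_⟩
          by_contra h'
          exact hz.2 ⟨(bM_lt hE.s0 hL0 G z).1 (not_le.1 h'), ball_subset_ball nnm (hK hz.1)⟩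
end Unit2

section Unit3
variable {n N : ℕ} {p q α A₀ A₁ c₀ C₀ s : ℝ}
lemma ex_exp (n : ℕ) (hp : 2 < p) (hpq : p < q) (hα : 0 < α) (hα1 : α ≤ 1) (hq : q < p + 2 * α / (nR + 2)) :
    ∃ s d : ℝ, Ex n p q s ∧ s < d ∧ d < 1 ∧ 0 < 2 - q * oA ∧ oA * αn + (q - 2 * αn) / p < 1 ∧ q - 1 ≤ p * d := by
  have hn : Rz < nR + 2 := psv
  have hp0 : 0 < p := by linarith
  have hq1 : 0 < q - 1 := by linarith
  have ha : 2 * α / (nR + 2) ≤ 1 := by rw [div_le_one hn]; have : Rz ≤ n := psv; linarith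
  have cg : ∀ {F : ℝ → ℝ} {x : ℝ}, ContinuousAt F 1 → x < F 1 → ∀ᶠ y in 𝓝[<] Ro, x < F y := fun hF hx => (hF.mono_left nhdsWithin_le_nhds).eventually_const_lt hx
  have l1 : ∀ᶠ y in 𝓝[<] Ro, y < 1 := eventually_mem_nhdsWithin
  have q1 : 1 < q / qm := by rw [lt_div_iff₀ hq1]; linarith
  have e1 := cg continuousAt_id (by show 1 / q < 1; rw [div_lt_one lia0]; linarith)
  have e2 : ∀ᶠ s in 𝓝[<] Ro, 1 < p * s := cg (F := fun s => p * s) fpr lia0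
  have e3 : ∀ᶠ s in 𝓝[<] Ro, 1 < q / qm * s := cg (F := fun s => q / qm * s) fpr lia0
  have q2 : q / qm * 1 / (q / qm * 1 - 1) = q := by
    have := hq1.ne'
    rw [mul_one, show q / qm - 1 = 1 / qm by field_simp; ring]; field_simp
  have e4 : ∀ᶠ s in 𝓝[<] Ro, 0 < p * s * zC - q / qm * s / mC * qA := by
    refine cg ?_ ?_
    · refine ContinuousAt.sub fpr (ContinuousAt.mul (ContinuousAt.div fpr fpr ?_) continuousAt_const)
      rw [mul_one]; linarith
    · simp only [q2]
      have h1 : qp0 * (nR+2) < 2 * α := by rw [← lt_div_iff₀ hn]; linarith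
      nlinarith
  obtain ⟨s, s1, h1, h2, h3, h4⟩ := (l1.and (e1.and (e2.and (e3.and e4)))).exists
  have s0 : 0 < s := lt_trans (by have : 0 < q := by linarith
                                  positivity) h1
  have hσ : q ≤ q / qm * s / mC := by
    rw [le_div_iff₀ lia0]
    have : q / qm * s * qm = q * s := by field_simp
    nlinarith
  have e5 := cg continuousAt_id s1
  have e6 : ∀ᶠ d in 𝓝[<] Ro, 0 < 2 - q * oA := cg (F := fun d => 2 - q * oA) fpr nnm
  have e7 : ∀ᶠ d in 𝓝[<] Ro, 0 < 1 - (oA * αn + (q - 2 * αn) / p) := by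
    refine cg fpr ?_
    have : (q - 2 * αn) / p < 1 := by rw [div_lt_one hp0, ← mul_div_assoc]; linarith
    linarith
  have e8 : ∀ᶠ d in 𝓝[<] Ro, q - 1 < p * d := cg (F := fun d => p * d) fpr lia0
  obtain ⟨d, d1, k1, k2, k3, k4⟩ := (l1.and (e5.and (e6.and (e7.and e8)))).exists
  exact ⟨s, d, ⟨s0, s1.le, h1.le, h2, h3, by linarith, hσ, by linarith⟩, k1, d1, k2, by linarith, k4.le⟩
lemma ex_cut (n : ℕ) : ∃ (η : Pn) (K : Set bA) (M : ℝ), CO η K M ∧ (∀ z, 0 ≤ η z) ∧ (∀ z ∈ bO 1, η z = 1) ∧ K ⊆ ball 0 jD := by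
  let b : ContDiffBump O0 := ⟨1, 17/16, by norm_num, by norm_num⟩
  have hb : ContDiff ℝ (⊤ : ℕ∞) b := b.contDiff
  have hc := b.hasCompactSupport
  obtain ⟨M, hM⟩ := (hb.continuous_fderiv smp).bounded_above_of_compact_support (hc.fderiv (𝕜 := ℝ))
  refine ⟨b, tsupport b, max M 1, ⟨hb.differentiable smp, hc, subset_rfl, fun z => ?_, fun z v => ?_⟩, fun z => b.nonneg, fun z hz => b.one_of_mem_closedBall (ball_subset_closedBall hz), ?_⟩
  · rw [abs_of_nonneg b.nonneg]; exact b.le_one.trans rC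
  · exact ((fderiv ℝ b z).le_opNorm v).trans (mul_le_mul_of_nonneg_right ((hM z).trans yB) vB)
  · rw [b.tsupport_eq]; exact closedBall_subset_ball nnm
lemma globU (hE : Ex n p q s) (hp : 2 < p) (hpq : p < q) (hA0 : 0 ≤ A₀) (hC0 : 0 ≤ C₀) (N : ℕ) {ω : ℝ} (hω : 0 < ω) :
    ∃ ε > 0, ∀ (α A₁ c₀ δ : ℝ) (a v f : Pn) (u : Fin N → Pn) (V B : Fin N → Fin n → Pn), UD p q α A₀ A₁ c₀ C₀ a v f u V B →
      s ≤ δ → δ ≤ 1 → ∫⁻ z in bO 2, ofReal (vz ^ s) ≤ ofReal ε →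
      ∫⁻ z in bO 2, ofReal (fz ^ δ) ≤ ofReal ε →
      ∃ u' : Fin N → Pn, UD p q α A₀ A₁ c₀ C₀ a v f u' V B ∧ ∀ r, 1 ≤ r → r ≤ q/qm*s/oD →
        ∫⁻ z in bO f32, ofReal (Yu u' z ^ r) ≤ ofReal ω := by
  set σ' := q/qm*s/oD with hσ'
  have s0 := hE.s0
  have hσ1 := hE.σ2
  set v3 : ℝ := 2 * vb n * (f32 ^ n * f32) with hv3
  set v2 : ℝ := 2 * vb n * (2 ^ n * 2) with hv2
  have vb0 := vb_pos n
  obtain ⟨l, hl1, hl2, hl⟩ := ((ev_small v3 (half_pos hω)).and ((ev_small 1 one_pos).and self_mem_nhdsWithin)).exists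
  have hl := hl
  obtain ⟨w, hw1, hw⟩ := ((ev_small (l ^ (-σ') * ((N:ℝ) ^ σ' * N)) (half_pos hω)).and self_mem_nhdsWithin).exists
  have hw := hw
  obtain ⟨e, he, He⟩ := glob hE hp hpq hA0 hC0 hw
  obtain ⟨x, hx1, hx2, hx⟩ := ((ev_small (2 ^ q * v2) (half_pos he)).and ((ev_small 1 one_pos).and self_mem_nhdsWithin)).exists
  have hx := hx
  obtain ⟨ε, hε1, hε⟩ := ((ev_small (2 ^ q * (1 + (x ^ s⁻¹)⁻¹)) (half_pos he)).and self_mem_nhdsWithin).exists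
  have hε := hε
  refine ⟨ε, hε, ?_⟩
  intro α A₁ c₀ δ a v f u V B hd hsδ hδ1 h1 h2
  have mv := (hd.vm.pow_const p).add (hd.cf.m.mul (hd.vm.pow_const q))
  have mf := (hd.fm.pow_const p).add (hd.cf.m.mul (hd.fm.pow_const q))
  set y := x ^ s⁻¹
  have hy : 0 < y := psv
  have hy1 : y ≤ 1 := rpow_le_one hx.le lia0 psv
  have hys : y ^ s = x := rpow_inv_rpow hx.le s0.ne'
  have hX : ∫⁻ z in bO 2, ofReal ((pA ^ p + a z * pA ^ q) ^ s) ≤ ofReal e := by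
    have pt : ∀ z, ofReal ((pA ^ p + a z * pA ^ q) ^ s) ≤ ofReal (2 ^ q) * (ofReal (vz ^ s) + (ofReal x + ofReal y⁻¹ * ofReal (fz ^ δ))) := by
      intro z
      have a0 := hd.cf.nn z
      have v0 := hd.v0 z
      have f0 := hd.f0 z
      have H1 : 0 ≤ v z ^ p + a z * v z ^ q := psv
      have H2 : 0 ≤ f z ^ p + a z * f z ^ q := psv
      rw [← ofReal_mul psv, ← ofReal_add hx.le psv, ← ofReal_add psv psv, ← ofReal_mul psv]
      refine ofReal_le_ofReal ?_
      refine (rpow_le_rpow psv (H_add v0 f0 a0 lia0 hpq.le) s0.le).trans ?_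
      rw [mul_rpow psv psv]
      refine mul_le_mul ?_ ((rpow_add_le_add_rpow H1 H2 s0.le hE.s1).trans (add_le_add le_rfl ?_)) psv psv
      · exact (rpow_le_rpow_of_exponent_le (one_le_rpow nnm lia0) hE.s1).trans (rpow_one _).le
      · refine (xab H2 hy hy1 s0.le le_rfl hsδ).trans ?_
        rw [hys]
        refine add_le_add le_rfl (mul_le_mul_of_nonneg_right ?_ psv)
        rw [← rpow_neg_one]
        exact rpow_le_rpow_of_exponent_ge hy hy1 lia0
    refine (lintegral_mono fun z => pt z).trans ?_
    have m1 : Measurable fun z => ofReal (vz ^ s) := (mv.pow_const s).ennreal_ofReal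
    rw [lintegral_const_mul' _ _ ofReal_ne_top, lintegral_add_left m1, lintegral_add_left measurable_const, lintegral_const_mul' _ _ ofReal_ne_top, setLIntegral_const, vol_ball 2 nnm]
    refine (mul_le_mul_right (add_le_add h1 (add_le_add le_rfl (mul_le_mul_right h2 _))) _).trans ?_
    rw [← ofReal_mul hx.le, ← ofReal_mul psv, ← ofReal_add psv psv, ← ofReal_add psv psv, ← ofReal_mul psv]
    refine ofReal_le_ofReal ?_
    linarith only [hx1, hε1]
  have hc : ∀ i, ∃ c, ∫⁻ z in bO f32, ‖u i z - c‖ₑ ^ σ' ≤ ofReal w := fun i =>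
    He a (fun z => v z + f z) gD (V i) (B i) hd.cf.m (hd.vm.add hd.fm) (hd.um i) (hd.Vm i) (hd.Bm i) hd.cf.nn hd.cf.le (fun z => add_nonneg (hd.v0 z) (hd.f0 z))
      (fun z j => (hd.hV i j z).trans (le_add_of_nonneg_right (hd.f0 z))) (by filter_upwards [hd.hB] with z h hz j using h hz i j) (hd.ws i) hX
  choose c hc using hc
  set u' : Fin N → Pn := fun i => (ball 0 2).indicator fun z => u i z - c i
  have um' : ∀ i, Measurable (u' i) := fun i => ((hd.um i).sub_const _).indicator measurableSet_ball
  refine ⟨u', { hd with um := um', ws := fun i => (hd.ws i).shift (c i) }, ?_⟩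
  intro r hr1 hr2
  have pt : ∀ z ∈ bO f32, ofReal (Yu u' z ^ r) ≤ ofReal l + ofReal (l ^ (-σ') * (N:ℝ) ^ σ') * ∑ i, ‖u i z - c i‖ₑ ^ σ' := by
    intro z hz
    have e1 : ∀ i, |u' i z| = |u i z - c i| := fun i => by
      simp only [u', indicator_of_mem (ball_subset_ball (by norm_num : (3/2:ℝ) ≤ 2) hz)]
    have h3 : Yu u' z ^ σ' ≤ (N:ℝ) ^ σ' * ∑ i, |u i z - c i| ^ σ' := by
      rcases N.eq_zero_or_pos with rfl | hN
      · simp [Yu, zero_rpow (show σ' ≠ 0 by linarith)]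
      have hh := Real.rpow_sum_le_const_mul_sum_rpow (s := Finset.univ) (fun i => |u' i z|) (show 1 ≤ σ' by linarith)
      simp only [card_univ, card_fin, abs_abs] at hh
      simp only [e1] at hh
      have hY : Yu u' z = ∑ i, |u i z - c i| := by simp only [Yu, e1]
      rw [hY]
      refine hh.trans (mul_le_mul_of_nonneg_right ?_ (sum_nonneg fun i _ => by positivity))
      exact rpow_le_rpow_of_exponent_le (by exact_mod_cast hN) lia0
    have h4 := xab (Yu0 u' z) hl lia0 zero_le_one hr1 hr2
    rw [rpow_one] at h4
    have h5 : ∑ i, ‖u i z - c i‖ₑ ^ σ' = ofReal (∑ i, |u i z - c i| ^ σ') := by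
      rw [ofReal_sum_of_nonneg fun i _ => by positivity]
      refine sum_congr rfl fun i _ => ?_
      rw [← ofReal_rpow_of_nonneg jA lia0, ← norm_eq_abs, ofReal_norm]
    rw [h5, ← ofReal_mul psv, ← ofReal_add hl.le (mul_nonneg psv (sum_nonneg fun i _ => by positivity))]
    refine ofReal_le_ofReal (h4.trans ?_)
    have := mul_le_mul_of_nonneg_left h3 (show 0 ≤ l ^ (-σ') by positivity)
    linarith
  refine (setLIntegral_mono' measurableSet_ball pt).trans ?_
  rw [lintegral_add_left measurable_const, lintegral_const_mul' _ _ ofReal_ne_top, setLIntegral_const, vol_ball f32 nnm]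
  have mi : ∀ i ∈ (Finset.univ : Finset (Fin N)), Measurable fun z => ‖u i z - c i‖ₑ ^ σ' := fun i _ => ((hd.um i).sub_const _).enorm.pow_const _
  rw [lintegral_finsetSum _ mi]
  have h6 : ∑ i, ∫⁻ z in bO f32, ‖u i z - c i‖ₑ ^ σ' ≤ ofReal (N * w) := by
    refine (sum_le_sum fun i _ => hc i).trans ?_
    rw [sum_const, card_univ, card_fin, nsmul_eq_mul, ofReal_mul psv, ofReal_natCast]
  refine (add_le_add le_rfl (mul_le_mul_right h6 _)).trans ?_
  rw [← ofReal_mul hl.le, ← ofReal_mul psv, ← ofReal_add psv psv]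
  refine ofReal_le_ofReal ?_
  rw [hv3] at hl1
  have e9 : l ^ (-σ') * (N:ℝ) ^ σ' * (N * w) = l ^ (-σ') * ((N:ℝ) ^ σ' * N) * w := by ring
  rw [e9]
  linarith only [hl1, hw1]
end Unit3

section Unit4
variable {n N : ℕ} {p q α A₀ A₁ c₀ C₀ s d : ℝ}
lemma hmul {x δ : ℝ} {β : ℝ≥0∞} (hx : 0 ≤ x) (hδ : 0 < δ) (hδ1 : δ ≤ 1) (h : ofReal x ≤ β) :
    ofReal x * (β⁻¹) ^ (1-δ) ≤ ofReal (x ^ δ) := by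
  rcases hx.eq_or_lt with rfl | hx
  · simp
  refine (mul_le_mul_right (ENNReal.rpow_le_rpow (ENNReal.inv_le_inv.2 h) lia0) _).trans leq
  rw [← ofReal_inv_of_pos hx, ofReal_rpow_of_pos psv, ← ofReal_mul hx.le, inv_rpow hx.le, ← rpow_neg hx.le]
  nth_rewrite 1 [← rpow_one x]
  rw [← rpow_add hx]; congr 2; ring
lemma yng {x δ : ℝ} {β : ℝ≥0∞} (hx : 0 ≤ x) (hδ : 0 < δ) (hδ1 : δ < 1) (hβ : β ≠ 0) :
    ofReal (x ^ δ) ≤ ofReal x * (β⁻¹) ^ (1-δ) + ofReal (1-δ) * β ^ δ := by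
  by_cases ht : β = ∞
  · rw [ht, top_rpow_of_pos hδ, mul_top (by simpa using hδ1)]; simp
  have t0 : 0 < β.toReal := toReal_pos hβ ht
  rw [← ofReal_toReal ht]
  set t := β.toReal
  rw [← ofReal_inv_of_pos t0, ofReal_rpow_of_pos psv, ofReal_rpow_of_pos t0, ← ofReal_mul hx, ← ofReal_mul lia0, ← ofReal_add psv (mul_nonneg lia0 psv)]
  refine ofReal_le_ofReal ?_
  have h := Real.geom_mean_le_arith_mean2_weighted hδ.le (show 0 ≤ 1-δ by linarith) (show 0 ≤ x * (t⁻¹) ^ (1-δ) by positivity) (show 0 ≤ t ^ δ by positivity) (by ring)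
  have e : (x * (t⁻¹) ^ (1-δ)) ^ δ * (t ^ δ) ^ (1-δ) = x ^ δ := by
    rw [mul_rpow hx psv, inv_rpow t0.le, ← rpow_neg t0.le, ← rpow_mul t0.le, ← rpow_mul t0.le, mul_assoc, ← rpow_add t0, show -(1-δ)*δ + δ*(1-δ) = 0 by ring, rpow_zero, mul_one]
  rw [e] at h
  refine h.trans (add_le_add (mul_le_of_le_one_left psv hδ1.le) le_rfl)
lemma unitM (hE : Ex n p q s) (hp : 2 < p) (hpq : p < q) (hα : 0 < α) (hα1 : α ≤ 1) (hA0 : 0 ≤ A₀) (hA1 : 0 ≤ A₁) (hc0 : 0 < c₀) (hC0 : 0 ≤ C₀) (hsd : s < d) (hd1 : d < 1)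
    (h2 : 0 < 2 - q * oA) (he : oA * αn + (q - 2 * αn) / p < 1) (N : ℕ) {Kb : ℝ} (hKb : 0 ≤ Kb) :
    ∃ C > 0, ∀ (δ θ ω : ℝ) (a v f : Pn) (u : Fin N → Pn) (V B : Fin N → Fin n → Pn), UD p q α A₀ A₁ c₀ C₀ a v f u V B →
      d ≤ δ → δ < 1 → 0 < θ → θ ≤ 1 → 0 ≤ ω → ω ≤ 1 →
      ∫⁻ z in bO 2, ofReal pC ≤ ofReal Kb →
      ∫⁻ z in bO 2, ofReal (fz ^ δ) ≤ ofReal ω →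
      (∀ r, 1 ≤ r → r ≤ q/qm*s/oD → ∫⁻ z in bO f32, ofReal (Yu u z ^ r) ≤ ofReal ω) →
      ∫⁻ z in bO 1, ofReal (vz ^ δ) ≤ ofReal (C * (yA + θ + θ ^ aB * ω)) := by
  obtain ⟨η, K, M, hη, η0, η1, hK⟩ := ex_cut n
  obtain ⟨C, hC, HC⟩ := levU hE hp hpq hA0 hC0 N hη η0 hK
  have s0 := hE.s0
  have hM : 0 ≤ M := (abs_nonneg _).trans (hη.b 0)
  have vb0 := vb_pos n
  obtain ⟨Cm, hCm, Hm⟩ := ms_strong n (d/s) (1/s) (by rwa [one_lt_div s0]) (by gcongr)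
  set K1 := 2 ^ q * Kb + 1
  set K2 := Cm * K1
  have hK1 : 0 < K1 := psv
  have hK2 : 0 < K2 := psv
  have d0 : 0 < d := s0.trans hsd
  obtain ⟨Λ, hΛ, HΛ⟩ := hsm_lem n (D := K2 / eD) hα hα1 hp hpq hA0 hA1 psv h2 he
  have Λ0 : 0 < Λ := by linarith
  set D := DU n N q A₀ C₀ M with hD
  have hD0 : 0 ≤ D := by rw [hD, DU]; positivity
  set v1 : ℝ := 2 * vb n * (1 ^ n * 1)
  refine ⟨c₀⁻¹ * (C / d * K2 + 2 * D * Kb + 8 * D) + K2 + Λ * v1, by positivity, ?_⟩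
  intro δ θ ω a v f u V B hd hdδ hδ1 hθ hθ1 hω hω1 hKbI hfI hY
  have δ0 : 0 < δ := d0.trans_le hdδ
  set G := GG p q a v f u with hG
  have mG : Measurable G := GG_meas hd
  have mv : Measurable fun z => v z ^ p + a z * v z ^ q := (hd.vm.pow_const p).add (hd.cf.m.mul (hd.vm.pow_const q))
  have mf : Measurable fun z => f z ^ p + a z * f z ^ q := (hd.fm.pow_const p).add (hd.cf.m.mul (hd.fm.pow_const q))
  have mY := Yu_meas hd.um
  have Hv0 : ∀ z, 0 ≤ v z ^ p + a z * v z ^ q := fun z => by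
    have h1 := hd.cf.nn z
    have h2 := hd.v0 z
    positivity
  have Hf0 : ∀ z, 0 ≤ f z ^ p + a z * f z ^ q := fun z => by
    have h1 := hd.cf.nn z
    have h2 := hd.f0 z
    positivity
  have HX : ∀ z, (v z ^ p + a z * v z ^ q ≤ G z) ∧ (f z ^ p + a z * f z ^ q ≤ G z) ∧ 0 ≤ G z := fun z => by
    have h1 := hd.cf.nn z
    have h2 := hd.f0 z
    have h3 := hd.v0 z
    have h4 : 0 ≤ Yu u z ^ q := rpow_nonneg (Yu0 u z) q
    have hh : ∀ x, 0 ≤ x → x ≤ v z + f z → x ^ p + a z * x ^ q ≤ G z := fun x h0 hx => by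
      have k1 := rpow_le_rpow h0 hx (show 0 ≤ p by linarith only [hp])
      have k2 := mul_le_mul_of_nonneg_left (rpow_le_rpow h0 hx (show 0 ≤ q by linarith only [hp, hpq])) h1
      rw [hG, GG]; linarith only [k1, k2, h4]
    have h5 := hh (v z) h3 (by linarith only [h2])
    exact ⟨h5, hh _ h2 (by linarith only [h3]), (Hv0 z).trans h5⟩
  have sub : bO f32 ⊆ ball 0 2 := ball_subset_ball nnm
  have hqδ : 1 ≤ q * δ := by
    have : 1 / q * q ≤ δ * q := mul_le_mul_of_nonneg_right (hE.sq.trans (hsd.le.trans hdδ)) lia0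
    rw [one_div, inv_mul_cancel₀ lia0] at this; linarith
  have hGI : ∫⁻ z in bO f32, ofReal (G z ^ δ) ≤ ofReal K1 := by
    have pt : ∀ z, ofReal (G z ^ δ) ≤ ofReal (2 ^ q) * ofReal pC + ofReal (Yu u z ^ (q * δ)) := by
      intro z
      have a0 := hd.cf.nn z
      have v0 := hd.v0 z
      have f0 := hd.f0 z
      have Y0 := Yu0 u z
      have H1 := Hv0 z
      have H2 := Hf0 z
      rw [← ofReal_mul psv, ← ofReal_add psv psv]
      refine ofReal_le_ofReal ?_
      rw [hG, GG]
      refine (rpow_add_le_add_rpow psv psv δ0.le hδ1.le).trans (add_le_add ?_ (rpow_mul Y0 q δ).ge)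
      refine (rpow_le_rpow psv (H_add v0 f0 a0 lia0 hpq.le) δ0.le).trans ?_
      rw [mul_rpow psv psv]
      refine mul_le_mul_of_nonneg_right ?_ psv
      exact (rpow_le_rpow_of_exponent_le (one_le_rpow nnm lia0) hδ1.le).trans (rpow_one _).le
    refine (lintegral_mono fun z => pt z).trans ?_
    have m1 : Measurable fun z => ofReal (Yu u z ^ (q * δ)) := (mY.pow_const _).ennreal_ofReal
    rw [lintegral_add_right _ m1, lintegral_const_mul' _ _ ofReal_ne_top]
    refine (add_le_add (mul_le_mul_right ((lintegral_mono_set sub).trans hKbI) _) (hY (q * δ) hqδ ?_)).trans ?_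
    · exact (mul_le_of_le_one_right lia0 hδ1.le).trans hE.σq
    rw [← ofReal_mul psv, ← ofReal_add psv hω]
    exact ofReal_le_ofReal lia0
  have ePow : ∀ z, Gh s G z ^ (δ/s) = (bO f32).indicator (fun z => ofReal (G z ^ δ)) z := fun z => by
    by_cases hz : z ∈ bO f32
    · rw [Gh, indicator_of_mem hz, indicator_of_mem hz, ofReal_rpow_of_nonneg (rpow_nonneg (HX z).2.2 _) psv, ← rpow_mul (HX z).2.2, mul_div_cancel₀ _ s0.ne']
    · rw [Gh, indicator_of_notMem hz, indicator_of_notMem hz, zero_rpow_of_pos psv]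
  have hGP : ∫⁻ z, Gh s G z ^ (δ/s) ≤ ofReal K1 := by
    simp only [ePow]; rwa [lintegral_indicator measurableSet_ball]
  have hfi : ∫⁻ y, Gh s G y ≠ ∞ := by
    have h1 : ∫⁻ y, Gh s G y ≤ ∫⁻ y in bO f32, (1 + Gh s G y ^ (δ/s)) := by
      rw [← lintegral_indicator measurableSet_ball]
      refine lintegral_mono fun z => ?_
      by_cases hz : z ∈ bO f32
      · rw [indicator_of_mem hz]; exact enn_le_one_add _ (by rw [one_le_div s0]; linarith)
      · rw [Gh, indicator_of_notMem hz]; exact zero_le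
    rw [lintegral_add_left measurable_const, setLIntegral_one] at h1
    refine ne_top_of_le_ne_top (add_ne_top.2 ⟨vol_ball_lt _, ?_⟩) h1
    exact ne_top_of_le_ne_top ofReal_ne_top ((setLIntegral_le_lintegral _ _).trans hGP)
  set b := bM s G with hb
  have mb : Measurable b := bM_meas s G
  have hbI : ∫⁻ z, b z ^ δ ≤ ofReal K2 := by
    have e : ∀ z, b z ^ δ = MS lC z ^ (δ/s) := fun z => by rw [hb, bM, ← ENNReal.rpow_mul, inv_mul_eq_div]
    simp only [e]
    refine (Hm _ (Gh_meas mG) (δ/s) (by gcongr) (by gcongr)).trans ((mul_le_mul_right hGP _).trans leq)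
    rw [← ofReal_mul hCm.le]
  have hbge := bM_ge s0 mG (fun z => (HX z).2.2) hfi
  have hcheb : ∀ L, 0 < L → volume {z | ofReal L < b z} ≤ ofReal (K2 * L ^ (-δ)) := fun L hL => by
    have h1 : ofReal (L ^ δ) * volume {z | ofReal L < b z} ≤ ofReal K2 := by
      refine le_trans ?_ ((mul_meas_ge_le_lintegral (mb.pow_const δ) (ofReal (L ^ δ))).trans hbI)
      refine mul_le_mul_right (measure_mono fun z hz => ?_) _
      show ofReal (L ^ δ) ≤ b z ^ δ
      rw [← ofReal_rpow_of_pos hL]; exact ENNReal.rpow_le_rpow (le_of_lt hz) δ0.le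
    have h3 := mul_le_mul_right h1 (ofReal (L ^ (-δ)))
    rw [← mul_assoc, ← ofReal_mul psv, ← rpow_add hL, neg_add_cancel, rpow_zero, ofReal_one, one_mul, ← ofReal_mul psv] at h3
    rwa [mul_comm K2]
  set k₁ : Pe := fun z => ofReal (c₀ * nB) with hk₁
  set k₂ : Pe := K.indicator (fun z => ofReal bC) with hk₂
  have mk1 : Measurable k₁ := ((hη.d.continuous.measurable.mul mv).const_mul _).ennreal_ofReal
  have mRU : Measurable fun z => ofReal bC := by
    unfold RU
    exact ((mv.const_mul _).add ((mf.add (((mY.pow_const _).add (mY.pow_const _)).add (mY.pow_const _))).const_mul _)).ennreal_ofReal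
  have mk2 : Measurable k₂ := mRU.indicator hη.cK.measurableSet
  have hI := intg volume mb mk1 mk2 (U := ball 0 f54) measurableSet_ball Λ0 (show 0 < 1 - δ by linarith) (show 1 - δ < 1 by linarith) hC.le (fun L hL => by
    have hL1 : 1 ≤ L := hΛ.trans hL
    have hL0 : 0 < L := by linarith
    refine HC α A₁ c₀ a v f u V B L θ hd hL1 hθ hθ1 hfi ?_
    intro w hw R hR _ hsub
    refine HΛ (a w) δ L R (hd.cf.nn w) (hd.cf.le w (ball_subset_ball nnm hw.2)) hdδ hL hR ?_
    have h1 : volume (Qrs w R (R ^ 2 * be p q L a w)) ≤ ofReal (K2 * L ^ (-δ)) :=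
      (measure_mono fun z hz => (bM_lt s0 hL0 G z).2 (hsub hz).1).trans (hcheb L hL0)
    rw [Qrs_vol' w hR, ofReal_le_ofReal_iff psv] at h1
    rw [div_mul_eq_mul_div, le_div_iff₀ psv]
    unfold be at h1
    linarith only [h1])
  rw [show 1 - yA = δ by ring] at hI
  set h : Pe := fun z => ((max (b z) (ofReal Λ))⁻¹) ^ yA with hh
  have mh : Measurable h := ((mb.max measurable_const).inv).pow_const _
  have h1 : ∀ z, h z ≤ 1 := fun z => ENNReal.rpow_le_one (ENNReal.inv_le_one.2 (le_max_of_le_right (ENNReal.one_le_ofReal.2 hΛ))) lia0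
  have hD2 : ∫⁻ z, k₂ z * h z ≤ ofReal (D * θ * Kb + D * θ ^ aB * (4 * ω)) := by
    have e : ∀ z, k₂ z * h z = K.indicator (fun z => ofReal bC * h z) z := fun z => by
      by_cases hz : z ∈ K <;> simp [hk₂, hz]
    simp only [e]
    rw [lintegral_indicator hη.cK.measurableSet]
    have t0 : 0 ≤ θ ^ aB := psv
    have hK3 : K ⊆ ball 0 f32 := hK.trans (ball_subset_ball nnm)
    have pt : ∀ᵐ z ∂(volume.restrict K), ofReal bC * h z ≤ ofReal (D * θ) * ofReal pC +
        ofReal (D * θ ^ aB) * (ofReal (fz ^ δ) + (ofReal (Yu u z ^ R2) + ofReal (Yu u z ^ p) + ofReal (Yu u z ^ q))) := by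
      rw [ae_restrict_iff' hη.cK.measurableSet]
      filter_upwards [hbge] with z hz hzK
      have hz := hz (hK3 hzK)
      have H1 := Hv0 z
      have H2 := Hf0 z
      have Y0 := Yu0 u z
      have k1 := hmul (β := max (b z) (ofReal Λ)) H1 δ0 hδ1.le ((ofReal_le_ofReal (HX z).1).trans (hz.trans yB))
      have k2 := hmul (β := max (b z) (ofReal Λ)) H2 δ0 hδ1.le ((ofReal_le_ofReal (HX z).2.1).trans (hz.trans yB))
      have k3 : ofReal (Yu u z ^ R2 + Yu u z ^ p + Yu u z ^ q) * h z ≤ ofReal (Yu u z ^ R2) + ofReal (Yu u z ^ p) + ofReal (Yu u z ^ q) := by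
        refine (mul_le_of_le_one_right' (h1 z)).trans ?_
        rw [ofReal_add psv psv, ofReal_add psv psv]
      unfold RU
      rw [ofReal_add psv psv, ofReal_mul (p := D * θ) psv, ofReal_mul (p := D * θ ^ aB) psv,
        ofReal_add H2 psv, add_mul, mul_assoc, mul_assoc, add_mul]
      refine add_le_add (mul_le_mul_right (k1.trans (ofReal_le_ofReal (rpow_le_rpow H1 lia0 δ0.le))) _) (mul_le_mul_right (add_le_add k2 k3) _)
    refine (lintegral_mono_ae pt).trans ?_
    have mYr : ∀ r : ℝ, Measurable fun z => ofReal (Yu u z ^ r) := fun r => (mY.pow_const r).ennreal_ofReal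
    have mfd : Measurable fun z => ofReal (fz ^ δ) := (mf.pow_const δ).ennreal_ofReal
    have mvd : Measurable fun z => ofReal (D * θ) * ofReal pC := (((mv.add mf).pow_const δ).ennreal_ofReal).const_mul _
    have m2p : Measurable fun z => ofReal (Yu u z ^ R2) + ofReal (Yu u z ^ p) := (mYr 2).add (mYr p)
    rw [lintegral_add_left mvd, lintegral_const_mul' _ _ ofReal_ne_top, lintegral_const_mul' _ _ ofReal_ne_top, lintegral_add_left mfd, lintegral_add_left m2p, lintegral_add_left (mYr 2)]
    have hYK : ∀ r, 1 ≤ r → r ≤ q → ∫⁻ z in K, ofReal (Yu u z ^ r) ≤ ofReal ω := fun r hr hr' => (lintegral_mono_set hK3).trans (hY r hr (hr'.trans hE.σq))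
    refine (add_le_add (mul_le_mul_right ((lintegral_mono_set (hK3.trans sub)).trans hKbI) _) (mul_le_mul_right (add_le_add ((lintegral_mono_set (hK3.trans sub)).trans hfI)
      (add_le_add (add_le_add (hYK 2 nnm lia0) (hYK p lia0 hpq.le)) (hYK q lia0 le_rfl))) _)).trans leq
    rw [← ofReal_add hω hω, ← ofReal_add psv hω, ← ofReal_add hω psv, ← ofReal_mul psv, ← ofReal_mul psv, ← ofReal_add psv psv]
    congr 1; ring
  have hK1h : ∫⁻ z, k₁ z * h z ≤ ofReal (yA * C / δ * K2 + 2 * (D * θ * Kb + D * θ ^ aB * (4 * ω))) := by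
    have p1 : 0 ≤ yA * C / δ := div_nonneg (mul_nonneg lia0 hC.le) δ0.le
    have p2 : 0 ≤ D * θ * Kb + D * θ ^ aB * (4 * ω) := psv
    refine (hI.trans (add_le_add (mul_le_mul_right ((setLIntegral_le_lintegral _ _).trans hbI) _) (mul_le_mul_right hD2 _))).trans leq
    rw [← ofReal_mul p1, ← ENNReal.ofReal_ofNat 2, ← ofReal_mul nnm, ← ofReal_add (mul_nonneg p1 hK2.le) psv]
  have pt : ∀ z ∈ bO 1, ofReal (vz ^ δ) ≤ ofReal c₀⁻¹ * (k₁ z * h z) + ofReal yA * (b z ^ δ + ofReal Λ) := by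
    intro z hz
    refine (yng (β := max (b z) (ofReal Λ)) (Hv0 z) δ0 hδ1 ?_).trans (add_le_add leq (mul_le_mul_right ?_ _))
    · exact (lt_of_lt_of_le (ofReal_pos.2 Λ0) rC).ne'
    · simp only [hk₁, η1 z hz, one_mul]
      rw [← mul_assoc, ← ofReal_mul psv, inv_mul_cancel_left₀ hc0.ne']
    · rcases max_choice (b z) (ofReal Λ) with h' | h' <;> rw [h']
      · exact le_self_add
      · refine le_add_left ?_
        rw [ofReal_rpow_of_pos Λ0]
        exact ofReal_le_ofReal ((rpow_le_rpow_of_exponent_le hΛ hδ1.le).trans (rpow_one _).le)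
  refine (setLIntegral_mono' measurableSet_ball pt).trans ?_
  have m5 : Measurable fun z => ofReal c₀⁻¹ * (k₁ z * h z) := (mk1.mul mh).const_mul _
  rw [lintegral_add_left m5, lintegral_const_mul' _ _ ofReal_ne_top, lintegral_const_mul' _ _ ofReal_ne_top, lintegral_add_right _ measurable_const, setLIntegral_const, vol_ball 1 one_pos]
  refine (add_le_add (mul_le_mul_right ((setLIntegral_le_lintegral _ _).trans hK1h) _) (mul_le_mul_right (add_le_add ((setLIntegral_le_lintegral _ _).trans hbI) le_rfl) _)).trans ?_
  have p0 : 0 ≤ 1 - δ := by linarith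
  have p1 : 0 ≤ yA * C / δ * K2 := psv
  have p2 : 0 ≤ D * θ * Kb + D * θ ^ aB * (4 * ω) := psv
  rw [← ofReal_mul Λ0.le, ← ofReal_add hK2.le psv, ← ofReal_mul p0, ← ofReal_mul psv, ← ofReal_add psv (mul_nonneg p0 psv)]
  refine ofReal_le_ofReal ?_
  have q1 : yA * C / δ * K2 ≤ C / d * K2 * yA := by
    have : C / δ ≤ C / d := by gcongr
    calc yA * C / δ * K2 = C / δ * K2 * yA := by ring
      _ ≤ _ := by gcongr
  set t := θ ^ aB * ω
  have ht : 0 ≤ t := psv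
  have ci : 0 < c₀⁻¹ := psv
  set U := C / d * K2
  have hU : 0 ≤ U := psv
  have q2 : c₀⁻¹ * (yA * C / δ * K2 + 2 * (D * θ * Kb + D * θ ^ aB * (4 * ω))) ≤ c₀⁻¹ * (U * yA + 2 * D * Kb * θ + 8 * D * t) := by
    refine mul_le_mul_of_nonneg_left ?_ ci.le
    have : D * θ ^ aB * (4 * ω) = 4 * D * t := by simp only [t]; ring
    rw [this]; linarith only [q1]
  refine (add_le_add q2 le_rfl).trans ?_
  set W := Λ * (2 * vb n * (1 ^ n * 1)) with hW
  have hW0 : 0 ≤ W := psv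
  have r1 : 0 ≤ c₀⁻¹ * U * (θ + t) := psv
  have r2 : 0 ≤ c₀⁻¹ * (2 * D * Kb) * (yA + t) := psv
  have r3 : 0 ≤ c₀⁻¹ * (8 * D) * (yA + θ) := psv
  have r4 : 0 ≤ (K2 + W) * (θ + t) := psv
  linarith only [r1, r2, r3, r4]
end Unit4

lemma unitT (n N : ℕ) {p q α A₀ A₁ c₀ C₀ Kb ω : ℝ} (hp : 2 < p) (hpq : p < q) (hα : 0 < α) (hα1 : α ≤ 1) (hq : q < p + 2 * α / (nR + 2))
    (hA0 : 0 ≤ A₀) (hA1 : 0 ≤ A₁) (hc0 : 0 < c₀) (hC0 : 0 ≤ C₀) (hKb : 0 ≤ Kb) (hω : 0 < ω) :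
    ∃ s δ₂ ε : ℝ, 0 < s ∧ s < δ₂ ∧ δ₂ < 1 ∧ 0 < 2 - q * (1 - δ₂) ∧ q - 1 ≤ p * δ₂ ∧ 0 < ε ∧
      ∀ (δ : ℝ) (a v f : Pn) (u : Fin N → Pn) (V B : Fin N → Fin n → Pn), UD p q α A₀ A₁ c₀ C₀ a v f u V B → δ₂ < δ → δ < 1 →
      ∫⁻ z in bO 2, ofReal pC ≤ ofReal Kb →
      ∫⁻ z in bO 2, ofReal (vz ^ s) ≤ ofReal ε →
      ∫⁻ z in bO 2, ofReal (fz ^ δ) ≤ ofReal ε →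
      ∫⁻ z in bO 1, ofReal (vz ^ δ) ≤ ofReal ω := by
  obtain ⟨s, d, hE, hsd, hd1, h2, he, hqd⟩ := ex_exp n hp hpq hα hα1 hq
  obtain ⟨C, hC, HC⟩ := unitM hE hp hpq hα hα1 hA0 hA1 hc0 hC0 hsd hd1 h2 he N hKb
  have hω3 : 0 < ω / 3 := psv
  obtain ⟨θ, hθ1, hθ2, hθ⟩ := ((ev_small C hω3).and ((ev_small 1 one_pos).and self_mem_nhdsWithin)).exists
  have hθ := hθ
  obtain ⟨w, hw1, hw2, hw⟩ := ((ev_small (C * θ ^ aB) hω3).and ((ev_small 1 one_pos).and self_mem_nhdsWithin)).exists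
  have hw := hw
  obtain ⟨x, hx1, hx2, hx⟩ := ((ev_small C hω3).and ((ev_small 1 (show 0 < 1 - d by linarith)).and self_mem_nhdsWithin)).exists
  have hx : 0 < x := hx
  obtain ⟨e, he0, He⟩ := globU hE hp hpq hA0 hC0 N hw
  have hdx : d < 1 - x := by linarith
  refine ⟨s, 1 - x, min e w, hE.s0, by linarith, by linarith, ?_, ?_, lt_min he0 hw, ?_⟩
  · have := mul_lt_mul_of_pos_left hdx (show 0 < q by linarith)
    linarith
  · have := mul_lt_mul_of_pos_left hdx (show 0 < p by linarith)
    linarith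
  intro δ a v f u V B hd hδ hδ1 k1 k2 k3
  have le1 : ofReal (min e w) ≤ ofReal e := ofReal_le_ofReal (min_le_left _ _)
  have le2 : ofReal (min e w) ≤ ofReal w := ofReal_le_ofReal (min_le_right _ _)
  obtain ⟨u', hd', hY⟩ := He α A₁ c₀ δ a v f u V B hd lia0 hδ1.le (k2.trans le1) (k3.trans le1)
  refine (HC δ θ w a v f u' V B hd' lia0 hδ1 hθ lia0 hw.le lia0 k1 (k3.trans le2) hY).trans (ofReal_le_ofReal ?_)
  have : C * yA ≤ C * x := mul_le_mul_of_nonneg_left lia0 hC.le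
  linarith

section Red
variable {n N : ℕ} {p q α L₁ L₂ aH : ℝ}
lemma mn0 (ξ : Mat N n) : 0 ≤ mnorm ξ := Real.sqrt_nonneg _
lemma le_mn (ξ : Mat N n) (i : Fin N) (j : Fin n) : |ξ i j| ≤ mnorm ξ := by
  refine Real.abs_le_sqrt ?_
  rw [pow_two]
  exact (single_le_sum (fun _ _ => mul_self_nonneg _)
    (Finset.mem_univ j)).trans (single_le_sum
    (fun _ _ => sum_nonneg fun _ _ => mul_self_nonneg _) (Finset.mem_univ i))
lemma le_vn (ξ : Vec N) (i : Fin N) : |ξ i| ≤ vnorm ξ := by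
  refine Real.abs_le_sqrt ?_
  rw [pow_two]
  exact single_le_sum (fun _ _ => mul_self_nonneg _)
    (Finset.mem_univ i)
lemma mdot_cs (ξ ζ : Mat N n) : mdot ξ ζ ≤ mnorm ξ * mnorm ζ := by
  simp only [mdot, mnorm, ← sum_prod_type',
    ← sum_prod_type',
    ← sum_prod_type']
  have := Real.sum_mul_le_sqrt_mul_sqrt Finset.univ (fun x : Fin N × Fin n => ξ x.1 x.2) fun x => ζ x.1 x.2
  simpa only [pow_two] using this
lemma mn_meas : Measurable (mnorm : Mat N n → ℝ) := by
  unfold mnorm mdot; fun_prop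
lemma rp1 {x : ℝ} (hx : 0 ≤ x) {r : ℝ} (hr : 2 < r) : x ^ (r - 2) * x = x ^ (r - 1) := by
  rw [← Real.rpow_add_one' hx lia0]; congr 1; ring
lemma rhs_mn (S : Setting n N p q α L₁ L₂ aH) (z : Pt n) (i : Fin N) (j : Fin n) :
    |rhsF S z i j| ≤ mnorm kA ^ pm + S.a z * mnorm kA ^ qm := by
  have h0 := mn0 kA
  have hp := S.hp2
  have hpq := S.hpq
  have e : rhsF S z i j = (mnorm kA ^ (p-2) + S.a z * mnorm kA ^ (q-2)) * S.F z i j := by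
    unfold rhsF; ring
  have ha := S.ha0 z
  have hk : 0 ≤ mnorm kA ^ (p-2) + S.a z * mnorm kA ^ (q-2) := psv
  rw [e, abs_mul, abs_of_nonneg hk, ← rp1 h0 hp, ← rp1 h0 (hp.trans hpq)]
  refine (mul_le_mul_of_nonneg_left (le_mn _ i j) hk).trans (le_of_eq (by ring))
lemma rhs_dot (S : Setting n N p q α L₁ L₂ aH) (z : Pt n) (ξ : Mat N n) :
    mdot (rhsF S z) ξ ≤ (mnorm kA ^ pm + S.a z * mnorm kA ^ qm) * mnorm ξ := by
  have h0 := mn0 kA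
  have hp := S.hp2
  have hpq := S.hpq
  have ha := S.ha0 z
  have hk : 0 ≤ mnorm kA ^ (p-2) + S.a z * mnorm kA ^ (q-2) := psv
  have e : mdot (rhsF S z) ξ = (mnorm kA ^ (p-2) + S.a z * mnorm kA ^ (q-2)) * mdot kA ξ := by
    simp only [rhsF, mdot, mul_sum]
    exact sum_congr rfl fun i _ => sum_congr rfl fun j _ => by ring
  rw [e, ← rp1 h0 hp, ← rp1 h0 (hp.trans hpq)]
  refine (mul_le_mul_of_nonneg_left (mdot_cs _ ξ) hk).trans (le_of_eq (by ring))
def Bfl (S : Setting n N p q α L₁ L₂ aH) (Du : Pt n → Mat N n) (i : Fin N) (j : Fin n) (z : Pt n) : ℝ :=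
  S.A z dC i j - rhsF S z i j
variable {S : Setting n N p q α L₁ L₂ aH} {u : Pt n → Vec N} {Du : Pt n → Mat N n} {δ : ℝ}
lemma A_meas (hs : Measurable Du) (i : Fin N) (j : Fin n) : Measurable fun z => S.A z dC i j := by
  have h := S.hAM.comp (measurable_id.prodMk hs)
  exact (measurable_pi_apply j).comp ((measurable_pi_apply i).comp h)
lemma rhs_meas (i : Fin N) (j : Fin n) : Measurable fun z => rhsF S z i j := by
  have h1 := S.hFM
  have h2 := S.haM
  have h3 := mn_meas.comp h1
  have h4 := (measurable_pi_apply j).comp ((measurable_pi_apply i).comp h1)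
  unfold rhsF
  fun_prop
lemma cyl_meas : MeasurableSet cyS := S.hΩo.measurableSet.prod measurableSet_Ioo
lemma cyl_fin : volume cyS < ∞ := by
  unfold cyl
  rw [volume_eq_prod, prod_prod]
  exact ENNReal.mul_lt_top S.hΩb.measure_lt_top measure_Ioo_lt_top
lemma rp_cmp {x r s : ℝ} (hx : 0 ≤ x) (hr : 0 ≤ r) (hrs : r ≤ s) : x ^ r ≤ 1 + x ^ s := by
  rcases le_total x 1 with h | h
  · linarith [rpow_le_one hx h hr, rpow_nonneg hx s]
  · linarith [rpow_le_rpow_of_exponent_le h hrs]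
lemma Hf0 (z : Pt n) {x : ℝ} (hx : 0 ≤ x) : 0 ≤ Hf S.a p q z x :=
  add_nonneg (rpow_nonneg hx _) (mul_nonneg (S.ha0 z) (rpow_nonneg hx _))
lemma A_int (hs : VeryWeakSolution S u Du δ) (hq : q - 1 ≤ p * δ) (i : Fin N) (j : Fin n) :
    IntegrableOn (fun z => S.A z dC i j) cyS := by
  obtain ⟨M, hM⟩ := S.haB
  have hc : IntegrableOn (fun _ => Ro) cyS := integrableOn_const (hs := cyl_fin.ne)
  have hp := S.hp2
  have hpq := S.hpq
  have hL := S.hL₁.le.trans S.hL₁₂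
  refine Integrable.mono' ((hc.add hs.henergy).const_mul (L₂ * (1 + M)))
    (A_meas hs.hDuM i j).aestronglyMeasurable ?_
  filter_upwards [S.hAgrow] with z hz
  have h0 := mn0 dC
  have ha := S.ha0 z
  have haM := hM ⟨z, rfl⟩
  have h1 : ∀ r, 0 ≤ r → r ≤ p * δ → mnorm dC ^ r ≤ 1 + Hf S.a p q z (mnorm dC) ^ δ := by
    intro r hr hrp
    refine (rp_cmp h0 hr hrp).trans ?_
    rw [rpow_mul h0]
    have : mnorm dC ^ p ≤ Hf S.a p q z (mnorm dC) := le_add_of_nonneg_right psv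
    have := rpow_le_rpow psv this hs.hδ.1.le
    linarith only [this]
  have h2 := h1 pm lia0 lia0
  have h3 := h1 qm lia0 hq
  rw [norm_eq_abs, mul_assoc]
  refine (le_mn _ i j).trans ((hz dC).trans (mul_le_mul_of_nonneg_left ?_ hL))
  have h4 :=
    mul_le_mul haM h3 psv (ha.trans haM)
  simp only [Pi.add_apply]
  linarith only [h2, h4]
lemma rhs_int (i : Fin N) (j : Fin n) : IntegrableOn (fun z => rhsF S z i j) cyS := by
  obtain ⟨M, hM⟩ := S.haB
  have hc : IntegrableOn (fun _ => Ro) cyS := integrableOn_const (hs := cyl_fin.ne)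
  have hp := S.hp2
  have hpq := S.hpq
  refine Integrable.mono' ((hc.const_mul (1 + M)).add S.hFint) (rhs_meas i j).aestronglyMeasurable
    (of_forall fun z => ?_)
  rw [norm_eq_abs]
  refine (rhs_mn S z i j).trans ?_
  have h0 := mn0 kA
  have ha := S.ha0 z
  have haM := hM ⟨z, rfl⟩
  have h2 := rp_cmp h0 (by linarith : 0 ≤ p-1) (by linarith : p - 1 ≤ p)
  have h3 := mul_le_mul_of_nonneg_left (rp_cmp h0 (by linarith : 0 ≤ q-1) (by linarith : q - 1 ≤ q)) ha
  simp only [Pi.add_apply, Hf]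
  linarith only [h2, h3, haM]
lemma B_int (hs : VeryWeakSolution S u Du δ) (hq : q - 1 ≤ p * δ) (i : Fin N) (j : Fin n) :
    IntegrableOn (Bfl S Du i j) cyS := (A_int hs hq i j).sub (rhs_int i j)
lemma u_int (hs : VeryWeakSolution S u Du δ) (i : Fin N) : IntegrableOn (fun z => u z i) cyS :=
  Integrable.mono' hs.huL1 ((measurable_pi_apply i).comp hs.huM).aestronglyMeasurable
    (of_forall fun z => le_vn (u z) i)
lemma D_int (hs : VeryWeakSolution S u Du δ) (i : Fin N) (j : Fin n) : IntegrableOn (fun z => Du z i j) cyS :=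
  Integrable.mono' hs.hDuL1 ((measurable_pi_apply j).comp ((measurable_pi_apply i).comp hs.hDuM)).aestronglyMeasurable
    (of_forall fun z => le_mn dC i j)
lemma int_tst {f : Pn} {s : Set bA} (hf : IntegrableOn f s) {ψ : Pn} (hψ : ContDiff ℝ (⊤ : ℕ∞) ψ)
    (hc : HasCompactSupport ψ) (v : Pt n) : IntegrableOn (fun z => f z * fderiv ℝ ψ z v) s := by
  have h1 : Continuous fun z => fderiv ℝ ψ z v := (hψ.continuous_fderiv smp).clm_apply continuous_const
  have h2 := hc.fderiv_apply ℝ v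
  obtain ⟨C, hC⟩ := h1.bounded_above_of_compact_support h2
  exact Integrable.mul_bdd hf h1.aestronglyMeasurable (of_forall hC)
lemma sc_eq (hs : VeryWeakSolution S u Du δ) (hq : q - 1 ≤ p * δ) (i : Fin N) {ψ : Pn}
    (hψ : ContDiff ℝ (⊤ : ℕ∞) ψ) (hc : HasCompactSupport ψ) (ht : tsupport ψ ⊆ cyl S.Ω S.T) :
    ∫ z in cyl S.Ω S.T, u z i * fderiv ℝ ψ z (0,1) = ∑ j, ∫ z in cyl S.Ω S.T, Bfl S Du i j z * dxj ψ j z := by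
  have hφ : ContDiff ℝ (⊤ : ℕ∞) (fun z k => if k = i then ψ z else 0 : Pt n → Vec N) := by
    rw [contDiff_pi]; intro k
    by_cases h : k = i
    · simpa [h] using hψ
    · simpa [h] using contDiff_const
  have hsup : support (fun z k => if k = i then ψ z else 0 : Pt n → Vec N) ⊆ support ψ := by
    intro z hz hz0
    exact hz (by funext k; simp [hz0])
  have key := hs.hweak (fun z k => if k = i then ψ z else 0) hφ
    (hc.mono hsup) ((closure_mono hsup).trans ht)
  have e0 : ∀ z k, fderiv ℝ (fun w => if k = i then ψ w else 0) z = if k = i then fderiv ℝ ψ z else 0 := by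
    intro z k
    by_cases h : k = i <;> simp [h]
  have e1 : ∀ z, vdot (u z) (dtd (fun z k => if k = i then ψ z else 0 : Pt n → Vec N) z) = u z i * fderiv ℝ ψ z (0,1) := by
    intro z
    have hd : ∀ k, DifferentiableAt ℝ (fun w => if k = i then ψ w else 0) z := fun k =>
      (contDiff_pi.1 hφ k).differentiable smp z
    simp only [dtd, fderiv_pi hd, ContinuousLinearMap.pi_apply, vdot, e0]
    rw [Finset.sum_eq_single i (fun k _ hk => by simp [hk]) smp]
    simp
  have e2 : ∀ (ξ : Mat N n) z, mdot ξ (gradm (fun z k => if k = i then ψ z else 0 : Pt n → Vec N) z) = ∑ j, ξ i j * dxj ψ j z := by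
    intro ξ z
    simp only [gradm, mdot, e0, dxj]
    rw [Finset.sum_eq_single i (fun k _ hk => by simp [hk]) smp]
    simp
  simp only [e1, e2] at key
  have i1 : IntegrableOn (fun z => -(u z i * fderiv ℝ ψ z (0,1))) cyS := (int_tst (u_int hs i) hψ hc (0,1)).neg
  have i2 : ∀ j, IntegrableOn (fun z => S.A z dC i j * dxj ψ j z) cyS := fun j => int_tst (A_int hs hq i j) hψ hc eJ
  have i3 : ∀ j, IntegrableOn (fun z => rhsF S z i j * dxj ψ j z) cyS := fun j => int_tst (rhs_int (S := S) i j) hψ hc eJ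
  rw [integral_add i1 (integrable_finsetSum _ fun j _ => i2 j), integral_neg,
    integral_finsetSum _ (fun j _ => i2 j), integral_finsetSum _ (fun j _ => i3 j)] at key
  have : ∀ j, ∫ z in cyl S.Ω S.T, Bfl S Du i j z * dxj ψ j z = (∫ z in cyl S.Ω S.T, S.A z dC i j * dxj ψ j z)
      - ∫ z in cyl S.Ω S.T, rhsF S z i j * dxj ψ j z := by
    intro j
    rw [← integral_sub (i2 j) (i3 j)]
    simp only [Bfl, sub_mul]
  rw [sum_congr rfl fun j _ => this j, sum_sub_distrib]
  linarith only [key]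
end Red

section Red2
variable {n N : ℕ} {p q α L₁ L₂ aH : ℝ} {S : Setting n N p q α L₁ L₂ aH} {u : Pt n → Vec N} {Du : Pt n → Mat N n} {δ : ℝ}
  {w : Pt n} {r τ : ℝ} {Y : Set bA}
def scf (w : Pt n) (r τ k : ℝ) (f : Pn) : Pn :=
  (ball 0 2).indicator fun z => k * f Tz
lemma scf_meas (k : ℝ) {f : Pn} (hf : Measurable f) : Measurable (scf w r τ k f) :=
  ((hf.comp (TT_cont w r τ).measurable).const_mul k).indicator measurableSet_ball
lemma scf_int (hr : 0 < r) (hτ : 0 < τ) (hb : ball 0 2 ⊆ TT w r τ ⁻¹' Y) (k : ℝ) {f : Pn} (hf : IntegrableOn f Y) :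
    Integrable (scf w r τ k f) := by
  have h1 : IntegrableOn f Y (Measure.map gB volume) := by
    rw [TT_map w hr hτ, IntegrableOn, restrict_smul]
    exact hf.smul_measure ofReal_ne_top
  rw [(TT_emb w hr hτ).integrableOn_map_iff] at h1
  exact IntegrableOn.integrable_indicator ((h1.mono_set hb).const_mul k) measurableSet_ball
lemma scf_ii (hr : 0 < r) (hτ : 0 < τ) (hb : ball 0 2 ⊆ TT w r τ ⁻¹' Y) (k : ℝ) (f χ : Pn)
    (hχ : ∀ z ∉ bO 2, χ Tz = 0) :
    ∫ z, scf w r τ k f z * χ Tz = k * (rnτ⁻¹ * ∫ z in Y, f z * χ z) := by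
  rw [← TT_int w hr hτ Y fun z => f z * χ z, setIntegral_eq_integral_of_forall_compl_eq_zero, ← integral_const_mul]
  · congr 1; funext z
    by_cases h : z ∈ bO 2
    · rw [scf, indicator_of_mem h, mul_assoc]
    · rw [hχ z h]; ring
  · intro z hz
    rw [hχ z fun h => hz (hb h), mul_zero]
lemma pull (hr : 0 < r) (hτ : 0 < τ) (hb : ball 0 2 ⊆ TT w r τ ⁻¹' Y) {ψ : Pn} (h1 : ContDiff ℝ (⊤ : ℕ∞) ψ)
    (h2 : HasCompactSupport ψ) (h3 : tsupport ψ ⊆ ball 0 2) :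
    ∃ φ : Pn, ContDiff ℝ (⊤ : ℕ∞) φ ∧ HasCompactSupport φ ∧ tsupport φ ⊆ Y ∧
      (∀ z, ψ z = φ Tz) ∧ (∀ j z, dxj ψ j z = r * dxj φ j Tz) ∧
      ∀ z, fderiv ℝ ψ z (0,1) = τ * fderiv ℝ φ Tz (0,1) := by
  have hi : ContDiff ℝ (⊤ : ℕ∞) fun z : Pt n => ((r⁻¹ • (z.1 - w.1), τ⁻¹ * (z.2 - w.2)) : Pt n) := by fun_prop
  have hφ : ContDiff ℝ (⊤ : ℕ∞) (ψ ∘ (TTh w r τ hr hτ).symm) := h1.comp hi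
  have e : ∀ z, ψ z = (ψ ∘ (TTh w r τ hr hτ).symm) Tz := fun z =>
    congrArg ψ ((TTh w r τ hr hτ).symm_apply_apply z).symm
  have e' : ψ = fun z => 1 * (ψ ∘ (TTh w r τ hr hτ).symm) Tz := by
    funext z; rw [one_mul]; exact e z
  have hφ1 : ContDiff ℝ 1 (ψ ∘ (TTh w r τ hr hτ).symm) := hφ.of_le smp
  refine ⟨_, hφ, h2.comp_homeomorph _, ?_, e, fun j z => ?_, fun z => ?_⟩
  · rw [tsupport_comp_eq_preimage]
    intro z hz
    have := hb (h3 hz)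
    have e2 : TT w r τ ((TTh w r τ hr hτ).symm z) = z := (TTh w r τ hr hτ).apply_symm_apply z
    rwa [mem_preimage, e2] at this
  · conv_lhs => rw [e']
    rw [TT_dxj hφ1, one_mul]
  · conv_lhs => rw [e']
    rw [TT_fderiv hφ1, smul_zero, mul_one, one_mul,
      show ((0, τ) : Pt n) = τ • (0, 1) by simp, map_smul, smul_eq_mul]
lemma off {ψ : Pn} (h3 : tsupport ψ ⊆ ball 0 2) {z : Pt n} (hz : z ∉ bO 2) : fderiv ℝ ψ z = 0 := by
  by_contra h
  exact hz (h3 (support_fderiv_subset ℝ h))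
lemma sc_ws (hs : VeryWeakSolution S u Du δ) (hq : q - 1 ≤ p * δ) (hr : 0 < r) (hτ : 0 < τ)
    (hb : ball 0 2 ⊆ TT w r τ ⁻¹' cyl S.Ω S.T) {m : ℝ} (hm : 0 < m) {k : ℝ} (hk : k = τ / (m * r * r)) (i : Fin N) :
    WS (scf w r τ (m * r)⁻¹ fun z => u z i) (fun j => scf w r τ m⁻¹ fun z => Du z i j)
      (fun j => scf w r τ k (Bfl S Du i j)) := by
  refine ⟨scf_int hr hτ hb _ (u_int hs i), fun j => scf_int hr hτ hb _ (D_int hs i j),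
    fun j => scf_int hr hτ hb _ (B_int hs hq i j), fun j ψ h1 h2 h3 => ?_, fun ψ h1 h2 h3 => ?_⟩
  · obtain ⟨φ, g1, g2, g3, g4, g5, -⟩ := pull hr hτ hb h1 h2 h3
    have z1 : ∀ z ∉ bO 2, dxj φ j Tz = 0 := fun z hz => by
      have := g5 j z
      rw [dxj, off h3 hz] at this
      simpa [hr.ne'] using this.symm
    have z2 : ∀ z ∉ bO 2, φ Tz = 0 := fun z hz => by
      rw [← g4]; exact image_eq_zero_of_notMem_tsupport fun h => hz (h3 h)
    simp_rw [g5, g4, mul_left_comm _ r]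
    rw [integral_const_mul, scf_ii hr hτ hb _ (fun z => u z i) (dxj φ j) z1,
      scf_ii hr hτ hb _ (fun z => Du z i j) φ z2, hs.hgrad i j φ g1 g2 g3]
    field_simp
  · obtain ⟨φ, g1, g2, g3, -, g5, g6⟩ := pull hr hτ hb h1 h2 h3
    have z1 : ∀ j, ∀ z ∉ bO 2, dxj φ j Tz = 0 := fun j z hz => by
      have := g5 j z
      rw [dxj, off h3 hz] at this
      simpa [hr.ne'] using this.symm
    have z2 : ∀ z ∉ bO 2, fderiv ℝ φ Tz (0,1) = 0 := fun z hz => by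
      have := g6 z
      rw [off h3 hz] at this
      simpa [hτ.ne'] using this.symm
    simp_rw [g5, g6, mul_left_comm _ r, mul_left_comm _ τ]
    rw [integral_const_mul, scf_ii hr hτ hb _ (fun z => u z i) (fun z => fderiv ℝ φ z (0,1)) z2, sc_eq hs hq i g1 g2 g3]
    simp_rw [integral_const_mul, scf_ii hr hτ hb k (Bfl S Du i _) (dxj φ _) (z1 _)]
    rw [← mul_sum, ← mul_sum, ← mul_sum, hk]
    field_simp
end Red2

section Red3
variable {n N : ℕ} {p q α L₁ L₂ aH : ℝ} {S : Setting n N p q α L₁ L₂ aH} {u : Pt n → Vec N} {Du : Pt n → Mat N n} {δ : ℝ}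
  {w : Pt n} {r τ m : ℝ}
lemma hsc (hm : 0 < m) {x : ℝ} (hx : 0 ≤ x) (b : ℝ) {P Q d : ℝ} (hd : Q = P + d) :
    (m⁻¹ * x) ^ P + m ^ d * b * (m⁻¹ * x) ^ Q = m ^ (-P) * (x ^ P + b * x ^ Q) := by
  have e : m ^ (-P) = m ^ d * m ^ (-Q) := by rw [← rpow_add hm, hd]; congr 1; ring
  rw [mul_rpow psv hx, mul_rpow psv hx, inv_rpow hm.le, inv_rpow hm.le,
    ← rpow_neg hm.le, ← rpow_neg hm.le]
  linear_combination (b * x ^ Q) * (-e)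
lemma ae_pull (hr : 0 < r) (hτ : 0 < τ) (hb : ball 0 2 ⊆ TT w r τ ⁻¹' cyl S.Ω S.T) {P : Pt n → Prop}
    (h : ∀ᵐ z ∂(volume.restrict cyS), P z) : ∀ᵐ z : Pt n, z ∈ bO 2 → P Tz := by
  rw [ae_restrict_iff' cyl_meas] at h
  have h1 : ∀ᵐ z ∂(Measure.map gB volume), z ∈ cyl S.Ω S.T → P z := by
    rw [TT_map w hr hτ]; exact Measure.ae_smul_measure h _
  filter_upwards [ae_of_ae_map (TT_cont w r τ).measurable.aemeasurable h1] with z hz hz2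
  exact hz (hb hz2)
lemma sc_cf (hr : 0 < r) (hτ : 0 < τ) (hτr : τ ≤ r ^ 2) (hm : 0 < m)
    (hb : ball 0 2 ⊆ TT w r τ ⁻¹' cyl S.Ω S.T) (hw : w ∈ cyl S.Ω S.T) (hca : m ^ qp0 * S.a w ≤ 1)
    (hd : m ^ qp0 * r ^ α ≤ 1) :
    Cf p q α (1 + 2 * aH) aH fun z => m ^ qp0 * S.a Tz := by
  have hA := S.haH
  have hα := S.hα.1
  have hα1 := S.hα.2
  have hM : 0 < m ^ qp0 := psv
  have hr2 : (r ^ 2) ^ mD = r ^ α := by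
    rw [← rpow_natCast, ← rpow_mul hr.le]; congr 1; push_cast; ring
  have key : ∀ z w' : Pt n, TT w r τ z ∈ cyl S.Ω S.T → TT w r τ w' ∈ cyl S.Ω S.T →
      |m ^ qp0 * S.a Tz - m ^ qp0 * S.a (TT w r τ w')| ≤ aH * max (‖z.1 - w'.1‖ ^ α) (|z.2 - w'.2| ^ mD) := by
    intro z w' hz hw'
    have h1 := S.haHol _ hz.1 _ hw'.1 _ hz.2 _ hw'.2
    have e1 : ‖(TT w r τ z).1 - (TT w r τ w').1‖ = r * ‖z.1 - w'.1‖ := by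
      simp only [TT, add_sub_add_left_eq_sub, ← smul_sub, norm_smul, norm_eq_abs, abs_of_pos hr]
    have e2 : |(TT w r τ z).2 - (TT w r τ w').2| = τ * |z.2 - w'.2| := by
      simp only [TT, add_sub_add_left_eq_sub, ← mul_sub, abs_mul, abs_of_pos hτ]
    rw [e1, e2] at h1
    have h2 : max ((r * ‖z.1 - w'.1‖) ^ α) ((τ * |z.2 - w'.2|) ^ mD) ≤ r ^ α * max (‖z.1 - w'.1‖ ^ α) (|z.2 - w'.2| ^ mD) := by
      rw [mul_max_of_nonneg _ _ psv]
      refine max_le_max (le_of_eq (mul_rpow hr.le vB)) ?_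
      rw [← hr2, ← mul_rpow psv jA]
      exact rpow_le_rpow psv (by gcongr) psv
    rw [← mul_sub, abs_mul, abs_of_pos hM]
    calc _ ≤ m ^ (q-p) * (aH * (r ^ α * max (‖z.1 - w'.1‖ ^ α) (|z.2 - w'.2| ^ mD))) := by
          refine mul_le_mul_of_nonneg_left (h1.trans ?_) hM.le
          exact mul_le_mul_of_nonneg_left h2 hA.le
      _ = (m ^ (q-p) * r ^ α) * (aH * max (‖z.1 - w'.1‖ ^ α) (|z.2 - w'.2| ^ mD)) := by ring
      _ ≤ _ := mul_le_of_le_one_left psv hd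
  refine ⟨(S.haM.comp (TT_cont w r τ).measurable).const_mul _, fun z => mul_nonneg hM.le (S.ha0 _), by positivity, hA.le,
    fun z hz => ?_, fun z hz w' hw' => key z w' (hb hz) (hb hw'), hα, hα1, S.hp2, S.hpq⟩
  have e0 : TT w r τ 0 = w := by simp [TT]
  have h1 := key z 0 (hb hz) (by rw [e0]; exact hw)
  rw [e0] at h1
  rw [mem_ball_zero_iff] at hz
  have h2 : max (‖z.1 - (0 : Pt n).1‖ ^ α) (|z.2 - (0 : Pt n).2| ^ mD) ≤ 2 := by
    have g1 : ‖z.1 - (0 : Pt n).1‖ ≤ 2 := by simpa using (norm_fst_le z).trans hz.le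
    have g2 : |z.2 - (0 : Pt n).2| ≤ 2 := by simpa using (norm_snd_le z).trans hz.le
    have k : ∀ {x e : ℝ}, 0 ≤ x → x ≤ 2 → 0 ≤ e → e ≤ 1 → x ^ e ≤ 2 := fun {x e} h0 h2 he he1 =>
      (rpow_le_rpow h0 h2 he).trans ((rpow_le_rpow_of_exponent_le nnm he1).trans smp)
    exact max_le (k vB g1 hα.le hα1) (k jA g2 psv lia0)
  have h3 := mul_le_mul_of_nonneg_left h2 hA.le
  have h4 := le_abs_self (m ^ qp0 * S.a Tz - m ^ qp0 * S.a w)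
  linarith only [h1, h3, h4, hca]
lemma flux_b {a x y L : ℝ} (ha : 0 ≤ a) (hx : 0 ≤ x) (hy : 0 ≤ y) (hL : 0 ≤ L) {P Q : ℝ} (hP : 0 ≤ P) (hQ : 0 ≤ Q) {b c : ℝ}
    (hb : |b| ≤ L * (x ^ P + a * x ^ Q)) (hc : |c| ≤ y ^ P + a * y ^ Q) :
    |b - c| ≤ (L + 1) * (aD ^ P + a * aD ^ Q) := by
  have h1 : x ^ P + a * x ^ Q ≤ aD ^ P + a * aD ^ Q := by gcongr <;> linarith
  have h2 : y ^ P + a * y ^ Q ≤ aD ^ P + a * aD ^ Q := by gcongr <;> linarith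
  have := mul_le_mul_of_nonneg_left h1 hL
  linarith only [abs_sub b c, hb, hc, this, h2]
lemma coer_b {a x y L θ b c : ℝ} (ha : 0 ≤ a) (hx : 0 ≤ x) (hy : 0 ≤ y) (hp : 2 < p) (hpq : p < q) (hL : 0 < L)
    (hθ : θ = max 1 (2 / L)) (hb : L * (x ^ p + a * x ^ q) ≤ b) (hc : c ≤ (y ^ pm + a * y ^ qm) * x) :
    L / 2 * (x ^ p + a * x ^ q) ≤ b - c + θ * (y ^ p + a * y ^ q) := by
  have h1 := hθ ▸ le_max_left _ _
  have h2 := hθ ▸ le_max_right _ _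
  have h0 : 0 < θ := by linarith
  have hi : ∀ e : ℝ, 2 < e → θ ^ (1 - e) ≤ L / 2 := by
    intro e he
    refine (rpow_le_rpow_of_exponent_le h1 (by linarith : 1 - e ≤ -1)).trans ?_
    rw [rpow_neg_one]
    exact (inv_anti₀ psv h2).trans (le_of_eq (by field_simp))
  have k1 := yg hy hx (by linarith : 1 < p) h0
  have k2 := mul_le_mul_of_nonneg_left (yg hy hx (by linarith : 1 < q) h0) ha
  have k3 := mul_le_mul_of_nonneg_right (hi p hp) (rpow_nonneg hx p)
  have k4 := mul_le_mul_of_nonneg_left (mul_le_mul_of_nonneg_right (hi q (hp.trans hpq)) (rpow_nonneg hx q)) ha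
  linarith only [hb, hc, k1, k2, k3, k4]
lemma sc_ud (hs : VeryWeakSolution S u Du δ) (hq : q - 1 ≤ p * δ) (hr : 0 < r) (hm : 0 < m) (hτe : τ = m ^ (2-p) * r ^ 2) (hτr : τ ≤ r ^ 2)
    (hb : ball 0 2 ⊆ TT w r τ ⁻¹' cyl S.Ω S.T) (hw : w ∈ cyl S.Ω S.T) (hca : m ^ qp0 * S.a w ≤ 1)
    (hd : m ^ qp0 * r ^ α ≤ 1) :
    UD p q α (1 + 2 * aH) aH (L₁ / 2) (L₂ + 1 + max 1 (2 / L₁)) (fun z => m ^ qp0 * S.a Tz)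
      (fun z => m⁻¹ * mnorm (Du Tz)) (fun z => m⁻¹ * mnorm (S.F Tz))
      (fun i => scf w r τ (m * r)⁻¹ fun z => u z i) (fun i j => scf w r τ m⁻¹ fun z => Du z i j)
      (fun i j => scf w r τ (m ^ (1-p)) (Bfl S Du i j)) := by
  have hL := S.hL₁
  have hL2 := hL.trans_le S.hL₁₂
  have hp := S.hp2
  have hpq := S.hpq
  have hτ : 0 < τ := by rw [hτe]; positivity
  have hT := (TT_cont w r τ).measurable
  have hm1 := inv_pos.2 hm
  have hθ1 : 1 ≤ max 1 (2 / L₁) := le_max_left _ _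
  have hDm : ∀ i j, Measurable fun z => Du z i j := fun i j => (measurable_pi_apply j).comp ((measurable_pi_apply i).comp hs.hDuM)
  have hM : 0 < m ^ (1 - p) := psv
  have hk : m ^ (1-p) = τ / (m * r * r) := by
    rw [hτe, show R2 - p = (1 - p) + 1 by ring, rpow_add_one hm.ne']
    field_simp
  refine ⟨sc_cf hr hτ hτr hm hb hw hca hd, by positivity, by positivity,
    (mn_meas.comp (hs.hDuM.comp hT)).const_mul _, (mn_meas.comp (S.hFM.comp hT)).const_mul _,
    fun i => scf_meas _ ((measurable_pi_apply i).comp hs.huM), fun i j => scf_meas _ (hDm i j),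
    fun i j => scf_meas _ ((A_meas hs.hDuM i j).sub (rhs_meas i j)),
    fun z => mul_nonneg hm1.le qC, fun z => mul_nonneg hm1.le qC, fun i j z => ?_, ?_, ?_,
    fun i => sc_ws hs hq hr hτ hb hm hk i⟩
  · by_cases h : z ∈ bO 2
    · rw [scf, indicator_of_mem h, abs_mul, abs_of_pos hm1]
      exact mul_le_mul_of_nonneg_left (le_mn _ i j) hm1.le
    · rw [scf, indicator_of_notMem h, abs_zero]
      exact mul_nonneg hm1.le qC
  · filter_upwards [ae_pull hr hτ hb S.hAgrow] with z hz hz2 i j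
    rw [scf, indicator_of_mem hz2, abs_mul, abs_of_pos hM, ← mul_add,
      hsc hm (add_nonneg qC qC) _ (by ring : q - 1 = pm + qp0), neg_sub, mul_left_comm]
    refine mul_le_mul_of_nonneg_left ?_ hM.le
    have ha := S.ha0 Tz
    refine (flux_b ha (mn0 (Du Tz)) (mn0 (S.F Tz)) hL2.le (by linarith : 0 ≤ p - 1) (by linarith : 0 ≤ q - 1)
      ((le_mn _ i j).trans (hz hz2 _)) (rhs_mn S _ i j)).trans ?_
    refine mul_le_mul_of_nonneg_right lia0 ?_
    have := add_nonneg (mn0 (Du Tz)) (mn0 (S.F Tz))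
    positivity
  · filter_upwards [ae_pull hr hτ hb S.hAcoer] with z hz hz2
    have e1 : ∑ i, ∑ j, scf w r τ (m ^ (1-p)) (Bfl S Du i j) z * scf w r τ m⁻¹ (fun z => Du z i j) z =
        m ^ bD * (mdot (S.A Tz (Du Tz)) (Du Tz) - mdot (rhsF S Tz) (Du Tz)) := by
      have e2 : m ^ bD = m ^ (1-p) * m⁻¹ := by
        rw [← rpow_neg_one m, ← rpow_add hm]; congr 1; ring
      rw [mdot, mdot, ← sum_sub_distrib, mul_sum]
      refine sum_congr rfl fun i _ => ?_
      rw [← sum_sub_distrib, mul_sum]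
      refine sum_congr rfl fun j _ => ?_
      rw [scf, scf, indicator_of_mem hz2, indicator_of_mem hz2, e2, Bfl]
      ring
    have ha := S.ha0 Tz
    have hH : 0 ≤ mnorm (S.F Tz) ^ p + S.a Tz * mnorm (S.F Tz) ^ q := Hf0 (S := S) _ qC
    rw [e1, hsc hm qC _ (by ring : q = p + qp0), hsc hm qC _ (by ring : q = p + qp0), mul_left_comm,
      mul_left_comm _ (m ^ bD), ← mul_add]
    refine mul_le_mul_of_nonneg_left ((coer_b ha qC qC hp hpq hL rfl (hz hz2 _) (rhs_dot S _ _)).trans ?_) psv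
    have := mul_nonneg (by linarith only [hL2] : 0 ≤ L₂ + 1) hH
    linarith only [this]
end Red3

section Red4
variable {n N : ℕ} {p q α L₁ L₂ aH : ℝ} {S : Setting n N p q α L₁ L₂ aH} {u : Pt n → Vec N} {Du : Pt n → Mat N n} {δ : ℝ}
  {w : Pt n} {r τ m : ℝ}
lemma Qp_eq (hτ : τ = m ^ (2-p) * r ^ 2) (c : ℝ) : Qp p w m (c * r) = Qrs w (r * c) (τ * c ^ 2) := by
  rw [Qp, hτ]; congr 1 <;> ring
lemma Qp_pre (hr : 0 < r) (hm : 0 < m) (hτ : τ = m ^ (2-p) * r ^ 2) (c : ℝ) :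
    TT w r τ ⁻¹' (Qp p w m (c * r)) = Qrs 0 c (c ^ 2) := by
  rw [Qp_eq hτ, TT_pre w hr (by rw [hτ]; positivity)]
lemma Qp_vr (hr : 0 < r) (hm : 0 < m) (hτ : τ = m ^ (2-p) * r ^ 2) {c : ℝ} (hc : 0 < c) :
    volume.real (Qp p w m (c * r)) = 2 * vb n * (c ^ n * c ^ 2) * rnτ := by
  have h0 := vb_pos n
  have hτ0 : 0 < τ := by rw [hτ]; positivity
  rw [Qp_eq hτ, Measure.real, Qrs_vol' w psv, toReal_ofReal psv]
  rw [mul_pow]; ring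
lemma HD0 (z : Pt n) : 0 ≤ HDu S Du z := Hf0 z qC
lemma HF0 (z : Pt n) : 0 ≤ HFf S z := Hf0 z qC
lemma HD_meas (h : Measurable Du) : Measurable (HDu S Du) := by
  have h1 := mn_meas.comp h
  have h2 := S.haM
  unfold HDu Hf; fun_prop
lemma HF_meas : Measurable (HFf S) := by
  have h1 := mn_meas.comp S.hFM
  have h2 := S.haM
  unfold HFf Hf; fun_prop
lemma rp_int {g : Pn} {E : Set bA} (hg : Measurable g) (h0 : ∀ z, 0 ≤ g z) (hE : volume E < ∞) {e d : ℝ} (he : 0 ≤ e)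
    (hed : e ≤ d) (hi : IntegrableOn (fun z => g z ^ d) E) : IntegrableOn (fun z => g z ^ e) E := by
  have hc : IntegrableOn (fun _ => Ro) E := integrableOn_const (hs := hE.ne)
  refine Integrable.mono' (hc.add hi) (hg.pow_const e).aestronglyMeasurable (of_forall fun z => ?_)
  rw [norm_eq_abs, abs_of_nonneg (rpow_nonneg (h0 z) _)]
  exact rp_cmp (h0 z) he hed
lemma F_int {e : ℝ} (he : 0 ≤ e) (he1 : e ≤ 1) : IntegrableOn (fun z => HFf S z ^ e) cyS :=
  rp_int HF_meas HF0 cyl_fin he he1 (by simp only [rpow_one]; exact S.hFint)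
lemma DF_int (hs : VeryWeakSolution S u Du δ) : IntegrableOn (fun z => (HDu S Du z + HFf S z) ^ δ) cyS := by
  refine Integrable.mono' (hs.henergy.add (F_int hs.hδ.1.le hs.hδ.2.le))
    (((HD_meas hs.hDuM).add HF_meas).pow_const δ).aestronglyMeasurable (of_forall fun z => ?_)
  rw [norm_eq_abs, abs_of_nonneg (rpow_nonneg (add_nonneg (HD0 z) (HF0 z)) _)]
  exact rpow_add_le_add_rpow (HD0 z) (HF0 z) hs.hδ.1.le hs.hδ.2.le
lemma scL (hr : 0 < r) (hτ : 0 < τ) (hm : 0 < m) {g : Pn} (h0 : ∀ z, 0 ≤ g z) {E : Set bA} {e : ℝ}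
    (hi : IntegrableOn (fun z => g z ^ e) E) :
    ∫⁻ z in TT w r τ ⁻¹' E, ofReal ((m ^ bD * g Tz) ^ e) =
      ofReal (m ^ (-(p * e)) * rnτ⁻¹ * ∫ z in E, g z ^ e) := by
  have e1 : ∀ z, ofReal ((m ^ bD * g Tz) ^ e) = ofReal (m ^ (-(p * e))) *
      ofReal (g Tz ^ e) := fun z => by
    rw [mul_rpow psv (h0 _), ← rpow_mul hm.le, neg_mul, ofReal_mul psv]
  simp_rw [e1]
  rw [lintegral_const_mul' _ _ ofReal_ne_top, TT_lint w hr hτ E fun z => ofReal (g z ^ e),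
    ← ofReal_integral_eq_lintegral_ofReal hi (of_forall fun z => rpow_nonneg (h0 z) _), ← mul_assoc,
    ← ofReal_mul psv, ← ofReal_mul psv]
lemma b2_sub : bO 2 ⊆ Qrs 0 2 (2 ^ 2) := by
  rw [ball_eq_Qrs]; exact Qrs_mono 0 le_rfl nnm
lemma mpow_le (hm : 0 < m) {J x K : ℝ} (hJ : 0 < J) {e : ℝ} (h : x ≤ K * (m ^ (p * e) * J)) : m ^ (-(p * e)) * J⁻¹ * x ≤ K := by
  have h1 : 0 < m ^ (p * e) := psv
  rw [rpow_neg hm.le, ← mul_inv, inv_mul_le_iff₀ psv]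
  linarith only [h]
def UT (n N : ℕ) (p q α A₀ A₁ c₀ C₀ Kb ω s δ₂ ε : ℝ) : Prop :=
  ∀ (δ : ℝ) (a v f : Pn) (u : Fin N → Pn) (V B : Fin N → Fin n → Pn), UD p q α A₀ A₁ c₀ C₀ a v f u V B → δ₂ < δ → δ < 1 →
      ∫⁻ z in bO 2, ofReal pC ≤ ofReal Kb →
      ∫⁻ z in bO 2, ofReal (vz ^ s) ≤ ofReal ε →
      ∫⁻ z in bO 2, ofReal (fz ^ δ) ≤ ofReal ε →
      ∫⁻ z in bO 1, ofReal (vz ^ δ) ≤ ofReal ω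
lemma dicho {s δ₂ ε ε' : ℝ} (hU : UT n N p q α (1 + 2 * aH) aH (L₁ / 2) (L₂ + 1 + max 1 (2 / L₁)) (2 * vb n * sD) (vb n / 2) s δ₂ ε)
    (hs0 : 0 < s) (hs2 : s < δ₂) (hq : q - 1 ≤ p * δ₂) (hδ : δ ∈ Set.Ioo δ₂ 1) (hs : VeryWeakSolution S u Du δ)
    (he : ε' ≤ ε) (he' : ε' ≤ vb n / 2) {π ρ : ℝ} (hP : PHyp S Du w π ρ δ) {J : ℝ} (hJ : J = ρ ^ n * (π ^ (2-p) * ρ ^ 2)) :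
    (∫ z in Qp p w π (16 * ρ), (HDu S Du z + HFf S z) ^ δ) ≤ 2 * vb n * sD * (π ^ eB * J) ∧
    (ε' * (π ^ kC * J) ≤ ∫ z in Qp p w π kB, HDu S Du z ^ s ∨
      ε' * (π ^ eB * J) ≤ ∫ z in Qp p w π kB, HFf S z ^ δ) := by
  have hp := S.hp2
  have hpq := S.hpq
  have hr := hP.hρ.1
  have hm1 := hP.hπ
  have hm : 0 < π := by linarith
  obtain ⟨τ, hτe⟩ : ∃ τ, τ = π ^ (2-p) * ρ ^ 2 := ⟨_, rfl⟩
  have hτ : 0 < τ := by rw [hτe]; positivity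
  have hτr : τ ≤ ρ ^ 2 := by
    rw [hτe]; exact mul_le_of_le_one_left psv (Real.rpow_le_one_of_one_le_of_nonpos hm1.le lia0)
  have hJ' : J = ρ ^ n * τ := by rw [hJ, hτe]
  have hJ0 : 0 < J := by rw [hJ']; positivity
  have hvb := vb_pos n
  have hcy : ∀ c : ℝ, 0 ≤ c → c ≤ 16 → Qp p w π (c * ρ) ⊆ cyl S.Ω S.T := fun c hc0 hc => by
    refine Subset.trans ?_ hP.hsub
    rw [Qp_eq hτe, Qp_eq hτe]
    exact Qrs_mono w (by gcongr) (by gcongr)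
  have hQ := fun c => Qp_pre (w := w) hr hm hτe c
  have hb :=
    (b2_sub.trans (hQ 2).ge).trans (preimage_mono (hcy 2 nnm nnm))
  have hX : (∫ z in Qp p w π (16 * ρ), (HDu S Du z + HFf S z) ^ δ) ≤ 2 * vb n * sD * (π ^ eB * J) := by
    have h := hP.hup
    rw [setAverage_eq, Qp_vr hr hm hτe nnm, smul_eq_mul, ← hJ', inv_mul_le_iff₀ psv, mul_comm δ] at h
    linarith only [h]
  refine ⟨hX, ?_⟩
  have hca : π ^ qp0 * S.a w ≤ 1 := by
    have h := hP.hcase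
    rw [rpow_sub hm, div_mul_eq_mul_div, div_le_one psv]
    linarith only [h]
  have hd : π ^ qp0 * ρ ^ α ≤ 1 := by
    have h := mul_le_mul_of_nonneg_left hP.hdecay (by positivity : 0 ≤ π ^ qp0)
    rwa [← rpow_add hm, show q - p + (p - q) = 0 by ring, rpow_zero] at h
  have hqδ := hq.trans (mul_le_mul_of_nonneg_left hδ.1.le lia0)
  have ud := sc_ud hs hqδ hr hm hτe hτr hb hP.hz₀ hca hd
  have e1 : ∀ z, (π⁻¹ * mnorm (Du Tρ)) ^ p + π ^ (q-p) * S.a Tρ * (π⁻¹ * mnorm (Du Tρ)) ^ q =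
      π ^ bD * HDu S Du Tρ := fun z => hsc hm qC _ (by ring)
  have e2 : ∀ z, (π⁻¹ * mnorm (S.F Tρ)) ^ p + π ^ (q-p) * S.a Tρ * (π⁻¹ * mnorm (S.F Tρ)) ^ q =
      π ^ bD * HFf S Tρ := fun z => hsc hm qC _ (by ring)
  have key := hU δ _ _ _ _ _ _ ud hδ.1 hδ.2
  simp only [e1, e2, ← mul_add] at key
  have i1 := fun c h0 hc => (rp_int (HD_meas hs.hDuM) HD0 cyl_fin hs0.le (hs2.le.trans hδ.1.le) hs.henergy).mono_set (hcy c h0 hc)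
  have i2 := fun c h0 hc => (F_int hs.hδ.1.le hs.hδ.2.le).mono_set (hcy c h0 hc)
  have i3 := fun c h0 hc => (DF_int hs).mono_set (hcy c h0 hc)
  have hDF0 : ∀ z, 0 ≤ HDu S Du z + HFf S z := fun z => add_nonneg (HD0 z) (HF0 z)
  by_contra hcon
  rw [not_or, not_le, not_le] at hcon
  have bs := b2_sub.trans (hQ 2).ge
  have k2 : ∫⁻ z in bO 2, ofReal ((π ^ bD * HFf S Tρ) ^ δ) ≤ ofReal ε' := by
    refine (lintegral_mono_set bs).trans ?_
    rw [scL hr hτ hm HF0 (i2 2 nnm nnm)]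
    refine ofReal_le_ofReal (mpow_le hm psv ?_)
    rw [← hJ']; exact hcon.2.le
  have k3 := key (by
      refine (lintegral_mono_set (t := TT w ρ τ ⁻¹' Qp p w π (16 * ρ)) ?_).trans ?_
      · rw [hQ]; exact b2_sub.trans (Qrs_mono 0 nnm nnm)
      rw [scL hr hτ hm hDF0 (i3 16 nnm le_rfl)]
      refine ofReal_le_ofReal (mpow_le hm psv ?_)
      rw [← hJ']; exact hX) (by
      refine (lintegral_mono_set bs).trans ?_
      rw [scL hr hτ hm HD0 (i1 2 nnm nnm)]
      refine ofReal_le_ofReal ((mpow_le hm psv ?_).trans he)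
      rw [← hJ']; exact hcon.1.le) (k2.trans (ofReal_le_ofReal he))
  have k4 : ∫⁻ z in bO 1, ofReal ((π ^ bD * (HDu S Du Tρ + HFf S Tρ)) ^ δ) ≤ ofReal (vb n) := by
    have hM : 0 < π ^ bD := psv
    calc _ ≤ ∫⁻ z in bO 1, (ofReal ((π ^ bD * HDu S Du Tρ) ^ δ) + ofReal ((π ^ bD * HFf S Tρ) ^ δ)) := by
          refine lintegral_mono fun z => ?_
          have h1 := mul_nonneg hM.le (HD0 (S := S) (Du := Du) Tρ)
          have h2 := mul_nonneg hM.le (HF0 (S := S) Tρ)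
          rw [← ofReal_add (rpow_nonneg h1 _) (rpow_nonneg h2 _), mul_add]
          exact ofReal_le_ofReal (rpow_add_le_add_rpow h1 h2 hs.hδ.1.le hs.hδ.2.le)
      _ ≤ ofReal (vb n / 2) + ofReal (vb n / 2) := by
          have g1 : Measurable fun z => ofReal ((π ^ bD * HDu S Du Tρ) ^ δ) :=
            ((((HD_meas hs.hDuM).comp (TT_cont w ρ τ).measurable).const_mul _).pow_const δ).ennreal_ofReal
          rw [lintegral_add_left g1]
          exact add_le_add k3 ((lintegral_mono_set (ball_subset_ball nnm)).trans (k2.trans (ofReal_le_ofReal he')))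
      _ = _ := by rw [← ofReal_add psv psv, add_halves]
  have hZ : bO 1 = TT w ρ τ ⁻¹' Qp p w π (1 * ρ) := by rw [hQ, ball_eq_Qrs]; norm_num
  rw [hZ, scL hr hτ hm hDF0 (i3 1 nnm nnm), ofReal_le_ofReal_iff hvb.le] at k4
  have h := hP.hlow
  rw [← one_mul ρ, setAverage_eq, Qp_vr hr hm hτe nnm, one_mul ρ, smul_eq_mul, ← hJ', le_inv_mul_iff₀ psv, mul_comm δ] at h
  rw [rpow_neg hm.le, ← mul_inv, inv_mul_le_iff₀ psv, ← hJ', one_mul ρ] at k4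
  have : 0 < vb n * (π ^ eB * J) := psv
  simp only [one_pow, mul_one] at h
  linarith only [h, k4, this]
end Red4

section Red5
variable {n N : ℕ} {p q α L₁ L₂ aH : ℝ} {S : Setting n N p q α L₁ L₂ aH} {u : Pt n → Vec N} {Du : Pt n → Mat N n} {δ : ℝ}
  {w : Pt n}
lemma levq {g : Pn} {E Y : Set bA} (hg : Measurable g) (h0 : ∀ z, 0 ≤ g z) (hY : MeasurableSet Y) (hE : MeasurableSet E)
    (hEY : E ⊆ Y) (hEf : volume E ≠ ∞) {e Λ : ℝ} (he : 0 ≤ e) (hΛ : 0 ≤ Λ) (hi : IntegrableOn (fun z => g z ^ e) E) :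
    ∫ z in E, g z ^ e ≤ (∫ z in E ∩ cD, g z ^ e) + Λ ^ e * volume.real E := by
  have hP : MeasurableSet cD := hY.inter (hg measurableSet_Ioi)
  have hc : IntegrableOn (fun _ => Λ ^ e) E := integrableOn_const (hs := hEf)
  have hI := hi.indicator hP
  calc _ ≤ ∫ z in E, ({z ∈ Y | Λ < g z}.indicator (fun z => g z ^ e) z + Λ ^ e) := by
        refine setIntegral_mono_on hi (hI.add hc) hE fun z hz => ?_
        have k := rpow_nonneg hΛ e
        by_cases h : z ∈ cD
        · rw [indicator_of_mem h]; linarith only [k]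
        · rw [indicator_of_notMem h, zero_add]
          exact rpow_le_rpow (h0 z) (not_lt.1 fun hl => h ⟨hEY hz, hl⟩) he
    _ = _ := by
        rw [integral_add hI hc, setIntegral_indicator hP, setIntegral_const, smul_eq_mul, mul_comm (volume.real E)]
lemma lev2 {P M c s e b ε I K J m : ℝ} (hM : 0 < M) (hc : 2 ≤ c) (hP : P ≤ 2 * M) (hP0 : 0 ≤ P) (hs : 0 < s) (hse : s ≤ e) (hb : 0 < b)
    (hcs : (2 / c) ^ s * b ≤ ε / 2) (hJ : 0 < J) (hme : m = M ^ e) (h1 : ε * (m * J) ≤ I)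
    (h2 : I ≤ K + (c⁻¹ * P) ^ e * (b * J)) : ε / 2 * (m * J) ≤ K := by
  have hc0 : 0 < c := by linarith
  have h3 : (c⁻¹ * P) ^ e ≤ (2 / c) ^ s * m := by
    have k1 : c⁻¹ * P ≤ (2 / c) * M := (mul_le_mul_of_nonneg_left hP psv).trans (le_of_eq (by ring))
    refine (rpow_le_rpow psv k1 lia0).trans ?_
    rw [mul_rpow psv hM.le, hme]
    refine mul_le_mul_of_nonneg_right ?_ psv
    exact rpow_le_rpow_of_exponent_ge psv ((div_le_one hc0).2 hc) hse
  have hm : 0 < m := by rw [hme]; positivity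
  have h4 := mul_le_mul_of_nonneg_right h3 (by positivity : 0 ≤ b * J)
  have h5 := mul_le_mul_of_nonneg_right hcs (by positivity : 0 ≤ m * J)
  linarith only [h1, h2, h4, h5]
lemma finale {s δ₂ ε c b2 : ℝ} (hU : UT n N p q α (1 + 2 * aH) aH (L₁ / 2) (L₂ + 1 + max 1 (2 / L₁)) (2 * vb n * sD) (vb n / 2) s δ₂ ε)
    (hs0 : 0 < s) (hs2 : s < δ₂) (hq : q - 1 ≤ p * δ₂) (hδ : δ ∈ Set.Ioo δ₂ 1) (hs : VeryWeakSolution S u Du δ)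
    {ε' : ℝ} (he0 : 0 < ε') (he : ε' ≤ ε) (he' : ε' ≤ vb n / 2) (hb2 : b2 = 2 * vb n * (2 ^ n * 2 ^ 2)) (hc2 : 2 ≤ c)
    (hcs : (2 / c) ^ s * b2 ≤ ε' / 2) (hc16 : 2 * vb n * sD ≤ c * (ε' / 2))
    (hk : 1 ≤ c * (min 1 xB) ^ (1 / s)) (hk1 : 1 ≤ c * xB)
    {π ρ : ℝ} (hP : PHyp S Du w π ρ δ) :
    (π ^ (δ * p) ≤ c * (⨍ z in Qp p w π kB, HDu S Du z ^ s) ^ (δ / s) + c * (⨍ z in Qp p w π kB, HFf S z ^ δ))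
    ∧ (∫ z in Qp p w π (16 * ρ), HDu S Du z ^ δ) ≤ c * Hf S.a p q w π ^ (δ - s)
        * (∫ z in Qp p w π kB ∩ PsiSet S Du (c⁻¹ * Hf S.a p q w π), HDu S Du z ^ s)
      + c * (∫ z in Qp p w π kB ∩ PhiSet S (c⁻¹ * Hf S.a p q w π), HFf S z ^ δ) := by
  obtain ⟨J, hJ⟩ : ∃ J, J = ρ ^ n * (π ^ (2-p) * ρ ^ 2) := ⟨_, rfl⟩
  obtain ⟨hX, hD⟩ := dicho hU hs0 hs2 hq hδ hs he he' hP hJ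
  have hp := S.hp2
  have hr := hP.hρ.1
  have hm1 := hP.hπ
  have hm : 0 < π := by linarith
  have hvb := vb_pos n
  have hb0 : 0 < b2 := by rw [hb2]; positivity
  have hJ0 : 0 < J := by rw [hJ]; positivity
  have hc0 : 0 < c := by linarith
  have hsδ := hs2.trans hδ.1
  have hδ0 := hs0.trans hsδ
  have hY : Qp p w π kB ⊆ cyl S.Ω S.T := by
    refine Subset.trans ?_ hP.hsub
    rw [Qp_eq rfl, Qp_eq rfl]
    exact Qrs_mono w (by gcongr; norm_num) (by gcongr; norm_num)
  have hYv : volume.real (Qp p w π kB) = b2 * J := by rw [Qp_vr hr hm rfl nnm, hb2, hJ]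
  have iD := (rp_int (HD_meas hs.hDuM) HD0 cyl_fin hs0.le hsδ.le hs.henergy).mono_set hY
  have iF := (F_int hs.hδ.1.le hs.hδ.2.le).mono_set hY
  have pD : ∀ {E : Set bA} {e : ℝ}, 0 ≤ ∫ z in E, HDu S Du z ^ e := fun {E e} =>
    integral_nonneg fun z => rpow_nonneg (HD0 z) _
  have pF : ∀ {E : Set bA} {e : ℝ}, 0 ≤ ∫ z in E, HFf S z ^ e := fun {E e} =>
    integral_nonneg fun z => rpow_nonneg (HF0 z) _
  have hπδ : π ^ (δ * p) = π ^ eB := by rw [mul_comm]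
  constructor
  · rw [setAverage_eq, setAverage_eq, hYv, smul_eq_mul, smul_eq_mul, hπδ]
    have q1 : 0 ≤ c * ((b2 * J)⁻¹ * ∫ z in Qp p w π kB, HDu S Du z ^ s) ^ (δ / s) :=
      mul_nonneg hc0.le (rpow_nonneg (mul_nonneg psv pD) _)
    have q2 : 0 ≤ c * ((b2 * J)⁻¹ * ∫ z in Qp p w π kB, HFf S z ^ δ) :=
      mul_nonneg hc0.le (mul_nonneg psv pF)
    rcases hD with h | h
    · refine le_add_of_le_of_nonneg ?_ q2
      have h1 : min 1 xB * π ^ kC ≤ (b2 * J)⁻¹ * ∫ z in Qp p w π kB, HDu S Du z ^ s := by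
        rw [le_inv_mul_iff₀ psv]
        refine le_trans ?_ h
        have := mul_le_mul_of_nonneg_right (min_le_right 1 xB) (by positivity : 0 ≤ b2 * J * π ^ kC)
        refine le_trans (le_of_eq (by ring)) (this.trans leq)
        field_simp
      have hmin : 0 < min 1 xB := lt_min one_pos psv
      have h2 := rpow_le_rpow psv h1 (by positivity : 0 ≤ δ / s)
      rw [mul_rpow hmin.le psv, ← rpow_mul hm.le, show p * s * (δ / s) = p * δ by field_simp] at h2
      have h3 : (min 1 xB) ^ (1 / s) ≤ (min 1 xB) ^ (δ / s) :=
        rpow_le_rpow_of_exponent_ge hmin (min_le_left _ _) (by have := hδ.2; gcongr)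
      calc π ^ eB = 1 * π ^ eB := (one_mul _).symm
        _ ≤ (c * (min 1 xB) ^ (1 / s)) * π ^ eB := mul_le_mul_of_nonneg_right hk psv
        _ ≤ c * ((min 1 xB) ^ (δ / s) * π ^ eB) := by rw [mul_assoc]; gcongr
        _ ≤ _ := mul_le_mul_of_nonneg_left h2 hc0.le
    · refine le_add_of_nonneg_of_le q1 ?_
      rw [mul_left_comm, le_inv_mul_iff₀ psv]
      have h1 := mul_le_mul_of_nonneg_right hk1 (by positivity : 0 ≤ b2 * J * π ^ eB)
      have h2 := mul_le_mul_of_nonneg_left h hc0.le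
      rw [one_mul, show c * xB * (b2 * J * π ^ eB) = c * (ε' * (π ^ eB * J)) by field_simp] at h1
      exact h1.trans h2
  · have hPi1 : π ^ p ≤ Hf S.a p q w π := le_add_of_nonneg_right (mul_nonneg (S.ha0 w) psv)
    have hPi2 : Hf S.a p q w π ≤ 2 * π ^ p := by have := hP.hcase; unfold Hf; linarith only [this]
    have hM : 0 < π ^ p := psv
    have hPi0 := hM.trans_le hPi1
    have hL : (∫ z in Qp p w π (16 * ρ), HDu S Du z ^ δ) ≤ c * (ε' / 2 * (π ^ eB * J)) := by
      have h1 : (∫ z in Qp p w π (16 * ρ), HDu S Du z ^ δ) ≤ ∫ z in Qp p w π (16 * ρ), (HDu S Du z + HFf S z) ^ δ := by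
        refine setIntegral_mono (hs.henergy.mono_set hP.hsub) ((DF_int hs).mono_set hP.hsub) fun z => ?_
        exact rpow_le_rpow (HD0 z) (le_add_of_nonneg_right (HF0 z)) hδ0.le
      have h2 := mul_le_mul_of_nonneg_right hc16 (by positivity : 0 ≤ π ^ eB * J)
      linarith only [h1, h2, hX]
    have hYm : MeasurableSet (Qp p w π kB) := Qrs_meas _ _ _
    have hYt : volume (Qp p w π kB) ≠ ∞ := Qrs_vol_ne_top _ _ _
    have hΛ : 0 ≤ c⁻¹ * Hf S.a p q w π := psv
    refine hL.trans ?_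
    rcases hD with h | h
    · have h1 := levq (HD_meas hs.hDuM) HD0 cyl_meas hYm hY hYt hs0.le hΛ iD
      rw [hYv] at h1
      have h2 := lev2 hM hc2 hPi2 hPi0.le hs0 le_rfl hb0 hcs hJ0 (rpow_mul hm.le p s) h h1
      refine le_add_of_le_of_nonneg ?_ (mul_nonneg hc0.le pF)
      have h3 : π ^ eB = (π ^ p) ^ (δ - s) * π ^ kC := by
        rw [← rpow_mul hm.le, ← rpow_add hm]; congr 1; ring
      have h4 := rpow_le_rpow hM.le hPi1 (by linarith : 0 ≤ δ - s)
      rw [mul_assoc]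
      refine mul_le_mul_of_nonneg_left ?_ hc0.le
      calc _ = (π ^ p) ^ (δ - s) * (ε' / 2 * (π ^ kC * J)) := by rw [h3]; ring
        _ ≤ _ := mul_le_mul h4 h2 psv psv
    · have h1 := levq HF_meas HF0 cyl_meas hYm hY hYt hδ0.le hΛ iF
      rw [hYv] at h1
      have h2 := lev2 hM hc2 hPi2 hPi0.le hs0 hsδ.le hb0 hcs hJ0 (rpow_mul hm.le p δ) h h1
      exact le_add_of_nonneg_of_le (mul_nonneg psv pD) (mul_le_mul_of_nonneg_left h2 hc0.le)
end Red5

/-- Lemma 4.5: reverse Hölder inequality in the `p`-intrinsic case. -/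
theorem reverse_holder_p (n N : ℕ) (p q α L₁ L₂ aH : ℝ) :
    ∃ c δ₁ δ₂ θ₀ : ℝ, 0 < c ∧ δ₁ ∈ Set.Ioo (0 : ℝ) 1 ∧ δ₂ ∈ Set.Ioo δ₁ 1 ∧
      0 < 2 - q * (1 - δ₂) ∧ θ₀ ∈ Set.Ioo (0 : ℝ) δ₂ ∧
      ∀ (S : Setting n N p q α L₁ L₂ aH) (u : Pt n → Vec N) (Du : Pt n → Mat N n) (δ : ℝ),
        δ ∈ Set.Ioo δ₂ 1 → VeryWeakSolution S u Du δ →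
        ∃ R₀ ∈ Set.Ioo (0 : ℝ) 1,
          ∀ (z₀ : Pt n) (π ρ : ℝ), ρ < R₀ → PHyp S Du z₀ π ρ δ →
            PiBig S u Du z₀ π ρ →
            (π ^ (δ * p)
                ≤ c * (⨍ z in Qp p z₀ π (2 * ρ), HDu S Du z ^ θ₀) ^ (δ / θ₀)
                  + c * (⨍ z in Qp p z₀ π (2 * ρ), HFf S z ^ δ))
            ∧ (∫ z in Qp p z₀ π (16 * ρ), HDu S Du z ^ δ)
                ≤ c * Hf S.a p q z₀ π ^ (δ - θ₀)
                    * (∫ z in Qp p z₀ π (2 * ρ) ∩ PsiSet S Du (c⁻¹ * Hf S.a p q z₀ π),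
                        HDu S Du z ^ θ₀)
                  + c * (∫ z in Qp p z₀ π (2 * ρ) ∩ PhiSet S (c⁻¹ * Hf S.a p q z₀ π),
                        HFf S z ^ δ) := by
  by_cases hex : Nonempty (Setting n N p q α L₁ L₂ aH)
  · obtain ⟨S0⟩ := hex
    have hL := S0.hL₁
    have hL2 : 0 < L₂ := hL.trans_le S0.hL₁₂
    have hA := S0.haH
    have hvb := vb_pos n
    obtain ⟨s, δ₂, ε, hs0, hs2, h21, h2q, hq, hε, hU⟩ := unitT n N (A₀ := 1 + 2 * aH) (A₁ := aH) (c₀ := L₁ / 2)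
      (C₀ := L₂ + 1 + max 1 (2 / L₁)) (Kb := 2 * vb n * (16 ^ n * 16 ^ 2)) (ω := vb n / 2) S0.hp2 S0.hpq S0.hα.1 S0.hα.2
      S0.hqub (by positivity) hA.le (by positivity) (by positivity) (by positivity) (by positivity)
    obtain ⟨e, he⟩ : ∃ e, e = min ε (vb n / 2) := ⟨_, rfl⟩
    have he0 : 0 < e := by rw [he]; exact lt_min hε (by positivity)
    obtain ⟨b, hb⟩ : ∃ b, b = 2 * vb n * (2 ^ n * 2 ^ 2) := ⟨_, rfl⟩
    have hb0 : 0 < b := by rw [hb]; positivity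
    have hk : 0 < (min 1 (e / b)) ^ (1 / s) := Real.rpow_pos_of_pos (lt_min one_pos (by positivity)) _
    have hk1 : 0 < e / b := by positivity
    have ht : Tendsto (fun c : ℝ => (2 / c) ^ s * b) atTop (𝓝 0) := by
      have h1 : Tendsto (fun c : ℝ => 2 / c) atTop (𝓝 0) := tendsto_const_nhds.div_atTop tendsto_id
      have h2 := (h1.rpow_const (p := s) (Or.inr hs0.le)).mul_const b
      rwa [Real.zero_rpow hs0.ne', zero_mul] at h2
    obtain ⟨c, h1, h2, h3, h4, h5⟩ := ((ht.eventually_le_const (show 0 < e / 2 by positivity)).and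
      ((eventually_ge_atTop 2).and ((eventually_ge_atTop (2 * vb n * (16 ^ n * 16 ^ 2) / (e / 2))).and
      ((eventually_ge_atTop (1 / (min 1 (e / b)) ^ (1 / s))).and (eventually_ge_atTop (1 / (e / b))))))).exists
    rw [div_le_iff₀ (by positivity)] at h3
    rw [div_le_iff₀ hk] at h4
    rw [div_le_iff₀ hk1] at h5
    refine ⟨c, s, δ₂, s, by linarith, ⟨hs0, by linarith⟩, ⟨hs2, h21⟩, h2q, ⟨hs0, hs2⟩, fun S u Du δ hδ hs => ⟨1 / 2, by norm_num, ?_⟩⟩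
    intro z₀ π ρ _ hP _
    exact finale hU hs0 hs2 hq hδ hs he0 (he ▸ min_le_left _ _) (he ▸ min_le_right _ _) hb h2 h1 h3 h4 h5 hP
  · have ht : Tendsto (fun d : ℝ => 2 - q * (1 - d)) (𝓝[<] 1) (𝓝 2) := by
      have : Tendsto (fun d : ℝ => 2 - q * (1 - d)) (𝓝 1) (𝓝 (2 - q * (1 - 1))) := Continuous.tendsto (by fun_prop) 1
      rw [sub_self, mul_zero, sub_zero] at this
      exact this.mono_left nhdsWithin_le_nhds
    obtain ⟨d, h1, h2, h3⟩ := ((ht.eventually_const_lt (show (0:ℝ) < 2 by norm_num)).and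
      ((Ioo_mem_nhdsLT (show (1/2 : ℝ) < 1 by norm_num)))).exists
    exact ⟨1, 1 / 2, d, 1 / 2, one_pos, by norm_num, ⟨h2, h3⟩, h1, ⟨by norm_num, h2⟩, fun S => absurd ⟨S⟩ hex⟩
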